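/- One has liminf_{x→∞} f(x)·(log x)/x > 0.306. -/

import Mathlib

/-- `Pmax n` is the largest prime factor of `n`, with the convention `Pmax 1 = 1`. -/
def Pmax (n : ℕ) : ℕ := if n ≤ 1 then 1 else n.primeFactors.sup id

/-- The Schinzel–Szekeres function: if `n = p₁ p₂ ⋯ p_Ω` with `p₁ ≥ p₂ ≥ ⋯ ≥ p_Ω` prime,
`SS n = max_{1 ≤ k ≤ Ω} p₁ ⋯ p_{k-1} p_k²`, and `SS 1 = 1`.
(`Nat.primeFactorsList n` is the *increasing* list of prime factors with multiplicity;
the value produced for the index `j` is the one for `k = Ω - j`.) -/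
def SS (n : ℕ) : ℕ :=
  ((List.range n.primeFactorsList.length).map
    (fun j => (n.primeFactorsList.drop j).headI * (n.primeFactorsList.drop j).prod)).foldr max 1

/-- A chain in the divisor graph: a finite sequence of pairwise distinct positive
integers in which any two consecutive terms are adjacent in the divisor graph
(the smaller divides the larger). -/
def IsDivChain (l : List ℕ) : Prop :=
  l.Nodup ∧ (∀ n ∈ l, 0 < n) ∧ l.Chain' (fun a b => a ∣ b ∨ b ∣ a)

/-- `fchain x` is the maximum length of a chain all of whose terms are `≤ x`. -/
noncomputable def fchain (x : ℝ) : ℕ :=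
  sSup {L : ℕ | ∃ l : List ℕ, IsDivChain l ∧ (∀ n ∈ l, (n : ℝ) ≤ x) ∧ l.length = L}

section

/-- index primes -/
noncomputable def prm (i : ℕ) : ℕ := Nat.nth Nat.Prime i

lemma prm_prime (i : ℕ) : (prm i).Prime := Nat.prime_nth_prime i
lemma prm_zero : prm 0 = 2 := Nat.nth_prime_zero_eq_two
lemma prm_lt {i j : ℕ} (h : i < j) : prm i < prm j :=
  Nat.nth_strictMono Nat.infinite_setOfPred_prime h
lemma prm_le {i j : ℕ} (h : i ≤ j) : prm i ≤ prm j :=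
  (Nat.nth_strictMono Nat.infinite_setOfPred_prime).monotone h
lemma prm_surj {p : ℕ} (hp : p.Prime) : ∃ i, prm i = p :=
  ⟨Nat.count Nat.Prime p, Nat.nth_count hp⟩
/-- a prime at most `prm (i+1)` is `prm (i+1)` or at most `prm i` -/
lemma prm_cases {p i : ℕ} (hp : p.Prime) (h : p ≤ prm (i+1)) : p = prm (i+1) ∨ p ≤ prm i := by
  obtain ⟨j, rfl⟩ := prm_surj hp
  rcases Nat.lt_or_ge i j with h1 | h1
  · left
    exact le_antisymm h (prm_le h1)
  · right
    exact prm_le h1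

lemma four_mul_le_sq (m p : ℕ) (h : 2 ≤ p) : 4 * m ≤ m * p ^ 2 := by
  have : 2 ^ 2 ≤ p ^ 2 := Nat.pow_le_pow_left h 2
  nlinarith

/-- head multiplier -/
noncomputable def hd (i : ℕ) : ℕ := if i = 0 then 4 else prm i

def DAdj (a b : ℕ) : Prop := a ∣ b ∨ b ∣ a

lemma DAdj.symm {a b : ℕ} (h : DAdj a b) : DAdj b a := Or.symm h

structure Good (X m i : ℕ) (l : List ℕ) : Prop where
  nodup : l.Nodup
  chain : l.IsChain DAdj
  terr : ∀ e ∈ l, e ≤ 2 * X ∧ ∃ r, e = m * r ∧ 1 < r ∧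
    ∀ q, q.Prime → q ∣ r → q ≤ prm i ∧ m * q ^ 2 ≤ X
  last : 4 * m ≤ X → l.getLast? = some (2 * m)
  head : m * prm i ^ 2 ≤ X → l.head? = some (m * hd i)
  cover : ∀ r, 1 < r → (∀ q, q.Prime → q ∣ r → q ≤ prm i) →
    (∀ d, d ∣ r → 1 < d → m * d * d.minFac ≤ X) → m * r ∈ l

lemma hd_dvd_prime {i q : ℕ} (hq : q.Prime) (h : q ∣ hd i) : q ≤ prm i := by
  unfold hd at h
  split_ifs at h with h0
  · subst h0
    rw [prm_zero]
    have : q ∣ 2 ^ 2 := by simpa using h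
    exact (Nat.prime_dvd_prime_iff_eq hq Nat.prime_two).1 (hq.dvd_of_dvd_pow this) |>.le
  · exact Nat.le_of_dvd (prm_prime i).pos h

lemma hd_ge_two (i : ℕ) : 2 ≤ hd i := by
  unfold hd
  split_ifs
  · norm_num
  · exact (prm_prime i).two_le

lemma good_zero (X m : ℕ) (hm : 0 < m) : ∃ l, Good X m 0 l := by
  by_cases h4 : 4 * m ≤ X
  · -- J = log2 (X/m) ≥ 2
    set J := Nat.log 2 (X / m) with hJ
    have hXm : 4 ≤ X / m := (Nat.le_div_iff_mul_le hm).2 h4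
    have hJ2 : 2 ≤ J := by
      rw [hJ]
      exact Nat.le_log_of_pow_le (by norm_num) (by simpa using hXm)
    have hpow : ∀ j, j ≤ J → 2 ^ j * m ≤ X := fun j hj => by
      rw [← Nat.le_div_iff_mul_le hm]
      exact le_trans (Nat.pow_le_pow_right (by norm_num) hj)
        (Nat.pow_log_le_self 2 (by omega))
    have hpow' : ∀ j, 2 ^ j * m ≤ X → j ≤ J := fun j hj => by
      rw [← Nat.le_div_iff_mul_le hm] at hj
      exact Nat.le_log_of_pow_le (by norm_num) hj
    obtain ⟨K, hK⟩ : ∃ K, J = K + 2 := ⟨J - 2, by omega⟩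
    refine ⟨(List.range (K + 1)).map (fun j => 2 ^ (j + 2) * m) ++ [2 * m], ?_⟩
    have hinj : Function.Injective (fun j => 2 ^ (j + 2) * m) := by
      intro a b hab
      simp only at hab
      have := Nat.eq_of_mul_eq_mul_right hm hab
      have := Nat.pow_right_injective (le_refl 2) this
      omega
    constructor
    · rw [List.nodup_append]
      refine ⟨List.Nodup.map hinj List.nodup_range, by simp, ?_⟩
      intro a ha b hb
      simp only [List.mem_map, List.mem_range] at ha
      obtain ⟨j, hj, rfl⟩ := ha
      simp only [List.mem_singleton] at hb
      subst hb
      intro h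
      have := Nat.eq_of_mul_eq_mul_right hm h
      rw [pow_add] at this
      have := Nat.one_le_two_pow (n := j)
      omega
    · rw [List.isChain_append]
      refine ⟨?_, by simp, ?_⟩
      · rw [List.isChain_map, List.isChain_iff_getElem]
        intro j hj
        simp only [List.getElem_range]
        left
        exact mul_dvd_mul (pow_dvd_pow 2 (by omega)) dvd_rfl
      · intro x hx y hy
        simp only [List.head?_cons, Option.mem_def, Option.some.injEq] at hy
        subst hy
        have := List.mem_of_getLast? hx
        simp only [List.mem_map, List.mem_range] at this
        obtain ⟨j, hj, rfl⟩ := this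
        right
        exact mul_dvd_mul (dvd_pow_self 2 (by omega)) dvd_rfl
    · intro e he
      have key : ∃ j, 1 ≤ j ∧ j ≤ J ∧ e = 2 ^ j * m := by
        simp only [List.mem_append, List.mem_map, List.mem_range, List.mem_singleton] at he
        rcases he with ⟨j, hj, rfl⟩ | rfl
        · exact ⟨j + 2, by omega, by omega, rfl⟩
        · exact ⟨1, le_refl _, by omega, by ring⟩
      obtain ⟨j, hj1, hjJ, rfl⟩ := key
      refine ⟨by have := hpow j hjJ; omega, 2 ^ j, by ring, Nat.one_lt_two_pow (by omega), ?_⟩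
      intro q hq hqd
      have := (Nat.prime_dvd_prime_iff_eq hq Nat.prime_two).1 (hq.dvd_of_dvd_pow hqd)
      subst this
      rw [prm_zero]
      exact ⟨le_refl _, by omega⟩
    · intro _
      simp [List.getLast?_append]
    · intro _
      simp only [hd, List.range_succ_eq_map, List.map_cons, List.cons_append, List.head?_cons]
      simp [mul_comm]
    · intro r hr hq hd
      rw [prm_zero] at hq
      obtain ⟨j, rfl⟩ : ∃ j, r = 2 ^ j := by
        refine ⟨_, Nat.eq_prime_pow_of_unique_prime_dvd (by omega) (p := 2) ?_⟩
        intro d hd1 hd2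
        exact le_antisymm (hq d hd1 hd2) hd1.two_le
      have hj0 : j ≠ 0 := by
        rintro rfl
        simp at hr
      have h2 := hd (2 ^ j) dvd_rfl hr
      rw [Nat.Prime.pow_minFac Nat.prime_two hj0] at h2
      simp only [List.mem_append, List.mem_map, List.mem_range, List.mem_singleton]
      have hjJ := hpow' (j + 1) (by rw [pow_succ]; nlinarith)
      rcases Nat.lt_or_ge 1 j with h | h
      · left
        exact ⟨j - 2, by omega, by rw [show j - 2 + 2 = j by omega, mul_comm]⟩
      · right
        have : j = 1 := by omega
        subst this
        ring
  · refine ⟨[], ?_⟩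
    constructor
    · simp
    · simp
    · simp
    · intro h
      exact absurd h h4
    · intro h
      rw [prm_zero] at h
      omega
    · intro r hr hq hd
      exfalso
      have h1 := hd r.minFac (Nat.minFac_dvd r) (Nat.minFac_prime (by omega)).one_lt
      have h2 := (Nat.minFac_prime (n := r) (by omega)).two_le
      have h3 := (Nat.minFac_prime (n := r.minFac) (Nat.minFac_prime (by omega)).ne_one).two_le
      apply h4
      calc 4 * m = m * 2 * 2 := by ring
        _ ≤ m * r.minFac * r.minFac.minFac := by gcongr
        _ ≤ X := h1

/-- adding a block for the new largest prime. -/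
lemma good_append (X m i : ℕ) (hm : 0 < m) (l B : List ℕ) (hl : Good X m i l)
    (hp : m * prm (i+1) ^ 2 ≤ X)
    (hBn : B.Nodup) (hBc : B.IsChain DAdj)
    (hBt : ∀ e ∈ B, e ≤ 2 * X ∧ ∃ r, e = m * (prm (i+1) * r) ∧ 0 < r ∧
      ∀ q, q.Prime → q ∣ r → q ≤ prm (i+1))
    (hBh : B.head? = some (m * prm (i+1)))
    (hBl : ∀ e ∈ B.getLast?, DAdj e (m * hd i))
    (hBcov : ∀ r, 0 < r → (∀ q, q.Prime → q ∣ r → q ≤ prm (i+1)) →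
      (∀ d, d ∣ r → 1 < d → m * prm (i+1) * d * d.minFac ≤ X) →
      (∀ d, d ∣ prm (i+1) * r → 1 < d → m * d * d.minFac ≤ X) → m * (prm (i+1) * r) ∈ B) :
    Good X m (i+1) (B ++ l) := by
  have hlt : prm i < prm (i+1) := prm_lt (by omega)
  have hpp := prm_prime (i+1)
  have hpi : m * prm i ^ 2 ≤ X := le_trans (by gcongr) hp
  have h4 : 4 * m ≤ X := by
    exact le_trans (four_mul_le_sq m _ hpp.two_le) hp
  have hlh := hl.head hpi
  constructor
  · rw [List.nodup_append]
    refine ⟨hBn, hl.nodup, ?_⟩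
    intro a ha b hb hab
    subst hab
    obtain ⟨_, r, hr, hr0, _⟩ := hBt a ha
    obtain ⟨_, r', hr', _, hq⟩ := hl.terr a hb
    rw [hr] at hr'
    have := Nat.eq_of_mul_eq_mul_left hm hr'
    have := (hq _ hpp ⟨r, this.symm⟩).1
    omega
  · rw [List.isChain_append]
    refine ⟨hBc, hl.chain, ?_⟩
    intro x hx y hy
    rw [hlh] at hy
    simp only [Option.mem_def, Option.some.injEq] at hy
    subst hy
    exact hBl x hx
  · intro e he
    rw [List.mem_append] at he
    rcases he with he | he
    · obtain ⟨h1, r, hr, hr0, hq⟩ := hBt e he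
      refine ⟨h1, _, hr, ?_, ?_⟩
      · have := hpp.two_le
        nlinarith
      · intro q hq1 hq2
        have : q ≤ prm (i+1) := by
          rcases (Nat.Prime.dvd_mul hq1).1 hq2 with h | h
          · exact Nat.le_of_dvd hpp.pos h
          · exact hq q hq1 h
        exact ⟨this, le_trans (by gcongr) hp⟩
    · obtain ⟨h1, r, hr, hr0, hq⟩ := hl.terr e he
      exact ⟨h1, r, hr, hr0, fun q h1 h2 => ⟨le_trans (hq q h1 h2).1 hlt.le, (hq q h1 h2).2⟩⟩
  · intro _
    rw [List.getLast?_append, hl.last h4]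
    rfl
  · intro _
    rw [List.head?_append, hBh]
    simp [hd]
  · intro r hr hq hdv
    rw [List.mem_append]
    by_cases hpr : prm (i+1) ∣ r
    · left
      obtain ⟨s, rfl⟩ := hpr
      have hs0 : 0 < s := Nat.pos_of_ne_zero (by rintro rfl; simp at hr)
      have hsq : ∀ q, q.Prime → q ∣ s → q ≤ prm (i+1) :=
        fun q h1 h2 => hq q h1 (h2.mul_left _)
      refine hBcov s hs0 hsq ?_ hdv
      intro d hd1 hd2
      have h := hdv (prm (i+1) * d) (mul_dvd_mul_left _ hd1) (by have := hpp.two_le; nlinarith)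
      have hmf : d.minFac ≤ (prm (i+1) * d).minFac := by
        have hP := Nat.minFac_prime (n := prm (i+1) * d) (by
          have := hpp.two_le
          nlinarith)
        rcases (Nat.Prime.dvd_mul hP).1 (Nat.minFac_dvd _) with h | h
        · rw [(Nat.prime_dvd_prime_iff_eq hP hpp).1 h]
          exact hsq _ (Nat.minFac_prime (by omega)) ((Nat.minFac_dvd d).trans hd1)
        · exact Nat.minFac_le_of_dvd hP.two_le h
      calc m * prm (i+1) * d * d.minFac ≤ m * prm (i+1) * d * (prm (i+1) * d).minFac := by gcongr
        _ = m * (prm (i+1) * d) * (prm (i+1) * d).minFac := by ring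
        _ ≤ X := h
    · right
      refine hl.cover r hr ?_ hdv
      intro q h1 h2
      rcases prm_cases h1 (hq q h1 h2) with h | h
      · exact absurd (h ▸ h2) hpr
      · exact h

lemma small_of_cond {X n r : ℕ} (hr : 1 < r) (h : ∀ d, d ∣ r → 1 < d → n * d * d.minFac ≤ X) :
    4 * n ≤ X := by
  have h1 := h r.minFac (Nat.minFac_dvd r) (Nat.minFac_prime (by omega)).one_lt
  have h2 := (Nat.minFac_prime (n := r) (by omega)).two_le
  have h3 := (Nat.minFac_prime (n := r.minFac) (Nat.minFac_prime (by omega)).ne_one).two_le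
  calc 4 * n = n * 2 * 2 := by ring
    _ ≤ n * r.minFac * r.minFac.minFac := by gcongr
    _ ≤ X := h1

set_option maxHeartbeats 2000000 in
lemma exists_good (X : ℕ) : ∀ k m i : ℕ, 0 < m → X < m + k → ∃ l, Good X m i l := by
  intro k
  induction k with
  | zero =>
    intro m i hm hX
    refine ⟨[], ?_⟩
    constructor
    · simp
    · simp
    · simp
    · intro h
      omega
    · intro h
      have := four_mul_le_sq m _ (prm_prime i).two_le
      omega
    · intro r hr hq hd
      have := small_of_cond hr hd
      omega
  | succ k ihk =>
    intro m i hm hX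
    induction i with
    | zero => exact good_zero X m hm
    | succ i ihi =>
      obtain ⟨l, hl⟩ := ihi
      have hlt : prm i < prm (i+1) := prm_lt (by omega)
      have hpp := prm_prime (i+1)
      have hp2 := hpp.two_le
      have hq2 := (prm_prime i).two_le
      by_cases hp : m * prm (i+1) ^ 2 ≤ X
      swap
      · refine ⟨l, hl.nodup, hl.chain, ?_, hl.last, fun h => absurd h hp, ?_⟩
        · intro e he
          obtain ⟨h1, r, hr, hr0, hq⟩ := hl.terr e he
          exact ⟨h1, r, hr, hr0, fun q h1 h2 => ⟨le_trans (hq q h1 h2).1 hlt.le, (hq q h1 h2).2⟩⟩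
        · intro r hr hq hdv
          refine hl.cover r hr ?_ hdv
          intro q h1 h2
          rcases prm_cases h1 (hq q h1 h2) with h | h
          · exfalso
            subst h
            have := hdv _ h2 hpp.one_lt
            rw [hpp.minFac_eq] at this
            apply hp
            calc _ = m * prm (i+1) * prm (i+1) := by ring
              _ ≤ X := this
          · exact h
      set p := prm (i+1) with hpdef
      set n := m * p with hn
      have hn0 : 0 < n := Nat.mul_pos hm (by omega)
      have hnm : m < n := by rw [hn]; nlinarith
      have hnp : n * p ≤ X := by
        calc n * p = m * p ^ 2 := by rw [hn]; ring
          _ ≤ X := hp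
      by_cases hI : n * prm i ^ 2 ≤ X
      · -- type I
        obtain ⟨g, hg⟩ := ihk n i hn0 (by omega)
        have h4n : 4 * n ≤ X := le_trans (four_mul_le_sq n _ hq2) hI
        have hghead := hg.head hI
        have hglast := hg.last h4n
        -- the middle block
        obtain ⟨M, hMn, hMc, hMt, hMh, hMcov⟩ : ∃ M : List ℕ, M.Nodup ∧ M.IsChain DAdj ∧
            (∀ e ∈ M, e ≤ 2 * X ∧ ∃ r, e = n * (p * r) ∧ 0 < r ∧
              ∀ q, q.Prime → q ∣ r → q ≤ p) ∧
            (∀ e ∈ M.getLast?, DAdj e (2 * n)) ∧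
            (∀ r, 0 < r → (∀ q, q.Prime → q ∣ r → q ≤ p) → n * p ^ 2 ≤ X →
              (∀ d, d ∣ r → 1 < d → n * p * d * d.minFac ≤ X) → n * (p * r) ∈ M) := by
          by_cases hnp2 : n * p ^ 2 ≤ X
          swap
          · exact ⟨[], by simp, by simp, by simp, by simp, fun r _ _ h => absurd h hnp2⟩
          by_cases h4 : 4 * (n * p) ≤ X
          · obtain ⟨c, hc⟩ := ihk (n * p) (i+1) (by positivity) (by nlinarith)
            refine ⟨(n * p) :: c, ?_, ?_, ?_, ?_, ?_⟩
            · rw [List.nodup_cons]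
              refine ⟨?_, hc.nodup⟩
              intro h
              obtain ⟨_, r, hr, hr0, _⟩ := hc.terr _ h
              have h5 : 0 < n * p := by positivity
              nlinarith
            · rw [List.isChain_cons]
              refine ⟨?_, hc.chain⟩
              intro y hy
              obtain ⟨_, r, hr, hr0, _⟩ := hc.terr _ (List.mem_of_head? hy)
              exact Or.inl ⟨r, hr⟩
            · intro e he
              rw [List.mem_cons] at he
              rcases he with rfl | he
              · exact ⟨by omega, 1, by ring, by norm_num, fun q h1 h2 => by
                  have := h1.one_lt
                  have := Nat.le_of_dvd (by norm_num) h2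
                  omega⟩
              · obtain ⟨h1, r, hr, hr0, hq⟩ := hc.terr e he
                exact ⟨h1, r, by rw [hr]; ring, by omega, fun q h1 h2 => (hq q h1 h2).1⟩
            · intro e he
              have hcl := hc.last h4
              rw [List.getLast?_cons, hcl] at he
              simp only [Option.getD_some, Option.mem_def, Option.some.injEq] at he
              subst he
              right
              exact ⟨p, by ring⟩
            · intro r hr hq _ hdv
              rcases Nat.lt_or_ge 1 r with h | h
              · have := hc.cover r h hq hdv
                rw [List.mem_cons]
                right
                rw [← mul_assoc]
                exact this
              · have : r = 1 := by omega
                subst this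
                simp
          · refine ⟨[n * p, 2 * n * p], ?_, ?_, ?_, ?_, ?_⟩
            · have h5 : 0 < n * p := by positivity
              simp only [List.nodup_cons, List.mem_singleton, List.not_mem_nil, not_false_eq_true,
                List.nodup_nil, and_true]
              nlinarith
            · simp only [List.isChain_cons_cons, List.isChain_singleton, and_true]
              exact Or.inl ⟨2, by ring⟩
            · intro e he
              simp only [List.mem_cons, List.not_mem_nil, or_false] at he
              rcases he with rfl | rfl
              · exact ⟨by omega, 1, by ring, by norm_num, fun q h1 h2 => by
                  have := h1.one_lt
                  have := Nat.le_of_dvd (by norm_num) h2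
                  omega⟩
              · exact ⟨by nlinarith, 2, by ring, by norm_num, fun q h1 h2 => 
                  (Nat.le_of_dvd (by norm_num) h2).trans hp2⟩
            · intro e he
              simp only [List.getLast?_cons_cons, List.getLast?_singleton, Option.mem_def,
                Option.some.injEq] at he
              subst he
              exact Or.inr ⟨p, by ring⟩
            · intro r hr hq _ hdv
              rcases Nat.lt_or_ge 1 r with h | h
              · exact absurd (small_of_cond h hdv) h4
              · have : r = 1 := by omega
                subst this
                simp
        refine ⟨_, good_append X m i hm l (n :: (M ++ g.reverse)) hl hp ?_ ?_ ?_ ?_ ?_ ?_⟩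
        · rw [List.nodup_cons, List.nodup_append]
          refine ⟨?_, hMn, List.nodup_reverse.2 hg.nodup, ?_⟩
          · intro h
            rw [List.mem_append, List.mem_reverse] at h
            rcases h with h | h
            · obtain ⟨_, r, hr, hr0, _⟩ := hMt n h
              have : 2 ≤ p * r := by nlinarith
              nlinarith
            · obtain ⟨_, r, hr, hr0, _⟩ := hg.terr n h
              nlinarith
          · intro a ha b hb hab
            subst hab
            rw [List.mem_reverse] at hb
            obtain ⟨_, r, hr, hr0, _⟩ := hMt a ha
            obtain ⟨_, r', hr', _, hq⟩ := hg.terr a hb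
            rw [hr] at hr'
            have := Nat.eq_of_mul_eq_mul_left hn0 hr'
            have := (hq _ hpp ⟨r, this.symm⟩).1
            omega
        · rw [List.isChain_cons, List.isChain_append, List.isChain_reverse, List.head?_append,
            List.head?_reverse, hglast]
          refine ⟨?_, hMc, hg.chain.imp fun a b h => h.symm, ?_⟩
          · intro y hy
            have : n ∣ y := by
              rcases hM : M.head? with _ | z
              · rw [hM] at hy
                simp only [Option.none_or, Option.mem_def, Option.some.injEq] at hy
                exact ⟨2, by rw [← hy]; ring⟩
              · rw [hM] at hy
                simp only [Option.some_or, Option.mem_def, Option.some.injEq] at hy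
                subst hy
                obtain ⟨_, r, hr, _⟩ := hMt _ (List.mem_of_head? hM)
                exact ⟨_, hr⟩
            exact Or.inl this
          · intro x hx y hy
            simp only [Option.mem_def, Option.some.injEq] at hy
            subst hy
            exact hMh x hx
        · intro e he
          rw [List.mem_cons, List.mem_append, List.mem_reverse] at he
          rcases he with rfl | he | he
          · exact ⟨by nlinarith, 1, by rw [hn]; ring, by norm_num, fun q h1 h2 => by
                  have := h1.one_lt
                  have := Nat.le_of_dvd (by norm_num) h2
                  omega⟩
          · obtain ⟨h1, r, hr, hr0, hq⟩ := hMt e he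
            refine ⟨h1, p * r, by rw [hr, hn]; ring, by positivity, ?_⟩
            intro q hq1 hq2
            rcases (Nat.Prime.dvd_mul hq1).1 hq2 with h | h
            · exact Nat.le_of_dvd hpp.pos h
            · exact hq q hq1 h
          · obtain ⟨h1, r, hr, hr0, hq⟩ := hg.terr e he
            exact ⟨h1, r, by rw [hr, hn]; ring, by omega, fun q h1 h2 => (hq q h1 h2).1.trans hlt.le⟩
        · rfl
        · intro e he
          rw [List.getLast?_cons, List.getLast?_append, List.getLast?_reverse, hghead] at he
          simp only [Option.some_or, Option.getD_some, Option.mem_def, Option.some.injEq] at he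
          subst he
          exact Or.inr ⟨p, by rw [hn]; ring⟩
        · intro r hr hq hdv hdv'
          rw [List.mem_cons, List.mem_append, List.mem_reverse]
          have heq : m * (p * r) = n * r := by rw [hn]; ring
          rw [heq]
          by_cases hpr : p ∣ r
          · right; left
            obtain ⟨s, rfl⟩ := hpr
            have hs0 : 0 < s := Nat.pos_of_ne_zero (by rintro rfl; simp at hr)
            have hsq : ∀ q, q.Prime → q ∣ s → q ≤ p := fun q h1 h2 => hq q h1 (h2.mul_left _)
            refine hMcov s hs0 hsq ?_ ?_
            · have := hdv p (Dvd.intro _ rfl) hpp.one_lt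
              rw [hpp.minFac_eq] at this
              calc n * p ^ 2 = n * p * p := by ring
                _ ≤ X := this
            · intro d hd1 hd2
              have h := hdv (p * d) (mul_dvd_mul_left _ hd1) (by nlinarith)
              have hmf : d.minFac ≤ (p * d).minFac := by
                have hP := Nat.minFac_prime (n := p * d) (by nlinarith)
                rcases (Nat.Prime.dvd_mul hP).1 (Nat.minFac_dvd _) with h | h
                · rw [(Nat.prime_dvd_prime_iff_eq hP hpp).1 h]
                  exact hsq _ (Nat.minFac_prime (by omega)) ((Nat.minFac_dvd d).trans hd1)
                · exact Nat.minFac_le_of_dvd hP.two_le h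
              calc n * p * d * d.minFac ≤ n * p * d * (p * d).minFac := by gcongr
                _ = n * (p * d) * (p * d).minFac := by ring
                _ ≤ X := h
          · rcases Nat.lt_or_ge 1 r with h | h
            · right; right
              refine hg.cover r h ?_ hdv
              intro q h1 h2
              rcases prm_cases h1 (hq q h1 h2) with h | h
              · exact absurd (hpdef.trans h.symm ▸ h2) hpr
              · exact h
            · left
              have : r = 1 := by omega
              subst this
              simp
      · by_cases h4n : 4 * n ≤ X
        · -- type II
          have hi0 : i ≠ 0 := by
            rintro rfl
            rw [prm_zero] at hI
            omega
          have hdi : hd i = prm i := by simp [hd, hi0]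
          obtain ⟨g, hg⟩ := ihk n (i+1) hn0 (by omega)
          have hglast := hg.last h4n
          refine ⟨_, good_append X m i hm l (n :: (g ++ [2 * n * prm i])) hl hp ?_ ?_ ?_ ?_ ?_ ?_⟩
          · rw [List.nodup_cons, List.nodup_append]
            refine ⟨?_, hg.nodup, by simp, ?_⟩
            · intro h
              rw [List.mem_append, List.mem_singleton] at h
              rcases h with h | h
              · obtain ⟨_, r, hr, hr0, _⟩ := hg.terr n h
                nlinarith
              · nlinarith
            · intro a ha b hb hab
              subst hab
              rw [List.mem_singleton] at hb
              obtain ⟨_, r', hr', _, hq⟩ := hg.terr a ha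
              have h2 : n * (2 * prm i) = n * r' := by rw [← hr', hb]; ring
              have := Nat.eq_of_mul_eq_mul_left hn0 h2
              exact hI (hq _ (prm_prime i) ⟨2, by rw [← this]; ring⟩).2
          · rw [List.isChain_cons, List.isChain_append, List.head?_append, hglast]
            refine ⟨?_, hg.chain, by simp, ?_⟩
            · intro y hy
              have : n ∣ y := by
                rcases hM : g.head? with _ | z
                · rw [hM] at hy
                  simp only [Option.none_or, Option.mem_def, Option.some.injEq, List.head?_cons] at hy
                  exact ⟨2 * prm i, by rw [← hy]; ring⟩
                · rw [hM] at hy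
                  simp only [Option.some_or, Option.mem_def, Option.some.injEq] at hy
                  subst hy
                  obtain ⟨_, r, hr, _⟩ := hg.terr _ (List.mem_of_head? hM)
                  exact ⟨_, hr⟩
              exact Or.inl this
            · intro x hx y hy
              simp only [Option.mem_def, Option.some.injEq, List.head?_cons] at hy hx
              subst hy hx
              exact Or.inl ⟨prm i, rfl⟩
          · intro e he
            rw [List.mem_cons, List.mem_append, List.mem_singleton] at he
            rcases he with rfl | he | rfl
            · exact ⟨by nlinarith, 1, by rw [hn]; ring, by norm_num, fun q h1 h2 => by
                  have := h1.one_lt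
                  have := Nat.le_of_dvd (by norm_num) h2
                  omega⟩
            · obtain ⟨h1, r, hr, hr0, hq⟩ := hg.terr e he
              exact ⟨h1, r, by rw [hr, hn]; ring, by omega, fun q h1 h2 => (hq q h1 h2).1⟩
            · refine ⟨by nlinarith, 2 * prm i, by rw [hn]; ring, by positivity, ?_⟩
              intro q hq1 hq2'
              rcases (Nat.Prime.dvd_mul hq1).1 hq2' with h | h
              · exact (Nat.le_of_dvd (by norm_num) h).trans hp2
              · exact (Nat.le_of_dvd (by omega) h).trans hlt.le
          · rfl
          · intro e he
            rw [← List.cons_append, List.getLast?_append] at he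
            simp only [List.getLast?_singleton, Option.some_or, Option.mem_def,
              Option.some.injEq] at he
            subst he
            rw [hdi]
            exact Or.inr ⟨2 * p, by rw [hn]; ring⟩
          · intro r hr hq hdv hdv'
            rw [List.mem_cons, List.mem_append]
            have heq : m * (p * r) = n * r := by rw [hn]; ring
            rw [heq]
            rcases Nat.lt_or_ge 1 r with h | h
            · right; left
              exact hg.cover r h hq hdv
            · left
              have : r = 1 := by omega
              subst this
              simp
        · -- type III
          have hh := hd_ge_two i
          refine ⟨_, good_append X m i hm l [n, n * hd i] hl hp ?_ ?_ ?_ ?_ ?_ ?_⟩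
          · simp only [List.nodup_cons, List.mem_singleton, List.not_mem_nil, not_false_eq_true,
                List.nodup_nil, and_true]
            nlinarith
          · simp only [List.isChain_cons_cons, List.isChain_singleton, and_true]
            exact Or.inl ⟨hd i, rfl⟩
          · intro e he
            simp only [List.mem_cons, List.not_mem_nil, or_false] at he
            rcases he with rfl | rfl
            · exact ⟨by nlinarith, 1, by rw [hn]; ring, by norm_num, fun q h1 h2 => by
                have := h1.one_lt
                have := Nat.le_of_dvd (by norm_num) h2
                omega⟩
            · refine ⟨?_, hd i, by rw [hn]; ring, by omega, fun q h1 h2 =>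
                (hd_dvd_prime h1 h2).trans hlt.le⟩
              unfold hd
              split_ifs with h0
              · subst h0
                rw [prm_zero] at hlt
                nlinarith
              · nlinarith
          · rfl
          · intro e he
            simp only [List.getLast?_cons_cons, List.getLast?_singleton, Option.mem_def,
                Option.some.injEq] at he
            subst he
            exact Or.inr ⟨p, by rw [hn]; ring⟩
          · intro r hr hq hdv hdv'
            rcases Nat.lt_or_ge 1 r with h | h
            · exact absurd (small_of_cond h hdv) h4n
            · have : r = 1 := by omega
              subst this
              simp [hn, hpdef]

/-- The set `A(X)`. -/
def InA (X n : ℕ) : Prop := 0 < n ∧ ∀ d, d ∣ n → 1 < d → d * d.minFac ≤ X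

theorem chain_lemma (X : ℕ) : ∃ l : List ℕ, l.Nodup ∧ (∀ n ∈ l, 0 < n) ∧
    l.IsChain DAdj ∧ (∀ n ∈ l, n = 1 ∨ n ≤ 2 * X) ∧ (∀ n, InA X n → n ∈ l) := by
  obtain ⟨g, hg⟩ := exists_good X (X+1) 1 (X + 1) one_pos (by omega)
  refine ⟨1 :: g, ?_, ?_, ?_, ?_, ?_⟩
  · rw [List.nodup_cons]
    refine ⟨fun h => ?_, hg.nodup⟩
    obtain ⟨_, r, hr, hr0, _⟩ := hg.terr _ h
    omega
  · intro n hn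
    rw [List.mem_cons] at hn
    rcases hn with rfl | hn
    · norm_num
    · obtain ⟨_, r, hr, hr0, _⟩ := hg.terr _ hn
      omega
  · rw [List.isChain_cons]
    exact ⟨fun y _ => Or.inl (one_dvd y), hg.chain⟩
  · intro n hn
    rw [List.mem_cons] at hn
    rcases hn with rfl | hn
    · left; rfl
    · right
      exact (hg.terr _ hn).1
  · intro n hn
    rw [List.mem_cons]
    rcases Nat.lt_or_ge 1 n with h | h
    · right
      have := hg.cover n h ?_ ?_
      · simpa using this
      · intro q hq hqn
        have h1 := hn.2 q hqn hq.one_lt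
        rw [hq.minFac_eq] at h1
        have h3 : X + 1 ≤ prm (X + 1) := (Nat.nth_strictMono Nat.infinite_setOfPred_prime).le_apply
        have := hq.two_le
        nlinarith
      · intro d h1 h2
        simpa using hn.2 d h1 h2
    · left
      have := hn.1
      omega

end

section
open Finset

/-- sum of logs -/
noncomputable def slog (N : ℕ) : ℝ := ∑ n ∈ Ioc 0 N, Real.log n

lemma slog_succ (N : ℕ) : slog (N+1) = slog N + Real.log (N+1 : ℕ) := by
  unfold slog
  rw [← Finset.insert_Ioc_right_eq_Ioc_add_one (by omega), Finset.sum_insert (by simp), add_comm]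

lemma slog_eq (N : ℕ) :
    slog N = ∑ n ∈ Ioc 0 N, ArithmeticFunction.vonMangoldt n * ((N / n : ℕ) : ℝ) := by
  rw [← ArithmeticFunction.sum_Ioc_mul_zeta_eq_sum, ArithmeticFunction.vonMangoldt_mul_zeta]
  rfl

lemma log_succ_sub_le (N : ℕ) (hN : 0 < N) :
    (N : ℝ) * (Real.log (N+1 : ℕ) - Real.log N) ≤ 1 := by
  have hN' : (0:ℝ) < N := by exact_mod_cast hN
  have h := Real.log_le_sub_one_of_pos (x := ((N+1 : ℕ) : ℝ) / N) (by positivity)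
  rw [Real.log_div (by positivity) (by positivity)] at h
  have : ((N+1 : ℕ) : ℝ) / N - 1 = 1 / N := by
    push_cast
    field_simp
    ring
  rw [this] at h
  calc (N:ℝ) * _ ≤ N * (1 / N) := by gcongr
    _ = 1 := by field_simp

lemma log_succ_sub_ge (N : ℕ) (hN : 0 < N) :
    1 ≤ ((N+1 : ℕ) : ℝ) * (Real.log (N+1 : ℕ) - Real.log N) := by
  have hN' : (0:ℝ) < N := by exact_mod_cast hN
  have h := Real.log_le_sub_one_of_pos (x := (N : ℝ) / (N+1 : ℕ)) (by positivity)
  rw [Real.log_div (by positivity) (by positivity)] at h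
  have : (N : ℝ) / (N+1 : ℕ) - 1 = - (1 / (N+1 : ℕ)) := by
    push_cast
    field_simp
    ring
  rw [this] at h
  calc (1:ℝ) = ((N+1 : ℕ) : ℝ) * (1 / (N+1 : ℕ)) := by field_simp
    _ ≤ _ := by gcongr; linarith

lemma slog_lower (N : ℕ) : (N : ℝ) * Real.log N - N ≤ slog N := by
  induction N with
  | zero => simp [slog]
  | succ N ih =>
    rw [slog_succ]
    rcases Nat.eq_zero_or_pos N with rfl | hN
    · simp [slog]
    have := log_succ_sub_le N hN
    push_cast at *
    nlinarith

lemma slog_upper (N : ℕ) (hN : 0 < N) : slog N ≤ (N : ℝ) * Real.log N - N + 1 + Real.log N := by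
  induction N with
  | zero => omega
  | succ N ih =>
    rw [slog_succ]
    rcases Nat.eq_zero_or_pos N with rfl | hN
    · simp [slog]
    have := log_succ_sub_ge N hN
    have := ih hN
    push_cast at *
    nlinarith

/-- sum of Lambda(n)/n -/
noncomputable def mert (N : ℕ) : ℝ := ∑ n ∈ Ioc 0 N, ArithmeticFunction.vonMangoldt n / n

lemma mert_lower (N : ℕ) (hN : 0 < N) : Real.log N - 1 ≤ mert N := by
  have hN' : (0:ℝ) < N := by exact_mod_cast hN
  have h1 := slog_lower N
  have h2 : slog N ≤ N * mert N := by
    rw [slog_eq, mert, Finset.mul_sum]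
    refine Finset.sum_le_sum fun n hn => ?_
    rw [mem_Ioc] at hn
    have : ((N / n : ℕ) : ℝ) ≤ N / n := Nat.cast_div_le
    calc _ ≤ ArithmeticFunction.vonMangoldt n * ((N:ℝ) / n) :=
          mul_le_mul_of_nonneg_left this ArithmeticFunction.vonMangoldt_nonneg
      _ = _ := by ring
  have : (N:ℝ) * (Real.log N - 1) ≤ N * mert N := by linarith
  exact le_of_mul_le_mul_left this hN'

lemma log4_le : Real.log 4 ≤ 1.4 := by
  have : Real.log 4 = 2 * Real.log 2 := by
    rw [show (4:ℝ) = 2 ^ 2 by norm_num, Real.log_pow]; norm_num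
  rw [this]
  have := Real.log_two_lt_d9
  linarith

lemma mert_upper (N : ℕ) (hN : 0 < N) : mert N ≤ Real.log N + 6 := by
  have hN' : (0:ℝ) < N := by exact_mod_cast hN
  have h1 := slog_upper N hN
  have h2 : N * mert N ≤ slog N + Chebyshev.psi N := by
    rw [slog_eq, mert, Finset.mul_sum, Chebyshev.psi, Nat.floor_natCast, ← Finset.sum_add_distrib]
    refine Finset.sum_le_sum fun n hn => ?_
    rw [mem_Ioc] at hn
    have hn0 : (0:ℝ) < n := by exact_mod_cast hn.1
    have : (N / n : ℝ) ≤ ((N / n : ℕ) : ℝ) + 1 := by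
      rw [div_le_iff₀ hn0]
      have := Nat.lt_div_mul_add (a := N) hn.1
      have h3 : N ≤ (N / n + 1) * n := by rw [add_mul, one_mul]; exact this.le
      exact_mod_cast h3
    calc _ = ArithmeticFunction.vonMangoldt n * ((N:ℝ) / n) := by ring
      _ ≤ ArithmeticFunction.vonMangoldt n * (((N / n : ℕ) : ℝ) + 1) :=
          mul_le_mul_of_nonneg_left this ArithmeticFunction.vonMangoldt_nonneg
      _ = _ := by ring
  have h3 := Chebyshev.psi_le_const_mul_self (x := N) hN'.le
  have h4 := log4_le
  have h5 := Real.log_le_sub_one_of_pos hN'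
  have : (N:ℝ) * mert N ≤ N * (Real.log N + 6) := by nlinarith
  exact le_of_mul_le_mul_left this hN'

/-- primes up to `N` -/
def prs (N : ℕ) : Finset ℕ := (Ioc 0 N).filter Nat.Prime

/-- `L(N) = ∑_{p ≤ N} log p/(p-1)` -/
noncomputable def Lf (N : ℕ) : ℝ := ∑ p ∈ prs N, Real.log p / (p - 1)

lemma mem_prs {N p : ℕ} : p ∈ prs N ↔ p.Prime ∧ p ≤ N := by
  simp only [prs, mem_filter, mem_Ioc]
  constructor
  · rintro ⟨⟨_, h⟩, hp⟩
    exact ⟨hp, h⟩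
  · rintro ⟨hp, h⟩
    exact ⟨⟨hp.pos, h⟩, hp⟩

lemma summable_log_tail : Summable (fun n : ℕ => Real.log n / ((n:ℝ) * (n - 1))) := by
  have h : Summable (fun n : ℕ => 4 * (1 / (n:ℝ) ^ (3/2 : ℝ))) :=
    (Real.summable_one_div_nat_rpow.2 (by norm_num)).mul_left 4
  refine Summable.of_nonneg_of_le ?_ ?_ h
  · intro n
    rcases Nat.lt_or_ge n 2 with hn | hn
    · interval_cases n <;> simp
    · have : (2:ℝ) ≤ n := by exact_mod_cast hn
      have := Real.log_nonneg (show (1:ℝ) ≤ n by linarith)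
      apply div_nonneg this
      nlinarith
  · intro n
    rcases Nat.lt_or_ge n 2 with hn | hn
    · interval_cases n <;> norm_num
    · have h2 : (2:ℝ) ≤ n := by exact_mod_cast hn
      have h1 := Real.log_le_rpow_div (x := n) (ε := 1/2) (by linarith) (by norm_num)
      have h3 : (n:ℝ) ^ (3/2:ℝ) = n * (n:ℝ) ^ (1/2:ℝ) := by
        rw [show (3/2:ℝ) = 1 + 1/2 by norm_num, Real.rpow_add (by linarith), Real.rpow_one]
      have h4 : (n:ℝ) = (n:ℝ) ^ (1/2:ℝ) * (n:ℝ) ^ (1/2:ℝ) := by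
        rw [← Real.rpow_add (by linarith)]; norm_num
      have h5 : 0 < (n:ℝ) ^ (1/2:ℝ) := by positivity
      rw [h3]
      set s := (n:ℝ) ^ (1/2:ℝ)
      rw [div_le_iff₀ (by nlinarith)]
      have h6 : Real.log n ≤ 2 * s := by linarith [h1]
      refine h6.trans ?_
      have : 4 * (1 / ((n:ℝ) * s)) * (n * (n - 1)) = 4 * (n - 1) / s := by field_simp
      rw [this, le_div_iff₀ h5]
      nlinarith

lemma mert_le_Lf (N : ℕ) : mert N ≤ Lf N := by
  unfold mert Lf
  -- group prime powers by their minFac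
  have hmaps : ∀ n ∈ (Ioc 0 N).filter IsPrimePow, n.minFac ∈ prs N := by
    intro n hn
    rw [mem_filter, mem_Ioc] at hn
    rw [mem_prs]
    exact ⟨Nat.minFac_prime hn.2.ne_one, (Nat.minFac_le hn.1.1).trans hn.1.2⟩
  have h1 : ∑ n ∈ Ioc 0 N, ArithmeticFunction.vonMangoldt n / n
      = ∑ n ∈ (Ioc 0 N).filter IsPrimePow, ArithmeticFunction.vonMangoldt n / n := by
    rw [Finset.sum_filter]
    refine Finset.sum_congr rfl fun n _ => ?_
    split_ifs with h
    · rfl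
    · rw [ArithmeticFunction.vonMangoldt_eq_zero_iff.2 h, zero_div]
  rw [h1, ← Finset.sum_fiberwise_of_maps_to hmaps]
  refine Finset.sum_le_sum fun p hp => ?_
  rw [mem_prs] at hp
  have hp1 : (1:ℝ) < p := by exact_mod_cast hp.1.one_lt
  have hsub : ((Ioc 0 N).filter IsPrimePow).filter (fun n => n.minFac = p)
      ⊆ (Finset.range N).image (fun k => p ^ (k+1)) := by
    intro n hn
    simp only [mem_filter, mem_Ioc] at hn
    obtain ⟨⟨⟨h0, hN⟩, hpp⟩, hm⟩ := hn
    obtain ⟨q, k, hq, hk, rfl⟩ := (isPrimePow_nat_iff _).1 hpp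
    rw [hq.pow_minFac (by omega)] at hm
    subst hm
    rw [mem_image]
    refine ⟨k - 1, ?_, by rw [Nat.sub_add_cancel hk]⟩
    rw [mem_range]
    have := Nat.lt_pow_self (n := k) hq.one_lt
    omega
  have hinj : Set.InjOn (fun k => p ^ (k+1)) (Finset.range N : Set ℕ) := by
    intro a _ b _ hab
    have := Nat.pow_right_injective hp.1.two_le hab
    omega
  calc _ ≤ ∑ n ∈ (Finset.range N).image (fun k => p ^ (k+1)),
        ArithmeticFunction.vonMangoldt n / n := by
        refine Finset.sum_le_sum_of_subset_of_nonneg hsub fun n _ _ => ?_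
        exact div_nonneg ArithmeticFunction.vonMangoldt_nonneg (by positivity)
    _ = ∑ k ∈ Finset.range N, Real.log p * ((p:ℝ)⁻¹ * (p:ℝ)⁻¹ ^ k) := by
        rw [Finset.sum_image hinj]
        refine Finset.sum_congr rfl fun k _ => ?_
        rw [ArithmeticFunction.vonMangoldt_apply_pow (by omega),
          ArithmeticFunction.vonMangoldt_apply_prime hp.1]
        push_cast
        rw [pow_succ, inv_pow, div_eq_mul_inv, mul_inv, mul_comm ((p:ℝ)^k)⁻¹]
    _ = Real.log p * ((p:ℝ)⁻¹ * ∑ k ∈ Finset.range N, (p:ℝ)⁻¹ ^ k) := by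
        rw [← Finset.mul_sum, ← Finset.mul_sum]
    _ ≤ Real.log p * ((p:ℝ)⁻¹ * ((1 - (p:ℝ)⁻¹)⁻¹)) := by
        have hlt : (p:ℝ)⁻¹ < 1 := inv_lt_one_of_one_lt₀ hp1
        have hnn : (0:ℝ) ≤ (p:ℝ)⁻¹ := by positivity
        have hg : ∑ k ∈ Finset.range N, (p:ℝ)⁻¹ ^ k ≤ (1 - (p:ℝ)⁻¹)⁻¹ := by
          rw [← tsum_geometric_of_lt_one hnn hlt]
          exact Summable.sum_le_tsum _ (fun k _ => by positivity)
            (summable_geometric_of_lt_one hnn hlt)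
        have := Real.log_nonneg hp1.le
        gcongr
    _ = Real.log p / (p - 1) := by
        have : (p:ℝ) - 1 ≠ 0 := by linarith
        field_simp

/-- Constant for the upper bound of `L`. -/
noncomputable def cL : ℝ := 6 + ∑' n : ℕ, Real.log n / ((n:ℝ) * (n - 1))

lemma Lf_lower (N : ℕ) (hN : 0 < N) : Real.log N - 1 ≤ Lf N :=
  (mert_lower N hN).trans (mert_le_Lf N)

lemma log_tail_nonneg (n : ℕ) : 0 ≤ Real.log n / ((n:ℝ) * (n - 1)) := by
  rcases Nat.lt_or_ge n 2 with hn | hn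
  · interval_cases n <;> simp
  · have : (2:ℝ) ≤ n := by exact_mod_cast hn
    have := Real.log_nonneg (show (1:ℝ) ≤ n by linarith)
    apply div_nonneg this
    nlinarith

lemma cL_pos : 6 ≤ cL := by
  unfold cL
  have : 0 ≤ ∑' n : ℕ, Real.log n / ((n:ℝ) * (n - 1)) := tsum_nonneg log_tail_nonneg
  linarith

lemma Lf_upper (N : ℕ) (hN : 0 < N) : Lf N ≤ Real.log N + cL := by
  have h1 : ∑ p ∈ prs N, Real.log p / p ≤ mert N := by
    unfold mert
    calc ∑ p ∈ prs N, Real.log p / p = ∑ p ∈ prs N, ArithmeticFunction.vonMangoldt p / p := by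
          refine Finset.sum_congr rfl fun p hp => ?_
          rw [ArithmeticFunction.vonMangoldt_apply_prime (mem_prs.1 hp).1]
      _ ≤ _ := by
          refine Finset.sum_le_sum_of_subset_of_nonneg (Finset.filter_subset _ _) fun n _ _ => ?_
          exact div_nonneg ArithmeticFunction.vonMangoldt_nonneg (by positivity)
  have h2 : Lf N = ∑ p ∈ prs N, Real.log p / p + ∑ p ∈ prs N, Real.log p / ((p:ℝ) * (p-1)) := by
    unfold Lf
    rw [← Finset.sum_add_distrib]
    refine Finset.sum_congr rfl fun p hp => ?_
    have hp1 : (1:ℝ) < p := by exact_mod_cast (mem_prs.1 hp).1.one_lt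
    have : (p:ℝ) - 1 ≠ 0 := by linarith
    field_simp
    ring
  have h3 : ∑ p ∈ prs N, Real.log p / ((p:ℝ) * (p-1)) ≤
      ∑' n : ℕ, Real.log n / ((n:ℝ) * (n - 1)) :=
    Summable.sum_le_tsum _ (fun n _ => log_tail_nonneg n) summable_log_tail
  have := mert_upper N hN
  unfold cL
  linarith

end

section

open Finset

def Sm (y z m : ℕ) : Prop := m ≠ 0 ∧ ∀ p, p.Prime → p ∣ m → y < p ∧ p ≤ z

def Dn (t n : ℕ) : Prop := ∀ d, d ∣ n → 1 < d → d * d.minFac ≤ t * n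

/-- alive at level z -/
def Al (y t z m : ℕ) : Prop := Sm y z m ∧ Dn t m ∧ z < t * m

/-- y-rough dense -/
def Rd (y t m : ℕ) : Prop := m ≠ 0 ∧ (∀ p, p.Prime → p ∣ m → y < p) ∧ Dn t m

open Classical in
noncomputable def Dd (y t z0 z1 : ℕ) : Finset ℕ :=
  (range (z1 + 1)).filter (fun d => Rd y t d ∧ z0 < t * d ∧ t * d ≤ z1)

open Classical in
noncomputable def ind (P : ℕ → Prop) (f : ℕ → ℝ) (n : ℕ) : ℝ := if P n then f n else 0

lemma split_inj {p : ℕ} (hp : p.Prime) :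
    Function.Injective (fun x : {m : ℕ // ¬ p ∣ m} × ℕ => x.1.1 * p ^ x.2) := by
  rintro ⟨⟨m, hm⟩, k⟩ ⟨⟨m', hm'⟩, k'⟩ h
  simp only at h
  have key : ∀ a b i j : ℕ, ¬ p ∣ a → a * p ^ i = b * p ^ j → j ≤ i := by
    intro a b i j ha hab
    by_contra hlt
    push Not at hlt
    obtain ⟨c, rfl⟩ := Nat.exists_eq_add_of_lt hlt
    apply ha
    have hpos : 0 < p ^ i := pow_pos hp.pos _
    have : a = b * p ^ (c + 1) := by
      apply Nat.eq_of_mul_eq_mul_right hpos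
      rw [hab]; ring
    rw [this, pow_succ]
    exact Dvd.intro_left (b * p ^ c) (by ring)
  have hk : k = k' := le_antisymm (key _ _ _ _ hm' h.symm) (key _ _ _ _ hm h)
  subst hk
  have := Nat.eq_of_mul_eq_mul_right (pow_pos hp.pos k) h
  subst this
  rfl

lemma split_pow {p : ℕ} (hp : p.Prime) (F : ℕ → ℝ) (hF : Summable F) (h0 : F 0 = 0) :
    ∑' n, F n = ∑' m, (if p ∣ m then 0 else ∑' k, F (m * p ^ k)) := by
  have hinj := split_inj hp
  rw [← hinj.tsum_eq (f := F)]
  · have hs : Summable (fun x : {m : ℕ // ¬ p ∣ m} × ℕ => F (x.1.1 * p ^ x.2)) :=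
      hF.comp_injective hinj
    rw [hs.tsum_prod]
    have := tsum_subtype (fun m : ℕ => ¬ p ∣ m) (fun m => ∑' k, F (m * p ^ k))
    erw [this]
    apply tsum_congr
    intro m
    simp only [Set.indicator]
    by_cases h : p ∣ m
    · rw [if_pos h, if_neg]; intro h'; exact h' h
    · rw [if_neg h, if_pos]; exact h
  · intro n hn
    have hn0 : n ≠ 0 := by rintro rfl; exact hn h0
    obtain ⟨k, m, hm, rfl⟩ := Nat.exists_eq_pow_mul_and_not_dvd hn0 p hp.ne_one
    exact ⟨⟨⟨m, hm⟩, k⟩, by simp [mul_comm]⟩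

lemma dn_mul_pow {t p m k : ℕ} (hp : p.Prime) (hm : m ≠ 0)
    (hq : ∀ q, q.Prime → q ∣ m → q < p) :
    Dn t (m * p ^ k) ↔ Dn t m ∧ (1 ≤ k → p ≤ t * m) := by
  have hpp : 0 < p ^ k := pow_pos hp.pos _
  constructor
  · intro h
    refine ⟨?_, ?_⟩
    · intro d hd h1
      have h2 := h (d * p ^ k) (Nat.mul_dvd_mul_right hd _) (lt_of_lt_of_le h1 (Nat.le_mul_of_pos_right _ hpp))
      have hmf : (d * p ^ k).minFac = d.minFac := by
        apply le_antisymm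
        · exact Nat.minFac_le_of_dvd (Nat.minFac_prime h1.ne').two_le
            (dvd_mul_of_dvd_left (Nat.minFac_dvd d) _)
        · have hpr : (d * p ^ k).minFac.Prime := Nat.minFac_prime (by
            have : d ≤ d * p ^ k := Nat.le_mul_of_pos_right _ hpp
            omega)
          have hdv := Nat.minFac_dvd (d * p ^ k)
          rcases (hpr.dvd_mul).1 hdv with h3 | h3
          · exact Nat.minFac_le_of_dvd hpr.two_le h3
          · have h4 := hpr.dvd_of_dvd_pow h3
            rw [(Nat.prime_dvd_prime_iff_eq hpr hp).1 h4]
            have := hq d.minFac (Nat.minFac_prime h1.ne') ((Nat.minFac_dvd d).trans hd)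
            omega
      rw [hmf] at h2
      apply Nat.le_of_mul_le_mul_right _ hpp
      calc d * d.minFac * p ^ k = d * p ^ k * d.minFac := by ring
        _ ≤ t * (m * p ^ k) := h2
        _ = t * m * p ^ k := by ring
    · intro hk
      have h2 := h (p ^ k) (Dvd.intro_left m rfl) (Nat.one_lt_pow (by omega) hp.one_lt)
      rw [hp.pow_minFac (by omega)] at h2
      apply Nat.le_of_mul_le_mul_right _ hpp
      calc p * p ^ k = p ^ k * p := by ring
        _ ≤ t * (m * p ^ k) := h2
        _ = t * m * p ^ k := by ring
  · rintro ⟨h1, h2⟩ d hd hd1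
    obtain ⟨e, f, he, hf, rfl⟩ := (Nat.dvd_mul).1 hd
    obtain ⟨j, hj, rfl⟩ := (Nat.dvd_prime_pow hp).1 hf
    have hjk : p ^ j ≤ p ^ k := Nat.pow_le_pow_right hp.pos hj
    have he0 : 0 < e := Nat.pos_of_dvd_of_pos he (Nat.pos_of_ne_zero hm)
    rcases Nat.lt_or_ge 1 e with h | h
    · have h3 := h1 e he h
      have h4 : (e * p ^ j).minFac ≤ e.minFac :=
        Nat.minFac_le_of_dvd (Nat.minFac_prime h.ne').two_le
          (dvd_mul_of_dvd_left (Nat.minFac_dvd e) _)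
      calc e * p ^ j * (e * p ^ j).minFac ≤ e * p ^ j * e.minFac := Nat.mul_le_mul_left _ h4
        _ = (e * e.minFac) * p ^ j := by ring
        _ ≤ (t * m) * p ^ k := Nat.mul_le_mul h3 hjk
        _ = _ := by ring
    · have : e = 1 := by omega
      subst this
      rw [one_mul] at hd1 ⊢
      have hj0 : j ≠ 0 := by rintro rfl; simp at hd1
      rw [hp.pow_minFac hj0]
      have h3 := h2 (by omega)
      calc p ^ j * p ≤ p ^ k * (t * m) := Nat.mul_le_mul hjk h3
        _ = _ := by ring

lemma sm_mono {y z z' m : ℕ} (h : z ≤ z') (hm : Sm y z m) : Sm y z' m :=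
  ⟨hm.1, fun p hp hd => ⟨(hm.2 p hp hd).1, (hm.2 p hp hd).2.trans h⟩⟩

lemma sm_step_np {y z m : ℕ} (h : ¬ ((z+1).Prime ∧ y < z+1)) : Sm y (z+1) m ↔ Sm y z m := by
  refine ⟨fun hm => ⟨hm.1, fun p hp hd => ?_⟩, sm_mono (Nat.le_succ z)⟩
  have h1 := hm.2 p hp hd
  refine ⟨h1.1, ?_⟩
  rcases Nat.lt_or_ge z p with h2 | h2
  · have : p = z + 1 := by omega
    subst this
    exact absurd ⟨hp, h1.1⟩ h
  · exact h2

lemma rd_le {y t n p : ℕ} (h : Rd y t n) (hp : p.Prime) (hd : p ∣ n) : p ≤ t * n := by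
  have h1 := h.2.2 p hd hp.one_lt
  rw [hp.minFac_eq] at h1
  exact (Nat.le_mul_of_pos_left p hp.pos).trans h1

lemma rd_iff {y t n z : ℕ} (hz : t * n ≤ z) : Rd y t n ↔ Sm y z n ∧ Dn t n := by
  constructor
  · intro h
    exact ⟨⟨h.1, fun p hp hd => ⟨h.2.1 p hp hd, (rd_le h hp hd).trans hz⟩⟩, h.2.2⟩
  · rintro ⟨h1, h2⟩
    exact ⟨h1.1, fun p hp hd => (h1.2 p hp hd).1, h2⟩

lemma al_rd {y t n z : ℕ} (h : Al y t z n) : Rd y t n :=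
  ⟨h.1.1, fun p hp hd => (h.1.2 p hp hd).1, h.2.1⟩

lemma sm_mul_pow {y z m k : ℕ} (hp : (z+1).Prime) (hy : y < z + 1) (hm : ¬ (z+1) ∣ m) :
    Sm y (z+1) (m * (z+1) ^ k) ↔ Sm y z m := by
  constructor
  · rintro ⟨h0, h⟩
    refine ⟨left_ne_zero_of_mul h0, fun q hq hd => ?_⟩
    have h1 := h q hq (dvd_mul_of_dvd_left hd _)
    refine ⟨h1.1, ?_⟩
    rcases Nat.lt_or_ge z q with h2 | h2
    · have : q = z + 1 := by omega
      subst this; exact absurd hd hm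
    · exact h2
  · rintro ⟨h0, h⟩
    refine ⟨mul_ne_zero h0 (pow_ne_zero _ hp.ne_zero), fun q hq hd => ?_⟩
    rcases hq.dvd_mul.1 hd with h1 | h1
    · have := h q hq h1; omega
    · have := (Nat.prime_dvd_prime_iff_eq hq hp).1 (hq.dvd_of_dvd_pow h1)
      omega

lemma summable_ind_of {P Q : ℕ → Prop} {f : ℕ → ℝ} (h : Summable (ind Q f)) (hPQ : ∀ n, P n → Q n) :
    Summable (ind P f) := by
  have : ind P f = Set.indicator {n | P n} (ind Q f) := by
    funext n
    by_cases hP : P n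
    · rw [Set.indicator_of_mem (by exact hP)]; simp [ind, hP, hPQ n hP]
    · rw [Set.indicator_of_notMem (by exact hP)]; simp [ind, hP]
  rw [this]
  exact h.indicator _

/-- One step. Pre y t z n = after adding prime z+1, before kill. -/
lemma step_prime {y t z : ℕ} (hp : (z+1).Prime) (hy : y < z + 1) (Φ0 Φ1 : ℕ → ℝ)
    (hs : Summable (ind (Sm y (z+1)) Φ1))
    (hΦ : ∀ m, Sm y z m → ∑' k, Φ1 (m * (z+1)^k) = Φ0 m) :
    ∑' n, ind (Al y t z) Φ0 n =
      ∑' n, ind (fun n => Sm y (z+1) n ∧ Dn t n ∧ z < t * n) Φ1 n := by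
  have hs' : Summable (ind (fun n => Sm y (z+1) n ∧ Dn t n ∧ z < t * n) Φ1) :=
    summable_ind_of hs (fun n h => h.1)
  rw [split_pow hp _ hs' (by simp [ind, Sm])]
  apply tsum_congr
  intro m
  by_cases hd : (z+1) ∣ m
  · rw [if_pos hd]
    unfold ind
    rw [if_neg]
    rintro ⟨h1, -⟩
    have := h1.2 _ hp hd
    omega
  rw [if_neg hd]
  by_cases hA : Al y t z m
  · have : ∀ k, ind (fun n => Sm y (z+1) n ∧ Dn t n ∧ z < t * n) Φ1 (m * (z+1)^k)
        = Φ1 (m * (z+1)^k) := by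
      intro k
      unfold ind
      rw [if_pos]
      refine ⟨(sm_mul_pow hp hy hd).2 hA.1, ?_, ?_⟩
      · rw [dn_mul_pow hp hA.1.1 (fun q hq h => by have := hA.1.2 q hq h; omega)]
        exact ⟨hA.2.1, fun _ => hA.2.2⟩
      · have : 0 < (z+1)^k := pow_pos hp.pos _
        calc z < t * m := hA.2.2
          _ ≤ t * (m * (z+1)^k) := Nat.mul_le_mul_left _ (Nat.le_mul_of_pos_right _ this)
    simp_rw [this]
    rw [hΦ m hA.1]
    simp [ind, hA]
  · have : ∀ k, ind (fun n => Sm y (z+1) n ∧ Dn t n ∧ z < t * n) Φ1 (m * (z+1)^k) = 0 := by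
      intro k
      unfold ind
      rw [if_neg]
      rintro ⟨h1, h2, h3⟩
      apply hA
      have h1' := (sm_mul_pow hp hy hd).1 h1
      rw [dn_mul_pow hp h1'.1 (fun q hq h => by have := h1'.2 q hq h; omega)] at h2
      refine ⟨h1', h2.1, ?_⟩
      rcases Nat.eq_zero_or_pos k with rfl | hk
      · simpa using h3
      · exact h2.2 hk
    simp_rw [this]
    simp [ind, hA]

lemma kill {y t z : ℕ} (ht : 1 ≤ t) (Φ1 : ℕ → ℝ) (hs : Summable (ind (Sm y (z+1)) Φ1)) :
    ∑' n, ind (fun n => Sm y (z+1) n ∧ Dn t n ∧ z < t * n) Φ1 n =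
      ∑' n, ind (Al y t (z+1)) Φ1 n + ∑ d ∈ Dd y t z (z+1), Φ1 d := by
  classical
  have h1 : Summable (ind (Al y t (z+1)) Φ1) := summable_ind_of hs (fun n h => h.1)
  have h2 : ∑ d ∈ Dd y t z (z+1), Φ1 d = ∑' n, ind (fun n => n ∈ Dd y t z (z+1)) Φ1 n := by
    rw [tsum_eq_sum (s := Dd y t z (z+1))]
    · apply Finset.sum_congr rfl
      intro d hd; simp [ind, hd]
    · intro d hd; simp [ind, hd]
  have h3 : Summable (ind (fun n => n ∈ Dd y t z (z+1)) Φ1) := by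
    apply summable_of_ne_finset_zero (s := Dd y t z (z+1))
    intro d hd; simp [ind, hd]
  rw [h2, ← h1.tsum_add h3]
  apply tsum_congr
  intro n
  have hmem : n ∈ Dd y t z (z+1) ↔ (Sm y (z+1) n ∧ Dn t n) ∧ t * n = z + 1 := by
    unfold Dd
    rw [mem_filter, mem_range]
    constructor
    · rintro ⟨-, h4, h5, h6⟩
      exact ⟨(rd_iff h6).1 h4, by omega⟩
    · rintro ⟨h4, h5⟩
      have : n ≤ t * n := Nat.le_mul_of_pos_left _ ht
      exact ⟨by omega, (rd_iff h5.le).2 h4, by omega, by omega⟩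
  unfold ind
  beta_reduce
  simp only [hmem]
  unfold Al
  by_cases ha : Sm y (z+1) n ∧ Dn t n
  · rcases lt_trichotomy (t * n) (z+1) with h | h | h
    · rw [if_neg, if_neg, if_neg] <;> first | omega | simp
    · rw [if_pos ⟨ha.1, ha.2, by omega⟩, if_neg (by omega), if_pos ⟨ha, h⟩, zero_add]
    · rw [if_pos ⟨ha.1, ha.2, by omega⟩, if_pos ⟨ha.1, ha.2, h⟩, if_neg (by omega), add_zero]
  · rw [if_neg (fun h => ha ⟨h.1, h.2.1⟩), if_neg (fun h => ha ⟨h.1, h.2.1⟩),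
      if_neg (fun h => ha h.1), add_zero]

structure Harm (y z1 : ℕ) (Φ : ℕ → ℕ → ℝ) : Prop where
  sm : ∀ z ≤ z1, Summable (ind (Sm y z) (Φ z))
  pr : ∀ z < z1, (z+1).Prime → y < z+1 → ∀ m, Sm y z m → ∑' k, Φ (z+1) (m * (z+1)^k) = Φ z m
  np : ∀ z < z1, ¬ ((z+1).Prime ∧ y < z+1) → ∀ m, Sm y z m → Φ (z+1) m = Φ z m

lemma Dd_succ {y t z0 z : ℕ} (h : z0 ≤ z) (g : ℕ → ℝ) :
    ∑ d ∈ Dd y t z0 (z+1), g d = ∑ d ∈ Dd y t z0 z, g d + ∑ d ∈ Dd y t z (z+1), g d := by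
  classical
  rw [← Finset.sum_union]
  · congr 1
    ext d
    unfold Dd
    simp only [mem_filter, mem_range, mem_union]
    constructor
    · rintro ⟨h1, h2, h3, h4⟩
      rcases Nat.lt_or_ge z (t * d) with h5 | h5
      · right; exact ⟨h1, h2, h5, h4⟩
      · left; refine ⟨?_, h2, h3, h5⟩
        have : 0 < t := by
          rcases Nat.eq_zero_or_pos t with rfl | h
          · simp at h3
          · exact h
        have : d ≤ t * d := Nat.le_mul_of_pos_left _ this
        omega
    · rintro (⟨h1, h2, h3, h4⟩ | ⟨h1, h2, h3, h4⟩)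
      · exact ⟨by omega, h2, h3, by omega⟩
      · exact ⟨by omega, h2, by omega, h4⟩
  · rw [Finset.disjoint_left]
    intro d h1 h2
    unfold Dd at h1 h2
    rw [mem_filter] at h1 h2
    omega

theorem proc {y t z0 z1 : ℕ} (ht : 1 ≤ t) (h01 : z0 ≤ z1) {Φ : ℕ → ℕ → ℝ} (H : Harm y z1 Φ) :
    ∑' n, ind (Al y t z0) (Φ z0) n =
      ∑' n, ind (Al y t z1) (Φ z1) n + ∑ d ∈ Dd y t z0 z1, Φ (t * d) d := by
  classical
  have key : ∀ z, z0 ≤ z → z ≤ z1 → ∑' n, ind (Al y t z0) (Φ z0) n =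
      ∑' n, ind (Al y t z) (Φ z) n + ∑ d ∈ Dd y t z0 z, Φ (t * d) d := by
    intro z hz
    induction z, hz using Nat.le_induction with
    | base =>
      intro _
      have : Dd y t z0 z0 = ∅ := by
        unfold Dd
        apply Finset.filter_eq_empty_iff.2
        intro d _; omega
      simp [this]
    | succ z hz ih =>
      intro hz1
      rw [ih (by omega), Dd_succ hz]
      have hk := kill (y := y) (t := t) (z := z) ht (Φ (z+1)) (H.sm _ hz1)
      have hd : ∑ d ∈ Dd y t z (z+1), Φ (t * d) d = ∑ d ∈ Dd y t z (z+1), Φ (z+1) d := by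
        apply Finset.sum_congr rfl
        intro d hd
        unfold Dd at hd
        rw [mem_filter] at hd
        have : t * d = z + 1 := by omega
        rw [this]
      have hst : ∑' n, ind (Al y t z) (Φ z) n =
          ∑' n, ind (fun n => Sm y (z+1) n ∧ Dn t n ∧ z < t * n) (Φ (z+1)) n := by
        by_cases hp : (z+1).Prime ∧ y < z+1
        · exact step_prime hp.1 hp.2 _ _ (H.sm _ hz1) (H.pr z (by omega) hp.1 hp.2)
        · apply tsum_congr
          intro n
          unfold ind Al
          simp only [sm_step_np hp]
          by_cases hA : Sm y z n ∧ Dn t n ∧ z < t * n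
          · rw [if_pos hA, if_pos hA, H.np z (by omega) hp n hA.1]
          · rw [if_neg hA, if_neg hA]
      rw [hst, hk, hd]
      ring
  exact key z1 h01 le_rfl

lemma sm_zero {y m : ℕ} : Sm y 0 m ↔ m = 1 := by
  constructor
  · rintro ⟨h0, h⟩
    by_contra h1
    obtain ⟨p, hp, hd⟩ := Nat.exists_prime_and_dvd h1
    have := (h p hp hd).2
    have := hp.pos
    omega
  · rintro rfl
    refine ⟨one_ne_zero, fun p hp hd => ?_⟩
    exact absurd (Nat.dvd_one.1 hd) hp.ne_one

lemma dn_one {t : ℕ} : Dn t 1 := by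
  intro d hd h1
  have := Nat.dvd_one.1 hd
  omega

lemma al_zero {y t m : ℕ} (ht : 1 ≤ t) : Al y t 0 m ↔ m = 1 := by
  unfold Al
  rw [sm_zero]
  constructor
  · exact fun h => h.1
  · rintro rfl
    exact ⟨rfl, dn_one, by omega⟩

lemma tsum_al_zero {y t : ℕ} (ht : 1 ≤ t) (f : ℕ → ℝ) : ∑' n, ind (Al y t 0) f n = f 1 := by
  rw [tsum_eq_single 1]
  · simp [ind, al_zero ht]
  · intro b hb; simp [ind, al_zero ht, hb]

/-- if `t > z` all smooth numbers are alive -/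
lemma al_of_lt {y t z m : ℕ} (h : z < t) : Al y t z m ↔ Sm y z m := by
  refine ⟨fun h => h.1, fun hm => ⟨hm, ?_, ?_⟩⟩
  · intro d hd h1
    have hdp := Nat.minFac_prime h1.ne'
    have h2 := (hm.2 _ hdp ((Nat.minFac_dvd d).trans hd)).2
    have h3 := Nat.le_of_dvd (Nat.pos_of_ne_zero hm.1) hd
    calc d * d.minFac ≤ m * z := Nat.mul_le_mul h3 h2
      _ ≤ m * t := Nat.mul_le_mul_left _ h.le
      _ = t * m := mul_comm _ _
  · have : 1 ≤ m := Nat.pos_of_ne_zero hm.1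
    calc z < t := h
      _ ≤ t * m := Nat.le_mul_of_pos_right _ this

end

section

open Finset

noncomputable def pr (y z : ℕ) : Finset ℕ := (prs z).filter (fun p => y < p)
noncomputable def Wf (y z : ℕ) : ℝ := ∏ p ∈ pr y z, (1 - 1 / (p:ℝ))
noncomputable def Lg (y z : ℕ) : ℝ := ∑ p ∈ pr y z, Real.log p / (p - 1)
noncomputable def Vr (y z : ℕ) : ℝ := ∑ p ∈ pr y z, Real.log p ^ 2 * p / ((p:ℝ) - 1) ^ 2

lemma mem_pr {y z p : ℕ} : p ∈ pr y z ↔ p.Prime ∧ y < p ∧ p ≤ z := by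
  unfold pr; rw [mem_filter, mem_prs]; tauto

lemma pr_succ_p {y z : ℕ} (hp : (z+1).Prime) (hy : y < z + 1) : pr y (z+1) = insert (z+1) (pr y z) := by
  ext p
  rw [mem_insert, mem_pr, mem_pr]
  constructor
  · rintro ⟨h1, h2, h3⟩
    rcases Nat.lt_or_ge z p with h | h
    · left; omega
    · right; exact ⟨h1, h2, h⟩
  · rintro (rfl | ⟨h1, h2, h3⟩)
    · exact ⟨hp, hy, le_rfl⟩
    · exact ⟨h1, h2, by omega⟩

lemma notMem_pr {y z : ℕ} : z + 1 ∉ pr y z := by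
  rw [mem_pr]; omega

lemma pr_succ_np {y z : ℕ} (h : ¬ ((z+1).Prime ∧ y < z + 1)) : pr y (z+1) = pr y z := by
  ext p
  rw [mem_pr, mem_pr]
  constructor
  · rintro ⟨h1, h2, h3⟩
    rcases Nat.lt_or_ge z p with h' | h'
    · have : p = z + 1 := by omega
      subst this; exact absurd ⟨h1, h2⟩ h
    · exact ⟨h1, h2, h'⟩
  · rintro ⟨h1, h2, h3⟩
    exact ⟨h1, h2, by omega⟩

lemma factor_pos {p : ℕ} (hp : p.Prime) : 0 < 1 - 1 / (p:ℝ) := by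
  have : (1:ℝ) < p := by exact_mod_cast hp.one_lt
  rw [sub_pos, div_lt_one (by linarith)]; exact this

lemma Wf_pos (y z : ℕ) : 0 < Wf y z := by
  apply Finset.prod_pos
  intro p hp
  exact factor_pos (mem_pr.1 hp).1

lemma Wf_le_one (y z : ℕ) : Wf y z ≤ 1 := by
  apply Finset.prod_le_one
  · intro p hp; exact (factor_pos (mem_pr.1 hp).1).le
  · intro p hp
    have : (0:ℝ) ≤ 1 / p := by positivity
    linarith

lemma Wf_zero (y : ℕ) : Wf y 0 = 1 := by
  have : pr y 0 = ∅ := by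
    ext p; rw [mem_pr]; simp; intro h1 _; exact h1.pos.ne'
  simp [Wf, this]

lemma Lg_zero (y : ℕ) : Lg y 0 = 0 := by
  have : pr y 0 = ∅ := by
    ext p; rw [mem_pr]; simp; intro h1 _; exact h1.pos.ne'
  simp [Lg, this]

lemma Vr_zero (y : ℕ) : Vr y 0 = 0 := by
  have : pr y 0 = ∅ := by
    ext p; rw [mem_pr]; simp; intro h1 _; exact h1.pos.ne'
  simp [Vr, this]

noncomputable def rtHom : ℕ →* ℝ where
  toFun m := (m:ℝ) ^ (-(1/2:ℝ))
  map_one' := by simp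
  map_mul' a b := by
    simp only [Nat.cast_mul]
    rw [Real.mul_rpow (Nat.cast_nonneg _) (Nat.cast_nonneg _)]

lemma summable_rt (y z : ℕ) : Summable (ind (Sm y z) (fun m => (m:ℝ) ^ (-(1/2:ℝ)))) := by
  classical
  have h := (EulerProduct.summable_and_hasSum_smoothNumbers_prod_primesBelow_geometric
    (f := rtHom) (by
      intro p hp
      change ‖(p:ℝ) ^ (-(1/2:ℝ))‖ < 1
      rw [Real.norm_of_nonneg (by positivity)]
      exact Real.rpow_lt_one_of_one_lt_of_neg (by exact_mod_cast hp.one_lt) (by norm_num)) (z+1)).1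
  have h2 : Summable ((Nat.smoothNumbers (z+1)).indicator (fun m : ℕ => ‖rtHom m‖)) :=
    summable_subtype_iff_indicator.1 h
  have h3 : ind (fun m => m ∈ Nat.smoothNumbers (z+1)) (fun m => (m:ℝ) ^ (-(1/2:ℝ)))
      = (Nat.smoothNumbers (z+1)).indicator (fun m : ℕ => ‖rtHom m‖) := by
    funext m
    unfold ind
    simp only [Set.indicator]
    split_ifs
    · change _ = ‖(m:ℝ) ^ (-(1/2:ℝ))‖
      rw [Real.norm_of_nonneg (by positivity)]
    · rfl
  rw [← h3] at h2
  apply summable_ind_of h2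
  intro n hn
  refine ⟨hn.1, fun p hp => ?_⟩
  have := hn.2 p (Nat.prime_of_mem_primeFactorsList hp) (Nat.dvd_of_mem_primeFactorsList hp)
  omega

lemma summable_sm (y z : ℕ) (f : ℕ → ℝ) (C : ℝ) (hf : ∀ m : ℕ, 1 ≤ m → |f m| ≤ C * (m:ℝ) ^ (-(1/2:ℝ))) :
    Summable (ind (Sm y z) f) := by
  apply Summable.of_norm_bounded ((summable_rt y z).mul_left C)
  intro m
  unfold ind
  split_ifs with h
  · exact hf m (Nat.pos_of_ne_zero h.1)
  · simp

lemma rt_bound (a b c : ℝ) (m : ℕ) (hm : 1 ≤ m) :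
    |(a + b * Real.log m + c * Real.log m ^ 2) / m| ≤
      (|a| + 4 * |b| + 16 * |c|) * (m:ℝ) ^ (-(1/2:ℝ)) := by
  have hm1 : (1:ℝ) ≤ m := by exact_mod_cast hm
  have hm0 : (0:ℝ) < m := by linarith
  have hl0 : 0 ≤ Real.log m := Real.log_nonneg hm1
  have hl : Real.log m ≤ 4 * (m:ℝ) ^ (1/4:ℝ) := by
    have := Real.log_le_rpow_div hm0.le (ε := 1/4) (by norm_num)
    linarith
  have h4 : (1:ℝ) ≤ (m:ℝ) ^ (1/4:ℝ) := Real.one_le_rpow hm1 (by norm_num)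
  set u := (m:ℝ) ^ (1/4:ℝ) with hu
  have hu4 : (m:ℝ) = u ^ 4 := by
    rw [hu, ← Real.rpow_natCast, ← Real.rpow_mul hm0.le]; norm_num
  have hum : (m:ℝ) ^ (-(1/2:ℝ)) = 1 / u ^ 2 := by
    rw [Real.rpow_neg hm0.le, one_div, hu, ← Real.rpow_natCast, ← Real.rpow_mul hm0.le]; norm_num
  rw [hum, abs_div, abs_of_pos hm0, div_le_iff₀ hm0]
  have hu0 : 0 < u := by linarith
  have : (|a| + 4 * |b| + 16 * |c|) * (1 / u ^ 2) * m = (|a| + 4 * |b| + 16 * |c|) * u ^ 2 := by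
    rw [hu4]; field_simp
  rw [this]
  have h1 : |a + b * Real.log m + c * Real.log m ^ 2| ≤ |a| + |b| * Real.log m + |c| * Real.log m ^ 2 := by
    have := abs_add_three a (b * Real.log m) (c * Real.log m ^ 2)
    rw [abs_mul, abs_mul, abs_of_nonneg hl0, abs_of_nonneg (sq_nonneg (Real.log (m:ℝ)))] at this
    exact this
  have h2 : Real.log m ≤ 4 * u ^ 2 := by nlinarith
  have h3 : Real.log m ^ 2 ≤ 16 * u ^ 2 := by nlinarith
  have h5 : (1:ℝ) ≤ u ^ 2 := by nlinarith
  have := abs_nonneg a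
  have := abs_nonneg b
  have := abs_nonneg c
  calc _ ≤ _ := h1
    _ ≤ |a| * u ^ 2 + |b| * (4 * u^2) + |c| * (16 * u ^ 2) := by
      gcongr
      nlinarith
    _ = _ := by ring

/-- quadratic log polynomial summable -/
lemma summable_quad (y z : ℕ) (a b c : ℝ) :
    Summable (ind (Sm y z) (fun m => (a + b * Real.log m + c * Real.log m ^ 2) / m)) :=
  summable_sm y z _ _ (fun m hm => rt_bound a b c m hm)

lemma geo_quad {q : ℝ} (h0 : 0 ≤ q) (h1 : q < 1) (α β γ : ℝ) :
    HasSum (fun k : ℕ => (1 - q) * q ^ k * (α + β * k + γ * (k:ℝ)^2))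
      (α + β * (q / (1 - q)) + γ * (q * (1 + q) / (1 - q)^2)) := by
  have hq : ‖q‖ < 1 := by rw [Real.norm_of_nonneg h0]; exact h1
  have s0 := hasSum_geometric_of_lt_one h0 h1
  have s1 := hasSum_coe_mul_geometric_of_norm_lt_one hq
  have s2 := hasSum_choose_mul_geometric_of_norm_lt_one 2 hq
  have h1q : (1 - q) ≠ 0 := by linarith
  have := ((s0.mul_left ((1 - q) * (α - 2 * γ))).add (s1.mul_left ((1-q) * (β - 3 * γ)))).add
    (s2.mul_left ((1-q) * (2 * γ)))
  convert this using 1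
  · rfl
  · funext k
    have hc : ((Nat.choose (k+2) 2 : ℕ) : ℝ) = ((k:ℝ) + 2) * (k + 1) / 2 := by
      rw [Nat.cast_choose_two]; push_cast; ring
    rw [hc]; ring
  · field_simp
    ring

noncomputable def Ph (y : ℕ) (z m : ℕ) : ℝ := Wf y z / m
noncomputable def Ph1 (y : ℕ) (z m : ℕ) : ℝ := Wf y z * (Real.log m - Lg y z) / m
noncomputable def Ph2 (y : ℕ) (z m : ℕ) : ℝ := Wf y z * ((Real.log m - Lg y z)^2 - Vr y z) / m

/-- general quadratic harmonicity at a prime step -/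
lemma quad_step {y z m : ℕ} (hp : (z+1).Prime) (hy : y < z+1) (hm : m ≠ 0) (a b c L V : ℝ) :
    HasSum (fun k : ℕ => Wf y (z+1) * (a + b * (Real.log ((m * (z+1)^k : ℕ):ℝ) - (L + Real.log (z+1 : ℕ) / (((z+1 : ℕ):ℝ) - 1)))
       + c * ((Real.log ((m * (z+1)^k : ℕ):ℝ) - (L + Real.log (z+1 : ℕ) / (((z+1 : ℕ):ℝ) - 1)))^2
         - (V + Real.log (z+1 : ℕ)^2 * (z+1 : ℕ) / (((z+1 : ℕ):ℝ) - 1)^2))) / ((m * (z+1)^k : ℕ):ℝ))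
      (Wf y z * (a + b * (Real.log m - L) + c * ((Real.log m - L)^2 - V)) / m) := by
  set p : ℝ := ((z+1 : ℕ):ℝ) with hpd
  have hp1 : (1:ℝ) < p := by rw [hpd]; exact_mod_cast hp.one_lt
  have hm0 : (0:ℝ) < m := by exact_mod_cast Nat.pos_of_ne_zero hm
  have hW : Wf y (z+1) = (1 - 1/p) * Wf y z := by
    unfold Wf; rw [pr_succ_p hp hy, prod_insert notMem_pr]
  set l := Real.log p
  set A := Real.log m - (L + l / (p - 1)) with hA
  set B := V + l^2 * p / (p-1)^2 with hB
  have hlog : ∀ k : ℕ, Real.log ((m * (z+1)^k : ℕ):ℝ) - (L + l / (p - 1)) = A + k * l := by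
    intro k
    have : ((m * (z+1)^k : ℕ):ℝ) = (m:ℝ) * p ^ k := by rw [hpd]; push_cast; ring
    rw [this, Real.log_mul hm0.ne' (by positivity), Real.log_pow]
    simp only [hA]; ring
  have hq0 : (0:ℝ) ≤ 1 / p := by positivity
  have hq1 : 1 / p < 1 := by rw [div_lt_one (by linarith)]; exact hp1
  have hg := (geo_quad hq0 hq1 (a + b * A + c * (A^2 - B)) (b * l + 2 * c * A * l) (c * l^2)).mul_left (Wf y z / m)
  convert hg using 1
  · rfl
  · funext k
    rw [hlog k, hW]
    have : ((m * (z+1)^k : ℕ):ℝ) = (m:ℝ) * p ^ k := by rw [hpd]; push_cast; ring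
    rw [this, one_div, inv_pow]
    have : p ≠ 0 := by linarith
    field_simp
    ring
  · have e1 : (1/p) / (1 - 1/p) = 1 / (p - 1) := by
      have : p ≠ 0 := by linarith
      have : p - 1 ≠ 0 := by linarith
      field_simp
    have e2 : (1/p) * (1 + 1/p) / (1 - 1/p)^2 = (p + 1) / (p - 1)^2 := by
      have : p ≠ 0 := by linarith
      have : p - 1 ≠ 0 := by linarith
      field_simp
    rw [e1, e2, hA, hB]
    have : p - 1 ≠ 0 := by linarith
    field_simp
    ring

lemma Lg_succ_p {y z : ℕ} (hp : (z+1).Prime) (hy : y < z+1) :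
    Lg y (z+1) = Lg y z + Real.log (z+1 : ℕ) / (((z+1 : ℕ):ℝ) - 1) := by
  unfold Lg; rw [pr_succ_p hp hy, sum_insert notMem_pr]; ring

lemma Vr_succ_p {y z : ℕ} (hp : (z+1).Prime) (hy : y < z+1) :
    Vr y (z+1) = Vr y z + Real.log (z+1 : ℕ)^2 * (z+1 : ℕ) / (((z+1 : ℕ):ℝ) - 1)^2 := by
  unfold Vr; rw [pr_succ_p hp hy, sum_insert notMem_pr]; ring

lemma harm_quad (y z1 : ℕ) (a b c : ℝ) : Harm y z1 (fun z m =>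
    Wf y z * (a + b * (Real.log m - Lg y z) + c * ((Real.log m - Lg y z)^2 - Vr y z)) / m) := by
  refine ⟨?_, ?_, ?_⟩
  · intro z _
    have := summable_quad y z (Wf y z * (a - b * Lg y z + c * (Lg y z ^2 - Vr y z)))
      (Wf y z * (b - 2 * c * Lg y z)) (Wf y z * c)
    convert this using 2
    funext m
    ring
  · intro z _ hp hy m hm
    beta_reduce
    rw [Lg_succ_p hp hy, Vr_succ_p hp hy]
    exact (quad_step hp hy hm.1 a b c (Lg y z) (Vr y z)).tsum_eq
  · intro z _ hnp m _
    beta_reduce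
    unfold Lg Vr Wf
    rw [pr_succ_np hnp]

lemma harm0 (y z1 : ℕ) : Harm y z1 (Ph y) := by
  convert harm_quad y z1 1 0 0 using 3
  unfold Ph; ring

lemma harm1 (y z1 : ℕ) : Harm y z1 (Ph1 y) := by
  convert harm_quad y z1 0 1 0 using 3
  unfold Ph1; ring

lemma harm2 (y z1 : ℕ) : Harm y z1 (Ph2 y) := by
  convert harm_quad y z1 0 0 1 using 3
  unfold Ph2; ring

end

section

open Finset

noncomputable def Tf (y t z : ℕ) : ℝ := ∑' n, ind (Al y t z) (Ph y z) n
noncomputable def Kf (y t z : ℕ) : ℝ := ∑' n, ind (Al y t z) (Ph1 y z) n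

lemma mem_Dd {y t z0 z1 d : ℕ} (ht : 1 ≤ t) : d ∈ Dd y t z0 z1 ↔ Rd y t d ∧ z0 < t * d ∧ t * d ≤ z1 := by
  classical
  unfold Dd
  rw [mem_filter, mem_range]
  constructor
  · exact fun h => h.2
  · intro h
    have : d ≤ t * d := Nat.le_mul_of_pos_left _ ht
    exact ⟨by omega, h⟩

lemma Dd_pos {y t z0 z1 d : ℕ} (ht : 1 ≤ t) (h : d ∈ Dd y t z0 z1) : (0:ℝ) < d := by
  have := ((mem_Dd ht).1 h).1.1
  exact_mod_cast Nat.pos_of_ne_zero this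

lemma T_step {y t z0 z1 : ℕ} (ht : 1 ≤ t) (h : z0 ≤ z1) :
    Tf y t z0 = Tf y t z1 + ∑ d ∈ Dd y t z0 z1, Wf y (t * d) / d :=
  proc ht h (harm0 y z1)

lemma T_zero {y t : ℕ} (ht : 1 ≤ t) : Tf y t 0 = 1 := by
  unfold Tf; rw [tsum_al_zero ht]; simp [Ph, Wf_zero]

lemma K_zero {y t : ℕ} (ht : 1 ≤ t) : Kf y t 0 = 0 := by
  unfold Kf; rw [tsum_al_zero ht]; simp [Ph1, Wf_zero, Lg_zero]

lemma K_step {y t z0 z1 : ℕ} (ht : 1 ≤ t) (h : z0 ≤ z1) :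
    Kf y t z0 = Kf y t z1 + ∑ d ∈ Dd y t z0 z1, Wf y (t * d) * (Real.log d - Lg y (t * d)) / d :=
  proc ht h (harm1 y z1)

lemma K_id {y t z : ℕ} (ht : 1 ≤ t) :
    Kf y t z = ∑ d ∈ Dd y t 0 z, Wf y (t * d) / d * (Lg y (t * d) - Real.log d) := by
  have := K_step (y := y) ht (Nat.zero_le z)
  rw [K_zero ht] at this
  have h2 : ∑ d ∈ Dd y t 0 z, Wf y (t * d) / d * (Lg y (t * d) - Real.log d)
      = - ∑ d ∈ Dd y t 0 z, Wf y (t * d) * (Real.log d - Lg y (t * d)) / d := by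
    rw [← Finset.sum_neg_distrib]
    apply Finset.sum_congr rfl
    intro d _; ring
  rw [h2]; linarith

lemma ind_congr {P Q : ℕ → Prop} {f : ℕ → ℝ} (h : ∀ n, P n ↔ Q n) : ind P f = ind Q f := by
  have : P = Q := funext fun n => propext (h n)
  rw [this]

lemma ind_nonneg {P : ℕ → Prop} {f : ℕ → ℝ} (h : ∀ n, P n → 0 ≤ f n) (n : ℕ) : 0 ≤ ind P f n := by
  unfold ind; split_ifs with hP
  · exact h n hP
  · exact le_rfl

lemma Ph_nonneg (y z m : ℕ) : 0 ≤ Ph y z m := div_nonneg (Wf_pos y z).le (Nat.cast_nonneg _)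

lemma T_nonneg (y t z : ℕ) : 0 ≤ Tf y t z := tsum_nonneg (ind_nonneg (fun n _ => Ph_nonneg y z n))

lemma WD_nonneg (y t z0 z1 : ℕ) : 0 ≤ ∑ d ∈ Dd y t z0 z1, Wf y (t * d) / d :=
  Finset.sum_nonneg (fun d _ => div_nonneg (Wf_pos y _).le (Nat.cast_nonneg _))

lemma T_anti {y t z0 z1 : ℕ} (ht : 1 ≤ t) (h : z0 ≤ z1) : Tf y t z1 ≤ Tf y t z0 := by
  have := T_step (y := y) ht h
  have := WD_nonneg y t z0 z1
  linarith

lemma T_le_one {y t z : ℕ} (ht : 1 ≤ t) : Tf y t z ≤ 1 := by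
  rw [← T_zero (y := y) ht]; exact T_anti ht (Nat.zero_le _)

lemma WD_le_one {y t z : ℕ} (ht : 1 ≤ t) : ∑ d ∈ Dd y t 0 z, Wf y (t * d) / d ≤ 1 := by
  have := T_step (y := y) ht (Nat.zero_le z)
  rw [T_zero ht] at this
  have := T_nonneg y t z
  linarith

lemma Dd_empty {y t z : ℕ} (h : z < t) : Dd y t 0 z = ∅ := by
  apply Finset.eq_empty_of_forall_notMem
  intro d hd
  rw [mem_Dd (by omega)] at hd
  have h1 : 1 ≤ d := Nat.pos_of_ne_zero hd.1.1
  have : t ≤ t * d := Nat.le_mul_of_pos_right _ h1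
  omega

lemma sm_sum (y z : ℕ) : ∑' n, ind (Sm y z) (Ph y z) n = 1 := by
  have h := T_step (y := y) (t := z+1) (by omega) (Nat.zero_le z)
  rw [T_zero (by omega), Dd_empty (by omega), Finset.sum_empty, add_zero] at h
  rw [h]
  unfold Tf
  rw [ind_congr (fun n => al_of_lt (show z < z+1 by omega))]

lemma sm_sum1 (y z : ℕ) : ∑' n, ind (Sm y z) (Ph1 y z) n = 0 := by
  have h := K_step (y := y) (t := z+1) (by omega) (Nat.zero_le z)
  rw [K_zero (by omega), Dd_empty (by omega), Finset.sum_empty, add_zero] at h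
  rw [h]
  unfold Kf
  rw [ind_congr (fun n => al_of_lt (show z < z+1 by omega))]

lemma sm_summable (y z : ℕ) : Summable (ind (Sm y z) (Ph y z)) := (harm0 y z).sm z le_rfl
lemma sm_summable1 (y z : ℕ) : Summable (ind (Sm y z) (Ph1 y z)) := (harm1 y z).sm z le_rfl

lemma sum_inv_ge (z : ℕ) : Real.log z ≤ ∑ m ∈ Ioc 0 z, 1 / (m:ℝ) := by
  rcases Nat.eq_zero_or_pos z with rfl | hz
  · simp
  have h := log_add_one_le_harmonic z
  rw [harmonic_eq_sum_Icc] at h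
  have h2 : Real.log z ≤ Real.log ((z+1 : ℕ):ℝ) := by
    apply Real.log_le_log (by exact_mod_cast hz)
    push_cast; linarith
  refine h2.trans (h.trans (le_of_eq ?_))
  push_cast
  rw [show Icc 1 z = Ioc 0 z from by ext; simp [Nat.succ_le_iff]]
  simp

lemma sum_inv_le (z : ℕ) (hz : 1 ≤ z) : ∑ m ∈ Ioc 0 z, 1 / (m:ℝ) ≤ 1 + Real.log z := by
  induction z, hz using Nat.le_induction with
  | base => simp
  | succ n hn ih =>
    rw [Finset.sum_Ioc_succ_top (Nat.zero_le n)]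
    have hn0 : (0:ℝ) < n := by exact_mod_cast hn
    have h1 : Real.log ((n:ℝ)/(n+1)) ≤ (n:ℝ)/(n+1) - 1 := Real.log_le_sub_one_of_pos (by positivity)
    rw [Real.log_div hn0.ne' (by positivity)] at h1
    have h3 : (n:ℝ)/(n+1) - 1 = - (1 / ((n:ℝ)+1)) := by field_simp; ring
    push_cast
    linarith

lemma sm_of_le {z m : ℕ} (h : m ∈ Ioc 0 z) : Sm 0 z m := by
  rw [mem_Ioc] at h
  exact ⟨by omega, fun p hp hd => ⟨hp.pos, (Nat.le_of_dvd h.1 hd).trans h.2⟩⟩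

lemma Wf_upper (z : ℕ) : Wf 0 z * Real.log z ≤ 1 := by
  have h1 : ∑ m ∈ Ioc 0 z, ind (Sm 0 z) (Ph 0 z) m ≤ ∑' n, ind (Sm 0 z) (Ph 0 z) n :=
    (sm_summable 0 z).sum_le_tsum _ (fun n _ => ind_nonneg (fun n _ => Ph_nonneg _ _ _) n)
  rw [sm_sum] at h1
  have h2 : ∑ m ∈ Ioc 0 z, ind (Sm 0 z) (Ph 0 z) m = Wf 0 z * ∑ m ∈ Ioc 0 z, 1 / (m:ℝ) := by
    rw [mul_sum]
    apply sum_congr rfl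
    intro m hm
    unfold ind
    rw [if_pos (sm_of_le hm), Ph]; ring
  rw [h2] at h1
  exact (mul_le_mul_of_nonneg_left (sum_inv_ge z) (Wf_pos 0 z).le).trans h1

lemma Lg_nonneg (y z : ℕ) : 0 ≤ Lg y z := by
  apply Finset.sum_nonneg
  intro p hp
  have : (1:ℝ) < p := by exact_mod_cast (mem_pr.1 hp).1.one_lt
  exact div_nonneg (Real.log_nonneg this.le) (by linarith)

lemma pr_zero (z : ℕ) : pr 0 z = prs z := by
  ext p; rw [mem_pr, mem_prs]
  exact ⟨fun h => ⟨h.1, h.2.2⟩, fun h => ⟨h.1, h.1.pos, h.2⟩⟩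

lemma Lg_zero_eq (z : ℕ) : Lg 0 z = Lf z := by
  unfold Lg Lf; rw [pr_zero]

lemma sm_tail (N z : ℕ) (hN : 2 ≤ N) :
    1 ≤ Wf 0 z * (1 + Real.log N) + Lg 0 z / Real.log N := by
  classical
  have hlN : 0 < Real.log N := Real.log_pos (by exact_mod_cast hN)
  have hE : Summable (fun n => ind (Sm 0 z) (Ph1 0 z) n + Lg 0 z * ind (Sm 0 z) (Ph 0 z) n) :=
    (sm_summable1 0 z).add ((sm_summable 0 z).mul_left _)
  have hEs : ∑' n, (ind (Sm 0 z) (Ph1 0 z) n + Lg 0 z * ind (Sm 0 z) (Ph 0 z) n) = Lg 0 z := by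
    rw [(sm_summable1 0 z).tsum_add ((sm_summable 0 z).mul_left _), tsum_mul_left, sm_sum, sm_sum1]
    ring
  have hfin : Summable (ind (fun n => n ∈ Ioc 0 N) (Ph 0 z)) := by
    apply summable_of_ne_finset_zero (s := Ioc 0 N)
    intro d hd; simp [ind, hd]
  have hfs : ∑' n, ind (fun n => n ∈ Ioc 0 N) (Ph 0 z) n = Wf 0 z * ∑ m ∈ Ioc 0 N, 1 / (m:ℝ) := by
    rw [tsum_eq_sum (s := Ioc 0 N), mul_sum]
    · apply Finset.sum_congr rfl
      intro d hd; simp only [ind, if_pos hd, Ph]; ring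
    · intro d hd; simp [ind, hd]
  have hle : ∑' n, ind (Sm 0 z) (Ph 0 z) n ≤ ∑' n, (ind (fun n => n ∈ Ioc 0 N) (Ph 0 z) n +
      (1 / Real.log N) * (ind (Sm 0 z) (Ph1 0 z) n + Lg 0 z * ind (Sm 0 z) (Ph 0 z) n)) := by
    apply (sm_summable 0 z).tsum_le_tsum _ (hfin.add (hE.mul_left _))
    intro n
    have hval : ind (Sm 0 z) (Ph1 0 z) n + Lg 0 z * ind (Sm 0 z) (Ph 0 z) n
        = ind (Sm 0 z) (Ph 0 z) n * Real.log n := by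
      unfold ind
      split_ifs
      · unfold Ph1 Ph; ring
      · ring
    rw [hval]
    have h0 : 0 ≤ ind (Sm 0 z) (Ph 0 z) n := ind_nonneg (fun n _ => Ph_nonneg _ _ _) n
    by_cases hn : n ∈ Ioc 0 N
    · have h1 : ind (Sm 0 z) (Ph 0 z) n ≤ Ph 0 z n := by
        unfold ind; split_ifs
        · exact le_rfl
        · exact Ph_nonneg _ _ _
      have h2 : ind (fun n => n ∈ Ioc 0 N) (Ph 0 z) n = Ph 0 z n := by simp only [ind, if_pos hn]
      rw [h2]
      have : 0 ≤ 1 / Real.log N * (ind (Sm 0 z) (Ph 0 z) n * Real.log n) := by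
        have := Real.log_natCast_nonneg n
        positivity
      linarith
    · have h2 : ind (fun n => n ∈ Ioc 0 N) (Ph 0 z) n = 0 := by simp only [ind, if_neg hn]
      rw [h2, zero_add]
      by_cases hn0 : n = 0
      · subst hn0; simp [ind, Sm]
      have hnN : N < n := by rw [mem_Ioc] at hn; omega
      have : Real.log N ≤ Real.log n := Real.log_le_log (by positivity) (by exact_mod_cast hnN.le)
      rw [one_div, inv_mul_eq_div, le_div_iff₀ hlN]
      exact mul_le_mul_of_nonneg_left this h0
  rw [sm_sum, hfin.tsum_add (hE.mul_left _), tsum_mul_left, hEs, hfs] at hle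
  have := mul_le_mul_of_nonneg_left (sum_inv_le N (by omega)) (Wf_pos 0 z).le
  calc (1:ℝ) ≤ _ := hle
    _ ≤ Wf 0 z * (1 + Real.log N) + 1 / Real.log N * Lg 0 z := by linarith
    _ = _ := by ring

lemma Wf_lower (z : ℕ) (hz : 1 ≤ z) : 1 / Wf 0 z ≤ 4 * (Real.log z + cL + 1) := by
  have hL0 := Lg_nonneg 0 z
  have hLu : Lg 0 z ≤ Real.log z + cL := by rw [Lg_zero_eq]; exact Lf_upper z hz
  have hW := Wf_pos 0 z
  have hc := cL_pos
  have hlz : 0 ≤ Real.log z := Real.log_natCast_nonneg z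
  set N := ⌈Real.exp (2 * (Real.log z + cL))⌉₊ with hN
  have h1 : Real.exp (2 * (Real.log z + cL)) ≤ N := Nat.le_ceil _
  have h2 : (N:ℝ) < Real.exp (2 * (Real.log z + cL)) + 1 := Nat.ceil_lt_add_one (Real.exp_pos _).le
  have h3 : 1 ≤ Real.exp (2 * (Real.log z + cL)) := Real.one_le_exp (by linarith)
  have h4 : 2 * (Real.log z + cL) ≤ Real.log N := by
    rw [Real.le_log_iff_exp_le (by linarith)]; exact h1
  have h5 : Real.log N ≤ 2 * (Real.log z + cL) + 1 := by
    have : (N:ℝ) ≤ Real.exp (2 * (Real.log z + cL) + 1) := by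
      rw [Real.exp_add]
      have := Real.add_one_le_exp (1:ℝ)
      nlinarith
    rw [Real.log_le_iff_le_exp (by linarith)]
    exact this
  have hN2 : 2 ≤ N := by
    have : (2:ℝ) ≤ N := by
      have := Real.add_one_le_exp (2 * (Real.log z + cL))
      linarith
    exact_mod_cast this
  have ht := sm_tail N z hN2
  have hq : Lg 0 z / Real.log N ≤ 1 / 2 := by
    rw [div_le_div_iff₀ (by linarith) (by norm_num)]
    linarith
  rw [div_le_iff₀ hW]
  have : Wf 0 z * (1 + Real.log N) ≤ Wf 0 z * (2 * (Real.log z + cL) + 2) :=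
    mul_le_mul_of_nonneg_left (by linarith) hW.le
  nlinarith

lemma pr_union {y z : ℕ} (h : y ≤ z) : pr 0 z = pr 0 y ∪ pr y z := by
  ext p
  rw [mem_union, mem_pr, mem_pr, mem_pr]
  constructor
  · rintro ⟨h1, h2, h3⟩
    rcases Nat.lt_or_ge y p with h' | h'
    · right; exact ⟨h1, h', h3⟩
    · left; exact ⟨h1, h2, h'⟩
  · rintro (⟨h1, h2, h3⟩ | ⟨h1, h2, h3⟩)
    · exact ⟨h1, h2, h3.trans h⟩
    · exact ⟨h1, h1.pos, h3⟩

lemma pr_disj (y z : ℕ) : Disjoint (pr 0 y) (pr y z) := by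
  rw [Finset.disjoint_left]
  intro p h1 h2
  rw [mem_pr] at h1 h2; omega

lemma Wf_mul {y z : ℕ} (h : y ≤ z) : Wf 0 z = Wf 0 y * Wf y z := by
  unfold Wf; rw [pr_union h, prod_union (pr_disj y z)]

lemma Lg_add {y z : ℕ} (h : y ≤ z) : Lg 0 z = Lg 0 y + Lg y z := by
  unfold Lg; rw [pr_union h, sum_union (pr_disj y z)]

lemma Wf_one (y z : ℕ) (h : z ≤ y) : Wf y z = 1 := by
  have : pr y z = ∅ := by
    apply Finset.eq_empty_of_forall_notMem
    intro p; rw [mem_pr]; omega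
  simp [Wf, this]

lemma Wyz_lower {y z : ℕ} (hy : 1 ≤ y) (hz : 1 ≤ z) :
    1 / Wf y z ≤ 8 * (Real.log z + cL + 1) / (1 + Real.log y) + 1 := by
  have hc := cL_pos
  have hlz : 0 ≤ Real.log z := Real.log_natCast_nonneg z
  have hly : 0 ≤ Real.log y := Real.log_natCast_nonneg y
  rcases Nat.le_total y z with h | h
  · have h1 := Wf_lower z hz
    have h2 := Wf_upper y
    have h3 := Wf_le_one 0 y
    have h4 : Wf 0 y ≤ 2 / (1 + Real.log y) := by
      rw [le_div_iff₀ (by linarith)]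
      linarith
    have h5 : 1 / Wf y z = Wf 0 y * (1 / Wf 0 z) := by
      rw [Wf_mul h]
      have := Wf_pos 0 y
      have := Wf_pos y z
      field_simp
    rw [h5]
    calc Wf 0 y * (1 / Wf 0 z) ≤ 2 / (1 + Real.log y) * (4 * (Real.log z + cL + 1)) := by
          apply mul_le_mul h4 h1
          · have := Wf_pos 0 z; positivity
          · positivity
      _ = 8 * (Real.log z + cL + 1) / (1 + Real.log y) := by ring
      _ ≤ _ := by linarith
  · rw [Wf_one y z h]
    have : 0 ≤ 8 * (Real.log z + cL + 1) / (1 + Real.log y) := by positivity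
    linarith

lemma Lg_upper {y z : ℕ} (hy : 1 ≤ y) (h : y ≤ z) : Lg y z ≤ Real.log z - Real.log y + cL + 1 := by
  have := Lg_add h
  have h1 := Lf_upper z (by omega)
  have h2 := Lf_lower y (by omega)
  rw [Lg_zero_eq, Lg_zero_eq] at this
  linarith

lemma Lg_lower {y z : ℕ} (hy : 1 ≤ y) (h : y ≤ z) : Real.log z - Real.log y - cL - 1 ≤ Lg y z := by
  have := Lg_add h
  have h1 := Lf_lower z (by omega)
  have h2 := Lf_upper y (by omega)
  rw [Lg_zero_eq, Lg_zero_eq] at this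
  linarith

noncomputable def kap (y t : ℕ) : ℝ := Real.log t - Real.log y + cL + 1

lemma kap_ge {y t : ℕ} (hy : 1 ≤ y) (h : y ≤ t) : cL + 1 ≤ kap y t := by
  unfold kap
  have : Real.log y ≤ Real.log t := Real.log_le_log (by exact_mod_cast hy) (by exact_mod_cast h)
  linarith

lemma K_le {y t z : ℕ} (hy : 1 ≤ y) (h : y ≤ t) : Kf y t z ≤ kap y t := by
  have ht : 1 ≤ t := by omega
  rw [K_id ht]
  have hk := kap_ge hy h
  have hc := cL_pos
  calc _ ≤ ∑ d ∈ Dd y t 0 z, Wf y (t * d) / d * kap y t := by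
        apply Finset.sum_le_sum
        intro d hd
        have hd0 := Dd_pos ht hd
        have hd1 : 1 ≤ d := by exact_mod_cast hd0
        apply mul_le_mul_of_nonneg_left _ (div_nonneg (Wf_pos y _).le hd0.le)
        have h1 := Lg_upper hy (show y ≤ t * d from h.trans (Nat.le_mul_of_pos_right _ hd1))
        rw [Nat.cast_mul, Real.log_mul (by positivity) hd0.ne'] at h1
        unfold kap
        linarith
    _ = (∑ d ∈ Dd y t 0 z, Wf y (t * d) / d) * kap y t := by rw [sum_mul]
    _ ≤ 1 * kap y t := mul_le_mul_of_nonneg_right (WD_le_one ht) (by linarith)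
    _ = kap y t := one_mul _

end

section

open Finset

lemma one_sub_sum_le_prod' (s : Finset ℕ) (f : ℕ → ℝ) (h0 : ∀ i ∈ s, 0 ≤ f i) (h1 : ∀ i ∈ s, f i ≤ 1) :
    1 - ∑ i ∈ s, f i ≤ ∏ i ∈ s, (1 - f i) := by
  classical
  induction s using Finset.induction_on with
  | empty => simp
  | insert a s ha ih =>
    rw [sum_insert ha, prod_insert ha]
    have h2 := ih (fun i hi => h0 i (mem_insert_of_mem hi)) (fun i hi => h1 i (mem_insert_of_mem hi))
    have h3 := h0 a (mem_insert_self a s)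
    have h4 := h1 a (mem_insert_self a s)
    have h5 : 0 ≤ ∑ i ∈ s, f i := sum_nonneg (fun i hi => h0 i (mem_insert_of_mem hi))
    nlinarith

lemma Wf_mul' {y z w : ℕ} (h : y ≤ z) (h' : z ≤ w) : Wf y w = Wf y z * Wf z w := by
  have h1 := Wf_mul (h.trans h')
  have h2 := Wf_mul h'
  have h3 := Wf_mul h
  have h0 := Wf_pos 0 y
  have : Wf 0 y * Wf y w = Wf 0 y * (Wf y z * Wf z w) := by rw [← h1, h2, h3]; ring
  exact mul_left_cancel₀ h0.ne' this

lemma Wf_ge {z w : ℕ} (hz : 2 ≤ z) (h : z ≤ w) :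
    1 - (Real.log w - Real.log z + cL + 1) / Real.log z ≤ Wf z w := by
  have hlz : 0 < Real.log z := Real.log_pos (by exact_mod_cast hz)
  have h1 := one_sub_sum_le_prod' (pr z w) (fun p => 1 / (p:ℝ)) (fun i _ => by positivity) (by
    intro p hp
    have : (1:ℝ) < p := by exact_mod_cast (mem_pr.1 hp).1.one_lt
    rw [div_le_one (by linarith)]; exact this.le)
  have h2 : ∑ p ∈ pr z w, 1 / (p:ℝ) ≤ Lg z w / Real.log z := by
    rw [le_div_iff₀ hlz, sum_mul]
    apply Finset.sum_le_sum
    intro p hp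
    have hp' := mem_pr.1 hp
    have hp1 : (1:ℝ) < p := by exact_mod_cast hp'.1.one_lt
    have : Real.log z ≤ Real.log p := Real.log_le_log (by positivity) (by exact_mod_cast hp'.2.1.le)
    rw [div_mul_eq_mul_div, one_mul]
    apply div_le_div₀ (Real.log_nonneg hp1.le) this (by linarith) (by linarith)
  have h3 := Lg_upper (show 1 ≤ z by omega) h
  have h4 : Lg z w / Real.log z ≤ (Real.log w - Real.log z + cL + 1) / Real.log z :=
    div_le_div_of_nonneg_right h3 hlz.le
  unfold Wf
  linarith

lemma al_summable (y t z : ℕ) : Summable (ind (Al y t z) (Ph y z)) :=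
  summable_ind_of (sm_summable y z) (fun n h => h.1)
lemma al_summable1 (y t z : ℕ) : Summable (ind (Al y t z) (Ph1 y z)) :=
  summable_ind_of (sm_summable1 y z) (fun n h => h.1)

lemma T_sq {y t z : ℕ} (hy : 1 ≤ y) (hyt : y ≤ t) (hyz : y ≤ z) (hz : 2 ≤ z) :
    Tf y t (z^2) * Real.log z ≤ 3 * kap y t := by
  classical
  have ht : 1 ≤ t := by omega
  have ht0 : (0:ℝ) < t := by exact_mod_cast ht
  have hz0 : (0:ℝ) < z := by exact_mod_cast (show 0 < z by omega)
  have hlz : 0 < Real.log z := Real.log_pos (by exact_mod_cast hz)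
  have hzz : z ≤ z^2 := by nlinarith
  have hc := cL_pos
  set D := Dd y t z (z^2) with hD
  have hDs : Summable (ind (fun n => n ∈ D) (fun d => Wf y (t*d) / d)) := by
    apply summable_of_ne_finset_zero (s := D)
    intro d hd; simp [ind, hd]
  have hDt : ∑' n, ind (fun n => n ∈ D) (fun d => Wf y (t*d) / d) n = ∑ d ∈ D, Wf y (t*d) / d := by
    rw [tsum_eq_sum (s := D)]
    · apply Finset.sum_congr rfl
      intro d hd; simp only [ind, if_pos hd]
    · intro d hd; simp [ind, hd]
  set A : ℝ := Real.log t + Lg y z - Real.log z + cL + 1 with hA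
  have hle : ∑' n, ind (Al y t z) (Ph y z) n ≤ ∑' n, (ind (fun n => n ∈ D) (fun d => Wf y (t*d) / d) n
      + (1 / Real.log z) * (ind (Al y t z) (Ph1 y z) n + A * ind (Al y t z) (Ph y z) n)) := by
    apply (al_summable y t z).tsum_le_tsum _
      (hDs.add (((al_summable1 y t z).add ((al_summable y t z).mul_left A)).mul_left _))
    intro n
    by_cases hn : Al y t z n
    · have hn0 : (0:ℝ) < n := by exact_mod_cast Nat.pos_of_ne_zero hn.1.1
      have hlog : Real.log ((t * n : ℕ):ℝ) = Real.log t + Real.log n := by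
        rw [Nat.cast_mul, Real.log_mul ht0.ne' hn0.ne']
      have e1 : ind (Al y t z) (Ph y z) n = Wf y z / n := by simp only [ind, if_pos hn, Ph]
      have e2 : ind (Al y t z) (Ph1 y z) n = Wf y z * (Real.log n - Lg y z) / n := by
        simp only [ind, if_pos hn, Ph1]
      have e3 : 1 / Real.log z * (Wf y z * (Real.log n - Lg y z) / n + A * (Wf y z / n))
          = Wf y z / n * ((Real.log ((t * n : ℕ):ℝ) - Real.log z + cL + 1) / Real.log z) := by
        rw [hlog, hA]; ring
      rw [e1, e2, e3]
      have hWn : 0 < Wf y z / n := div_pos (Wf_pos y z) hn0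
      by_cases hb : t * n ≤ z^2
      · have hmem : n ∈ D := (mem_Dd ht).2 ⟨al_rd hn, hn.2.2, hb⟩
        have e4 : ind (fun n => n ∈ D) (fun d => Wf y (t*d) / d) n = Wf y (t * n) / n := by
          simp only [ind, if_pos hmem]
        rw [e4, Wf_mul' hyz hn.2.2.le]
        have := Wf_ge hz hn.2.2.le
        have e5 : Wf y z * Wf z (t * n) / n = Wf y z / n * Wf z (t*n) := by ring
        rw [e5, ← mul_add]
        exact le_mul_of_one_le_right hWn.le (by linarith)
      · push Not at hb
        have h0 : 0 ≤ ind (fun n => n ∈ D) (fun d => Wf y (t*d) / d) n :=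
          ind_nonneg (fun d _ => div_nonneg (Wf_pos _ _).le (Nat.cast_nonneg _)) n
        have h2 : 2 * Real.log z ≤ Real.log ((t * n : ℕ):ℝ) := by
          rw [← Real.log_rpow hz0]
          apply Real.log_le_log (by positivity)
          have : ((z^2 : ℕ):ℝ) ≤ ((t * n : ℕ):ℝ) := by exact_mod_cast hb.le
          push_cast at this ⊢
          exact_mod_cast this
        have h3 : 1 ≤ (Real.log ((t * n : ℕ):ℝ) - Real.log z + cL + 1) / Real.log z := by
          rw [le_div_iff₀ hlz]; linarith
        have := le_mul_of_one_le_right hWn.le h3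
        linarith
    · have e1 : ind (Al y t z) (Ph y z) n = 0 := by simp only [ind, if_neg hn]
      have e2 : ind (Al y t z) (Ph1 y z) n = 0 := by simp only [ind, if_neg hn]
      rw [e1, e2]
      have h0 : 0 ≤ ind (fun n => n ∈ D) (fun d => Wf y (t*d) / d) n :=
        ind_nonneg (fun d _ => div_nonneg (Wf_pos _ _).le (Nat.cast_nonneg _)) n
      simpa using h0
  rw [hDs.tsum_add (((al_summable1 y t z).add ((al_summable y t z).mul_left A)).mul_left _),
    tsum_mul_left, (al_summable1 y t z).tsum_add ((al_summable y t z).mul_left A), tsum_mul_left, hDt] at hle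
  have hT := T_step (y := y) ht hzz
  have hK := K_le (z := z) hy hyt
  have hAle : A ≤ 2 * kap y t := by
    have h1 := Lg_upper hy hyz
    have h2 := kap_ge hy hyt
    rw [hA]
    unfold kap at h2 ⊢
    linarith
  have hT1 := T_le_one (y := y) (t := t) (z := z) ht
  have hT0 := T_nonneg y t z
  have hkp := kap_ge hy hyt
  change Tf y t z ≤ _ + 1 / Real.log z * (Kf y t z + A * Tf y t z) at hle
  have h5 : Tf y t (z^2) ≤ 1 / Real.log z * (Kf y t z + A * Tf y t z) := by linarith
  have h6 : Kf y t z + A * Tf y t z ≤ 3 * kap y t := by nlinarith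
  calc Tf y t (z^2) * Real.log z ≤ 1 / Real.log z * (Kf y t z + A * Tf y t z) * Real.log z :=
        mul_le_mul_of_nonneg_right h5 hlz.le
    _ = Kf y t z + A * Tf y t z := by field_simp
    _ ≤ _ := h6

lemma Wf_anti (y : ℕ) {a b : ℕ} (h : a ≤ b) : Wf y b ≤ Wf y a := by
  have : Antitone (Wf y) := by
    apply antitone_nat_of_succ_le
    intro n
    by_cases hp : (n+1).Prime ∧ y < n + 1
    · unfold Wf
      rw [pr_succ_p hp.1 hp.2, prod_insert notMem_pr]
      have h1 := Wf_pos y n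
      unfold Wf at h1
      have h2 : (0:ℝ) ≤ 1 / ((n+1 : ℕ):ℝ) := by positivity
      nlinarith
    · unfold Wf; rw [pr_succ_np hp]
  exact this h

lemma Dd_le {y t z0 z1 : ℕ} (ht : 1 ≤ t) (h : z0 ≤ z1) :
    ∑ d ∈ Dd y t z0 z1, 1 / (d:ℝ) ≤ Tf y t z0 * (1 / Wf y z1) := by
  have hT := T_step (y := y) ht h
  have hT0 := T_nonneg y t z1
  have hW := Wf_pos y z1
  rw [mul_one_div, le_div_iff₀ hW, sum_mul]
  calc _ ≤ ∑ d ∈ Dd y t z0 z1, Wf y (t * d) / d := by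
        apply sum_le_sum
        intro d hd
        have hd' := (mem_Dd ht).1 hd
        have : Wf y z1 ≤ Wf y (t * d) := by
          exact Wf_anti y hd'.2.2
        rw [one_div_mul_eq_div]
        exact div_le_div_of_nonneg_right this (Nat.cast_nonneg _)
    _ ≤ _ := by linarith

lemma window_bound {y t J : ℕ} (hy : 1 ≤ y) (hyt : y ≤ t) :
    ∑ d ∈ Dd y t (2^J) (2^(2*J+2)), 1 / (d:ℝ) ≤ 1000 * (cL + 1) * (1 + kap y t / (1 + Real.log y)) := by
  have ht : 1 ≤ t := by omega
  have hc := cL_pos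
  have hk := kap_ge hy hyt
  have hk0 : 0 < kap y t := by linarith
  have hly : 0 ≤ Real.log y := Real.log_natCast_nonneg y
  have hl2 : Real.log 2 ≤ 0.7 := by have := Real.log_two_lt_d9; linarith
  have hl2' : 0.69 ≤ Real.log 2 := by have := Real.log_two_gt_d9; linarith
  refine (Dd_le ht (Nat.pow_le_pow_right (by norm_num) (by omega))).trans ?_
  have hW := Wyz_lower hy (show 1 ≤ 2^(2*J+2) from Nat.one_le_two_pow)
  have hlz : Real.log ((2^(2*J+2) : ℕ):ℝ) = (2*J+2) * Real.log 2 := by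
    push_cast; rw [Real.log_pow]; push_cast; ring
  rw [hlz] at hW
  have hT0 := T_nonneg y t (2^J)
  have hT1 := T_le_one (y := y) (t := t) (z := 2^J) ht
  have hJ0 : (0:ℝ) ≤ J := Nat.cast_nonneg J
  have hW0 : 0 < 1 / Wf y (2^(2*J+2)) := by have := Wf_pos y (2^(2*J+2)); positivity
  have hden : 0 < 1 + Real.log y := by linarith
  by_cases hcase : 2 ≤ J ∧ y ≤ 2^(J/2)
  · obtain ⟨hJ, hyJ⟩ := hcase
    have hJ1 : (2:ℝ) ≤ J := by exact_mod_cast hJ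
    have h1 := T_sq hy hyt hyJ (show 2 ≤ 2^(J/2) from by
      calc 2 = 2^1 := by norm_num
        _ ≤ 2^(J/2) := Nat.pow_le_pow_right (by norm_num) (by omega))
    have h2 : Tf y t (2^J) ≤ Tf y t ((2^(J/2))^2) := by
      apply T_anti ht
      rw [← pow_mul]
      exact Nat.pow_le_pow_right (by norm_num) (by omega)
    have hJ2 : (J:ℝ) / 3 ≤ ((J/2 : ℕ):ℝ) := by
      have : J ≤ 3 * (J/2) := by omega
      have : (J:ℝ) ≤ 3 * ((J/2 : ℕ):ℝ) := by exact_mod_cast this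
      linarith
    have h3 : Real.log ((2^(J/2) : ℕ):ℝ) = ((J/2 : ℕ):ℝ) * Real.log 2 := by
      push_cast; rw [Real.log_pow]
    rw [h3] at h1
    have h4 : Tf y t (2^J) * (0.23 * J) ≤ 3 * kap y t := by
      have : 0.23 * (J:ℝ) ≤ ((J/2 : ℕ):ℝ) * Real.log 2 := by nlinarith
      calc Tf y t (2^J) * (0.23 * J) ≤ Tf y t ((2^(J/2))^2) * (((J/2 : ℕ):ℝ) * Real.log 2) :=
            mul_le_mul h2 this (by positivity) (T_nonneg _ _ _)
        _ ≤ _ := h1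
    have h5 : Real.log y ≤ J := by
      have : Real.log y ≤ Real.log ((2^(J/2) : ℕ):ℝ) :=
        Real.log_le_log (by exact_mod_cast hy) (by exact_mod_cast hyJ)
      rw [h3] at this
      have h6 : ((J/2 : ℕ):ℝ) ≤ J := by exact_mod_cast Nat.div_le_self J 2
      nlinarith
    have h6 : 1 / Wf y (2^(2*J+2)) ≤ (30 + 8 * cL) * (2 * J) / (1 + Real.log y) := by
      refine hW.trans ?_
      rw [div_add_one hden.ne']
      apply div_le_div_of_nonneg_right _ hden.le
      nlinarith
    have h7 : Tf y t (2^J) ≤ 3 * kap y t / (0.23 * J) := by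
      rw [le_div_iff₀ (by positivity)]; exact h4
    calc _ ≤ 3 * kap y t / (0.23 * J) * ((30 + 8 * cL) * (2 * J) / (1 + Real.log y)) :=
          mul_le_mul h7 h6 hW0.le (by positivity)
      _ = (6 / 0.23 * (30 + 8 * cL)) * (kap y t / (1 + Real.log y)) := by field_simp; ring
      _ ≤ 1000 * (cL + 1) * (kap y t / (1 + Real.log y)) := by
          apply mul_le_mul_of_nonneg_right _ (by positivity)
          norm_num; linarith
      _ ≤ _ := by nlinarith
  · have h5 : ((J:ℝ) + 1) / 4 ≤ 1 + Real.log y := by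
      rcases Nat.lt_or_ge J 2 with hJ | hJ
      · have : (J:ℝ) ≤ 2 := by exact_mod_cast hJ.le
        linarith
      · have hlt : 2^(J/2) < y := by
          by_contra h; exact hcase ⟨hJ, by omega⟩
        have h3 : Real.log ((2^(J/2) : ℕ):ℝ) = ((J/2 : ℕ):ℝ) * Real.log 2 := by
          push_cast; rw [Real.log_pow]
        have h4 : Real.log ((2^(J/2) : ℕ):ℝ) ≤ Real.log y :=
          Real.log_le_log (by positivity) (by exact_mod_cast hlt.le)
        rw [h3] at h4
        have hJ2 : ((J:ℝ) - 1) / 2 ≤ ((J/2 : ℕ):ℝ) := by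
          have : J ≤ 2 * (J/2) + 1 := by omega
          have : (J:ℝ) ≤ 2 * ((J/2 : ℕ):ℝ) + 1 := by exact_mod_cast this
          linarith
        nlinarith
    have h6 : 1 / Wf y (2^(2*J+2)) ≤ 4 * (8 * (cL + 3)) + 1 := by
      refine hW.trans ?_
      have : 8 * ((2 * (J:ℝ) + 2) * Real.log 2 + cL + 1) / (1 + Real.log y) ≤ 4 * (8 * (cL + 3)) := by
        rw [div_le_iff₀ hden]
        have : 4 * (8 * (cL + 3)) * (((J:ℝ) + 1) / 4) ≤ 4 * (8 * (cL + 3)) * (1 + Real.log y) :=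
          mul_le_mul_of_nonneg_left h5 (by linarith)
        nlinarith
      linarith
    calc _ ≤ 1 * (4 * (8 * (cL + 3)) + 1) := mul_le_mul hT1 h6 hW0.le (by norm_num)
      _ ≤ 1000 * (cL + 1) * 1 := by linarith
      _ ≤ _ := by
        apply mul_le_mul_of_nonneg_left _ (by linarith)
        have : 0 ≤ kap y t / (1 + Real.log y) := by positivity
        linarith

end

section

/-- number of maximal runs -/
noncomputable def pc : List ℕ → ℕ
  | [] => 0
  | [_] => 1
  | a :: b :: l => (haveI := Classical.propDecidable (DAdj a b); if DAdj a b then 0 else 1) + pc (b :: l)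

/-- minimal obstruction divisors -/
def Vd (N d : ℕ) : Prop := 1 < d ∧ N < d * d.minFac ∧ ∀ e, e ∣ d → 1 < e → e < d → e * e.minFac ≤ N

lemma vd_exists {N n : ℕ} (hn : 0 < n) (h : ¬ InA N n) : ∃ d, Vd N d ∧ d ∣ n := by
  classical
  have h1 : ∃ d, d ∣ n ∧ 1 < d ∧ N < d * d.minFac := by
    by_contra hc
    push Not at hc
    exact h ⟨hn, fun d hd h1 => hc d hd h1⟩
  obtain ⟨ha, hb, hc⟩ := Nat.find_spec h1
  refine ⟨Nat.find h1, ⟨hb, hc, fun e he h2 h3 => ?_⟩, ha⟩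
  have := Nat.find_min h1 h3
  by_contra h4
  exact this ⟨he.trans ha, h2, by omega⟩

lemma coprime_of_small {d b : ℕ} (hb : 0 < b) (h : b < d.minFac) : Nat.Coprime d b := by
  apply Nat.Coprime.symm
  apply Nat.coprime_of_dvd
  intro k hk h1 h2
  have := Nat.minFac_le_of_dvd hk.two_le h2
  have := Nat.le_of_dvd hb h1
  omega

lemma vd_quot {N d n b : ℕ} (hv : Vd N d) (hn : n ≤ N) (h : n = d * b) : b < d.minFac := by
  by_contra hc
  have : d * d.minFac ≤ d * b := Nat.mul_le_mul_left _ (by omega)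
  have := hv.2.1
  omega

lemma vd_unique_aux {N n d d' : ℕ} (hn0 : 0 < n) (hn : n ≤ N) (hd : Vd N d) (hd' : Vd N d')
    (h : d ∣ n) (h' : d' ∣ n) (hp : d.minFac ≤ d'.minFac) : d = d' := by
  obtain ⟨b, rfl⟩ := h
  have hb : 0 < b := Nat.pos_of_mul_pos_left hn0
  have h1 := vd_quot hd hn rfl
  have h2 : Nat.Coprime d' b := coprime_of_small hb (by omega)
  have h3 : d' ∣ d := h2.dvd_of_dvd_mul_right h'
  by_contra hne
  have h4 : d' < d := lt_of_le_of_ne (Nat.le_of_dvd (by have := hd.1; omega) h3) (Ne.symm hne)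
  have := hd.2.2 d' h3 hd'.1 h4
  have := hd'.2.1
  omega

lemma vd_unique {N n d d' : ℕ} (hn0 : 0 < n) (hn : n ≤ N) (hd : Vd N d) (hd' : Vd N d')
    (h : d ∣ n) (h' : d' ∣ n) : d = d' := by
  rcases le_total d.minFac d'.minFac with hp | hp
  · exact vd_unique_aux hn0 hn hd hd' h h' hp
  · exact (vd_unique_aux hn0 hn hd' hd h' h hp).symm

lemma vd_nbr {N n n' d : ℕ} (hn : n ≤ N) (hn'0 : 0 < n') (hn0 : 0 < n) (hd : Vd N d)
    (h : d ∣ n) (h' : ¬ d ∣ n') (ha : DAdj n n') : InA N n' ∧ n' * d.minFac ≤ N := by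
  rcases ha with ha | ha
  · exact absurd (h.trans ha) h'
  obtain ⟨k, hk⟩ := ha
  have hk0 : 0 < k := by
    rcases Nat.eq_zero_or_pos k with h | h
    · subst h; omega
    · exact h
  have hkp : d.minFac ≤ k := by
    by_contra hc
    have : Nat.Coprime d k := coprime_of_small hk0 (by omega)
    exact h' (this.dvd_of_dvd_mul_right (hk ▸ h))
  have hb : n' * d.minFac ≤ N := by
    calc n' * d.minFac ≤ n' * k := Nat.mul_le_mul_left _ hkp
      _ = n := hk.symm
      _ ≤ N := hn
  refine ⟨⟨hn'0, fun e he h1 => ?_⟩, hb⟩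
  rcases le_or_gt e.minFac d.minFac with hq | hq
  · calc e * e.minFac ≤ n' * d.minFac := Nat.mul_le_mul (Nat.le_of_dvd hn'0 he) hq
      _ ≤ N := hb
  · obtain ⟨b, rfl⟩ := h
    have hb0 : 0 < b := Nat.pos_of_mul_pos_left hn0
    have hbq := vd_quot hd hn rfl
    have h2 : Nat.Coprime e b := coprime_of_small hb0 (by omega)
    have h3 : e ∣ d := h2.dvd_of_dvd_mul_right (he.trans ⟨k, hk⟩)
    have hne : e ≠ d := by rintro rfl; omega
    exact hd.2.2 e h3 h1 (lt_of_le_of_ne (Nat.le_of_dvd (by have := hd.1; omega) h3) hne)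

lemma pc_cons_cons (a b : ℕ) (l : List ℕ) :
    pc (a :: b :: l) = (haveI := Classical.propDecidable (DAdj a b); if DAdj a b then 0 else 1) + pc (b :: l) := by
  rw [pc]

lemma pc_cons_le (a : ℕ) (l : List ℕ) : pc (a :: l) ≤ 1 + pc l := by
  cases l with
  | nil => simp [pc]
  | cons b l =>
    rw [pc_cons_cons]; split_ifs <;> omega

lemma pc_pos {l : List ℕ} (h : l ≠ []) : 1 ≤ pc l := by
  induction l with
  | nil => exact absurd rfl h
  | cons a l ih =>
    cases l with
    | nil => simp [pc]
    | cons b l => rw [pc_cons_cons]; have := ih (by simp); omega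

lemma pc_chain {l : List ℕ} (h : l.IsChain DAdj) : pc l ≤ 1 := by
  induction l with
  | nil => simp [pc]
  | cons a l ih =>
    cases l with
    | nil => simp [pc]
    | cons b l =>
      rw [List.isChain_cons_cons] at h
      rw [pc_cons_cons, if_pos h.1]
      simpa using ih h.2

lemma pc_map {d : ℕ} (hd : 0 < d) (l : List ℕ) : pc (l.map (d * ·)) = pc l := by
  induction l with
  | nil => simp [pc]
  | cons a l ih =>
    cases l with
    | nil => simp [pc]
    | cons b l =>
      simp only [List.map_cons] at ih ⊢
      rw [pc_cons_cons, pc_cons_cons, ih]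
      have : DAdj (d * a) (d * b) ↔ DAdj a b := by
        unfold DAdj
        rw [Nat.mul_dvd_mul_iff_left hd, Nat.mul_dvd_mul_iff_left hd]
      by_cases hab : DAdj a b
      · rw [if_pos hab, if_pos (this.2 hab)]
      · rw [if_neg hab, if_neg (fun h => hab (this.1 h))]

lemma sum_pc_le {N : ℕ} (D : Finset ℕ) (i : ℕ) (hD : ∀ d ∈ D, Vd N d ∧ i ≤ d.minFac)
    (l : List ℕ) (hl : ∀ n ∈ l, 1 ≤ n ∧ n ≤ N) :
    ∑ d ∈ D, pc (l.filter (d ∣ ·)) ≤ pc l + l.tail.countP (fun n => haveI := Classical.propDecidable (InA N n ∧ n * i ≤ N); decide (InA N n ∧ n * i ≤ N)) := by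
  classical
  induction l with
  | nil => simp [pc]
  | cons a l ih =>
    have ih := ih (fun n hn => hl n (List.mem_cons_of_mem _ hn))
    have ha := hl a (by simp)
    by_cases hex : ∃ d ∈ D, d ∣ a
    · obtain ⟨d0, hd0, hda⟩ := hex
      have hoth : ∀ d ∈ D.erase d0, pc ((a::l).filter (d ∣ ·)) = pc (l.filter (d ∣ ·)) := by
        intro d hd
        rw [Finset.mem_erase] at hd
        have : ¬ d ∣ a := fun h => hd.1 (vd_unique ha.1 ha.2 (hD d hd.2).1 (hD d0 hd0).1 h hda)
        rw [List.filter_cons_of_neg (by simpa using this)]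
      rw [← Finset.add_sum_erase _ _ hd0] at ih ⊢
      rw [Finset.sum_congr rfl hoth]
      rw [List.filter_cons_of_pos (by simpa using hda)]
      cases l with
      | nil => simp [pc] at ih ⊢
      | cons b l =>
        have hb := hl b (by simp)
        simp only [List.tail_cons] at ih ⊢
        rw [List.countP_cons, pc_cons_cons]
        by_cases hadj : DAdj a b
        · rw [if_pos hadj]
          by_cases hdb : d0 ∣ b
          · rw [List.filter_cons_of_pos (by simpa using hdb)] at ih ⊢
            rw [pc_cons_cons, if_pos hadj]
            omega
          · have h1 := vd_nbr ha.2 hb.1 ha.1 (hD d0 hd0).1 hda hdb hadj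
            have h2 : InA N b ∧ b * i ≤ N :=
              ⟨h1.1, (Nat.mul_le_mul_left _ (hD d0 hd0).2).trans h1.2⟩
            have h3 := pc_cons_le a ((b::l).filter (d0 ∣ ·))
            simp only [h2, and_self, decide_true, if_true]
            omega
        · rw [if_neg hadj]
          have h3 := pc_cons_le a ((b::l).filter (d0 ∣ ·))
          omega
    · push Not at hex
      have hoth : ∀ d ∈ D, pc ((a::l).filter (d ∣ ·)) = pc (l.filter (d ∣ ·)) := by
        intro d hd
        rw [List.filter_cons_of_neg (by simpa using hex d hd)]
      rw [Finset.sum_congr rfl hoth]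
      cases l with
      | nil => simp [pc]
      | cons b l =>
        simp only [List.tail_cons] at ih ⊢
        rw [List.countP_cons, pc_cons_cons]
        omega

end

section

def Lin (N : ℕ) (α β : ℝ) : Prop :=
  ∀ l : List ℕ, l.Nodup → (∀ n ∈ l, 1 ≤ n ∧ n ≤ N) → (l.length : ℝ) ≤ α + β * pc l

open Classical in
noncomputable def VV (N i : ℕ) : ℕ := ((Finset.Icc 1 N).filter (fun n => InA N n ∧ n * 2^i ≤ N)).card

open Classical in
noncomputable def Ds (N : ℕ) : Finset ℕ := (Finset.Icc 1 N).filter (Vd N)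

noncomputable def lev (d : ℕ) : ℕ := Nat.log 2 d.minFac

lemma Lin.mono {N M : ℕ} {α β : ℝ} (h : Lin M α β) (hN : N ≤ M) : Lin N α β :=
  fun l h1 h2 => h l h1 (fun n hn => ⟨(h2 n hn).1, (h2 n hn).2.trans hN⟩)

lemma Lin.mono' {N : ℕ} {α β α' β' : ℝ} (h : Lin N α β) (ha : α ≤ α') (hb : β ≤ β') : Lin N α' β' :=
  fun l h1 h2 => (h l h1 h2).trans (by
    have : β * pc l ≤ β' * pc l := mul_le_mul_of_nonneg_right hb (Nat.cast_nonneg _)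
    linarith)

lemma len_le {N : ℕ} {l : List ℕ} (h1 : l.Nodup) (h2 : ∀ n ∈ l, 1 ≤ n ∧ n ≤ N) : l.length ≤ N := by
  classical
  rw [← List.toFinset_card_of_nodup h1]
  have : l.toFinset ⊆ Finset.Icc 1 N := by
    intro n hn
    rw [List.mem_toFinset] at hn
    exact Finset.mem_Icc.2 (h2 n hn)
  simpa using Finset.card_le_card this

lemma lin_full (N : ℕ) : Lin N N 0 := by
  intro l h1 h2
  have := len_le h1 h2
  have : (l.length:ℝ) ≤ N := by exact_mod_cast this
  linarith

lemma lin_pc (N : ℕ) : Lin N 0 N := by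
  intro l h1 h2
  rcases eq_or_ne l [] with rfl | h
  · simp [pc]
  have h3 := len_le h1 h2
  have h4 : (l.length:ℝ) ≤ N := by exact_mod_cast h3
  have h5 : (1:ℝ) ≤ pc l := by exact_mod_cast pc_pos h
  have : (0:ℝ) ≤ N := Nat.cast_nonneg _
  nlinarith

lemma countP_le_card {N : ℕ} {l : List ℕ} (P : ℕ → Prop) [DecidablePred P] (h1 : l.Nodup)
    (h2 : ∀ n ∈ l, 1 ≤ n ∧ n ≤ N) : l.countP (fun n => decide (P n)) ≤ ((Finset.Icc 1 N).filter P).card := by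
  classical
  rw [List.countP_eq_length_filter, ← List.toFinset_card_of_nodup (h1.filter _)]
  apply Finset.card_le_card
  intro n hn
  rw [List.mem_toFinset, List.mem_filter] at hn
  rw [Finset.mem_filter, Finset.mem_Icc]
  exact ⟨h2 n hn.1, by simpa using hn.2⟩

lemma lin_class {N d : ℕ} {α β : ℝ} (hd : 0 < d) (h : Lin (N / d) α β) {l : List ℕ} (h1 : l.Nodup)
    (h2 : ∀ n ∈ l, 1 ≤ n ∧ n ≤ N) :
    ((l.filter (d ∣ ·)).length : ℝ) ≤ α + β * pc (l.filter (d ∣ ·)) := by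
  set m := l.filter (d ∣ ·) with hm
  have hmd : ∀ n ∈ m, d ∣ n ∧ 1 ≤ n ∧ n ≤ N := by
    intro n hn
    rw [hm, List.mem_filter] at hn
    exact ⟨by simpa using hn.2, h2 n hn.1⟩
  have hmn : m.Nodup := h1.filter _
  have e : (m.map (· / d)).map (d * ·) = m := by
    rw [List.map_map]
    conv_rhs => rw [← List.map_id m]
    apply List.map_congr_left
    intro n hn
    simpa using Nat.mul_div_cancel' (hmd n hn).1
  have h3 := h (m.map (· / d)) (by
    apply List.Nodup.of_map (d * ·)
    rw [e]; exact hmn) (by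
    intro n hn
    rw [List.mem_map] at hn
    obtain ⟨k, hk, rfl⟩ := hn
    obtain ⟨ha, hb, hc⟩ := hmd k hk
    exact ⟨Nat.div_pos (Nat.le_of_dvd hb ha) hd, Nat.div_le_div_right hc⟩)
  rw [← pc_map hd, e, List.length_map] at h3
  exact h3

lemma decomp {N j : ℕ} (hN : N < 2^(j+1)) (α β : ℕ → ℝ) (b : ℕ → ℝ) (hb : ∀ i, 0 ≤ b i)
    (hL : ∀ d ∈ Ds N, Lin (N / d) (α d) (β d)) (hβ : ∀ d ∈ Ds N, β d ≤ b (lev d)) :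
    Lin N (VV N 0 + ∑ d ∈ Ds N, α d + ∑ i ∈ Finset.range (j+1), b i * VV N i)
      (∑ i ∈ Finset.range (j+1), b i) := by
  classical
  intro l h1 h2
  have hDs : ∀ d ∈ Ds N, 0 < d ∧ d ≤ N ∧ Vd N d := by
    intro d hd
    unfold Ds at hd
    rw [Finset.mem_filter, Finset.mem_Icc] at hd
    exact ⟨hd.1.1, hd.1.2, hd.2⟩
  -- length
  have hlen : l.length ≤ VV N 0 + ∑ d ∈ Ds N, (l.filter (d ∣ ·)).length := by
    rw [← List.toFinset_card_of_nodup h1]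
    have hsub : l.toFinset ⊆ (Finset.Icc 1 N).filter (fun n => InA N n ∧ n * 2^0 ≤ N) ∪
        (Ds N).biUnion (fun d => (l.filter (d ∣ ·)).toFinset) := by
      intro n hn
      rw [List.mem_toFinset] at hn
      have hn2 := h2 n hn
      rw [Finset.mem_union]
      by_cases hA : InA N n
      · left
        rw [Finset.mem_filter, Finset.mem_Icc]
        exact ⟨hn2, hA, by simpa using hn2.2⟩
      · right
        obtain ⟨d, hd, hdn⟩ := vd_exists hn2.1 hA
        rw [Finset.mem_biUnion]
        refine ⟨d, ?_, ?_⟩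
        · unfold Ds
          rw [Finset.mem_filter, Finset.mem_Icc]
          exact ⟨⟨hd.1.le, (Nat.le_of_dvd hn2.1 hdn).trans hn2.2⟩, hd⟩
        · rw [List.mem_toFinset, List.mem_filter]
          exact ⟨hn, by simpa using hdn⟩
    refine (Finset.card_le_card hsub).trans ((Finset.card_union_le _ _).trans ?_)
    apply Nat.add_le_add
    · exact le_of_eq rfl
    · refine Finset.card_biUnion_le.trans (Finset.sum_le_sum fun d _ => ?_)
      exact List.toFinset_card_le _
  have hlen' : (l.length:ℝ) ≤ VV N 0 + ∑ d ∈ Ds N, ((l.filter (d ∣ ·)).length:ℝ) := by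
    exact_mod_cast hlen
  have hcl : ∑ d ∈ Ds N, ((l.filter (d ∣ ·)).length:ℝ) ≤
      ∑ d ∈ Ds N, α d + ∑ d ∈ Ds N, b (lev d) * pc (l.filter (d ∣ ·)) := by
    rw [← Finset.sum_add_distrib]
    refine Finset.sum_le_sum fun d hd => ?_
    refine (lin_class (hDs d hd).1 (hL d hd) h1 h2).trans ?_
    have := mul_le_mul_of_nonneg_right (hβ d hd) (Nat.cast_nonneg (α := ℝ) (pc (l.filter (d ∣ ·))))
    linarith
  have hlev : ∀ d ∈ Ds N, lev d ∈ Finset.range (j+1) := by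
    intro d hd
    rw [Finset.mem_range]
    unfold lev
    have hm : d.minFac ≤ N := (Nat.minFac_le (hDs d hd).1).trans (hDs d hd).2.1
    have := Nat.log_lt_of_lt_pow (b := 2) (Nat.minFac_pos d).ne' (hm.trans_lt hN)
    exact this
  have hsum : ∑ d ∈ Ds N, b (lev d) * pc (l.filter (d ∣ ·)) ≤
      ∑ i ∈ Finset.range (j+1), b i * (pc l + VV N i) := by
    rw [← Finset.sum_fiberwise_of_maps_to hlev]
    refine Finset.sum_le_sum fun i _ => ?_
    have : ∑ d ∈ (Ds N).filter (fun d => lev d = i), b (lev d) * (pc (l.filter (d ∣ ·)):ℝ) =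
        b i * ((∑ d ∈ (Ds N).filter (fun d => lev d = i), pc (l.filter (d ∣ ·)) : ℕ) : ℝ) := by
      push_cast
      rw [Finset.mul_sum]
      refine Finset.sum_congr rfl fun d hd => ?_
      rw [(Finset.mem_filter.1 hd).2]
    rw [this]
    apply mul_le_mul_of_nonneg_left _ (hb i)
    have h5 := sum_pc_le (N := N) ((Ds N).filter (fun d => lev d = i)) (2^i) (by
      intro d hd
      rw [Finset.mem_filter] at hd
      refine ⟨(hDs d hd.1).2.2, ?_⟩
      rw [← hd.2]
      exact Nat.pow_log_le_self 2 (Nat.minFac_pos d).ne') l h2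
    have h6 : l.tail.countP (fun n => decide (InA N n ∧ n * 2^i ≤ N)) ≤ VV N i :=
      countP_le_card _ (h1.sublist (List.tail_sublist l)) (fun n hn => h2 n (List.mem_of_mem_tail hn))
    have h7 : ∑ d ∈ (Ds N).filter (fun d => lev d = i), pc (l.filter (d ∣ ·)) ≤ pc l + VV N i := by
      refine h5.trans ?_
      apply Nat.add_le_add_left
      convert h6
    exact_mod_cast h7
  have hexp : ∑ i ∈ Finset.range (j+1), b i * ((pc l:ℝ) + VV N i) =
      ∑ i ∈ Finset.range (j+1), b i * VV N i + (∑ i ∈ Finset.range (j+1), b i) * pc l := by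
    rw [Finset.sum_mul, ← Finset.sum_add_distrib]
    refine Finset.sum_congr rfl fun i _ => by ring
  linarith

end

section

noncomputable def c0 : ℝ := 1000 * (cL + 1)
lemma c0_pos : 0 < c0 := by unfold c0; have := cL_pos; linarith

lemma disj_sum {I : Finset ℕ} {E : ℕ → Finset ℕ} {D : Finset ℕ} {w u : ℕ → ℝ}
    (hE : ∀ j ∈ I, E j ⊆ D) (hdis : ∀ j ∈ I, ∀ k ∈ I, ∀ n, n ∈ E j → n ∈ E k → j = k)
    (hw : ∀ j ∈ I, ∀ n ∈ E j, w j ≤ u n) (hu : ∀ n ∈ D, 0 ≤ u n) :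
    ∑ j ∈ I, ((E j).card : ℝ) * w j ≤ ∑ n ∈ D, u n := by
  classical
  have h1 : ∑ j ∈ I, ((E j).card : ℝ) * w j ≤ ∑ j ∈ I, ∑ n ∈ E j, u n := by
    refine Finset.sum_le_sum fun j hj => ?_
    rw [← nsmul_eq_mul]
    exact Finset.card_nsmul_le_sum _ _ _ (fun n hn => hw j hj n hn)
  refine h1.trans ?_
  rw [← Finset.sum_biUnion]
  · apply Finset.sum_le_sum_of_subset_of_nonneg
    · intro n hn
      rw [Finset.mem_biUnion] at hn
      obtain ⟨j, hj, hn⟩ := hn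
      exact hE j hj hn
    · intro n hn _; exact hu n hn
  · intro j hj k hk hjk
    rw [Function.onFun, Finset.disjoint_left]
    intro n hn hn'
    exact hjk (hdis j hj k hk n hn hn')

lemma pow_window {a b j k n : ℕ} (h : b ≤ a + 1) (h1 : 2^j < n * 2^b) (h2 : n * 2^a ≤ 2^j)
    (h3 : 2^k < n * 2^b) (h4 : n * 2^a ≤ 2^k) : j = k := by
  have key : ∀ {j k : ℕ}, 2^j < n * 2^b → n * 2^a ≤ 2^k → j < k + 1 := by
    intro j k h1 h4
    have h5 : n * 2^b ≤ 2^(k+1) := by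
      calc n * 2^b ≤ n * 2^(a+1) := Nat.mul_le_mul_left _ (Nat.pow_le_pow_right (by norm_num) h)
        _ = (n * 2^a) * 2 := by ring
        _ ≤ 2^k * 2 := Nat.mul_le_mul_right _ h4
        _ = 2^(k+1) := by ring
    exact (Nat.pow_lt_pow_iff_right (by norm_num)).1 (h1.trans_le h5)
  have := key h1 h4
  have := key h3 h2
  omega

open Classical in
noncomputable def Ee (e j : ℕ) : Finset ℕ :=
  (Finset.Icc 1 (2^j)).filter (fun n => InA (2^j) n ∧ 2^j < n * 2^(e+1) ∧ n * 2^e ≤ 2^j)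

lemma mem_Ee {e j n : ℕ} : n ∈ Ee e j ↔ (1 ≤ n ∧ n ≤ 2^j) ∧ InA (2^j) n ∧ 2^j < n * 2^(e+1) ∧ n * 2^e ≤ 2^j := by
  classical
  unfold Ee
  rw [Finset.mem_filter, Finset.mem_Icc]

lemma avg_Ee (e J : ℕ) : ∑ j ∈ Finset.Ico J (2*J), ((Ee e j).card : ℝ) * (1/2^j) ≤
    c0 * (cL + 3) * ((e+1)/2^e) := by
  have hc := cL_pos
  have h1 : ∑ j ∈ Finset.Ico J (2*J), ((Ee e j).card : ℝ) * (1/2^j) ≤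
      ∑ n ∈ Dd 1 (2^(e+1)) (2^J) (2^(2*J+2)), (1/2^e) * (1/(n:ℝ)) := by
    apply disj_sum
    · intro j hj n hn
      rw [Finset.mem_Ico] at hj
      obtain ⟨⟨h1, h2⟩, h3, h4, h5⟩ := mem_Ee.1 hn
      rw [mem_Dd Nat.one_le_two_pow]
      refine ⟨⟨by omega, fun p hp _ => hp.one_lt, fun d hd hd1 => ?_⟩, ?_, ?_⟩
      · have := h3.2 d hd hd1
        rw [mul_comm]; rw [mul_comm _ n]
        rw [mul_comm] at this
        omega
      · rw [mul_comm]
        exact (Nat.pow_le_pow_right (by norm_num) hj.1).trans_lt h4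
      · calc 2^(e+1) * n = (n * 2^e) * 2 := by ring
          _ ≤ 2^j * 2 := Nat.mul_le_mul_right _ h5
          _ = 2^(j+1) := by ring
          _ ≤ 2^(2*J+2) := Nat.pow_le_pow_right (by norm_num) (by omega)
    · intro j _ k _ n hj hk
      obtain ⟨⟨h1, h2⟩, h3, h4, h5⟩ := mem_Ee.1 hj
      obtain ⟨⟨h1', h2'⟩, h3', h4', h5'⟩ := mem_Ee.1 hk
      exact pow_window le_rfl h4 h5 h4' h5'
    · intro j _ n hn
      obtain ⟨⟨h1, h2⟩, h3, h4, h5⟩ := mem_Ee.1 hn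
      rw [one_div_mul_one_div]
      apply one_div_le_one_div_of_le
      · have : (0:ℝ) < n := by exact_mod_cast h1
        positivity
      · rw [mul_comm]; exact_mod_cast h5
    · intro n _; positivity
  refine h1.trans ?_
  rw [← Finset.mul_sum]
  have h2 := window_bound (y := 1) (t := 2^(e+1)) (J := J) le_rfl Nat.one_le_two_pow
  have h3 : 1 + kap 1 (2^(e+1)) / (1 + Real.log ((1:ℕ):ℝ)) ≤ (cL + 3) * (e+1) := by
    unfold kap
    push_cast
    rw [Real.log_one, Real.log_pow]
    have := Real.log_two_lt_d9
    have : (0:ℝ) ≤ e := Nat.cast_nonneg e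
    push_cast
    nlinarith
  have h4 : 1000 * (cL + 1) * (1 + kap 1 (2^(e+1)) / (1 + Real.log ((1:ℕ):ℝ))) ≤ c0 * ((cL + 3) * (e+1)) :=
    mul_le_mul_of_nonneg_left h3 c0_pos.le
  calc _ ≤ 1/2^e * (c0 * ((cL + 3) * (e+1))) := mul_le_mul_of_nonneg_left (h2.trans h4) (by positivity)
    _ = _ := by ring

lemma geo_tail (i M : ℕ) : ∑ e ∈ Finset.Ico i M, ((e:ℝ)+1)/2^e ≤ (2*i+4)/2^i := by
  rcases le_or_gt i M with h | h
  · have : ∀ M, i ≤ M → ∑ e ∈ Finset.Ico i M, ((e:ℝ)+1)/2^e = (2*i+4)/2^i - (2*M+4)/2^M := by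
      intro M hM
      induction M, hM using Nat.le_induction with
      | base => simp
      | succ n hn ih =>
        rw [Finset.sum_Ico_succ_top hn, ih]
        push_cast
        rw [pow_succ]
        field_simp
        ring
    rw [this M h]
    have : (0:ℝ) ≤ (2*M+4)/2^M := by positivity
    linarith
  · rw [Finset.Ico_eq_empty (by omega)]
    simp only [Finset.sum_empty]; positivity

lemma avg_VV (i J : ℕ) : ∑ j ∈ Finset.Ico J (2*J), (VV (2^j) i : ℝ) * (1/2^j) ≤
    c0 * (cL + 3) * ((2*i+4)/2^i) := by
  classical
  have h1 : ∀ j ∈ Finset.Ico J (2*J), VV (2^j) i ≤ ∑ e ∈ Finset.Ico i (2*J), (Ee e j).card := by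
    intro j hj
    rw [Finset.mem_Ico] at hj
    refine le_trans ?_ (Finset.card_biUnion_le)
    unfold VV
    apply Finset.card_le_card
    intro n hn
    rw [Finset.mem_filter, Finset.mem_Icc] at hn
    obtain ⟨⟨h1, h2⟩, h3, h4⟩ := hn
    rw [Finset.mem_biUnion]
    have hq : 2^j / n ≠ 0 := (Nat.div_pos h2 h1).ne'
    have ha := Nat.pow_log_le_self 2 hq
    have hb := Nat.lt_pow_succ_log_self (b := 2) (by norm_num) (2^j/n)
    refine ⟨Nat.log 2 (2^j/n), ?_, mem_Ee.2 ⟨⟨h1, h2⟩, h3, ?_, ?_⟩⟩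
    · rw [Finset.mem_Ico]
      constructor
      · apply Nat.le_log_of_pow_le (by norm_num)
        rw [Nat.le_div_iff_mul_le h1, mul_comm]; exact h4
      · have : 2^(Nat.log 2 (2^j/n)) ≤ 2^j := ha.trans (Nat.div_le_self _ _)
        have := (Nat.pow_le_pow_iff_right (show 1 < 2 by norm_num)).1 this
        omega
    · have := (Nat.div_lt_iff_lt_mul h1).1 hb
      rw [mul_comm]; exact this
    · rw [Nat.le_div_iff_mul_le h1] at ha
      rw [mul_comm]; exact ha
  calc _ ≤ ∑ j ∈ Finset.Ico J (2*J), ∑ e ∈ Finset.Ico i (2*J), ((Ee e j).card:ℝ) * (1/2^j) := by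
        refine Finset.sum_le_sum fun j hj => ?_
        rw [← Finset.sum_mul]
        apply mul_le_mul_of_nonneg_right _ (by positivity)
        exact_mod_cast h1 j hj
    _ = ∑ e ∈ Finset.Ico i (2*J), ∑ j ∈ Finset.Ico J (2*J), ((Ee e j).card:ℝ) * (1/2^j) := Finset.sum_comm
    _ ≤ ∑ e ∈ Finset.Ico i (2*J), c0 * (cL + 3) * ((e+1)/2^e) := Finset.sum_le_sum fun e _ => avg_Ee e J
    _ = c0 * (cL + 3) * ∑ e ∈ Finset.Ico i (2*J), (((e:ℝ)+1)/2^e) := by rw [Finset.mul_sum]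
    _ ≤ _ := by
      apply mul_le_mul_of_nonneg_left (geo_tail _ _)
      have := cL_pos; have := c0_pos
      positivity

open Classical in
noncomputable def Nn (i h j : ℕ) : Finset ℕ :=
  (Ds (2^j)).filter (fun d => lev d = i ∧ Nat.log 2 (2^j / d) = h)

lemma mem_Ds {N d : ℕ} : d ∈ Ds N ↔ (1 ≤ d ∧ d ≤ N) ∧ Vd N d := by
  classical
  unfold Ds
  rw [Finset.mem_filter, Finset.mem_Icc]

lemma Nn_props {i h j d : ℕ} (hd : d ∈ Nn i h j) : 1 ≤ d ∧ d ≤ 2^j ∧ Vd (2^j) d ∧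
    2^i ≤ d.minFac ∧ d.minFac < 2^(i+1) ∧ d * 2^h ≤ 2^j ∧ 2^j < d * 2^(h+1) ∧ h ≤ i ∧ 1 ≤ i := by
  classical
  unfold Nn at hd
  rw [Finset.mem_filter, mem_Ds] at hd
  obtain ⟨⟨⟨h1, h2⟩, h3⟩, h4, h5⟩ := hd
  have hp := Nat.minFac_prime (n := d) (by have := h3.1; omega)
  have ha := Nat.pow_log_le_self 2 hp.pos.ne'
  have hb := Nat.lt_pow_succ_log_self (b := 2) (by norm_num) d.minFac
  have hq : 2^j / d ≠ 0 := (Nat.div_pos h2 h1).ne'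
  have ha' := Nat.pow_log_le_self 2 hq
  have hb' := Nat.lt_pow_succ_log_self (b := 2) (by norm_num) (2^j/d)
  unfold lev at h4
  rw [h4] at ha hb
  rw [h5] at ha' hb'
  rw [Nat.le_div_iff_mul_le h1, mul_comm] at ha'
  have hb'' := (Nat.div_lt_iff_lt_mul h1).1 hb'
  rw [mul_comm] at hb''
  refine ⟨h1, h2, h3, ha, hb, ha', hb'', ?_, ?_⟩
  · have h6 : d * 2^h < d * 2^(i+1) := by
      calc d * 2^h ≤ 2^j := ha'
        _ < d * d.minFac := h3.2.1
        _ ≤ d * 2^(i+1) := Nat.mul_le_mul_left _ hb.le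
    have h7 := Nat.lt_of_mul_lt_mul_left h6
    have := (Nat.pow_lt_pow_iff_right (show 1 < 2 by norm_num)).1 h7
    omega
  · by_contra hc
    have : i = 0 := by omega
    subst this
    have := hp.two_le
    simp at hb
    omega

lemma avg_Nn (i h J : ℕ) : ∑ j ∈ Finset.Ico J (2*J), ((Nn i h j).card : ℝ) * (1/2^j) ≤
    c0 * (20 * (cL + 5)^2) * (1 / (2^h * (i+1))) := by
  classical
  have hc := cL_pos
  by_cases hhi : h ≤ i ∧ 1 ≤ i
  swap
  · have : ∀ j ∈ Finset.Ico J (2*J), ((Nn i h j).card : ℝ) * (1/2^j) = 0 := by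
      intro j _
      have : Nn i h j = ∅ := by
        rw [Finset.eq_empty_iff_forall_notMem]
        intro d hd
        have := Nn_props hd
        exact hhi ⟨this.2.2.2.2.2.2.2.1, this.2.2.2.2.2.2.2.2⟩
      rw [this]; simp
    rw [Finset.sum_eq_zero this]
    have := c0_pos
    positivity
  obtain ⟨hhi, hi1⟩ := hhi
  set y := 2^i - 1 with hy
  set t := 2^(i+h+2) with ht
  have h2i : 2 ≤ 2^i := by
    calc 2 = 2^1 := by norm_num
      _ ≤ 2^i := Nat.pow_le_pow_right (by norm_num) hi1
  have hy1 : 1 ≤ y := by omega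
  have hyt : y ≤ t := by
    have : 2^i ≤ 2^(i+h+2) := Nat.pow_le_pow_right (by norm_num) (by omega)
    omega
  set D := (pr y (2^(i+1)) ×ˢ Dd y t (2^J) (2^(2*J+2))).image (fun q => q.1 * q.2) with hD
  have h1 : ∑ j ∈ Finset.Ico J (2*J), ((Nn i h j).card : ℝ) * (1/2^j) ≤
      ∑ n ∈ D, (1/2^h) * (1/(n:ℝ)) := by
    apply disj_sum
    · intro j hj d hd
      rw [Finset.mem_Ico] at hj
      obtain ⟨h1, h2, h3, h4, h5, h6, h7, h8, h9⟩ := Nn_props hd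
      have hp := Nat.minFac_prime (n := d) (by have := h3.1; omega)
      obtain ⟨a, ha⟩ := Nat.minFac_dvd d
      set p := d.minFac with hpd
      have ha0 : 0 < a := by
        rcases Nat.eq_zero_or_pos a with h | h
        · subst h; omega
        · exact h
      have had : a < d := by
        rw [ha]; have := hp.two_le; nlinarith
      have hta : 2^j < t * a := by
        have : p * 2^j < p * (t * a) := by
          calc p * 2^j < 2^(i+1) * 2^j := Nat.mul_lt_mul_of_pos_right h5 (by positivity)
            _ ≤ 2^(i+1) * (d * 2^(h+1)) := Nat.mul_le_mul_left _ h7.le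
            _ = p * (t * a) := by rw [ht, ha]; ring
        exact Nat.lt_of_mul_lt_mul_left this
      have hta2 : t * a ≤ 2^(j+2) := by
        have : 2^i * (t * a) ≤ 2^i * 2^(j+2) := by
          calc 2^i * (t * a) ≤ p * (t * a) := Nat.mul_le_mul_right _ h4
            _ = 2^(i+2) * (d * 2^h) := by rw [ht, ha]; ring
            _ ≤ 2^(i+2) * 2^j := Nat.mul_le_mul_left _ h6
            _ = 2^i * 2^(j+2) := by ring
        exact Nat.le_of_mul_le_mul_left this (by positivity)
      rw [hD, Finset.mem_image]
      refine ⟨(p, a), ?_, ha.symm⟩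
      rw [Finset.mem_product, mem_pr, mem_Dd Nat.one_le_two_pow]
      refine ⟨⟨hp, by simp only; omega, h5.le⟩, ⟨ha0.ne', ?_, ?_⟩, ?_, ?_⟩
      · intro q hq hqa
        have : p ≤ q := Nat.minFac_le_of_dvd hq.two_le (hqa.trans ⟨p, by rw [ha, mul_comm]⟩)
        omega
      · intro e he he1
        have := h3.2.2 e (he.trans ⟨p, by rw [ha, mul_comm]⟩) he1 ((Nat.le_of_dvd ha0 he).trans_lt had)
        exact this.trans hta.le
      · exact (Nat.pow_le_pow_right (by norm_num) hj.1).trans_lt hta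
      · exact hta2.trans (Nat.pow_le_pow_right (by norm_num) (by omega))
    · intro j _ k _ n hj hk
      obtain ⟨h1, h2, h3, h4, h5, h6, h7, h8, h9⟩ := Nn_props hj
      obtain ⟨h1', h2', h3', h4', h5', h6', h7', h8', h9'⟩ := Nn_props hk
      exact pow_window le_rfl h7 h6 h7' h6'
    · intro j _ n hn
      obtain ⟨h1, h2, h3, h4, h5, h6, h7, h8, h9⟩ := Nn_props hn
      rw [one_div_mul_one_div]
      apply one_div_le_one_div_of_le
      · have : (0:ℝ) < n := by exact_mod_cast h1
        positivity
      · rw [mul_comm]; exact_mod_cast h6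
    · intro n _; positivity
  refine h1.trans ?_
  rw [← Finset.mul_sum]
  have h2 : ∑ n ∈ D, 1/(n:ℝ) ≤ (∑ p ∈ pr y (2^(i+1)), 1/(p:ℝ)) * ∑ a ∈ Dd y t (2^J) (2^(2*J+2)), 1/(a:ℝ) := by
    refine (Finset.sum_image_le_of_nonneg (fun n _ => by positivity)).trans ?_
    rw [Finset.sum_product, Finset.sum_mul]
    refine Finset.sum_le_sum fun p _ => ?_
    rw [Finset.mul_sum]
    refine Finset.sum_le_sum fun a _ => ?_
    push_cast
    rw [one_div_mul_one_div]
  have hl2 : Real.log 2 ≤ 0.7 := by have := Real.log_two_lt_d9; linarith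
  have hl2' : 0.69 ≤ Real.log 2 := by have := Real.log_two_gt_d9; linarith
  have hi1' : (1:ℝ) ≤ i := by exact_mod_cast hi1
  have hhi' : (h:ℝ) ≤ i := by exact_mod_cast hhi
  have hlogy : ((i:ℝ) - 1) * Real.log 2 ≤ Real.log y := by
    have h3 : 2^(i-1) ≤ y := by
      have : 2^i = 2 * 2^(i-1) := by rw [← pow_succ']; congr 1; omega
      have : 1 ≤ 2^(i-1) := Nat.one_le_two_pow
      omega
    have h4 : Real.log ((2^(i-1) : ℕ):ℝ) ≤ Real.log y :=
      Real.log_le_log (by positivity) (by exact_mod_cast h3)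
    push_cast at h4
    rw [Real.log_pow, Nat.cast_sub hi1] at h4
    simpa using h4
  have h0 : (0:ℝ) ≤ h := Nat.cast_nonneg h
  have h3 : ∑ p ∈ pr y (2^(i+1)), 1/(p:ℝ) ≤ 4 * (cL + 5) / (i+1) := by
    rw [le_div_iff₀ (by positivity), Finset.sum_mul]
    have hle : 2^i ≤ 2^(i+1) := Nat.pow_le_pow_right (by norm_num) (by omega)
    have hL := Lg_upper (y := y) (z := 2^(i+1)) hy1 (by omega)
    have hL2 : ∑ p ∈ pr y (2^(i+1)), 1/(p:ℝ) * (i+1) ≤ 4 * Lg y (2^(i+1)) := by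
      unfold Lg
      rw [Finset.mul_sum]
      refine Finset.sum_le_sum fun p hp => ?_
      rw [mem_pr] at hp
      have h5 : 2^i ≤ p := by omega
      have h6 : Real.log ((2^i : ℕ):ℝ) ≤ Real.log p :=
        Real.log_le_log (by positivity) (by exact_mod_cast h5)
      push_cast at h6
      rw [Real.log_pow] at h6
      have hp2 : (2:ℝ) ≤ p := by exact_mod_cast hp.1.two_le
      have h7 : (i:ℝ) + 1 ≤ 4 * Real.log p := by nlinarith
      calc 1/(p:ℝ) * (i+1) ≤ 1/((p:ℝ)-1) * (4 * Real.log p) := by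
            apply mul_le_mul _ h7 (by positivity)
            · apply one_div_nonneg.2; linarith
            · apply one_div_le_one_div_of_le <;> linarith
        _ = _ := by ring
    refine hL2.trans ?_
    apply mul_le_mul_of_nonneg_left _ (by norm_num)
    refine hL.trans ?_
    push_cast
    rw [Real.log_pow]
    push_cast
    nlinarith
  have h4 := window_bound (J := J) hy1 hyt
  have h5 : 1 + kap y t / (1 + Real.log y) ≤ 5 * (cL + 5) := by
    have hden : 0.6 * (i:ℝ) ≤ 1 + Real.log y := by nlinarith
    have : kap y t / (1 + Real.log y) ≤ 4 * (cL + 5) := by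
      rw [div_le_iff₀ (by linarith)]
      unfold kap
      rw [ht]
      push_cast
      rw [Real.log_pow]
      push_cast
      nlinarith
    linarith
  have h6 : ∑ a ∈ Dd y t (2^J) (2^(2*J+2)), 1/(a:ℝ) ≤ c0 * (5 * (cL + 5)) :=
    h4.trans (mul_le_mul_of_nonneg_left h5 c0_pos.le)
  calc _ ≤ 1/2^h * ((4 * (cL + 5) / (i+1)) * (c0 * (5 * (cL + 5)))) := by
        apply mul_le_mul_of_nonneg_left _ (by positivity)
        refine h2.trans ?_
        apply mul_le_mul h3 h6 (Finset.sum_nonneg fun _ _ => by positivity)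
        positivity
    _ = _ := by field_simp; ring

end

section

noncomputable def lam (i : ℕ) : ℕ := 4 * Nat.log 2 (i+1)
noncomputable def hgt (j d : ℕ) : ℕ := Nat.log 2 (2^j / d)
def gd (j d : ℕ) : Prop := lev d ≤ hgt j d + lam (lev d)

lemma Ds_props {j d : ℕ} (hd : d ∈ Ds (2^j)) : 0 < d ∧ 2^(lev d) ≤ d ∧
    2^j / d < 2^(hgt j d + 1) ∧ hgt j d ≤ lev d ∧ lev d ≤ j ∧ 2^j / d ≤ 2^(j - lev d) := by
  classical
  have hN : d ∈ Nn (lev d) (hgt j d) j := by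
    unfold Nn
    rw [Finset.mem_filter]
    exact ⟨hd, rfl, rfl⟩
  obtain ⟨h1, h2, h3, h4, h5, h6, h7, h8, h9⟩ := Nn_props hN
  have h10 : 2^(lev d) ≤ d := h4.trans (Nat.minFac_le h1)
  have h11 : lev d ≤ j := (Nat.pow_le_pow_iff_right (show 1 < 2 by norm_num)).1 (h10.trans h2)
  refine ⟨h1, h10, ?_, h8, h11, ?_⟩
  · rw [Nat.div_lt_iff_lt_mul h1, mul_comm]; exact h7
  · calc 2^j / d ≤ 2^j / 2^(lev d) := Nat.div_le_div_left h10 (by positivity)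
      _ = 2^(j - lev d) := Nat.pow_div h11 (by norm_num)

open Classical in
noncomputable def A1 (j : ℕ) : ℝ := VV (2^j) 0 + ∑ d ∈ Ds (2^j), (if gd j d then (2:ℝ)^(hgt j d + 1) else 0) +
  ∑ i ∈ Finset.range (j+1), ((2:ℝ)^i / 2^(lam i)) * VV (2^j) i
noncomputable def B1 (j : ℕ) : ℝ := (j+1) * 2^(j/2)
open Classical in
noncomputable def A2 (j : ℕ) : ℝ := VV (2^j) 0 + ∑ d ∈ Ds (2^j), (if gd j d then A1 (hgt j d + 1) else 0) +
  ∑ i ∈ Finset.range (j+1), ((2:ℝ)^i / 2^(lam i) + B1 (i+1)) * VV (2^j) i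
noncomputable def B2 (j : ℕ) : ℝ := B1 j + (j+1) * B1 (j+1)

lemma A1_nonneg (j : ℕ) : 0 ≤ A1 j := by
  classical
  unfold A1
  have : 0 ≤ ∑ i ∈ Finset.range (j+1), ((2:ℝ)^i / 2^(lam i)) * VV (2^j) i :=
    Finset.sum_nonneg fun i _ => by positivity
  have : 0 ≤ ∑ d ∈ Ds (2^j), (if gd j d then (2:ℝ)^(hgt j d + 1) else 0) :=
    Finset.sum_nonneg fun d _ => by split_ifs <;> positivity
  positivity

lemma B1_mono {i j : ℕ} (h : i ≤ j) : B1 i ≤ B1 j := by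
  unfold B1
  have : (i:ℝ) ≤ j := by exact_mod_cast h
  gcongr
  · norm_num

lemma B1_nonneg (j : ℕ) : 0 ≤ B1 j := by unfold B1; positivity

noncomputable def b1 (j i : ℕ) : ℝ := min ((2:ℝ)^i / 2^(lam i)) ((2:ℝ)^(j-i))

lemma b1_nonneg (j i : ℕ) : 0 ≤ b1 j i := by unfold b1; positivity

lemma b1_sum (j : ℕ) : ∑ i ∈ Finset.range (j+1), b1 j i ≤ B1 j := by
  have : ∀ i ∈ Finset.range (j+1), b1 j i ≤ 2^(j/2) := by
    intro i hi
    rw [Finset.mem_range] at hi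
    unfold b1
    rcases le_or_gt i (j/2) with h | h
    · refine (min_le_left _ _).trans ?_
      calc (2:ℝ)^i / 2^(lam i) ≤ 2^i := div_le_self (by positivity) (one_le_pow₀ (by norm_num))
        _ ≤ _ := pow_le_pow_right₀ (by norm_num) h
    · refine (min_le_right _ _).trans ?_
      exact pow_le_pow_right₀ (by norm_num) (by omega)
  refine (Finset.sum_le_card_nsmul _ _ _ this).trans ?_
  rw [Finset.card_range, nsmul_eq_mul]
  unfold B1
  push_cast
  exact le_rfl

lemma bad_bound {j d : ℕ} (hd : d ∈ Ds (2^j)) (hg : ¬ gd j d) : ((2^j / d : ℕ):ℝ) ≤ b1 j (lev d) := by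
  obtain ⟨h1, h2, h3, h4, h5, h6⟩ := Ds_props hd
  unfold gd at hg
  push Not at hg
  unfold b1
  apply le_min
  · rw [le_div_iff₀ (by positivity)]
    have : 2^j / d * 2^(lam (lev d)) ≤ 2^(lev d) := by
      calc 2^j / d * 2^(lam (lev d)) ≤ 2^(hgt j d + 1) * 2^(lam (lev d)) := Nat.mul_le_mul_right _ h3.le
        _ = 2^(hgt j d + 1 + lam (lev d)) := by ring
        _ ≤ 2^(lev d) := Nat.pow_le_pow_right (by norm_num) (by omega)
    exact_mod_cast this
  · exact_mod_cast h6

lemma lin1 (j : ℕ) : Lin (2^j) (A1 j) (B1 j) := by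
  classical
  have h := decomp (N := 2^j) (j := j) (Nat.pow_lt_pow_right (by norm_num) (by omega))
    (fun d => if gd j d then (2:ℝ)^(hgt j d + 1) else 0)
    (fun d => if gd j d then 0 else ((2^j / d : ℕ):ℝ)) (b1 j) (b1_nonneg j) (by
      intro d hd
      obtain ⟨h1, h2, h3, h4, h5, h6⟩ := Ds_props hd
      split_ifs with hg
      · refine (lin_full (2^j/d)).mono' ?_ le_rfl
        exact_mod_cast h3.le
      · exact lin_pc _) (by
      intro d hd
      split_ifs with hg
      · exact b1_nonneg _ _
      · exact bad_bound hd hg)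
  refine h.mono' ?_ (b1_sum j)
  unfold A1
  gcongr with i hi
  · unfold b1; exact min_le_left _ _

lemma lin2 (j : ℕ) : Lin (2^j) (A2 j) (B2 j) := by
  classical
  have h := decomp (N := 2^j) (j := j) (Nat.pow_lt_pow_right (by norm_num) (by omega))
    (fun d => if gd j d then A1 (hgt j d + 1) else 0)
    (fun d => if gd j d then B1 (hgt j d + 1) else ((2^j / d : ℕ):ℝ)) (fun i => b1 j i + B1 (i+1))
    (fun i => add_nonneg (b1_nonneg j i) (B1_nonneg _)) (by
      intro d hd
      obtain ⟨h1, h2, h3, h4, h5, h6⟩ := Ds_props hd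
      split_ifs with hg
      · exact (lin1 _).mono h3.le
      · exact lin_pc _) (by
      intro d hd
      obtain ⟨h1, h2, h3, h4, h5, h6⟩ := Ds_props hd
      split_ifs with hg
      · have := B1_mono (show hgt j d + 1 ≤ lev d + 1 by omega)
        have := b1_nonneg j (lev d)
        linarith
      · have := bad_bound hd hg
        have := B1_nonneg (lev d + 1)
        linarith)
  refine h.mono' ?_ ?_
  · unfold A2
    gcongr with i hi
    · unfold b1; exact min_le_left _ _
  · rw [Finset.sum_add_distrib]
    unfold B2
    apply add_le_add (b1_sum j)
    have : ∀ i ∈ Finset.range (j+1), B1 (i+1) ≤ B1 (j+1) := by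
      intro i hi
      rw [Finset.mem_range] at hi
      exact B1_mono (by omega)
    refine (Finset.sum_le_card_nsmul _ _ _ this).trans ?_
    rw [Finset.card_range, nsmul_eq_mul]
    push_cast
    exact le_rfl

noncomputable def cN : ℝ := c0 * (20 * (cL + 5)^2)
noncomputable def c1 : ℝ := c0 * (cL + 3)
lemma cN_pos : 0 < cN := by unfold cN; have := c0_pos; have := cL_pos; positivity
lemma c1_pos : 0 < c1 := by unfold c1; have := c0_pos; have := cL_pos; positivity

noncomputable def Tt (M : ℕ) : Finset (ℕ × ℕ) :=
  (Finset.range M ×ˢ Finset.range M).filter (fun q => q.2 ≤ q.1 ∧ q.1 ≤ q.2 + lam q.1)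

open Classical in
lemma avg_good (φ : ℕ → ℝ) (hφ : ∀ h, 0 ≤ φ h) (J : ℕ) :
    ∑ j ∈ Finset.Ico J (2*J), (∑ d ∈ Ds (2^j), (if gd j d then φ (hgt j d) else 0)) * (1/2^j) ≤
      cN * ∑ q ∈ Tt (2*J), φ q.2 * (1 / (2^q.2 * (q.1+1))) := by
  have h1 : ∀ j ∈ Finset.Ico J (2*J), ∑ d ∈ Ds (2^j), (if gd j d then φ (hgt j d) else 0) ≤
      ∑ q ∈ Tt (2*J), φ q.2 * (Nn q.1 q.2 j).card := by
    intro j hj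
    rw [Finset.mem_Ico] at hj
    rw [← Finset.sum_filter]
    rw [← Finset.sum_fiberwise_of_maps_to (t := Tt (2*J)) (g := fun d => (lev d, hgt j d))]
    · refine Finset.sum_le_sum fun q _ => ?_
      calc _ = ∑ d ∈ ((Ds (2^j)).filter (gd j)).filter (fun d => (lev d, hgt j d) = q), φ q.2 := by
            refine Finset.sum_congr rfl fun d hd => ?_
            rw [← (Finset.mem_filter.1 hd).2]
        _ = (((Ds (2^j)).filter (gd j)).filter (fun d => (lev d, hgt j d) = q)).card * φ q.2 := by
            rw [Finset.sum_const, nsmul_eq_mul]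
        _ ≤ (Nn q.1 q.2 j).card * φ q.2 := by
            apply mul_le_mul_of_nonneg_right _ (hφ _)
            have : ((Ds (2^j)).filter (gd j)).filter (fun d => (lev d, hgt j d) = q) ⊆ Nn q.1 q.2 j := by
              intro d hd
              rw [Finset.mem_filter, Finset.mem_filter] at hd
              unfold Nn
              rw [Finset.mem_filter]
              obtain ⟨⟨ha, _⟩, hb⟩ := hd
              rw [← hb]
              exact ⟨ha, rfl, rfl⟩
            exact_mod_cast Finset.card_le_card this
        _ = _ := mul_comm _ _
    · intro d hd
      rw [Finset.mem_filter] at hd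
      obtain ⟨h1, h2, h3, h4, h5, h6⟩ := Ds_props hd.1
      unfold Tt
      rw [Finset.mem_filter, Finset.mem_product, Finset.mem_range, Finset.mem_range]
      exact ⟨⟨by simp only; omega, by simp only; omega⟩, h4, hd.2⟩
  calc _ ≤ ∑ j ∈ Finset.Ico J (2*J), ∑ q ∈ Tt (2*J), φ q.2 * ((Nn q.1 q.2 j).card * (1/2^j)) := by
        refine Finset.sum_le_sum fun j hj => ?_
        refine (mul_le_mul_of_nonneg_right (h1 j hj) (by positivity)).trans ?_
        rw [Finset.sum_mul]
        exact le_of_eq (Finset.sum_congr rfl fun q _ => by ring)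
    _ = ∑ q ∈ Tt (2*J), φ q.2 * ∑ j ∈ Finset.Ico J (2*J), ((Nn q.1 q.2 j).card:ℝ) * (1/2^j) := by
        rw [Finset.sum_comm]
        refine Finset.sum_congr rfl fun q _ => ?_
        rw [Finset.mul_sum]
    _ ≤ ∑ q ∈ Tt (2*J), φ q.2 * (cN * (1 / (2^q.2 * (q.1+1)))) := by
        refine Finset.sum_le_sum fun q _ => ?_
        exact mul_le_mul_of_nonneg_left (avg_Nn q.1 q.2 J) (hφ _)
    _ = _ := by
        rw [Finset.mul_sum]
        exact Finset.sum_congr rfl fun q _ => by ring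

lemma avg_Vsum (c : ℕ → ℝ) (hc : ∀ i, 0 ≤ c i) (J : ℕ) :
    ∑ j ∈ Finset.Ico J (2*J), (∑ i ∈ Finset.range (j+1), c i * VV (2^j) i) * (1/2^j) ≤
      c1 * ∑ i ∈ Finset.range (2*J), c i * ((2*i+4)/2^i) := by
  calc _ ≤ ∑ j ∈ Finset.Ico J (2*J), ∑ i ∈ Finset.range (2*J), c i * (VV (2^j) i * (1/2^j)) := by
        refine Finset.sum_le_sum fun j hj => ?_
        rw [Finset.mem_Ico] at hj
        rw [Finset.sum_mul]
        have : Finset.range (j+1) ⊆ Finset.range (2*J) := by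
          intro i hi; rw [Finset.mem_range] at *; omega
        refine le_trans (le_of_eq (Finset.sum_congr rfl fun i _ => by ring))
          (Finset.sum_le_sum_of_subset_of_nonneg this fun i _ _ => ?_)
        have := hc i
        positivity
    _ = ∑ i ∈ Finset.range (2*J), c i * ∑ j ∈ Finset.Ico J (2*J), (VV (2^j) i:ℝ) * (1/2^j) := by
        rw [Finset.sum_comm]
        refine Finset.sum_congr rfl fun q _ => ?_
        rw [Finset.mul_sum]
    _ ≤ ∑ i ∈ Finset.range (2*J), c i * (c1 * ((2*i+4)/2^i)) := by
        refine Finset.sum_le_sum fun i _ => ?_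
        exact mul_le_mul_of_nonneg_left (avg_VV i J) (hc _)
    _ = _ := by
        rw [Finset.mul_sum]
        exact Finset.sum_congr rfl fun q _ => by ring

end

section

lemma sum_inj_le {ι κ : Type*} {s : Finset ι} {t : Finset κ} {f : ι → ℝ} {g : κ → ℝ} (e : ι → κ)
    (hg : ∀ x ∈ t, x ∉ e '' s → 0 ≤ g x) (hm : ∀ x ∈ s, e x ∈ t) (hi : Set.InjOn e s)
    (hle : ∀ x ∈ s, f x ≤ g (e x)) : ∑ x ∈ s, f x ≤ ∑ x ∈ t, g x := by
  classical
  refine (Finset.sum_le_sum hle).trans ?_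
  rw [← Finset.sum_image hi]
  apply Finset.sum_le_sum_of_subset_of_nonneg
  · intro x hx
    obtain ⟨y, hy, rfl⟩ := Finset.mem_image.1 hx
    exact hm y hy
  · intro x hx hx'
    refine hg x hx ?_
    rintro ⟨y, hy, rfl⟩
    exact hx' (Finset.mem_image_of_mem _ hy)

lemma tele (M : ℕ) : ∑ i ∈ Finset.range M, 1/(((i:ℝ)+1)*(i+2)) ≤ 1 := by
  have : ∑ i ∈ Finset.range M, 1/(((i:ℝ)+1)*(i+2)) = 1 - 1/((M:ℝ)+1) := by
    induction M with
    | zero => simp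
    | succ n ih =>
      rw [Finset.sum_range_succ, ih]
      push_cast
      field_simp
      ring
  rw [this]
  have : (0:ℝ) ≤ 1/((M:ℝ)+1) := by positivity
  linarith

lemma lam_term (i : ℕ) : (2:ℝ)^i / 2^(lam i) * ((2*i+4)/2^i) ≤ 32 * (1/(((i:ℝ)+1)*(i+2))) := by
  have h1 : i + 1 < 2^(Nat.log 2 (i+1) + 1) := Nat.lt_pow_succ_log_self (by norm_num) _
  have h2 : ((i:ℝ)+2) / 2 ≤ 2^(Nat.log 2 (i+1)) := by
    have : i + 2 ≤ 2 * 2^(Nat.log 2 (i+1)) := by rw [← pow_succ']; omega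
    have : (i:ℝ) + 2 ≤ 2 * 2^(Nat.log 2 (i+1)) := by exact_mod_cast this
    linarith
  have h3 : (((i:ℝ)+2)/2)^4 ≤ 2^(lam i) := by
    unfold lam
    rw [mul_comm, pow_mul]
    gcongr
  have hi : (0:ℝ) ≤ i := Nat.cast_nonneg i
  calc (2:ℝ)^i / 2^(lam i) * ((2*i+4)/2^i) = (2*i+4) / 2^(lam i) := by field_simp
    _ ≤ (2*i+4) / (((i:ℝ)+2)/2)^4 := by gcongr
    _ ≤ _ := by
      rw [mul_one_div, div_le_div_iff₀ (by positivity) (by positivity)]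
      have : (32:ℝ) * ((i+2)/2)^4 = 2 * (i+2)^4 := by ring
      rw [this]
      have : (2*(i:ℝ)+4) * ((i+1)*(i+2)) = 2 * (i+2)^2 * (i+1) := by ring
      rw [this]
      have : 2 * ((i:ℝ)+2)^4 = 2 * (i+2)^2 * (i+2)^2 := by ring
      rw [this]
      apply mul_le_mul_of_nonneg_left _ (by positivity)
      nlinarith

lemma lam_sum (M : ℕ) : ∑ i ∈ Finset.range M, (2:ℝ)^i / 2^(lam i) * ((2*i+4)/2^i) ≤ 32 := by
  refine (Finset.sum_le_sum fun i _ => lam_term i).trans ?_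
  rw [← Finset.mul_sum]
  have := tele M
  linarith

/-- polynomial weight -/
noncomputable def Pw (s : ℕ) : ℝ := (4*s+5)*(s+2)

lemma lam_le {i s : ℕ} (h : i < 2^(s+1)) : lam i ≤ 4 * (s+1) := by
  unfold lam
  have : Nat.log 2 (i+1) ≤ s+1 := by
    calc Nat.log 2 (i+1) ≤ Nat.log 2 (2^(s+1)) := Nat.log_mono_right (by omega)
      _ = s+1 := Nat.log_pow (by norm_num) _
  omega

lemma harm_le (s : ℕ) : ∑ i ∈ Finset.range (2^(s+1)), 1/((i:ℝ)+1) ≤ s + 2 := by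
  have h := harmonic_le_one_add_log (2^(s+1))
  have h2 : ((harmonic (2^(s+1)) : ℚ) : ℝ) = ∑ i ∈ Finset.range (2^(s+1)), 1/((i:ℝ)+1) := by
    unfold harmonic
    push_cast
    exact Finset.sum_congr rfl fun i _ => by rw [one_div]
  rw [← h2]
  refine h.trans ?_
  push_cast
  rw [Real.log_pow]
  have := Real.log_two_lt_d9
  push_cast
  have : (0:ℝ) ≤ s := Nat.cast_nonneg s
  nlinarith

lemma Tt_sum1 (s : ℕ) : ∑ q ∈ Tt (2^(s+1)), (2:ℝ)^(q.2+1) * (1/(2^q.2*(q.1+1))) ≤ 2 * Pw s := by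
  have h1 : ∀ q ∈ Tt (2^(s+1)), (2:ℝ)^(q.2+1) * (1/(2^q.2*(q.1+1))) = 2 * (1/((q.1:ℝ)+1)) := by
    intro q _
    rw [pow_succ]; field_simp
  rw [Finset.sum_congr rfl h1, ← Finset.mul_sum]
  apply mul_le_mul_of_nonneg_left _ (by norm_num)
  have h2 : ∑ q ∈ Tt (2^(s+1)), 1/((q.1:ℝ)+1) ≤
      ∑ i ∈ Finset.range (2^(s+1)), ∑ h ∈ Finset.Icc (i - lam i) i, 1/((i:ℝ)+1) := by
    rw [Finset.sum_sigma']
    apply sum_inj_le (fun q => (⟨q.1, q.2⟩ : (_ : ℕ) × ℕ))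
    · intro x _ _; positivity
    · intro q hq
      unfold Tt at hq
      simp only [Finset.mem_filter, Finset.mem_product, Finset.mem_range] at hq
      simp only [Finset.mem_sigma, Finset.mem_range, Finset.mem_Icc]
      omega
    · intro a _ b _ hab
      simp only [Sigma.mk.injEq] at hab
      exact Prod.ext hab.1 (eq_of_heq hab.2)
    · intro q _; exact le_rfl
  refine h2.trans ?_
  have h3 : ∀ i ∈ Finset.range (2^(s+1)), ∑ h ∈ Finset.Icc (i - lam i) i, 1/((i:ℝ)+1) ≤ (4*s+5) * (1/((i:ℝ)+1)) := by
    intro i hi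
    rw [Finset.mem_range] at hi
    rw [Finset.sum_const, nsmul_eq_mul]
    apply mul_le_mul_of_nonneg_right _ (by positivity)
    have : (Finset.Icc (i - lam i) i).card ≤ 4*s+5 := by
      have := lam_le hi
      rw [Nat.card_Icc]; omega
    exact_mod_cast this
  refine (Finset.sum_le_sum h3).trans ?_
  rw [← Finset.mul_sum]
  unfold Pw
  apply mul_le_mul_of_nonneg_left (harm_le s) (by positivity)

noncomputable def C1 : ℝ := 36 * c1 + 2 * cN
lemma C1_pos : 0 < C1 := by unfold C1; have := c1_pos; have := cN_pos; positivity

lemma blockA1 (s : ℕ) : ∑ j ∈ Finset.Ico (2^s) (2^(s+1)), A1 j * (1/2^j) ≤ C1 * Pw s := by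
  classical
  have e : 2^(s+1) = 2 * 2^s := by rw [pow_succ']
  have h1 := avg_VV 0 (2^s)
  have h2 := avg_good (fun h => (2:ℝ)^(h+1)) (fun h => by positivity) (2^s)
  have h3 := avg_Vsum (fun i => (2:ℝ)^i / 2^(lam i)) (fun i => by positivity) (2^s)
  have h4 := lam_sum (2 * 2^s)
  have h5 := Tt_sum1 s
  rw [e] at h5 ⊢
  have hs : ∑ j ∈ Finset.Ico (2^s) (2*2^s), A1 j * (1/2^j) =
      ∑ j ∈ Finset.Ico (2^s) (2*2^s), (VV (2^j) 0 : ℝ) * (1/2^j) +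
      ∑ j ∈ Finset.Ico (2^s) (2*2^s), (∑ d ∈ Ds (2^j), (if gd j d then (2:ℝ)^(hgt j d+1) else 0)) * (1/2^j) +
      ∑ j ∈ Finset.Ico (2^s) (2*2^s), (∑ i ∈ Finset.range (j+1), (2:ℝ)^i / 2^(lam i) * VV (2^j) i) * (1/2^j) := by
    rw [← Finset.sum_add_distrib, ← Finset.sum_add_distrib]
    refine Finset.sum_congr rfl fun j _ => ?_
    unfold A1
    ring
  rw [hs]
  have hP : 1 ≤ Pw s := by
    unfold Pw
    have : (0:ℝ) ≤ s := Nat.cast_nonneg s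
    nlinarith
  have hc1 := c1_pos
  have hcN := cN_pos
  have h6 : cN * ∑ q ∈ Tt (2*2^s), (2:ℝ)^(q.2+1) * (1/(2^q.2*(q.1+1))) ≤ cN * (2 * Pw s) :=
    mul_le_mul_of_nonneg_left h5 hcN.le
  have h7 : c1 * ∑ i ∈ Finset.range (2*2^s), (2:ℝ)^i / 2^(lam i) * ((2*i+4)/2^i) ≤ c1 * 32 :=
    mul_le_mul_of_nonneg_left h4 hc1.le
  have h8 : c0 * (cL + 3) * ((2*((0:ℕ):ℝ)+4)/2^0) = 4 * c1 := by unfold c1; push_cast; ring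
  rw [h8] at h1
  unfold C1
  nlinarith

lemma log_lin (n : ℕ) : 8 * Nat.log 2 n ≤ n + 16 := by
  rcases Nat.lt_or_ge n 32 with h | h
  · interval_cases n <;> simp +decide
  · rcases Nat.eq_zero_or_pos n with h0 | h0
    · omega
    have h1 := Nat.pow_log_le_self 2 h0.ne'
    set L := Nat.log 2 n
    have h2 : ∀ L, 8 * L ≤ 2^L + 16 := by
      intro L
      rcases Nat.lt_or_ge L 5 with h | h
      · interval_cases L <;> norm_num
      · induction L, h using Nat.le_induction with
        | base => norm_num
        | succ m hm ih =>
          have : 2^5 ≤ 2^m := Nat.pow_le_pow_right (by norm_num) hm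
          rw [pow_succ]; omega
    have := h2 L
    omega

lemma nu_bound {h i s : ℕ} (hs : h + 1 < 2^(s+1)) (h2 : i ≤ h + lam i) : i ≤ h + 4 * (s + 6) := by
  have h3 : 2 * lam i ≤ i + 17 := by unfold lam; have := log_lin (i+1); omega
  have h4 : i + 1 ≤ 2^(s+6) := by
    have : 2^(s+6) = 32 * 2^(s+1) := by rw [pow_succ, pow_succ, pow_succ, pow_succ, pow_succ]; ring
    have : 2 ≤ 2^(s+1) := by
      calc 2 = 2^1 := by norm_num
        _ ≤ _ := Nat.pow_le_pow_right (by norm_num) (by omega)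
    omega
  have h5 : Nat.log 2 (i+1) ≤ s + 6 := by
    calc Nat.log 2 (i+1) ≤ Nat.log 2 (2^(s+6)) := Nat.log_mono_right h4
      _ = s+6 := Nat.log_pow (by norm_num) _
  unfold lam at h2
  omega

/-- summation weights -/
noncomputable def ww (g : ℕ) : ℝ := (4 * (Nat.log 2 g + 6) + 1) / g

lemma Tt_sum2 (M : ℕ) : ∑ q ∈ Tt M, A1 (q.2+1) * (1/(2^q.2*(q.1+1))) ≤
    ∑ g ∈ Finset.Ico 1 (M+1), 2 * (A1 g * (1/2^g)) * ww g := by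
  have h2 : ∑ q ∈ Tt M, A1 (q.2+1) * (1/(2^q.2*(q.1+1))) ≤
      ∑ h ∈ Finset.range M, ∑ i ∈ Finset.Icc h (h + 4 * (Nat.log 2 (h+1) + 6)), A1 (h+1) * (1/(2^h*(h+1))) := by
    rw [Finset.sum_sigma']
    apply sum_inj_le (fun q => (⟨q.2, q.1⟩ : (_ : ℕ) × ℕ))
    · intro x _ _
      have := A1_nonneg (x.1+1)
      positivity
    · intro q hq
      unfold Tt at hq
      simp only [Finset.mem_filter, Finset.mem_product, Finset.mem_range] at hq
      simp only [Finset.mem_sigma, Finset.mem_range, Finset.mem_Icc]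
      refine ⟨hq.1.2, hq.2.1, ?_⟩
      exact nu_bound (Nat.lt_pow_succ_log_self (by norm_num) _) hq.2.2
    · intro a _ b _ hab
      simp only [Sigma.mk.injEq] at hab
      exact Prod.ext (eq_of_heq hab.2) hab.1
    · intro q hq
      unfold Tt at hq
      rw [Finset.mem_filter] at hq
      simp only
      apply mul_le_mul_of_nonneg_left _ (A1_nonneg _)
      have : (q.2:ℝ) ≤ q.1 := by exact_mod_cast hq.2.1
      gcongr
  refine h2.trans ?_
  rw [Finset.range_eq_Ico, ← Finset.sum_Ico_add' (fun g => 2 * (A1 g * (1/2^g)) * ww g) 0 M 1]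
  refine Finset.sum_le_sum fun h _ => ?_
  rw [Finset.sum_const, nsmul_eq_mul, Nat.card_Icc]
  unfold ww
  have : ((h + 4 * (Nat.log 2 (h+1) + 6) + 1 - h : ℕ):ℝ) = 4 * (Nat.log 2 (h+1) + 6) + 1 := by
    rw [show h + 4 * (Nat.log 2 (h+1) + 6) + 1 - h = 4 * (Nat.log 2 (h+1) + 6) + 1 by omega]
    push_cast; ring
  rw [this]
  apply le_of_eq
  rw [pow_succ]
  push_cast
  field_simp

lemma block_w (R : ℕ) : ∑ g ∈ Finset.Ico 1 (2^R), 2 * (A1 g * (1/2^g)) * ww g ≤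
    ∑ s ∈ Finset.range R, 2 * (C1 * Pw s) * ((4*(s+6)+1)/2^s) := by
  induction R with
  | zero => simp
  | succ R ih =>
    rw [Finset.sum_range_succ, ← Finset.sum_Ico_consecutive _ (Nat.one_le_two_pow (n := R))
      (Nat.pow_le_pow_right (by norm_num) (by omega) : 2^R ≤ 2^(R+1))]
    refine add_le_add ih ?_
    calc _ ≤ ∑ g ∈ Finset.Ico (2^R) (2^(R+1)), 2 * (A1 g * (1/2^g)) * ((4*(R+6)+1)/2^R) := by
          refine Finset.sum_le_sum fun g hg => ?_
          rw [Finset.mem_Ico] at hg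
          have hl : Nat.log 2 g = R := Nat.log_eq_of_pow_le_of_lt_pow hg.1 hg.2
          apply mul_le_mul_of_nonneg_left
          · unfold ww
            rw [hl]
            have : (2:ℝ)^R ≤ g := by exact_mod_cast hg.1
            gcongr
          · have := A1_nonneg g; positivity
      _ = 2 * (∑ g ∈ Finset.Ico (2^R) (2^(R+1)), A1 g * (1/2^g)) * ((4*(R+6)+1)/2^R) := by
          rw [Finset.mul_sum, Finset.sum_mul]
      _ ≤ _ := by
          gcongr
          exact blockA1 R

lemma half_pow (i : ℕ) : (2:ℝ)^((i+1)/2) ≤ 2 * (3/2)^i := by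
  have h : ∀ i, (2:ℝ)^((i+1)/2) ≤ 2 * (3/2)^i ∧ (2:ℝ)^((i+2)/2) ≤ 2 * (3/2)^(i+1) := by
    intro i
    induction i with
    | zero => norm_num
    | succ n ih =>
      refine ⟨ih.2, ?_⟩
      rw [show (n+1+2)/2 = (n+1)/2+1 by omega, pow_succ, pow_succ, pow_succ]
      have := ih.1
      have : (0:ℝ) < (3/2)^n := by positivity
      nlinarith
  exact (h i).1

lemma summ_poly (k : ℕ) {r : ℝ} (h0 : 0 ≤ r) (h1 : r < 1) : Summable (fun n : ℕ => (n:ℝ)^k * r^n) := by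
  apply summable_pow_mul_geometric_of_norm_lt_one
  rwa [Real.norm_of_nonneg h0]

lemma summ1 : Summable (fun s : ℕ => 2 * (C1 * Pw s) * ((4*((s:ℝ)+6)+1)/2^s)) := by
  have h := fun k => summ_poly k (r := 1/2) (by norm_num) (by norm_num)
  have := (((h 3).mul_left (16*2*C1)).add ((h 2).mul_left (152*2*C1))).add
    (((h 1).mul_left (365*2*C1)).add ((h 0).mul_left (250*2*C1)))
  refine this.congr fun s => ?_
  unfold Pw
  rw [one_div, inv_pow]
  field_simp
  ring

lemma B1_bound (i : ℕ) : B1 (i+1) * (1/2^i) ≤ 2 * ((i:ℝ)+2) * (3/4)^i := by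
  unfold B1
  have h := half_pow i
  have e : (3/4:ℝ)^i = (3/2)^i * (1/2^i) := by rw [one_div, ← inv_pow, ← mul_pow]; norm_num
  rw [e]
  push_cast
  have : (0:ℝ) < 1/2^i := by positivity
  calc ((i:ℝ)+1+1) * 2^((i+1)/2) * (1/2^i) ≤ ((i:ℝ)+1+1) * (2 * (3/2)^i) * (1/2^i) := by gcongr
    _ = _ := by ring

lemma summ2 : Summable (fun i : ℕ => B1 (i+1) * ((2*(i:ℝ)+4)/2^i)) := by
  have h := fun k => summ_poly k (r := 3/4) (by norm_num) (by norm_num)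
  have := (((h 2).mul_left 4).add ((h 1).mul_left 16)).add ((h 0).mul_left 16)
  refine Summable.of_nonneg_of_le (fun i => ?_) (fun i => ?_) this
  · have := B1_nonneg (i+1); positivity
  · calc B1 (i+1) * ((2*(i:ℝ)+4)/2^i) = (B1 (i+1) * (1/2^i)) * (2*i+4) := by ring
      _ ≤ (2 * ((i:ℝ)+2) * (3/4)^i) * (2*i+4) := by
        apply mul_le_mul_of_nonneg_right (B1_bound i) (by positivity)
      _ = _ := by ring

lemma summ3 : Summable (fun i : ℕ => B2 i * (1/2^i)) := by
  have h := fun k => summ_poly k (r := 3/4) (by norm_num) (by norm_num)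
  have := (((h 2).mul_left 2).add ((h 1).mul_left 8)).add ((h 0).mul_left 8)
  refine Summable.of_nonneg_of_le (fun i => ?_) (fun i => ?_) this
  · unfold B2; have := B1_nonneg (i+1); have := B1_nonneg i; positivity
  · have h1 := B1_bound i
    have h2 := B1_mono (Nat.le_succ i)
    have h3 : (0:ℝ) < 1/2^i := by positivity
    unfold B2
    calc (B1 i + (i+1) * B1 (i+1)) * (1/2^i) ≤ (B1 (i+1) + (i+1) * B1 (i+1)) * (1/2^i) := by
          apply mul_le_mul_of_nonneg_right _ h3.le
          simp only [Nat.succ_eq_add_one] at h2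
          linarith
      _ = (i+2) * (B1 (i+1) * (1/2^i)) := by ring
      _ ≤ (i+2) * (2 * ((i:ℝ)+2) * (3/4)^i) := by
          apply mul_le_mul_of_nonneg_left h1 (by positivity)
      _ ≤ _ := by
          have : (0:ℝ) ≤ (3/4)^i := by positivity
          nlinarith

lemma blockA2 : ∃ C : ℝ, 0 < C ∧ ∀ s : ℕ, ∑ j ∈ Finset.Ico (2^s) (2^(s+1)), (A2 j + B2 j) * (1/2^j) ≤ C := by
  classical
  set S1 := ∑' s : ℕ, 2 * (C1 * Pw s) * ((4*((s:ℝ)+6)+1)/2^s) with hS1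
  set S2 := ∑' i : ℕ, B1 (i+1) * ((2*(i:ℝ)+4)/2^i) with hS2
  set S3 := ∑' i : ℕ, B2 i * (1/2^i) with hS3
  have hc1 := c1_pos
  have hcN := cN_pos
  have hC1 := C1_pos
  have p1 : ∀ s:ℕ, 0 ≤ 2 * (C1 * Pw s) * ((4*((s:ℝ)+6)+1)/2^s) := fun s => by unfold Pw; positivity
  have p2 : ∀ i:ℕ, 0 ≤ B1 (i+1) * ((2*(i:ℝ)+4)/2^i) := fun i => by have := B1_nonneg (i+1); positivity
  have p3 : ∀ i:ℕ, 0 ≤ B2 i * (1/2^i) := fun i => by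
    unfold B2; have := B1_nonneg (i+1); have := B1_nonneg i; positivity
  have hS1p : 0 ≤ S1 := tsum_nonneg p1
  have hS2p : 0 ≤ S2 := tsum_nonneg p2
  have hS3p : 0 ≤ S3 := tsum_nonneg p3
  refine ⟨4 * c1 + cN * S1 + c1 * (32 + S2) + S3, by positivity, fun s => ?_⟩
  have e : 2^(s+1) = 2 * 2^s := by rw [pow_succ']
  have h1 := avg_VV 0 (2^s)
  have h2 := avg_good (fun h => A1 (h+1)) (fun h => A1_nonneg _) (2^s)
  have h3 := avg_Vsum (fun i => (2:ℝ)^i / 2^(lam i) + B1 (i+1)) (fun i => by have := B1_nonneg (i+1); positivity) (2^s)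
  have h4 := lam_sum (2 * 2^s)
  have h5 : ∑ q ∈ Tt (2*2^s), A1 (q.2+1) * (1/(2^q.2*(q.1+1))) ≤ S1 := by
    refine (Tt_sum2 _).trans ?_
    refine le_trans ?_ ((block_w (s+2)).trans (summ1.sum_le_tsum _ (fun i _ => p1 i)))
    apply Finset.sum_le_sum_of_subset_of_nonneg
    · apply Finset.Ico_subset_Ico le_rfl
      have : 1 ≤ 2^s := Nat.one_le_two_pow
      rw [pow_succ, pow_succ]; omega
    · intro g _ _
      unfold ww
      have := A1_nonneg g; positivity
  have h6 : ∑ i ∈ Finset.range (2*2^s), ((2:ℝ)^i / 2^(lam i) + B1 (i+1)) * ((2*i+4)/2^i) ≤ 32 + S2 := by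
    simp only [add_mul _ _ ((2*(_:ℝ)+4)/2^_)]
    rw [Finset.sum_add_distrib]
    exact add_le_add h4 (summ2.sum_le_tsum _ (fun i _ => p2 i))
  have h7 : ∑ j ∈ Finset.Ico (2^s) (2*2^s), B2 j * (1/2^j) ≤ S3 := summ3.sum_le_tsum _ (fun i _ => p3 i)
  rw [e]
  have hs : ∑ j ∈ Finset.Ico (2^s) (2*2^s), (A2 j + B2 j) * (1/2^j) =
      ∑ j ∈ Finset.Ico (2^s) (2*2^s), (VV (2^j) 0 : ℝ) * (1/2^j) +
      ∑ j ∈ Finset.Ico (2^s) (2*2^s), (∑ d ∈ Ds (2^j), (if gd j d then A1 (hgt j d+1) else 0)) * (1/2^j) +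
      ∑ j ∈ Finset.Ico (2^s) (2*2^s), (∑ i ∈ Finset.range (j+1), ((2:ℝ)^i / 2^(lam i) + B1 (i+1)) * VV (2^j) i) * (1/2^j) +
      ∑ j ∈ Finset.Ico (2^s) (2*2^s), B2 j * (1/2^j) := by
    rw [← Finset.sum_add_distrib, ← Finset.sum_add_distrib, ← Finset.sum_add_distrib]
    refine Finset.sum_congr rfl fun j _ => ?_
    unfold A2
    ring
  rw [hs]
  have h8 : c0 * (cL + 3) * ((2*((0:ℕ):ℝ)+4)/2^0) = 4 * c1 := by unfold c1; push_cast; ring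
  rw [h8] at h1
  have h9 := mul_le_mul_of_nonneg_left h5 hcN.le
  have h10 := mul_le_mul_of_nonneg_left h6 hc1.le
  linarith

/-- main conclusion for (U) -/
theorem upper_U : ∃ C : ℝ, ∀ s : ℕ, ∃ j : ℕ, j ∈ Finset.Ico (2^s) (2^(s+1)) ∧ ∀ l : List ℕ, l.Nodup →
    (∀ n ∈ l, 0 < n ∧ n ≤ 2^j) → l.IsChain DAdj → (l.length:ℝ) * j ≤ C * 2^j := by
  obtain ⟨C, hC, h⟩ := blockA2
  refine ⟨2 * C, fun s => ?_⟩
  by_contra hcon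
  push Not at hcon
  have : ∀ j ∈ Finset.Ico (2^s) (2^(s+1)), C / 2^s < (A2 j + B2 j) * (1/2^j) := by
    intro j hj
    obtain ⟨l, h1, h2, h3, h4⟩ := hcon j hj
    have h5 := lin2 j l h1 h2
    have h6 : (pc l:ℝ) ≤ 1 := by exact_mod_cast pc_chain h3
    have hB : 0 ≤ B2 j := by unfold B2; have := B1_nonneg (j+1); have := B1_nonneg j; positivity
    have h7 : (l.length:ℝ) ≤ A2 j + B2 j := by nlinarith
    rw [Finset.mem_Ico] at hj
    have hj2 : (j:ℝ) ≤ 2 * 2^s := by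
      have : j ≤ 2 * 2^s := by rw [← pow_succ']; exact hj.2.le
      exact_mod_cast this
    have hs0 : (0:ℝ) < 2^s := by positivity
    have hj0 : (0:ℝ) < 2^j := by positivity
    have h8 : 2 * C * 2^j < (A2 j + B2 j) * (2 * 2^s) := by
      refine h4.trans_le ?_
      apply mul_le_mul h7 hj2 (Nat.cast_nonneg _) (le_trans (Nat.cast_nonneg _) h7)
    rw [mul_one_div, div_lt_div_iff₀ hs0 hj0]
    linarith
  have h2 := Finset.sum_lt_sum_of_nonempty (Finset.nonempty_Ico.2
    (Nat.pow_lt_pow_right (by norm_num) (Nat.lt_succ_self s) : 2^s < 2^(s+1))) this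
  rw [Finset.sum_const, Nat.card_Ico, nsmul_eq_mul] at h2
  have h3 : ((2^(s+1) - 2^s : ℕ):ℝ) = 2^s := by
    rw [show 2^(s+1) - 2^s = 2^s by rw [pow_succ]; omega]
    push_cast; rfl
  rw [h3, mul_div_cancel₀ _ (by positivity)] at h2
  have := h s
  linarith

end

section
open MeasureTheory intervalIntegral Set

noncomputable def gN : ℕ → ℝ → ℝ
  | 0 => fun _ => 1
  | (n+1) => fun v => 1 + ∫ τ in (1:ℝ)..(max 1 v), gN n (τ - 1) / max 1 τ

lemma gN_cont (n : ℕ) : Continuous (gN n) := by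
  induction n with
  | zero => exact continuous_const
  | succ n ih =>
    have hc : Continuous (fun τ : ℝ => gN n (τ - 1) / max 1 τ) := by
      apply Continuous.div
      · exact ih.comp (by fun_prop)
      · fun_prop
      · intro x
        have : (1:ℝ) ≤ max 1 x := le_max_left _ _
        linarith
    have h2 : Continuous (fun v : ℝ => ∫ τ in (1:ℝ)..v, gN n (τ - 1) / max 1 τ) :=
      intervalIntegral.continuous_primitive (fun a b => hc.intervalIntegrable a b) 1
    have : gN (n+1) = fun v => 1 + (fun v : ℝ => ∫ τ in (1:ℝ)..v, gN n (τ - 1) / max 1 τ) (max 1 v) := by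
      funext v; rfl
    rw [this]
    exact continuous_const.add (h2.comp (by fun_prop))

lemma gN_int_cont (n : ℕ) : Continuous (fun τ : ℝ => gN n (τ - 1) / max 1 τ) := by
  apply Continuous.div
  · exact (gN_cont n).comp (by fun_prop)
  · fun_prop
  · intro x
    have : (1:ℝ) ≤ max 1 x := le_max_left _ _
    linarith

lemma gN_stab (n : ℕ) : ∀ v : ℝ, v ≤ n + 1 → gN (n+1) v = gN n v := by
  induction n with
  | zero =>
    intro v hv
    have : max 1 v = 1 := max_eq_left (by simpa using hv)
    simp [gN, this]
  | succ n ih =>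
    intro v hv
    show 1 + _ = 1 + _
    congr 1
    apply intervalIntegral.integral_congr
    intro τ hτ
    rw [uIcc_of_le (le_max_left _ _)] at hτ
    have h1 : τ - 1 ≤ n + 1 := by
      have := hτ.2
      have h3 : max 1 v ≤ (n:ℝ) + 2 := max_le (by have : (0:ℝ) ≤ n := Nat.cast_nonneg n
                                                  linarith) (by push_cast at hv; linarith)
      linarith
    simp only
    rw [ih _ h1]

lemma gN_stab' (n m : ℕ) (hnm : n ≤ m) (v : ℝ) (hv : v ≤ n + 1) : gN m v = gN n v := by
  induction m, hnm using Nat.le_induction with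
  | base => rfl
  | succ m hm ih =>
    rw [gN_stab m v, ih]
    have : (n:ℝ) ≤ m := by exact_mod_cast hm
    linarith

noncomputable def gg (v : ℝ) : ℝ := gN ⌈v⌉₊ v

lemma gg_eqN (n : ℕ) (v : ℝ) (hv : v ≤ n + 1) : gg v = gN n v := by
  unfold gg
  rcases le_total n ⌈v⌉₊ with h | h
  · exact gN_stab' _ _ h v hv
  · symm
    apply gN_stab' _ _ h
    have := Nat.le_ceil v
    linarith

lemma gg_cont : Continuous gg := by
  rw [continuous_iff_continuousAt]
  intro v
  obtain ⟨n, hn⟩ := exists_nat_gt v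
  have : gg =ᶠ[nhds v] gN n := by
    filter_upwards [Iio_mem_nhds hn] with w hw
    apply gg_eqN
    have : w < n := hw
    linarith
  exact (gN_cont n).continuousAt.congr this.symm

lemma gg_int_cont : Continuous (fun τ : ℝ => gg (τ - 1) / max 1 τ) := by
  apply Continuous.div
  · exact gg_cont.comp (by fun_prop)
  · fun_prop
  · intro x
    have : (1:ℝ) ≤ max 1 x := le_max_left _ _
    linarith

lemma gg_eq (v : ℝ) : gg v = 1 + ∫ τ in (1:ℝ)..(max 1 v), gg (τ - 1) / max 1 τ := by
  obtain ⟨n, hn⟩ := exists_nat_gt v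
  rw [gg_eqN (n+1) v (by push_cast; linarith)]
  show 1 + _ = 1 + _
  congr 1
  apply intervalIntegral.integral_congr
  intro τ hτ
  rw [uIcc_of_le (le_max_left _ _)] at hτ
  simp only
  rw [gg_eqN n]
  have h3 : max 1 v ≤ (n:ℝ) + 1 := max_le (by have : (0:ℝ) ≤ n := Nat.cast_nonneg n
                                              linarith) (by linarith)
  have := hτ.2
  linarith

lemma gg_one (v : ℝ) (hv : v ≤ 1) : gg v = 1 := by
  rw [gg_eqN 0 v (by simpa using hv)]; rfl

lemma gg_eq' (v : ℝ) (hv : 1 ≤ v) : gg v = 1 + ∫ τ in (1:ℝ)..v, gg (τ - 1) / max 1 τ := by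
  rw [gg_eq, max_eq_right hv]

lemma gg_deriv (v : ℝ) (hv : 1 < v) : HasDerivAt gg (gg (v - 1) / v) v := by
  have h := (intervalIntegral.integral_hasDerivAt_right (gg_int_cont.intervalIntegrable 1 v)
    (gg_int_cont.stronglyMeasurableAtFilter _ _) gg_int_cont.continuousAt).const_add 1
  rw [max_eq_right hv.le] at h
  apply h.congr_of_eventuallyEq
  filter_upwards [Ioi_mem_nhds hv] with w hw
  exact gg_eq' w (le_of_lt hw)

lemma gN_ge (n : ℕ) : ∀ v, 1 ≤ gN n v := by
  induction n with
  | zero => intro v; exact le_refl _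
  | succ n ih =>
    intro v
    have : 0 ≤ ∫ τ in (1:ℝ)..(max 1 v), gN n (τ - 1) / max 1 τ := by
      apply intervalIntegral.integral_nonneg (le_max_left _ _)
      intro τ hτ
      have := ih (τ - 1)
      positivity
    show 1 ≤ 1 + _
    linarith

lemma gg_ge (v : ℝ) : 1 ≤ gg v := gN_ge _ v

lemma gN_le (n : ℕ) : ∀ v, 0 ≤ v → gN n v ≤ v + 1 := by
  induction n with
  | zero => intro v hv; show (1:ℝ) ≤ v + 1; linarith
  | succ n ih =>
    intro v hv
    have : ∫ τ in (1:ℝ)..(max 1 v), gN n (τ - 1) / max 1 τ ≤ ∫ τ in (1:ℝ)..(max 1 v), (1:ℝ) := by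
      apply intervalIntegral.integral_mono_on (le_max_left _ _)
        ((gN_int_cont n).intervalIntegrable _ _) (by simp)
      intro τ hτ
      have := ih (τ - 1) (by linarith [hτ.1])
      rw [max_eq_right hτ.1, div_le_one (by linarith [hτ.1])]
      linarith
    simp at this
    show 1 + _ ≤ _
    rcases le_total 1 v with h | h
    · rw [max_eq_right h] at this ⊢; linarith
    · rw [max_eq_left h] at this ⊢; linarith

lemma gg_le (v : ℝ) (hv : 0 ≤ v) : gg v ≤ v + 1 := gN_le _ v hv

lemma gg_ident (v : ℝ) (hv : 1 ≤ v) :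
    v * gg v = (∫ τ in (0:ℝ)..v, gg τ) + ∫ τ in (0:ℝ)..(v-1), gg τ := by
  have h1 : ∫ τ in (1:ℝ)..v, (gg τ + gg (τ - 1)) = v * gg v - 1 * gg 1 := by
    apply intervalIntegral.integral_eq_sub_of_hasDerivAt_of_le hv (f := fun τ => τ * gg τ)
    · exact (continuous_id.mul gg_cont).continuousOn
    · intro x hx
      have := (hasDerivAt_id x).mul (gg_deriv x hx.1)
      have hx0 : x ≠ 0 := by linarith [hx.1]
      have e : gg x + gg (x - 1) = 1 * gg x + id x * (gg (x - 1) / x) := by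
        simp only [id]; field_simp
      rw [e]; exact this
    · exact (gg_cont.add (gg_cont.comp (by fun_prop))).intervalIntegrable _ _
  have hc1 : Continuous (fun τ : ℝ => gg (τ - 1)) := gg_cont.comp (by fun_prop)
  rw [intervalIntegral.integral_add (gg_cont.intervalIntegrable _ _)
    (hc1.intervalIntegrable _ _)] at h1
  rw [intervalIntegral.integral_comp_sub_right (fun τ => gg τ)] at h1
  have h2 : ∫ τ in (0:ℝ)..1, gg τ = 1 := by
    rw [intervalIntegral.integral_congr (g := fun _ => (1:ℝ))]
    · simp
    · intro τ hτ
      rw [uIcc_of_le zero_le_one] at hτ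
      exact gg_one τ hτ.2
  have h3 := intervalIntegral.integral_add_adjacent_intervals (gg_cont.intervalIntegrable (μ := volume) 0 1)
    (gg_cont.intervalIntegrable (μ := volume) 1 v)
  rw [gg_one 1 le_rfl] at h1
  norm_num at h1
  linarith

lemma gg_mono {a b : ℝ} (hab : a ≤ b) : gg a ≤ gg b := by
  rw [gg_eq a, gg_eq b]
  have h1 : max 1 a ≤ max 1 b := max_le_max le_rfl hab
  have h3 := intervalIntegral.integral_add_adjacent_intervals
    (gg_int_cont.intervalIntegrable (μ := volume) 1 (max 1 a))
    (gg_int_cont.intervalIntegrable (μ := volume) (max 1 a) (max 1 b))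
  have : 0 ≤ ∫ τ in (max 1 a)..(max 1 b), gg (τ - 1) / max 1 τ := by
    apply intervalIntegral.integral_nonneg h1
    intro τ hτ
    have := gg_ge (τ - 1)
    positivity
  linarith

end

section
open MeasureTheory intervalIntegral Set

noncomputable def om (u : ℝ) : ℝ := gg (u - 1) / u
noncomputable def kk (u : ℝ) : ℝ := if u < 2 then 1 / u else om u - om (u - 1)

lemma om_nonneg (u : ℝ) (hu : 1 ≤ u) : 0 ≤ om u := by
  have := gg_ge (u - 1)
  unfold om; positivity

lemma om_le (u : ℝ) (hu : 1 ≤ u) : om u ≤ 1 := by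
  unfold om
  rw [div_le_one (by linarith)]
  have := gg_le (u - 1) (by linarith)
  linarith

lemma om_lt2 (u : ℝ) (hu : u ≤ 2) : om u = 1 / u := by
  unfold om; rw [gg_one _ (by linarith)]

lemma om_meas : Measurable om := by
  unfold om
  exact (gg_cont.comp (by fun_prop : Continuous fun τ : ℝ => τ - 1)).measurable.div measurable_id

lemma om_contOn : ContinuousOn om (Ioi 0) := by
  unfold om
  apply ContinuousOn.div
  · exact (gg_cont.comp (by fun_prop : Continuous fun τ : ℝ => τ - 1)).continuousOn
  · exact continuousOn_id
  · intro x hx; exact ne_of_gt hx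

lemma kk_meas : Measurable kk := by
  unfold kk
  apply Measurable.ite measurableSet_Iio
  · exact measurable_const.div measurable_id
  · exact om_meas.sub (om_meas.comp (measurable_id.sub_const 1))

lemma kk_abs_le (u : ℝ) (hu : 1 ≤ u) : |kk u| ≤ 1 := by
  unfold kk
  split_ifs with h
  · rw [abs_of_nonneg (by positivity), div_le_one (by linarith)]; exact hu
  · have h1 := om_nonneg u hu
    have h2 := om_le u hu
    have h3 := om_nonneg (u-1) (by linarith)
    have h4 := om_le (u-1) (by linarith)
    rw [abs_le]; constructor <;> linarith

lemma om_deriv (u : ℝ) (hu : 1 < u) (hu2 : u ≠ 2) : HasDerivAt om (-(kk u / u)) u := by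
  rcases lt_or_gt_of_ne hu2 with h | h
  · have h1 : HasDerivAt (fun u : ℝ => u⁻¹) (-(u ^ 2)⁻¹) u := hasDerivAt_inv (by linarith)
    have h2 : -(kk u / u) = -(u ^ 2)⁻¹ := by
      unfold kk; rw [if_pos h]; field_simp
    rw [h2]
    apply h1.congr_of_eventuallyEq
    filter_upwards [Iio_mem_nhds h] with w hw
    rw [om_lt2 w (le_of_lt hw), one_div]
  · have h0 : HasDerivAt (fun u : ℝ => gg (u - 1)) (gg (u - 1 - 1) / (u - 1)) u := by
      have := (gg_deriv (u-1) (by linarith)).comp_sub_const u 1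
      exact this
    have h1 := h0.div (hasDerivAt_id u) (by simp only [id]; linarith)
    have h2 : -(kk u / u) = (gg (u - 1 - 1) / (u - 1) * id u - gg (u - 1) * 1) / id u ^ 2 := by
      unfold kk; rw [if_neg (by linarith)]
      unfold om
      have : u - 1 ≠ 0 := by linarith
      have : u ≠ 0 := by linarith
      simp only [id]
      field_simp
      ring
    rw [h2]
    exact h1

lemma kk_ii (f : ℝ → ℝ) (hf : ContinuousOn f (Ici 1)) {a b : ℝ} (ha : 1 ≤ a) (hb : 1 ≤ b) :
    IntervalIntegrable (fun τ => kk τ * f τ) volume a b := by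
  have h1 : IntervalIntegrable f volume a b := by
    apply ContinuousOn.intervalIntegrable
    apply hf.mono
    intro x hx
    have := hx.1
    exact le_trans (le_min ha hb) this
  rw [intervalIntegrable_iff] at h1 ⊢
  have := h1.bdd_mul (c := 1) (f := kk) kk_meas.aestronglyMeasurable (by
    refine (ae_restrict_iff' measurableSet_uIoc).mpr (Filter.Eventually.of_forall ?_)
    intro x hx
    have := hx.1
    exact kk_abs_le x (le_trans (le_min ha hb) this.le))
  exact this

lemma inv_contOn : ContinuousOn (fun τ : ℝ => τ⁻¹) (Ici 1) :=
  ContinuousOn.inv₀ continuousOn_id (fun x hx => by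
    have : (1:ℝ) ≤ x := hx
    linarith)

lemma kkd_ii {a b : ℝ} (ha : 1 ≤ a) (hb : 1 ≤ b) :
    IntervalIntegrable (fun τ => kk τ / τ) volume a b := kk_ii _ inv_contOn ha hb

lemma kk_ii1 {a b : ℝ} (ha : 1 ≤ a) (hb : 1 ≤ b) :
    IntervalIntegrable kk volume a b := by
  have := kk_ii (fun _ => 1) continuousOn_const ha hb
  simpa using this

lemma om_int {a b : ℝ} (ha : 1 ≤ a) (hab : a ≤ b) :
    om a - om b = ∫ τ in a..b, kk τ / τ := by
  have := MeasureTheory.integral_eq_of_hasDerivAt_off_countable om (fun τ => -(kk τ / τ))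
    (a := a) (b := b) (countable_singleton (2:ℝ)) (by
      rw [uIcc_of_le hab]
      apply om_contOn.mono
      intro x hx
      have := hx.1
      exact lt_of_lt_of_le one_pos (ha.trans this)) (by
      intro x hx
      rw [min_eq_left hab, max_eq_right hab] at hx
      exact om_deriv x (lt_of_le_of_lt ha hx.1.1) (by simpa using hx.2)) (kkd_ii ha (ha.trans hab)).neg
  rw [intervalIntegral.integral_neg] at this
  linarith

lemma kk_rec (u : ℝ) (hu : 2 ≤ u) : kk u = -∫ τ in (u-1)..u, kk τ / τ := by
  rw [← om_int (by linarith) (by linarith)]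
  unfold kk; rw [if_neg (by linarith)]; ring


lemma kk_fact (n : ℕ) (hn : 1 ≤ n) : ∀ u : ℝ, (n + 1 : ℝ) ≤ u → |kk u| ≤ 1 / (n.factorial : ℝ) := by
  induction n, hn using Nat.le_induction with
  | base =>
    intro u hu
    simpa using kk_abs_le u (by norm_num at hu; linarith)
  | succ n hn ih =>
    intro u hu
    push_cast at hu
    have hn1 : (1:ℝ) ≤ n := by exact_mod_cast hn
    rw [kk_rec u (by linarith), abs_neg]
    have := intervalIntegral.norm_integral_le_of_norm_le_const (a := u - 1) (b := u)
      (f := fun τ => kk τ / τ) (C := 1 / ((n+1).factorial : ℝ)) (by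
        intro τ hτ
        rw [uIoc_of_le (by linarith)] at hτ
        have h1 := ih τ (by linarith [hτ.1])
        have hτ1 : (n:ℝ) + 1 ≤ τ := by linarith [hτ.1]
        rw [Real.norm_eq_abs, abs_div, abs_of_pos (by linarith : (0:ℝ) < τ), Nat.factorial_succ]
        push_cast
        rw [div_le_div_iff₀ (by linarith) (by positivity)]
        rw [le_div_iff₀ (by positivity)] at h1
        nlinarith)
    rw [show u - (u - 1) = 1 by ring, abs_one, mul_one] at this
    exact this

lemma fact_ge (n : ℕ) (hn : 1 ≤ n) : (n + 2) ^ 4 ≤ 625 * n.factorial := by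
  rcases Nat.lt_or_ge n 3 with h | h
  · interval_cases n <;> decide
  · induction n, h using Nat.le_induction with
    | base => decide
    | succ n hn ih =>
      have ih := ih (by omega)
      rw [Nat.factorial_succ]
      have h1 : (n + 1 + 2) ^ 4 ≤ (n + 1) * (n+2)^4 := by
        have h2 : (n+3)^2 ≤ 2 * (n+2)^2 := by nlinarith
        calc (n+1+2)^4 = ((n+3)^2)^2 := by ring
          _ ≤ (2*(n+2)^2)^2 := Nat.pow_le_pow_left h2 2
          _ = 4 * (n+2)^4 := by ring
          _ ≤ (n+1)*(n+2)^4 := Nat.mul_le_mul_right _ (by omega)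
      calc _ ≤ _ := h1
        _ ≤ (n+1) * (625 * n.factorial) := Nat.mul_le_mul_left _ ih
        _ = _ := by ring

lemma kk_decay (u : ℝ) (hu : 1 ≤ u) : |kk u| ≤ 625 / u ^ 4 := by
  rcases lt_or_ge u 2 with h | h
  · apply (kk_abs_le u hu).trans
    rw [le_div_iff₀ (by positivity)]
    have : u ^ 4 ≤ 2 ^ 4 := by gcongr
    norm_num at this; linarith
  · obtain ⟨n, hn⟩ : ∃ n : ℕ, n + 1 = ⌊u⌋₊ := ⟨⌊u⌋₊ - 1, by
      have : 1 ≤ ⌊u⌋₊ := by rw [Nat.one_le_floor_iff]; linarith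
      omega⟩
    have hn1 : 1 ≤ n := by
      have : 2 ≤ ⌊u⌋₊ := Nat.le_floor (by simpa using h)
      omega
    have h1 : (n:ℝ) + 1 ≤ u := by
      have := Nat.floor_le (by linarith : 0 ≤ u)
      rw [← hn] at this; push_cast at this; exact this
    have h2 : u ≤ n + 2 := by
      have := Nat.lt_floor_add_one u
      rw [← hn] at this; push_cast at this; linarith
    apply (kk_fact n hn1 u h1).trans
    rw [div_le_div_iff₀ (by positivity) (by positivity)]
    have h3 : ((n:ℝ) + 2) ^ 4 ≤ 625 * n.factorial := by exact_mod_cast fact_ge n hn1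
    have h4 : u ^ 4 ≤ ((n:ℝ) + 2)^4 := by gcongr
    linarith

lemma om_diff {a b : ℝ} (ha : 1 ≤ a) (hab : a ≤ b) : |om a - om b| ≤ 625 / a ^ 4 := by
  rw [om_int ha hab]
  have h1 : |∫ τ in a..b, kk τ / τ| ≤ ∫ τ in a..b, 625 / a^3 * (τ ^ 2)⁻¹ := by
    rw [← Real.norm_eq_abs]
    apply intervalIntegral.norm_integral_le_of_norm_le hab
    · refine Filter.Eventually.of_forall ?_
      intro τ hτ
      have hτ1 : a < τ := hτ.1
      have hτ0 : 0 < τ := by linarith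
      rw [Real.norm_eq_abs, abs_div, abs_of_pos (by linarith : (0:ℝ) < τ)]
      have h2 := kk_decay τ (by linarith)
      calc |kk τ| / τ ≤ (625 / τ^4) / τ := by gcongr
        _ = 625 / τ^3 * (τ^2)⁻¹ := by field_simp
        _ ≤ _ := by gcongr
    · apply ContinuousOn.intervalIntegrable
      apply ContinuousOn.mul continuousOn_const
      apply ContinuousOn.inv₀ (by fun_prop)
      intro x hx
      rw [uIcc_of_le hab] at hx
      have := hx.1
      have : 0 < x := by linarith
      positivity
  apply h1.trans
  have h2 : ∫ τ in a..b, (τ ^ 2)⁻¹ = a⁻¹ - b⁻¹ := by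
    have := intervalIntegral.integral_eq_sub_of_hasDerivAt (f := fun τ : ℝ => -τ⁻¹)
      (f' := fun τ => (τ^2)⁻¹) (a := a) (b := b) (by
        intro x hx
        rw [uIcc_of_le hab] at hx
        have := (hasDerivAt_inv (by linarith [hx.1] : x ≠ 0)).neg
        rw [neg_neg] at this
        exact this) (by
        apply ContinuousOn.intervalIntegrable
        apply ContinuousOn.inv₀ (by fun_prop)
        intro x hx
        rw [uIcc_of_le hab] at hx
        have := hx.1
        have : 0 < x := by linarith
        positivity)
    rw [this]; ring
  rw [intervalIntegral.integral_const_mul, h2]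
  have hb : 0 ≤ b⁻¹ := by rw [inv_nonneg]; linarith
  have : 625 / a^4 = 625 / a^3 * a⁻¹ := by field_simp
  rw [this]
  gcongr
  linarith

lemma om_lim : ∃ C : ℝ, ∀ a, 1 ≤ a → |om a - C| ≤ 625 / a ^ 4 := by
  have hc : CauchySeq (fun n : ℕ => om ((n:ℝ) + 1)) := by
    apply cauchySeq_of_le_tendsto_0' (fun n : ℕ => 625 / ((n:ℝ)+1)^4)
    · intro n m hnm
      have hn : (n:ℝ) ≤ m := by exact_mod_cast hnm
      rw [Real.dist_eq]
      exact om_diff (by have : (0:ℝ) ≤ n := Nat.cast_nonneg n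
                        linarith) (by linarith)
    · have h1 := tendsto_one_div_add_atTop_nhds_zero_nat (𝕜 := ℝ)
      have h2 := (h1.pow 4).const_mul 625
      have e : (fun n : ℕ => 625 / ((n:ℝ)+1)^4) = fun n : ℕ => 625 * (1 / ((n:ℝ)+1))^4 := by
        funext n; field_simp
      rw [e]; simpa using h2
  obtain ⟨C, hC⟩ := cauchySeq_tendsto_of_complete hc
  refine ⟨C, fun a ha => ?_⟩
  have h1 : Filter.Tendsto (fun n : ℕ => |om a - om ((n:ℝ)+1)|) Filter.atTop (nhds |om a - C|) :=
    (hC.const_sub _).abs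
  apply le_of_tendsto h1
  obtain ⟨N, hN⟩ := exists_nat_gt a
  filter_upwards [Filter.eventually_ge_atTop N] with n hn
  have : (N:ℝ) ≤ n := by exact_mod_cast hn
  exact om_diff ha (by linarith)

noncomputable def CC : ℝ := om_lim.choose
lemma CC_spec (a : ℝ) (ha : 1 ≤ a) : |om a - CC| ≤ 625 / a ^ 4 := om_lim.choose_spec a ha

end

section
open MeasureTheory intervalIntegral Set

lemma gg_log (v : ℝ) (h1 : 1 ≤ v) (h2 : v ≤ 2) : gg v = 1 + Real.log v := by
  rw [gg_eq' v h1]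
  congr 1
  rw [intervalIntegral.integral_congr (g := fun τ => τ⁻¹)]
  · rw [integral_inv_of_pos one_pos (by linarith), div_one]
  · intro τ hτ
    rw [uIcc_of_le h1] at hτ
    simp only
    rw [gg_one _ (by linarith [hτ.2]), max_eq_right hτ.1, one_div]

lemma kk_23 (u : ℝ) (h1 : 2 ≤ u) (h2 : u ≤ 3) :
    kk u = (1 + Real.log (u-1)) / u - 1 / (u-1) := by
  unfold kk
  rw [if_neg (by linarith), om_lt2 (u-1) (by linarith)]
  unfold om
  rw [gg_log _ (by linarith) (by linarith)]

lemma kk_up (u : ℝ) (h1 : 2 ≤ u) (h2 : u ≤ 3) : kk u ≤ 0.0652 := by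
  rw [kk_23 u h1 h2]
  have hl : Real.log (u-1) ≤ 0.6932 := by
    have := Real.log_le_log (by linarith : 0 < u - 1) (by linarith : u - 1 ≤ 2)
    have := Real.log_two_lt_d9
    linarith
  have hx : 0 < u - 1 := by linarith
  calc (1 + Real.log (u-1)) / u - 1 / (u-1) ≤ 1.6932 / u - 1 / (u-1) := by
        gcongr; linarith
    _ ≤ 0.0652 := by
        rw [div_sub_div _ _ (by linarith) (by linarith), div_le_iff₀ (by positivity)]
        nlinarith

lemma kk_low (u c : ℝ) (h1 : 2 ≤ u) (h2 : u ≤ 3)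
    (h : -2*(u-1)^2 + 3*(u-1) + 1 ≤ c * ((u-1)*u^2)) : -c ≤ kk u := by
  rw [kk_23 u h1 h2]
  have hl := Real.le_log_one_add_of_nonneg (x := u - 2) (by linarith)
  rw [show 1 + (u - 2) = u - 1 by ring, show u - 2 + 2 = u by ring] at hl
  have hx : 0 < u - 1 := by linarith
  calc -c ≤ (1 + 2*(u-2)/u)/u - 1/(u-1) := by
        have : (1 + 2*(u-2)/u)/u - 1/(u-1) = -(-2*(u-1)^2 + 3*(u-1) + 1) / ((u-1)*u^2) := by
          field_simp; ring
        rw [this, le_div_iff₀ (by positivity)]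
        linarith
    _ ≤ _ := by gcongr

lemma kk_q1 (u : ℝ) (h1 : 2 ≤ u) (h2 : u ≤ 2.25) : |kk u| ≤ 0.5 := by
  rw [abs_le]
  exact ⟨kk_low u 0.5 h1 (by linarith) (by nlinarith [mul_nonneg (sub_nonneg.2 h1) (sub_nonneg.2 h1)]), by linarith [kk_up u h1 (by linarith)]⟩

lemma kk_q2 (u : ℝ) (h1 : 2.25 ≤ u) (h2 : u ≤ 2.5) : |kk u| ≤ 0.257 := by
  rw [abs_le]
  exact ⟨kk_low u 0.257 (by linarith) (by linarith) (by nlinarith [mul_nonneg (sub_nonneg.2 h1) (sub_nonneg.2 h1)]), by linarith [kk_up u (by linarith) (by linarith)]⟩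

lemma kk_q3 (u : ℝ) (h1 : 2.5 ≤ u) (h2 : u ≤ 2.75) : |kk u| ≤ 0.107 := by
  rw [abs_le]
  exact ⟨kk_low u 0.107 (by linarith) (by linarith) (by nlinarith [mul_nonneg (sub_nonneg.2 h1) (sub_nonneg.2 h1)]), by linarith [kk_up u (by linarith) (by linarith)]⟩

lemma kk_q4 (u : ℝ) (h1 : 2.75 ≤ u) (h2 : u ≤ 3) : |kk u| ≤ 0.0652 := by
  rw [abs_le]
  exact ⟨kk_low u 0.0652 (by linarith) (by linarith) (by nlinarith [mul_nonneg (sub_nonneg.2 h1) (sub_nonneg.2 h1)]), kk_up u (by linarith) (by linarith)⟩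

lemma ak_ii {a b : ℝ} (ha : 1 ≤ a) (hb : 1 ≤ b) :
    IntervalIntegrable (fun τ => |kk τ|) volume a b := (kk_ii1 ha hb).abs

lemma akd_ii {a b : ℝ} (ha : 1 ≤ a) (hb : 1 ≤ b) :
    IntervalIntegrable (fun τ => |kk τ / τ|) volume a b := (kkd_ii ha hb).abs

lemma int_le_c {f : ℝ → ℝ} {a b c : ℝ} (hab : a ≤ b) (hf : IntervalIntegrable f volume a b)
    (h : ∀ x, a ≤ x → x ≤ b → f x ≤ c) : ∫ x in a..b, f x ≤ c * (b - a) := by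
  have := intervalIntegral.integral_mono_on hab hf (intervalIntegrable_const (c := c))
    (fun x hx => h x hx.1 hx.2)
  simpa [mul_comm] using this

lemma ak23 : ∫ τ in (2:ℝ)..3, |kk τ| ≤ 0.2324 := by
  have e1 := integral_add_adjacent_intervals (ak_ii (a := 2) (b := 2.25) (by norm_num) (by norm_num))
    (ak_ii (a := 2.25) (b := 3) (by norm_num) (by norm_num))
  have e2 := integral_add_adjacent_intervals (ak_ii (a := 2.25) (b := 2.5) (by norm_num) (by norm_num))
    (ak_ii (a := 2.5) (b := 3) (by norm_num) (by norm_num))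
  have e3 := integral_add_adjacent_intervals (ak_ii (a := 2.5) (b := 2.75) (by norm_num) (by norm_num))
    (ak_ii (a := 2.75) (b := 3) (by norm_num) (by norm_num))
  have f1 := int_le_c (by norm_num) (ak_ii (a := 2) (b := 2.25) (by norm_num) (by norm_num)) kk_q1
  have f2 := int_le_c (by norm_num) (ak_ii (a := 2.25) (b := 2.5) (by norm_num) (by norm_num)) kk_q2
  have f3 := int_le_c (by norm_num) (ak_ii (a := 2.5) (b := 2.75) (by norm_num) (by norm_num)) kk_q3
  have f4 := int_le_c (by norm_num) (ak_ii (a := 2.75) (b := 3) (by norm_num) (by norm_num)) kk_q4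
  rw [← e1, ← e2, ← e3]
  norm_num at f1 f2 f3 f4 ⊢
  linarith

lemma akd_le (a b c l : ℝ) (hl : 1 ≤ l) (hla : l ≤ a) (h : ∀ x, a ≤ x → x ≤ b → |kk x| ≤ c) (hc : 0 ≤ c) :
    ∀ x, a ≤ x → x ≤ b → |kk x / x| ≤ c / l := by
  intro x h1 h2
  rw [abs_div, abs_of_pos (by linarith : (0:ℝ) < x)]
  have := h x h1 h2
  have hl0 : 0 < l := by linarith
  gcongr
  linarith

/-- tail integrals of `|kk/τ|` -/
lemma pt (a b c P : ℝ) (h2 : 2 ≤ a) (hb : b ≤ 3) (hab : a ≤ b)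
    (h : ∀ x, a ≤ x → x ≤ b → |kk x| ≤ c) (hc : 0 ≤ c)
    (hP : ∫ τ in b..3, |kk τ / τ| ≤ P) : ∀ u, a ≤ u → u ≤ b →
    ∫ τ in u..3, |kk τ / τ| ≤ c / a * (b - a) + P := by
  intro u hu hub
  have e1 := integral_add_adjacent_intervals (akd_ii (a := u) (b := b) (by linarith) (by linarith))
    (akd_ii (a := b) (b := 3) (by linarith) (by norm_num))
  have f1 := int_le_c hub (akd_ii (a := u) (b := b) (by linarith) (by linarith))
    (fun x hx hx2 => akd_le a b c a (by linarith) le_rfl h hc x (by linarith) hx2)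
  have : c / a * (b - u) ≤ c / a * (b - a) := by
    have : 0 ≤ c / a := by apply div_nonneg hc; linarith
    gcongr
  linarith

lemma P4 : ∀ u, 2.75 ≤ u → u ≤ 3 → ∫ τ in u..3, |kk τ / τ| ≤ 0.00593 := by
  intro u h1 h2
  have := pt 2.75 3 0.0652 0 (by norm_num) (by norm_num) (by norm_num) kk_q4 (by norm_num) (by simp) u h1 h2
  norm_num at this ⊢; linarith
lemma P3 : ∀ u, 2.5 ≤ u → u ≤ 2.75 → ∫ τ in u..3, |kk τ / τ| ≤ 0.01664 := by
  intro u h1 h2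
  have := pt 2.5 2.75 0.107 _ (by norm_num) (by norm_num) (by norm_num) kk_q3 (by norm_num) (P4 2.75 (by norm_num) (by norm_num)) u h1 h2
  norm_num at this ⊢; linarith
lemma P2 : ∀ u, 2.25 ≤ u → u ≤ 2.5 → ∫ τ in u..3, |kk τ / τ| ≤ 0.0452 := by
  intro u h1 h2
  have := pt 2.25 2.5 0.257 _ (by norm_num) (by norm_num) (by norm_num) kk_q2 (by norm_num) (P3 2.5 (by norm_num) (by norm_num)) u h1 h2
  norm_num at this ⊢; linarith
lemma P1 : ∀ u, 2 ≤ u → u ≤ 2.25 → ∫ τ in u..3, |kk τ / τ| ≤ 0.1078 := by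
  intro u h1 h2
  have := pt 2 2.25 0.5 _ (by norm_num) (by norm_num) (by norm_num) kk_q1 (by norm_num) (P2 2.25 (by norm_num) (by norm_num)) u h1 h2
  norm_num at this ⊢; linarith

/-- continuous extension of the primitive -/
noncomputable def Aq (u : ℝ) : ℝ := ∫ τ in (2:ℝ)..(max 2 u), |kk τ / τ|

lemma Aq_cont : Continuous Aq := by
  have h1 : ∀ a b : ℝ, IntervalIntegrable (fun τ => |kk (max 1 τ) / max 1 τ|) volume a b := by
    intro a b
    have hm : Measurable (fun τ : ℝ => |kk (max 1 τ) / max 1 τ|) := by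
      apply Measurable.abs
      exact ((kk_meas.comp (measurable_const.max measurable_id)).div (measurable_const.max measurable_id))
    rw [intervalIntegrable_iff]
    apply Measure.integrableOn_of_bounded (M := 1) (by simp) hm.aestronglyMeasurable
    refine Filter.Eventually.of_forall ?_
    intro τ
    have h2 : (1:ℝ) ≤ max 1 τ := le_max_left _ _
    rw [Real.norm_eq_abs, abs_abs, abs_div, abs_of_pos (by linarith : 0 < max 1 τ), div_le_one (by linarith)]
    exact (kk_abs_le _ h2).trans h2
  have h2 := intervalIntegral.continuous_primitive h1 2
  have h3 : Aq = fun u => (fun b => ∫ τ in (2:ℝ)..b, |kk (max 1 τ) / max 1 τ|) (max 2 u) := by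
    funext u
    unfold Aq
    apply intervalIntegral.integral_congr
    intro τ hτ
    rw [uIcc_of_le (le_max_left _ _)] at hτ
    simp only
    rw [max_eq_right (by linarith [hτ.1] : (1:ℝ) ≤ τ)]
  rw [h3]
  exact h2.comp (by fun_prop)

lemma Aq_diff {a b : ℝ} (ha : 2 ≤ a) (hb : 2 ≤ b) : Aq b - Aq a = ∫ τ in a..b, |kk τ / τ| := by
  unfold Aq
  rw [max_eq_right ha, max_eq_right hb]
  have := integral_add_adjacent_intervals (akd_ii (a := 2) (b := a) (by norm_num) (by linarith))
    (akd_ii (a := a) (b := b) (by linarith) (by linarith))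
  linarith

lemma Aq_mono {a b : ℝ} (ha : 2 ≤ a) (hab : a ≤ b) : Aq a ≤ Aq b := by
  have h := Aq_diff ha (ha.trans hab)
  have : 0 ≤ ∫ τ in a..b, |kk τ / τ| := intervalIntegral.integral_nonneg hab (fun x _ => abs_nonneg _)
  linarith

lemma Aq23 : ∫ u in (2:ℝ)..3, (Aq 3 - Aq u) ≤ 0.044 := by
  have hi : ∀ a b : ℝ, IntervalIntegrable (fun u => Aq 3 - Aq u) volume a b := fun a b =>
    (continuous_const.sub Aq_cont).intervalIntegrable a b
  rw [← integral_add_adjacent_intervals (hi 2 2.25) (hi 2.25 3),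
    ← integral_add_adjacent_intervals (hi 2.25 2.5) (hi 2.5 3),
    ← integral_add_adjacent_intervals (hi 2.5 2.75) (hi 2.75 3)]
  have f1 := int_le_c (by norm_num) (hi 2 2.25) (c := 0.1078) (fun u h1 h2 => by
    rw [Aq_diff (by linarith) (by norm_num)]; exact P1 u h1 h2)
  have f2 := int_le_c (by norm_num) (hi 2.25 2.5) (c := 0.0452) (fun u h1 h2 => by
    rw [Aq_diff (by linarith) (by norm_num)]; exact P2 u h1 h2)
  have f3 := int_le_c (by norm_num) (hi 2.5 2.75) (c := 0.01664) (fun u h1 h2 => by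
    rw [Aq_diff (by linarith) (by norm_num)]; exact P3 u h1 h2)
  have f4 := int_le_c (by norm_num) (hi 2.75 3) (c := 0.00593) (fun u h1 h2 => by
    rw [Aq_diff (by linarith) (by norm_num)]; exact P4 u h1 h2)
  norm_num at f1 f2 f3 f4 ⊢
  linarith

lemma ak3 (N : ℝ) (hN : 3 ≤ N) : ∫ τ in (3:ℝ)..N, |kk τ| ≤ 0.066 := by
  have hc1 : Continuous (fun u => Aq (u - 1)) := Aq_cont.comp (by fun_prop)
  have h1 : ∫ τ in (3:ℝ)..N, |kk τ| ≤ ∫ u in (3:ℝ)..N, (Aq u - Aq (u-1)) := by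
    apply intervalIntegral.integral_mono_on hN (ak_ii (by norm_num) (by linarith))
      ((Aq_cont.sub hc1).intervalIntegrable _ _)
    intro u hu
    show |kk u| ≤ Aq u - Aq (u - 1)
    rw [Aq_diff (by linarith [hu.1]) (by linarith [hu.1]), kk_rec u (by linarith [hu.1]), abs_neg]
    exact intervalIntegral.abs_integral_le_integral_abs (by linarith)
  rw [intervalIntegral.integral_sub (Aq_cont.intervalIntegrable _ _) (hc1.intervalIntegrable _ _),
    intervalIntegral.integral_comp_sub_right (fun u => Aq u)] at h1
  have hi : ∀ a b : ℝ, IntervalIntegrable Aq volume a b := fun a b => Aq_cont.intervalIntegrable a b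
  have e1 := integral_add_adjacent_intervals (hi 2 3) (hi 3 N)
  have e2 := integral_add_adjacent_intervals (hi 2 (N-1)) (hi (N-1) N)
  have h2 : ∫ u in (N-1)..N, Aq u ≤ Aq N * (N - (N-1)) := int_le_c (by linarith) (hi _ _)
    (fun x h1 h2 => Aq_mono (by linarith) h2)
  have h3 := Aq23
  rw [intervalIntegral.integral_sub (by simp) (hi _ _)] at h3
  have h4 := Aq_diff (a := 3) (b := N) (by norm_num) (by linarith)
  have h5 : ∫ τ in (3:ℝ)..N, |kk τ / τ| ≤ ∫ τ in (3:ℝ)..N, (1/3) * |kk τ| := by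
    apply intervalIntegral.integral_mono_on hN (akd_ii (by norm_num) (by linarith))
      ((ak_ii (by norm_num) (by linarith)).const_mul _)
    intro u hu
    have h6 : 3 ≤ u := hu.1
    rw [abs_div, abs_of_pos (by linarith : (0:ℝ) < u), div_le_iff₀ (by linarith)]
    nlinarith [abs_nonneg (kk u)]
  rw [intervalIntegral.integral_const_mul] at h5
  norm_num at h1 h2 h3 ⊢
  linarith

lemma ak_total (U : ℝ) (hU : 3 ≤ U) : ∫ τ in (1:ℝ)..U, |kk τ| ≤ 0.992 := by
  have e1 := integral_add_adjacent_intervals (ak_ii (a := 1) (b := 2) (by norm_num) (by norm_num))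
    (ak_ii (a := 2) (b := U) (by norm_num) (by linarith))
  have e2 := integral_add_adjacent_intervals (ak_ii (a := 2) (b := 3) (by norm_num) (by norm_num))
    (ak_ii (a := 3) (b := U) (by norm_num) (by linarith))
  have h1 : ∫ τ in (1:ℝ)..2, |kk τ| = Real.log 2 := by
    rw [intervalIntegral.integral_congr_ae (g := fun τ => τ⁻¹)]
    · rw [integral_inv_of_pos one_pos (by norm_num), div_one]
    · have : ∀ᵐ τ : ℝ ∂volume, τ ≠ 2 := by simp [ae_iff]
      filter_upwards [this] with τ h2 hτ
      rw [uIoc_of_le (by norm_num)] at hτ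
      have h3 : τ < 2 := lt_of_le_of_ne hτ.2 h2
      have h4 : 1 < τ := hτ.1
      unfold kk; rw [if_pos h3, one_div, abs_of_pos (by positivity)]
  have := Real.log_two_lt_d9
  have := ak3 U hU
  have := ak23
  linarith

lemma om3 : om 3 = (1 + Real.log 2) / 3 := by
  unfold om; rw [gg_log _ (by norm_num) (by norm_num)]; norm_num

lemma CC_bd : 0.5423 ≤ CC ∧ CC ≤ 0.6 := by
  have key : ∀ n : ℕ, 3 ≤ n → |om 3 - CC| ≤ 0.022 + 625 / (n:ℝ)^4 := by
    intro n hn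
    have hn' : (3:ℝ) ≤ n := by exact_mod_cast hn
    have h1 := CC_spec n (by linarith)
    have h2 := om_int (a := 3) (b := n) (by norm_num) hn'
    have h3 : |∫ τ in (3:ℝ)..n, kk τ / τ| ≤ ∫ τ in (3:ℝ)..n, |kk τ / τ| :=
      intervalIntegral.abs_integral_le_integral_abs hn'
    have h5 : ∫ τ in (3:ℝ)..n, |kk τ / τ| ≤ ∫ τ in (3:ℝ)..n, (1/3) * |kk τ| := by
      apply intervalIntegral.integral_mono_on hn' (akd_ii (by norm_num) (by linarith))
        ((ak_ii (by norm_num) (by linarith)).const_mul _)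
      intro u hu
      have h6 : 3 ≤ u := hu.1
      rw [abs_div, abs_of_pos (by linarith : (0:ℝ) < u), div_le_iff₀ (by linarith)]
      nlinarith [abs_nonneg (kk u)]
    rw [intervalIntegral.integral_const_mul] at h5
    have h6 := ak3 n hn'
    rw [← h2] at h3
    have := abs_sub_le (om 3) (om n) CC
    linarith
  have h7 : |om 3 - CC| ≤ 0.022 := by
    have hl : Filter.Tendsto (fun n : ℕ => 0.022 + 625 / (n:ℝ)^4) Filter.atTop (nhds (0.022 + 0)) := by
      apply Filter.Tendsto.const_add
      apply Filter.Tendsto.const_div_atTop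
      exact (Filter.tendsto_pow_atTop (by norm_num)).comp tendsto_natCast_atTop_atTop
    rw [add_zero] at hl
    exact ge_of_tendsto hl (Filter.eventually_atTop.2 ⟨3, key⟩)
  rw [om3] at h7
  have := Real.log_two_lt_d9
  have := Real.log_two_gt_d9
  rw [abs_le] at h7
  constructor <;> norm_num at * <;> linarith

end

section
open Finset

def Rg (z r : ℕ) : Prop := r ≠ 0 ∧ ∀ p, p.Prime → p ∣ r → z < p

lemma rg_mul {z a b : ℕ} : Rg z (a * b) ↔ Rg z a ∧ Rg z b := by
  constructor
  · rintro ⟨h0, h⟩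
    exact ⟨⟨left_ne_zero_of_mul h0, fun p hp hd => h p hp (hd.mul_right b)⟩,
      ⟨right_ne_zero_of_mul h0, fun p hp hd => h p hp (hd.mul_left a)⟩⟩
  · rintro ⟨⟨h1, h2⟩, h3, h4⟩
    refine ⟨mul_ne_zero h1 h3, fun p hp hd => ?_⟩
    rcases (hp.dvd_mul).1 hd with h | h
    · exact h2 p hp h
    · exact h4 p hp h

lemma rg_one (z : ℕ) : Rg z 1 := ⟨one_ne_zero, fun p hp hd => by
  have := Nat.dvd_one.1 hd
  exact absurd (this ▸ hp) Nat.not_prime_one⟩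

open Classical in
noncomputable def rf (z N : ℕ) : Finset ℕ := (Ioc 0 N).filter (Rg z)

lemma mem_rf {z N r : ℕ} : r ∈ rf z N ↔ (0 < r ∧ r ≤ N) ∧ Rg z r := by
  classical
  simp [rf]

noncomputable def Og (z N : ℕ) : ℝ := ∑ r ∈ rf z N, 1 / (r:ℝ)
noncomputable def ML (z N : ℕ) : ℝ := ∑ r ∈ rf z N, ArithmeticFunction.vonMangoldt r / r

open Classical in
lemma log_trick (z N : ℕ) :
    ∑ r ∈ rf z N, Real.log r / r = ∑ r ∈ rf z N, 1 / (r:ℝ) * ML z (N / r) := by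
  let f : ArithmeticFunction ℝ := ⟨fun e => if Rg z e then ArithmeticFunction.vonMangoldt e / e else 0, by simp⟩
  let g : ArithmeticFunction ℝ := ⟨fun r => if Rg z r then 1 / (r:ℝ) else 0, by simp⟩
  have h := ArithmeticFunction.sum_Ioc_mul_eq_sum_sum g f N
  have h1 : ∑ n ∈ Ioc 0 N, (g * f) n = ∑ r ∈ rf z N, Real.log r / r := by
    rw [rf, sum_filter]
    refine sum_congr rfl fun n hn => ?_
    have hn0 : n ≠ 0 := by have := (mem_Ioc.1 hn).1; omega
    rw [ArithmeticFunction.mul_apply]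
    have h2 : ∀ x ∈ n.divisorsAntidiagonal, g x.1 * f x.2 =
        if Rg z n then ArithmeticFunction.vonMangoldt x.2 / n else 0 := by
      rintro ⟨a, b⟩ hx
      have hx := (Nat.mem_divisorsAntidiagonal.1 hx).1
      simp only at hx
      have hr := rg_mul (z := z) (a := a) (b := b)
      rw [hx] at hr
      show (if Rg z a then 1 / (a:ℝ) else 0) * (if Rg z b then ArithmeticFunction.vonMangoldt b / b else 0) = _
      rw [← hx]
      by_cases ha : Rg z a <;> by_cases hb : Rg z b <;> simp [ha, hb, rg_mul]
      ring
    rw [sum_congr rfl h2]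
    by_cases hr : Rg z n
    · simp only [hr, if_true]
      rw [← ArithmeticFunction.vonMangoldt_sum, Nat.sum_divisorsAntidiagonal' (fun a b => ArithmeticFunction.vonMangoldt b / (n:ℝ)), sum_div]
    · simp [hr]
  rw [← h1, h, rf, sum_filter]
  refine sum_congr rfl fun n hn => ?_
  show (if Rg z n then 1 / (n:ℝ) else 0) * _ = _
  split_ifs with hr
  · congr 1
    rw [ML, rf, sum_filter]
    rfl
  · simp

lemma rf_small {z N : ℕ} (h : N ≤ z) {r : ℕ} (hr : r ∈ rf z N) : r = 1 := by
  rw [mem_rf] at hr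
  by_contra h1
  obtain ⟨p, hp, hd⟩ := Nat.exists_prime_and_dvd h1
  have h2 := hr.2.2 p hp hd
  have h3 := Nat.le_of_dvd hr.1.1 hd
  omega

lemma Og_small {z N : ℕ} (h : N ≤ z) (hN : 1 ≤ N) : Og z N = 1 := by
  have : rf z N = {1} := by
    ext r; rw [mem_singleton]
    refine ⟨rf_small h, ?_⟩
    rintro rfl
    exact mem_rf.2 ⟨⟨one_pos, hN⟩, rg_one z⟩
  simp [Og, this]

lemma ML_nonneg (z N : ℕ) : 0 ≤ ML z N :=
  sum_nonneg fun r _ => div_nonneg ArithmeticFunction.vonMangoldt_nonneg (Nat.cast_nonneg r)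

lemma ML_small {z N : ℕ} (h : N ≤ z) : ML z N = 0 := by
  apply sum_eq_zero
  intro r hr
  rw [rf_small h hr]; simp

lemma ML_upper {z N : ℕ} (hz : 1 ≤ z) (h : z ≤ N) : ML z N ≤ Real.log N - Real.log z + 7 := by
  classical
  have h1 : ML z N + mert z ≤ mert N := by
    unfold ML mert
    have e : ∑ r ∈ rf z N, ArithmeticFunction.vonMangoldt r / (r:ℝ)
        = ∑ r ∈ (rf z N).filter (fun r => z < r), ArithmeticFunction.vonMangoldt r / (r:ℝ) := by
      rw [sum_filter]
      refine sum_congr rfl fun r hr => ?_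
      split_ifs with h2
      · rfl
      · have : r ∈ rf z z := mem_rf.2 ⟨⟨(mem_rf.1 hr).1.1, by omega⟩, (mem_rf.1 hr).2⟩
        rw [rf_small le_rfl this]; simp
    rw [e, ← sum_union]
    · apply sum_le_sum_of_subset_of_nonneg
      · intro r hr
        rcases mem_union.1 hr with hr | hr
        · rw [mem_filter, mem_rf] at hr
          exact mem_Ioc.2 hr.1.1
        · rw [mem_Ioc] at hr ⊢; omega
      · intro r _ _
        exact div_nonneg ArithmeticFunction.vonMangoldt_nonneg (Nat.cast_nonneg r)
    · rw [disjoint_left]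
      intro r hr hr2
      rw [mem_filter] at hr; rw [mem_Ioc] at hr2; omega
  have h2 := mert_lower z hz
  have h3 := mert_upper N (by omega)
  linarith

lemma ML_lower {z N : ℕ} (hz : 1 ≤ z) (h : z ≤ N) : Real.log N - Real.log z - 2 * cL ≤ ML z N := by
  classical
  have h1 := Lg_lower hz h
  have h2 : Lg z N ≤ ML z N + (cL - 6) := by
    have e1 : Lg z N = ∑ p ∈ pr z N, Real.log p / p + ∑ p ∈ pr z N, Real.log p / ((p:ℝ) * (p - 1)) := by
      unfold Lg
      rw [← sum_add_distrib]
      refine sum_congr rfl fun p hp => ?_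
      have : (1:ℝ) < p := by exact_mod_cast (mem_pr.1 hp).1.one_lt
      have : (p:ℝ) - 1 ≠ 0 := by linarith
      field_simp; ring
    have e2 : ∑ p ∈ pr z N, Real.log p / ((p:ℝ) * (p - 1)) ≤ cL - 6 := by
      unfold cL
      have := summable_log_tail.sum_le_tsum (pr z N) (fun n _ => log_tail_nonneg n)
      linarith
    have e3 : ∑ p ∈ pr z N, Real.log p / p ≤ ML z N := by
      unfold ML
      calc ∑ p ∈ pr z N, Real.log p / (p:ℝ) = ∑ p ∈ pr z N, ArithmeticFunction.vonMangoldt p / (p:ℝ) := by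
            refine sum_congr rfl fun p hp => ?_
            rw [ArithmeticFunction.vonMangoldt_apply_prime (mem_pr.1 hp).1]
        _ ≤ _ := by
            apply sum_le_sum_of_subset_of_nonneg
            · intro p hp
              have hp := mem_pr.1 hp
              refine mem_rf.2 ⟨⟨hp.1.pos, hp.2.2⟩, hp.1.ne_zero, fun q hq hd => ?_⟩
              rw [(Nat.prime_dvd_prime_iff_eq hq hp.1).1 hd]; exact hp.2.1
            · intro r _ _
              exact div_nonneg ArithmeticFunction.vonMangoldt_nonneg (Nat.cast_nonneg r)
    linarith
  linarith [cL_pos]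

lemma Og_nonneg (z N : ℕ) : 0 ≤ Og z N := sum_nonneg fun r _ => by positivity

lemma Og_mono (z : ℕ) {a b : ℕ} (h : a ≤ b) : Og z a ≤ Og z b := by
  classical
  apply sum_le_sum_of_subset_of_nonneg
  · intro r hr
    rw [mem_rf] at hr ⊢
    exact ⟨⟨hr.1.1, hr.1.2.trans h⟩, hr.2⟩
  · intro r _ _; positivity

lemma Og_le_W (z N : ℕ) : Og z N ≤ 1 / Wf z N := by
  classical
  rw [le_div_iff₀ (Wf_pos z N)]
  rw [← sm_sum z N]
  have h := (sm_summable z N).sum_le_tsum (rf z N) (fun n _ => ind_nonneg (fun n _ => Ph_nonneg _ _ _) n)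
  refine le_trans (le_of_eq ?_) h
  rw [Og, sum_mul]
  refine sum_congr rfl fun r hr => ?_
  have hr := mem_rf.1 hr
  have : Sm z N r := ⟨hr.2.1, fun p hp hd => ⟨hr.2.2 p hp hd, (Nat.le_of_dvd hr.1.1 hd).trans hr.1.2⟩⟩
  unfold ind Ph
  rw [if_pos this]; ring

end

section
open MeasureTheory

noncomputable def Pz (z : ℕ) (w : ℝ) : ℝ := Og z ⌊Real.exp w⌋₊

lemma Pz_mono (z : ℕ) {a b : ℝ} (h : a ≤ b) : Pz z a ≤ Pz z b := by
  unfold Pz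
  exact Og_mono z (Nat.floor_le_floor (Real.exp_le_exp.2 h))

lemma Pz_nonneg (z : ℕ) (a : ℝ) : 0 ≤ Pz z a := Og_nonneg _ _

lemma Pz_ii (z : ℕ) (a b : ℝ) : IntervalIntegrable (Pz z) volume a b :=
  Monotone.intervalIntegrable (fun _ _ h => Pz_mono z h)

lemma floor_exp_ge {w : ℝ} (hw : 0 ≤ w) : 1 ≤ ⌊Real.exp w⌋₊ := by
  apply Nat.le_floor
  simpa using Real.one_le_exp hw

lemma log_floor_le {w : ℝ} (hw : 0 ≤ w) : Real.log (⌊Real.exp w⌋₊ : ℝ) ≤ w := by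
  have h1 := floor_exp_ge hw
  rw [Real.log_le_iff_le_exp (by exact_mod_cast h1)]
  exact Nat.floor_le (Real.exp_pos _).le

lemma log_succ_le {n : ℕ} (hn : 1 ≤ n) : Real.log ((n:ℝ) + 1) ≤ Real.log n + 1 / n := by
  have hn' : (1:ℝ) ≤ n := by exact_mod_cast hn
  have h0 : (0:ℝ) < n := by linarith
  have h : (n:ℝ) + 1 = n * (1 + 1 / n) := by field_simp
  rw [h, Real.log_mul (by positivity) (by positivity)]
  have := Real.log_le_sub_one_of_pos (show (0:ℝ) < 1 + 1 / n by positivity)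
  linarith

lemma log_floor_ge {w : ℝ} (hw : 0 ≤ w) : w ≤ Real.log (⌊Real.exp w⌋₊ : ℝ) + 1 := by
  have h1 := floor_exp_ge hw
  have h2 := log_succ_le h1
  have h3 : w ≤ Real.log ((⌊Real.exp w⌋₊ : ℝ) + 1) := by
    rw [Real.le_log_iff_exp_le (by positivity)]
    exact (Nat.lt_floor_add_one _).le
  have h4 : (1:ℝ) / (⌊Real.exp w⌋₊ : ℝ) ≤ 1 := by
    rw [div_le_one (by exact_mod_cast h1)]; exact_mod_cast h1
  linarith

noncomputable def cR : ℝ := 2 * cL + 8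

lemma ML_approx {z : ℕ} (hz : 1 ≤ z) {w : ℝ} (hw : 0 ≤ w) :
    |ML z ⌊Real.exp w⌋₊ - max 0 (w - Real.log z)| ≤ cR := by
  have hc := cL_pos
  have h1 := log_floor_le hw
  have h2 := log_floor_ge hw
  unfold cR
  rcases le_total z ⌊Real.exp w⌋₊ with h | h
  · have h3 := ML_upper hz h
    have h4 := ML_lower hz h
    have h5 : Real.log z ≤ Real.log ⌊Real.exp w⌋₊ :=
      Real.log_le_log (by exact_mod_cast hz) (by exact_mod_cast h)
    rw [max_eq_right (by linarith), abs_le]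
    constructor <;> linarith
  · rw [ML_small h]
    have h5 : Real.log ⌊Real.exp w⌋₊ ≤ Real.log z :=
      Real.log_le_log (by exact_mod_cast floor_exp_ge hw) (by exact_mod_cast h)
    rw [zero_sub, abs_neg, abs_of_nonneg (le_max_left _ _)]
    apply max_le <;> linarith

lemma int_ind {a w : ℝ} (h0 : 0 ≤ a) (h1 : a ≤ w) :
    ∫ v in (0:ℝ)..w, (Set.Ici a).indicator (fun _ => (1:ℝ)) v = w - a := by
  rw [intervalIntegral.integral_of_le (h0.trans h1), MeasureTheory.integral_indicator measurableSet_Ici,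
    MeasureTheory.Measure.restrict_restrict measurableSet_Ici]
  simp only [integral_const, smul_eq_mul, mul_one, Measure.real, Measure.restrict_apply MeasurableSet.univ,
    Set.univ_inter]
  have : (volume (Set.Ici a ∩ Set.Ioc 0 w)) = ENNReal.ofReal (w - a) := by
    rcases eq_or_lt_of_le h0 with h | h
    · subst h
      have : Set.Ici (0:ℝ) ∩ Set.Ioc 0 w = Set.Ioc 0 w := by
        ext x; simp only [Set.mem_inter_iff, Set.mem_Ici, Set.mem_Ioc]; constructor
        · exact fun h => h.2
        · exact fun h => ⟨h.1.le, h⟩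
      rw [this, Real.volume_Ioc]
    · have : Set.Ici a ∩ Set.Ioc 0 w = Set.Icc a w := by
        ext x; simp only [Set.mem_inter_iff, Set.mem_Ici, Set.mem_Ioc, Set.mem_Icc]; constructor
        · exact fun h => ⟨h.1, h.2.2⟩
        · exact fun h' => ⟨h'.1, by linarith [h'.1], h'.2⟩
      rw [this, Real.volume_Icc]
  rw [this, ENNReal.toReal_ofReal (by linarith)]

lemma ind_ii (a : ℝ) (x y : ℝ) : IntervalIntegrable ((Set.Ici a).indicator (fun _ => (1:ℝ))) volume x y := by
  apply Monotone.intervalIntegrable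
  intro u v h
  by_cases h1 : a ≤ u
  · rw [Set.indicator_of_mem (show u ∈ Set.Ici a from h1), Set.indicator_of_mem (show v ∈ Set.Ici a from h1.trans h)]
  · rw [Set.indicator_of_notMem (show u ∉ Set.Ici a from h1)]
    exact Set.indicator_nonneg (fun _ _ => zero_le_one) _

lemma mem_rf_exp {z r : ℕ} {w : ℝ} : r ∈ rf z ⌊Real.exp w⌋₊ ↔ (0 < r ∧ Real.log r ≤ w) ∧ Rg z r := by
  rw [mem_rf]
  constructor
  · rintro ⟨⟨h1, h2⟩, h3⟩
    refine ⟨⟨h1, ?_⟩, h3⟩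
    rw [Real.log_le_iff_le_exp (by exact_mod_cast h1)]
    exact (Nat.le_floor_iff (Real.exp_pos _).le).1 h2
  · rintro ⟨⟨h1, h2⟩, h3⟩
    refine ⟨⟨h1, ?_⟩, h3⟩
    rw [Real.log_le_iff_le_exp (by exact_mod_cast h1)] at h2
    exact (Nat.le_floor_iff (Real.exp_pos _).le).2 h2

lemma int_Pz (z : ℕ) {w : ℝ} (hw : 0 ≤ w) :
    ∑ r ∈ rf z ⌊Real.exp w⌋₊, 1 / (r:ℝ) * (w - Real.log r) = ∫ v in (0:ℝ)..w, Pz z v := by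
  classical
  have h1 : ∫ v in (0:ℝ)..w, Pz z v = ∫ v in (0:ℝ)..w, ∑ r ∈ rf z ⌊Real.exp w⌋₊,
      1 / (r:ℝ) * (Set.Ici (Real.log r)).indicator (fun _ => (1:ℝ)) v := by
    apply intervalIntegral.integral_congr
    intro v hv
    rw [Set.uIcc_of_le hw] at hv
    show Pz z v = _
    have : rf z ⌊Real.exp v⌋₊ = (rf z ⌊Real.exp w⌋₊).filter (fun r : ℕ => Real.log (r:ℝ) ≤ v) := by
      ext r
      rw [Finset.mem_filter, mem_rf_exp, mem_rf_exp]
      constructor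
      · rintro ⟨⟨a, b⟩, c⟩; exact ⟨⟨⟨a, b.trans hv.2⟩, c⟩, b⟩
      · rintro ⟨⟨⟨a, b⟩, c⟩, d⟩; exact ⟨⟨a, d⟩, c⟩
    unfold Pz Og
    rw [this, Finset.sum_filter]
    apply Finset.sum_congr rfl
    intro r _
    by_cases h : Real.log r ≤ v
    · rw [if_pos h, Set.indicator_of_mem (show v ∈ Set.Ici _ from h), mul_one]
    · rw [if_neg h, Set.indicator_of_notMem (show v ∉ Set.Ici _ from h), mul_zero]
  rw [h1, intervalIntegral.integral_finsetSum]
  · apply Finset.sum_congr rfl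
    intro r hr
    rw [mem_rf_exp] at hr
    rw [intervalIntegral.integral_const_mul, int_ind _ hr.1.2]
    apply Real.log_nonneg
    exact_mod_cast hr.1.1
  · intro r _
    exact (ind_ii _ _ _).const_mul _

lemma floor_exp_div {w : ℝ} {r : ℕ} (hr : 0 < r) :
    ⌊Real.exp w⌋₊ / r = ⌊Real.exp (w - Real.log r)⌋₊ := by
  rw [Real.exp_sub, Real.exp_log (by exact_mod_cast hr), Nat.floor_div_natCast]

lemma Pz_eq {z : ℕ} (hz : 1 ≤ z) {w : ℝ} (hw : Real.log z ≤ w) :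
    |w * Pz z w - (∫ v in (0:ℝ)..w, Pz z v) - ∫ v in (0:ℝ)..(w - Real.log z), Pz z v| ≤ cR * Pz z w := by
  classical
  have hs : 0 ≤ Real.log z := Real.log_nonneg (by exact_mod_cast hz)
  have hw0 : 0 ≤ w := hs.trans hw
  have h1 : w * Pz z w - (∫ v in (0:ℝ)..w, Pz z v) = ∑ r ∈ rf z ⌊Real.exp w⌋₊, 1 / (r:ℝ) * ML z (⌊Real.exp w⌋₊ / r) := by
    rw [← log_trick, ← int_Pz z hw0, Pz, Og, Finset.mul_sum, ← Finset.sum_sub_distrib]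
    apply Finset.sum_congr rfl
    intro r _
    ring
  have h2 : ∫ v in (0:ℝ)..(w - Real.log z), Pz z v =
      ∑ r ∈ rf z ⌊Real.exp w⌋₊, 1 / (r:ℝ) * max 0 (w - Real.log r - Real.log z) := by
    rw [← int_Pz z (by linarith : 0 ≤ w - Real.log z)]
    have : rf z ⌊Real.exp (w - Real.log z)⌋₊ = (rf z ⌊Real.exp w⌋₊).filter (fun r : ℕ => Real.log (r:ℝ) ≤ w - Real.log z) := by
      ext r
      rw [Finset.mem_filter, mem_rf_exp, mem_rf_exp]
      constructor
      · rintro ⟨⟨a, b⟩, c⟩; exact ⟨⟨⟨a, by linarith⟩, c⟩, b⟩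
      · rintro ⟨⟨⟨a, b⟩, c⟩, d⟩; exact ⟨⟨a, d⟩, c⟩
    rw [this, Finset.sum_filter]
    apply Finset.sum_congr rfl
    intro r _
    by_cases h : Real.log r ≤ w - Real.log z
    · rw [if_pos h, max_eq_right (by linarith)]; ring
    · rw [if_neg h, max_eq_left (by linarith), mul_zero]
  rw [h1, h2, ← Finset.sum_sub_distrib, Pz, Og, Finset.mul_sum]
  refine (Finset.abs_sum_le_sum_abs _ _).trans (Finset.sum_le_sum fun r hr => ?_)
  rw [mem_rf_exp] at hr
  rw [← mul_sub, abs_mul, abs_of_nonneg (by positivity : (0:ℝ) ≤ 1 / r), mul_comm]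
  apply mul_le_mul_of_nonneg_right _ (by positivity)
  rw [floor_exp_div hr.1.1]
  exact ML_approx hz (by linarith [hr.1.2])

lemma Pz_small {z : ℕ} (hz : 1 ≤ z) {w : ℝ} (h0 : 0 ≤ w) (hw : w ≤ Real.log z) : Pz z w = 1 := by
  unfold Pz
  apply Og_small _ (floor_exp_ge h0)
  have : Real.exp w ≤ z := by
    rw [← Real.exp_log (show (0:ℝ) < z by exact_mod_cast hz)]; exact Real.exp_le_exp.2 hw
  exact Nat.floor_le_of_le this

lemma Pz_le {z : ℕ} (hz : 1 ≤ z) {w : ℝ} (h0 : 0 ≤ w) :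
    Pz z w ≤ 8 * (w + cL + 1) / (1 + Real.log z) + 1 := by
  unfold Pz
  have h1 := Wyz_lower hz (floor_exp_ge h0)
  have h2 := log_floor_le h0
  have hs : 0 ≤ Real.log z := Real.log_nonneg (by exact_mod_cast hz)
  refine (Og_le_W _ _).trans (h1.trans ?_)
  gcongr

noncomputable def Dz (z : ℕ) (w : ℝ) : ℝ := Pz z w - gg (w / Real.log z)

lemma Dz_ii (z : ℕ) (a b : ℝ) : IntervalIntegrable (Dz z) volume a b :=
  (Pz_ii z a b).sub ((gg_cont.comp (by fun_prop : Continuous fun w : ℝ => w / Real.log z)).intervalIntegrable a b)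

lemma gs_ident {s w : ℝ} (hs : 0 < s) (hw : s ≤ w) :
    w * gg (w / s) = (∫ v in (0:ℝ)..w, gg (v / s)) + ∫ v in (0:ℝ)..(w - s), gg (v / s) := by
  have h := gg_ident (w / s) (by rw [le_div_iff₀ hs]; linarith)
  rw [intervalIntegral.integral_comp_div (fun v => gg v) hs.ne', intervalIntegral.integral_comp_div (fun v => gg v) hs.ne']
  have e : (w - s) / s = w / s - 1 := by field_simp
  rw [zero_div, e, smul_eq_mul, smul_eq_mul, ← mul_add, ← h]
  field_simp

lemma Dz_eq {z : ℕ} (hz : 2 ≤ z) {w : ℝ} (hw : Real.log z ≤ w) :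
    |w * Dz z w - (∫ v in (0:ℝ)..w, Dz z v) - ∫ v in (0:ℝ)..(w - Real.log z), Dz z v| ≤ cR * Pz z w := by
  have hs : 0 < Real.log z := Real.log_pos (by exact_mod_cast hz)
  have h := Pz_eq (by omega : 1 ≤ z) hw
  have hg := gs_ident hs hw
  have hi : ∀ a b, ∫ v in a..b, Dz z v = (∫ v in a..b, Pz z v) - ∫ v in a..b, gg (v / Real.log z) := by
    intro a b
    exact intervalIntegral.integral_sub (Pz_ii z a b)
      ((gg_cont.comp (by fun_prop : Continuous fun w : ℝ => w / Real.log z)).intervalIntegrable a b)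
  rw [hi, hi]
  convert h using 2
  unfold Dz
  linear_combination -hg

lemma int_abs_le {f : ℝ → ℝ} {a b M : ℝ} (hab : a ≤ b) (h : ∀ x, a < x → x ≤ b → |f x| ≤ M) :
    |∫ x in a..b, f x| ≤ M * (b - a) := by
  have := intervalIntegral.norm_integral_le_of_norm_le_const (a := a) (b := b) (f := f) (C := M) (by
    intro x hx
    rw [Set.uIoc_of_le hab] at hx
    exact h x hx.1 hx.2)
  rwa [Real.norm_eq_abs, abs_of_nonneg (by linarith : 0 ≤ b - a)] at this

theorem Dz_bound (n : ℕ) : ∃ C : ℝ, 0 ≤ C ∧ ∀ z : ℕ, 2 ≤ z → ∀ w, 0 ≤ w → w ≤ Real.log z * (1 + n / 2) →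
    |Dz z w| ≤ C / Real.log z := by
  induction n with
  | zero =>
    refine ⟨0, le_rfl, fun z hz w h0 hw => ?_⟩
    have hs : 0 < Real.log z := Real.log_pos (by exact_mod_cast hz)
    have hw' : w ≤ Real.log z := by simpa using hw
    unfold Dz
    rw [Pz_small (by omega) h0 hw', gg_one _ (by rw [div_le_one hs]; exact hw')]
    simp
  | succ n ih =>
    obtain ⟨C, hC, ih⟩ := ih
    have hc := cL_pos
    have hcR : 0 ≤ cR := by unfold cR; linarith
    set B : ℝ := 8 * (n + 3 + cL) + 1 with hB
    have hB0 : 0 ≤ B := by positivity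
    refine ⟨4 * C + 2 * (cR * B), by positivity, fun z hz => ?_⟩
    have hs : 0 < Real.log z := Real.log_pos (by exact_mod_cast hz)
    set s := Real.log z with hsd
    set b := s * (1 + n / 2) with hb
    have hbs : s ≤ b := by rw [hb]; nlinarith [show (0:ℝ) ≤ n / 2 by positivity]
    have e1 : s * (1 + ((n + 1 : ℕ) : ℝ) / 2) = b + s / 2 := by rw [hb]; push_cast; ring
    have hPB : ∀ w, 0 ≤ w → w ≤ b + s / 2 → Pz z w ≤ B := by
      intro w h0 hw
      refine (Pz_le (by omega) h0).trans ?_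
      rw [hB]
      gcongr
      rw [div_le_iff₀ (by linarith)]
      have : w ≤ s * (n + 2) := hw.trans (by rw [hb]; nlinarith [show (0:ℝ) ≤ n by positivity])
      nlinarith [show (0:ℝ) ≤ n by positivity, show 0 ≤ s * cL by positivity]
    have hbd : ∀ w, 0 ≤ w → w ≤ b + s / 2 → |Dz z w| ≤ B + (n + 3) := by
      intro w h0 hw
      have h1 := hPB w h0 hw
      have h2 := Pz_nonneg z w
      have h3 := gg_ge (w / s)
      have h4 := gg_le (w / s) (by positivity)
      have h5 : w / s ≤ n + 2 := by
        rw [div_le_iff₀ hs]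
        exact hw.trans (by rw [hb]; nlinarith [show (0:ℝ) ≤ n by positivity])
      unfold Dz
      rw [abs_le]; constructor <;> linarith
    set S : Set ℝ := (fun w => |Dz z w|) '' Set.Ioc b (b + s / 2) with hS
    have hSb : BddAbove S := ⟨B + (n + 3), by
      rintro _ ⟨w, hw, rfl⟩
      exact hbd w (by linarith [hw.1]) hw.2⟩
    have hSn : S.Nonempty := ⟨_, ⟨b + s / 2, ⟨by linarith, le_rfl⟩, rfl⟩⟩
    set M := sSup S with hM
    have hDM : ∀ w, b < w → w ≤ b + s / 2 → |Dz z w| ≤ M := fun w h1 h2 =>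
      le_csSup hSb ⟨w, ⟨h1, h2⟩, rfl⟩
    have hM0 : 0 ≤ M := (abs_nonneg _).trans (hDM (b + s/2) (by linarith) le_rfl)
    have key : M ≤ 2 * (C / s) + M / 2 + cR * B / s := by
      apply csSup_le hSn
      rintro _ ⟨w, hw, rfl⟩
      have hw1 := hw.1
      have hw2 := hw.2
      show |Dz z w| ≤ _
      have hE := Dz_eq hz (show Real.log z ≤ w by linarith)
      rw [← hsd] at hE
      have hP := hPB w (by linarith) hw2
      have hsplit : ∫ v in (0:ℝ)..w, Dz z v = (∫ v in (0:ℝ)..b, Dz z v) + ∫ v in b..w, Dz z v :=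
        (intervalIntegral.integral_add_adjacent_intervals (Dz_ii z _ _) (Dz_ii z _ _)).symm
      have i1 := int_abs_le (f := Dz z) (show (0:ℝ) ≤ b by linarith) (fun x h1 h2 => ih z hz x h1.le h2)
      have i2 := int_abs_le (f := Dz z) (show b ≤ w by linarith) (fun x h1 h2 => hDM x h1 (h2.trans hw2))
      have i3 := int_abs_le (f := Dz z) (show 0 ≤ w - s by linarith)
        (fun x h1 h2 => ih z hz x h1.le (by show x ≤ b; linarith))
      have hCs : 0 ≤ C / s := by positivity
      have hE2 : cR * Pz z w ≤ cR * B := mul_le_mul_of_nonneg_left hP hcR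
      have hw0 : 0 < w := by linarith
      have h1 : w * |Dz z w| ≤ C / s * w + C / s * w + M * (w / 2) + cR * B := by
        rw [← abs_of_pos hw0, ← abs_mul, abs_of_pos hw0]
        rw [hsplit] at hE
        have j1 : C / s * (b - 0) ≤ C / s * w := mul_le_mul_of_nonneg_left (by linarith) hCs
        have j2 : M * (w - b) ≤ M * (w / 2) := mul_le_mul_of_nonneg_left (by linarith) hM0
        have j3 : C / s * (w - s - 0) ≤ C / s * w := mul_le_mul_of_nonneg_left (by linarith) hCs
        rw [abs_le] at *
        constructor <;> linarith
      have h2 : |Dz z w| ≤ 2 * (C / s) + M / 2 + cR * B / w := by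
        have : 2 * (C / s) + M / 2 + cR * B / w = (C / s * w + C / s * w + M * (w / 2) + cR * B) / w := by
          field_simp; ring
        rw [this, le_div_iff₀ hw0]; linarith
      have h3 : cR * B / w ≤ cR * B / s := by
        apply div_le_div_of_nonneg_left (by positivity) hs (by linarith)
      linarith
    have hMf : M ≤ (4 * C + 2 * (cR * B)) / s := by
      have : (4 * C + 2 * (cR * B)) / s = 2 * (2 * (C / s) + cR * B / s) := by ring
      rw [this]; linarith
    intro w h0 hw
    rw [e1] at hw
    rcases le_or_gt w b with h | h
    · refine (ih z hz w h0 h).trans ?_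
      gcongr
      nlinarith [mul_nonneg hcR hB0]
    · exact (hDM w h hw).trans hMf

theorem Pz_gg (U : ℝ) : ∃ C : ℝ, 0 ≤ C ∧ ∀ z : ℕ, 2 ≤ z → ∀ w, 0 ≤ w → w ≤ U * Real.log z →
    |Pz z w - gg (w / Real.log z)| ≤ C / Real.log z := by
  obtain ⟨n, hn⟩ := exists_nat_gt (2 * U)
  obtain ⟨C, hC, h⟩ := Dz_bound n
  refine ⟨C, hC, fun z hz w h0 hw => h z hz w h0 (hw.trans ?_)⟩
  have hs : 0 < Real.log z := Real.log_pos (by exact_mod_cast hz)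
  nlinarith

end

section
open Finset

noncomputable def cT (t : ℕ) : ℝ := 12 * kap 1 t + 2

lemma cT_pos {t : ℕ} (ht : 1 ≤ t) : 0 < cT t := by
  have := kap_ge (le_refl 1) ht
  have := cL_pos
  unfold cT; linarith

lemma T_log {t : ℕ} (ht : 1 ≤ t) (z : ℕ) : Tf 1 t z * Real.log z ≤ cT t := by
  have hk := kap_ge (le_refl 1) ht
  have hc := cL_pos
  have hT0 := T_nonneg 1 t z
  have hT1 := T_le_one (y := 1) (z := z) ht
  rcases Nat.lt_or_ge z 4 with h | h
  · have h1 : Real.log z ≤ 2 := by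
      rcases Nat.eq_zero_or_pos z with h0 | h0
      · subst h0; simp
      · have := Real.log_le_sub_one_of_pos (show (0:ℝ) < z by exact_mod_cast h0)
        have : (z:ℝ) ≤ 3 := by exact_mod_cast (by omega : z ≤ 3)
        linarith
    have h2 : 0 ≤ Real.log z := Real.log_natCast_nonneg z
    unfold cT
    nlinarith
  · have h2 : 2 ≤ Nat.sqrt z := by
      rw [Nat.le_sqrt]; omega
    set k := Nat.sqrt z
    have h3 : k ^ 2 ≤ z := by rw [pow_two]; exact Nat.sqrt_le z
    have h4 : z < (k + 1) ^ 2 := by rw [pow_two]; exact Nat.lt_succ_sqrt z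
    have h5 : z ≤ k ^ 4 := by
      have : (k + 1) ^ 2 ≤ k ^ 4 := by
        have : k + 1 ≤ k ^ 2 := by nlinarith
        calc (k+1)^2 ≤ (k^2)^2 := Nat.pow_le_pow_left this 2
          _ = k ^ 4 := by ring
      omega
    have h6 : Real.log z ≤ 4 * Real.log k := by
      have : Real.log z ≤ Real.log ((k:ℝ)^4) := Real.log_le_log (by exact_mod_cast (by omega : 0 < z)) (by exact_mod_cast h5)
      rw [Real.log_pow] at this
      exact_mod_cast this
    have h7 := T_sq (le_refl 1) ht (by omega : 1 ≤ k) h2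
    have h8 := T_anti (y := 1) ht h3
    have h9 : 0 ≤ Real.log k := Real.log_natCast_nonneg k
    unfold cT
    calc Tf 1 t z * Real.log z ≤ Tf 1 t (k^2) * (4 * Real.log k) :=
          mul_le_mul h8 h6 (Real.log_natCast_nonneg z) (T_nonneg _ _ _)
      _ ≤ _ := by linarith

noncomputable def cV : ℝ := 2 * (1 + 2 * (cL + 1))

lemma cV_pos : 0 < cV := by have := cL_pos; unfold cV; linarith

lemma log_half : (1:ℝ)/2 ≤ Real.log 2 := by have := Real.log_two_gt_d9; linarith

lemma Vr_le (z : ℕ) (hz : 1 ≤ z) : Vr 1 z ≤ cV * Real.log z ^ 2 := by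
  have hc := cL_pos
  rcases Nat.lt_or_ge z 2 with h | h
  · have : z = 1 := by omega
    subst this
    have : pr 1 1 = ∅ := by
      ext p; rw [mem_pr]; simp
    simp [Vr, this]
  have h1 : Vr 1 z ≤ 2 * Real.log z * Lg 1 z := by
    unfold Vr Lg
    rw [mul_sum]
    apply sum_le_sum
    intro p hp
    rw [mem_pr] at hp
    have hp2 : (2:ℝ) ≤ p := by exact_mod_cast hp.1.two_le
    have hl : 0 ≤ Real.log p := Real.log_nonneg (by linarith)
    have hlz : Real.log p ≤ Real.log z := Real.log_le_log (by linarith) (by exact_mod_cast hp.2.2)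
    have hp1 : (0:ℝ) < p - 1 := by linarith
    have e : Real.log p ^ 2 * p / ((p:ℝ) - 1)^2 = (Real.log p * (p / (p - 1))) * (Real.log p / (p - 1)) := by
      field_simp
    rw [e]
    apply mul_le_mul_of_nonneg_right _ (by positivity)
    have : (p:ℝ) / (p - 1) ≤ 2 := by rw [div_le_iff₀ hp1]; linarith
    calc Real.log p * (p / (p-1)) ≤ Real.log z * 2 := mul_le_mul hlz this (by positivity) (by linarith)
      _ = _ := by ring
  have h2 := Lg_upper (le_refl 1) hz
  have h3 : (1:ℝ)/2 ≤ Real.log z := log_half.trans (Real.log_le_log (by norm_num) (by exact_mod_cast h))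
  have h4 : Lg 1 z ≤ Real.log z * (1 + 2 * (cL + 1)) := by
    simp only [Nat.cast_one, Real.log_one] at h2
    nlinarith
  unfold cV
  nlinarith

noncomputable def Ed (t z : ℕ) : ℝ :=
  ∑ d ∈ Dd 1 t 0 z, Wf 1 (t * d) / d * Real.log ((t * d : ℕ):ℝ) ^ 2 + Tf 1 t z * Real.log z ^ 2

lemma Ed_step {t : ℕ} (ht : 1 ≤ t) (z : ℕ) :
    Ed t (z+1) = Ed t z + Tf 1 t z * (Real.log ((z+1 : ℕ):ℝ) ^ 2 - Real.log z ^ 2) := by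
  unfold Ed
  rw [Dd_succ (Nat.zero_le z)]
  have h1 : ∑ d ∈ Dd 1 t z (z+1), Wf 1 (t * d) / d * Real.log ((t * d : ℕ):ℝ) ^ 2 =
      (∑ d ∈ Dd 1 t z (z+1), Wf 1 (t * d) / d) * Real.log ((z+1 : ℕ):ℝ) ^ 2 := by
    rw [sum_mul]
    apply sum_congr rfl
    intro d hd
    rw [mem_Dd ht] at hd
    rw [show t * d = z + 1 by omega]
  rw [h1]
  have h2 := T_step (y := 1) ht (Nat.le_succ z)
  rw [Nat.succ_eq_add_one] at h2
  linear_combination (-(Real.log ((z+1 : ℕ):ℝ) ^ 2)) * h2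

lemma Ed_le {t : ℕ} (ht : 1 ≤ t) (z : ℕ) (hz : 2 ≤ z) : Ed t z ≤ |Ed t 2| + 3 * cT t * Real.log z := by
  have hc := cT_pos ht
  induction z, hz using Nat.le_induction with
  | base =>
    have : 0 ≤ Real.log ((2:ℕ):ℝ) := Real.log_natCast_nonneg 2
    have := le_abs_self (Ed t 2)
    nlinarith [mul_nonneg hc.le ‹0 ≤ Real.log ((2:ℕ):ℝ)›]
  | succ z hz ih =>
    rw [Ed_step ht]
    have h1 := T_log ht z
    have hz' : (2:ℝ) ≤ z := by exact_mod_cast hz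
    have h2 : Real.log ((z+1:ℕ):ℝ) ≤ 2 * Real.log z := by
      have : Real.log ((z+1:ℕ):ℝ) ≤ Real.log ((z:ℝ)^2) := by
        apply Real.log_le_log (by positivity)
        push_cast; nlinarith
      rw [Real.log_pow] at this; exact_mod_cast this
    have h3 : Real.log z ≤ Real.log ((z+1:ℕ):ℝ) := Real.log_le_log (by linarith) (by push_cast; linarith)
    have hT := T_nonneg 1 t z
    set a := Real.log z
    set b := Real.log ((z+1:ℕ):ℝ)
    have h4 : Tf 1 t z * (b^2 - a^2) ≤ 3 * cT t * (b - a) := by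
      calc Tf 1 t z * (b^2 - a^2) = (b - a) * (Tf 1 t z * (b + a)) := by ring
        _ ≤ (b - a) * (3 * (Tf 1 t z * a)) := by
          apply mul_le_mul_of_nonneg_left _ (by linarith)
          nlinarith
        _ ≤ (b - a) * (3 * cT t) := by
          apply mul_le_mul_of_nonneg_left _ (by linarith)
          linarith
        _ = _ := by ring
    linarith

/-- second moment density -/
noncomputable def PhQ (z m : ℕ) : ℝ := Ph 1 z m * (Real.log m - Lg 1 z) ^ 2

lemma PhQ_eq (z : ℕ) (P : ℕ → Prop) (m : ℕ) :
    ind P (PhQ z) m = ind P (Ph2 1 z) m + Vr 1 z * ind P (Ph 1 z) m := by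
  unfold ind PhQ Ph2 Ph
  split_ifs <;> ring

lemma smQ_summable (z : ℕ) : Summable (ind (Sm 1 z) (PhQ z)) := by
  have := ((harm2 1 z).sm z le_rfl).add ((sm_summable 1 z).mul_left (Vr 1 z))
  refine this.congr (fun m => ?_)
  rw [PhQ_eq]

lemma alQ_summable (t z : ℕ) : Summable (ind (Al 1 t z) (PhQ z)) :=
  summable_ind_of (smQ_summable z) (fun _ h => h.1)

lemma Q_le {t : ℕ} (ht : 1 ≤ t) (z : ℕ) (hz : 1 ≤ z) : ∑' m, ind (Al 1 t z) (PhQ z) m ≤ cV * Ed t z := by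
  have h1 : ∑' m, ind (Al 1 t z) (PhQ z) m = ∑' m, ind (Al 1 t z) (Ph2 1 z) m + Vr 1 z * Tf 1 t z := by
    rw [tsum_congr (PhQ_eq z _), Summable.tsum_add, tsum_mul_left]
    · rfl
    · exact summable_ind_of ((harm2 1 z).sm z le_rfl) (fun _ h => h.1)
    · exact (al_summable 1 t z).mul_left _
  have h2 := proc ht (Nat.zero_le z) (harm2 1 z)
  rw [tsum_al_zero ht] at h2
  have h3 : Ph2 1 0 1 = 0 := by simp [Ph2, Lg_zero, Vr_zero]
  rw [h3] at h2
  have h4 : ∑' m, ind (Al 1 t z) (Ph2 1 z) m ≤ ∑ d ∈ Dd 1 t 0 z, cV * (Wf 1 (t * d) / d * Real.log ((t * d : ℕ):ℝ) ^ 2) := by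
    have : ∑' m, ind (Al 1 t z) (Ph2 1 z) m = ∑ d ∈ Dd 1 t 0 z, -Ph2 1 (t*d) d := by
      rw [sum_neg_distrib]; linarith
    rw [this]
    apply sum_le_sum
    intro d hd
    have hd0 := Dd_pos ht hd
    rw [mem_Dd ht] at hd
    have hv := Vr_le (t * d) (by omega)
    have hW := Wf_pos 1 (t * d)
    unfold Ph2
    have e : -(Wf 1 (t * d) * ((Real.log d - Lg 1 (t * d)) ^ 2 - Vr 1 (t * d)) / d) =
      Wf 1 (t * d) / d * (Vr 1 (t*d) - (Real.log d - Lg 1 (t * d)) ^ 2) := by ring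
    rw [e, mul_left_comm]
    apply mul_le_mul_of_nonneg_left _ (by positivity)
    nlinarith [sq_nonneg (Real.log d - Lg 1 (t * d))]
  have h5 := Vr_le z hz
  have h6 := T_nonneg 1 t z
  rw [h1, Ed, mul_add, mul_sum]
  have h7 : Vr 1 z * Tf 1 t z ≤ cV * (Tf 1 t z * Real.log z ^ 2) := by
    calc _ ≤ cV * Real.log z ^ 2 * Tf 1 t z := mul_le_mul_of_nonneg_right h5 h6
      _ = _ := by ring
  linarith

lemma smQ_sum (z : ℕ) : ∑' m, ind (Sm 1 z) (PhQ z) m = Vr 1 z := by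
  rw [tsum_congr (PhQ_eq z _), Summable.tsum_add ((harm2 1 z).sm z le_rfl) ((sm_summable 1 z).mul_left _), tsum_mul_left, sm_sum]
  have h2 := proc (y := 1) (t := z + 1) (by omega) (Nat.zero_le z) (harm2 1 z)
  rw [tsum_al_zero (by omega), Dd_empty (by omega), ind_congr (fun n => al_of_lt (Nat.lt_succ_self z))] at h2
  have h3 : Ph2 1 0 1 = 0 := by simp [Ph2, Lg_zero, Vr_zero]
  rw [h3] at h2
  simp at h2
  rw [← h2]; ring

end

section
open Finset

lemma gg_lin (v : ℝ) (hv : 0 ≤ v) : |gg v - CC * (v + 1)| ≤ 625 / (v + 1) ^ 3 := by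
  have h := CC_spec (v + 1) (by linarith)
  have e : gg v - CC * (v + 1) = (v + 1) * (om (v + 1) - CC) := by
    unfold om
    rw [add_sub_cancel_right]
    field_simp
  rw [e, abs_mul, abs_of_pos (by linarith : 0 < v + 1)]
  calc (v + 1) * |om (v+1) - CC| ≤ (v + 1) * (625 / (v+1)^4) := mul_le_mul_of_nonneg_left h (by linarith)
    _ = _ := by field_simp

lemma Pz_neg {z : ℕ} {w : ℝ} (h : w < 0) : Pz z w = 0 := by
  unfold Pz
  have : ⌊Real.exp w⌋₊ = 0 := by
    rw [Nat.floor_eq_zero]; simpa using Real.exp_lt_exp.2 h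
  rw [this]
  have : rf z 0 = ∅ := by
    ext r; rw [mem_rf]; simp; omega
  simp [Og, this]

lemma point_bound {s Y L l p Cu : ℝ} (hs : 0 < s) (hY : 8 * s ≤ Y) (hL : L ≤ Y / 4) (hCu : 0 ≤ Cu)
    (h0 : l ≤ Y → |p - gg ((Y - l) / s)| ≤ Cu / s) (h1 : Y < l → p = 0) (hp : 0 ≤ p) :
    |s * p - CC * (Y + s - l)| ≤ Cu + 5000 * s ^ 4 / Y ^ 3 + 32 * (l - L) ^ 2 / Y := by
  obtain ⟨c1, c2⟩ := CC_bd
  have hY0 : 0 < Y := by linarith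
  have n1 : 0 ≤ 5000 * s ^ 4 / Y ^ 3 := by positivity
  have n2 : 0 ≤ 32 * (l - L) ^ 2 / Y := by positivity
  have h0' : l ≤ Y → |s * p - s * gg ((Y - l) / s)| ≤ Cu := by
    intro h
    rw [← mul_sub, abs_mul, abs_of_pos hs]
    calc s * |p - gg ((Y - l)/s)| ≤ s * (Cu / s) := mul_le_mul_of_nonneg_left (h0 h) hs.le
      _ = Cu := by field_simp
  rcases le_or_gt l (Y / 2) with hl | hl
  · have hlY : l ≤ Y := by linarith
    have a1 := h0' hlY
    set v := (Y - l) / s with hv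
    have hv1 : Y / 2 / s ≤ v := by rw [hv]; gcongr; linarith
    have hv0 : 0 ≤ v := le_trans (by positivity) hv1
    have a2 := gg_lin v hv0
    have a3 : 625 / (v + 1) ^ 3 ≤ 5000 * s ^ 3 / Y ^ 3 := by
      calc 625 / (v+1)^3 ≤ 625 / (Y / 2 / s) ^ 3 := by gcongr; linarith
        _ = _ := by field_simp; norm_num
    have e : s * gg v - CC * (Y + s - l) = s * (gg v - CC * (v + 1)) := by
      rw [hv]; field_simp; ring
    have a4 : |s * gg v - CC * (Y + s - l)| ≤ 5000 * s ^ 4 / Y ^ 3 := by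
      rw [e, abs_mul, abs_of_pos hs]
      calc s * |gg v - CC * (v+1)| ≤ s * (5000 * s ^ 3 / Y ^ 3) := mul_le_mul_of_nonneg_left (a2.trans a3) hs.le
        _ = _ := by ring
    rw [abs_le] at *
    constructor <;> linarith
  · have b1 : 4 * l ≤ 32 * (l - L) ^ 2 / Y := by
      rw [le_div_iff₀ hY0]
      have : l / 2 ≤ l - L := by linarith
      nlinarith
    have b2 : s * p ≤ 2 * l + Cu := by
      rcases le_or_gt l Y with h | h
      · have a1 := (abs_le.1 (h0' h)).2
        have a2 := gg_le ((Y - l) / s) (div_nonneg (by linarith) hs.le)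
        have a3 : s * gg ((Y-l)/s) ≤ Y - l + s := by
          calc s * gg ((Y-l)/s) ≤ s * ((Y-l)/s + 1) := mul_le_mul_of_nonneg_left a2 hs.le
            _ = _ := by field_simp
        linarith
      · rw [h1 h]; linarith
    have b3 : 0 ≤ s * p := by positivity
    rw [abs_le]
    constructor <;> nlinarith

lemma abs_main (U1 : ℝ) : ∃ Cu : ℝ, 0 ≤ Cu ∧ ∀ (z : ℕ) (Y : ℝ) (P : ℕ → Prop), 2 ≤ z → cL + 1 ≤ Real.log z →
    8 * Real.log z ≤ Y → Y ≤ U1 * Real.log z → (∀ m, P m → Sm 1 z m) →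
    |Real.log z * ∑' m, ind P (fun m => Ph 1 z m * Pz z (Y - Real.log m)) m -
      CC * ((Y + Real.log z - Lg 1 z) * (∑' m, ind P (Ph 1 z) m) - ∑' m, ind P (Ph1 1 z) m)| ≤
    (Cu + 5000 * Real.log z ^ 4 / Y ^ 3) * (∑' m, ind P (Ph 1 z) m) + 32 * (∑' m, ind P (PhQ z) m) / Y := by
  obtain ⟨Cu, hCu, H⟩ := Pz_gg U1
  refine ⟨Cu, hCu, fun z Y P hz hsl hY hYU hP => ?_⟩
  have hs : 0 < Real.log z := Real.log_pos (by exact_mod_cast hz)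
  have hL := Lg_upper (le_refl 1) (by omega : 1 ≤ z)
  simp only [Nat.cast_one, Real.log_one] at hL
  have S0 := summable_ind_of (sm_summable 1 z) hP
  have S1 := summable_ind_of (sm_summable1 1 z) hP
  have S2 := summable_ind_of (smQ_summable z) hP
  have SP : Summable (ind P (fun m => Ph 1 z m * Pz z (Y - Real.log m))) := by
    apply Summable.of_nonneg_of_le _ _ (S0.mul_right (Pz z Y))
    · exact ind_nonneg (fun m _ => mul_nonneg (Ph_nonneg _ _ _) (Pz_nonneg _ _))
    · intro m
      unfold ind
      split_ifs
      · apply mul_le_mul_of_nonneg_left _ (Ph_nonneg _ _ _)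
        apply Pz_mono
        have := Real.log_natCast_nonneg m
        linarith
      · simp
  set s := Real.log z with hsd
  have e1 : s * ∑' m, ind P (fun m => Ph 1 z m * Pz z (Y - Real.log m)) m -
      CC * ((Y + s - Lg 1 z) * (∑' m, ind P (Ph 1 z) m) - ∑' m, ind P (Ph1 1 z) m) =
      ∑' m, ind P (fun m => Ph 1 z m * (s * Pz z (Y - Real.log m) - CC * (Y + s - Real.log m))) m := by
    have f : ∀ m, ind P (fun m => Ph 1 z m * (s * Pz z (Y - Real.log m) - CC * (Y + s - Real.log m))) m =
        s * ind P (fun m => Ph 1 z m * Pz z (Y - Real.log m)) m -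
        ((CC * (Y + s - Lg 1 z)) * ind P (Ph 1 z) m - CC * ind P (Ph1 1 z) m) := by
      intro m; unfold ind Ph Ph1; split_ifs <;> ring
    rw [tsum_congr f, Summable.tsum_sub (SP.mul_left _) ((S0.mul_left _).sub (S1.mul_left _)),
      Summable.tsum_sub (S0.mul_left _) (S1.mul_left _), tsum_mul_left, tsum_mul_left, tsum_mul_left]
    ring
  rw [e1]
  have SR : Summable (fun m => (Cu + 5000 * s ^ 4 / Y ^ 3) * ind P (Ph 1 z) m + (32 / Y) * ind P (PhQ z) m) :=
    (S0.mul_left _).add (S2.mul_left _)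
  have hb : ∀ m, ‖ind P (fun m => Ph 1 z m * (s * Pz z (Y - Real.log m) - CC * (Y + s - Real.log m))) m‖ ≤
      (Cu + 5000 * s ^ 4 / Y ^ 3) * ind P (Ph 1 z) m + (32 / Y) * ind P (PhQ z) m := by
    intro m
    unfold ind
    split_ifs with h
    · have hm := (hP m h).1
      rw [Real.norm_eq_abs, abs_mul, abs_of_nonneg (Ph_nonneg _ _ _)]
      have := point_bound (s := s) (Y := Y) (L := Lg 1 z) (l := Real.log m) (p := Pz z (Y - Real.log m)) hs hY
        (by linarith) hCu (fun h => H z hz _ (by linarith) (by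
          have := Real.log_natCast_nonneg m
          linarith)) (fun h => Pz_neg (by linarith)) (Pz_nonneg _ _)
      calc _ ≤ Ph 1 z m * (Cu + 5000 * s ^ 4 / Y ^ 3 + 32 * (Real.log m - Lg 1 z) ^ 2 / Y) :=
            mul_le_mul_of_nonneg_left this (Ph_nonneg _ _ _)
        _ = _ := by unfold PhQ; ring
    · simp
  have := tsum_of_norm_bounded SR.hasSum hb
  rw [Real.norm_eq_abs] at this
  refine this.trans (le_of_eq ?_)
  rw [Summable.tsum_add (S0.mul_left _) (S2.mul_left _), tsum_mul_left, tsum_mul_left]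
  ring

end

section
open Finset

lemma Og_zero (z : ℕ) : Og z 0 = 0 := by
  have : rf z 0 = ∅ := by
    ext r; rw [mem_rf]; simp; omega
  simp [Og, this]

lemma rg_succ {z r : ℕ} (hp : (z+1).Prime) : Rg (z+1) r ↔ Rg z r ∧ ¬ (z+1) ∣ r := by
  constructor
  · rintro ⟨h0, h⟩
    exact ⟨⟨h0, fun p hp' hd => by have := h p hp' hd; omega⟩, fun hd => lt_irrefl _ (h _ hp hd)⟩
  · rintro ⟨⟨h0, h⟩, h2⟩
    refine ⟨h0, fun p hp' hd => ?_⟩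
    have := h p hp' hd
    rcases Nat.lt_or_ge (z+1) p with h3 | h3
    · exact h3
    · have : p = z + 1 := by omega
      exact absurd (this ▸ hd) h2

lemma rg_succ_np {z r : ℕ} (hp : ¬ (z+1).Prime) : Rg (z+1) r ↔ Rg z r := by
  constructor
  · rintro ⟨h0, h⟩
    exact ⟨h0, fun p hp' hd => by have := h p hp' hd; omega⟩
  · rintro ⟨h0, h⟩
    refine ⟨h0, fun p hp' hd => ?_⟩
    have := h p hp' hd
    rcases Nat.lt_or_ge (z+1) p with h3 | h3
    · exact h3
    · have : p = z + 1 := by omega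
      exact absurd (this ▸ hp') hp

lemma Og_rec {z : ℕ} (hp : (z+1).Prime) (M : ℕ) :
    Og z M = Og (z+1) M + 1 / ((z+1 : ℕ):ℝ) * Og z (M / (z+1)) := by
  classical
  have h1 : rf z M = rf (z+1) M ∪ (rf z (M/(z+1))).image (fun r => (z+1) * r) := by
    ext r
    rw [mem_union, mem_image, mem_rf, mem_rf]
    constructor
    · rintro ⟨⟨a, b⟩, c⟩
      by_cases hd : (z+1) ∣ r
      · right
        obtain ⟨q, rfl⟩ := hd
        refine ⟨q, ?_, rfl⟩
        rw [mem_rf]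
        refine ⟨⟨Nat.pos_of_mul_pos_left a, ?_⟩, (rg_mul.1 c).2⟩
        rw [Nat.le_div_iff_mul_le hp.pos]; linarith
      · left; exact ⟨⟨a, b⟩, (rg_succ hp).2 ⟨c, hd⟩⟩
    · rintro (⟨a, c⟩ | ⟨q, hq, rfl⟩)
      · exact ⟨a, ((rg_succ hp).1 c).1⟩
      · rw [mem_rf] at hq
        refine ⟨⟨Nat.mul_pos hp.pos hq.1.1, ?_⟩, rg_mul.2 ⟨⟨hp.ne_zero, fun p hp' hd => ?_⟩, hq.2⟩⟩
        · have := (Nat.le_div_iff_mul_le hp.pos).1 hq.1.2; linarith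
        · have := (Nat.prime_dvd_prime_iff_eq hp' hp).1 hd; omega
  have h2 : Disjoint (rf (z+1) M) ((rf z (M/(z+1))).image (fun r => (z+1) * r)) := by
    rw [disjoint_left]
    intro r hr hr'
    rw [mem_rf] at hr
    rw [mem_image] at hr'
    obtain ⟨q, _, rfl⟩ := hr'
    exact ((rg_succ hp).1 hr.2).2 ⟨q, rfl⟩
  unfold Og
  rw [h1, sum_union h2, sum_image, mul_sum]
  · congr 1
    apply sum_congr rfl
    intro r _
    push_cast
    rw [one_div_mul_one_div]
  · intro a _ b _ hab
    exact Nat.eq_of_mul_eq_mul_left hp.pos hab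

lemma Og_hasSum {z : ℕ} (hp : (z+1).Prime) (M : ℕ) :
    HasSum (fun k : ℕ => Og (z+1) (M / (z+1)^k) / ((z+1 : ℕ):ℝ)^k) (Og z M) := by
  induction M using Nat.strong_induction_on with
  | _ M ih =>
    rcases Nat.eq_zero_or_pos M with h | h
    · subst h
      simp only [Nat.zero_div, Og_zero, zero_div]
      exact hasSum_zero
    · have h1 := ih (M / (z+1)) (Nat.div_lt_self h hp.one_lt)
      rw [← hasSum_nat_add_iff' 1]
      have h2 := h1.mul_left (1 / ((z+1 : ℕ):ℝ))
      have e : Og z M - ∑ i ∈ range 1, Og (z+1) (M / (z+1)^i) / ((z+1 : ℕ):ℝ)^i = 1 / ((z+1 : ℕ):ℝ) * Og z (M / (z+1)) := by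
        rw [sum_range_one, Og_rec hp M]; simp
      rw [e]
      have e2 : (fun k : ℕ => Og (z+1) (M / (z+1)^(k+1)) / ((z+1 : ℕ):ℝ)^(k+1)) =
          fun k : ℕ => 1 / ((z+1 : ℕ):ℝ) * (Og (z+1) (M / (z+1) / (z+1)^k) / ((z+1 : ℕ):ℝ)^k) := by
        funext k
        rw [pow_succ' (z+1) k, ← Nat.div_div_eq_div_mul, pow_succ']
        field_simp
      rw [e2]
      exact h2

noncomputable def PhO (N : ℕ) (z m : ℕ) : ℝ := Og z (N / m) / m

lemma PhO_big {N z m : ℕ} (h : N < m) : PhO N z m = 0 := by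
  unfold PhO
  rw [Nat.div_eq_of_lt h, Og_zero, zero_div]

lemma harmO (N z1 : ℕ) : Harm 1 z1 (PhO N) := by
  refine ⟨?_, ?_, ?_⟩
  · intro z _
    apply summable_of_ne_finset_zero (s := range (N+1))
    intro m hm
    unfold ind
    rw [mem_range] at hm
    rw [PhO_big (by omega)]; simp
  · intro z _ hp _ m hm
    have h := (Og_hasSum hp (N / m)).div_const (m:ℝ)
    rw [show PhO N z m = Og z (N / m) / m from rfl, ← HasSum.tsum_eq h]
    apply tsum_congr
    intro k
    unfold PhO
    rw [Nat.div_div_eq_div_mul]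
    push_cast
    rw [div_div, mul_comm ((m:ℝ))]
  · intro z _ h m hm
    have hp : ¬ (z+1).Prime := by
      intro h'
      exact h ⟨h', h'.one_lt⟩
    unfold PhO Og
    congr 1
    have : rf (z+1) (N/m) = rf z (N/m) := by
      ext r; rw [mem_rf, mem_rf, rg_succ_np hp]
    rw [this]

lemma fe_ident {t : ℕ} (ht : 1 ≤ t) {z0 N : ℕ} (h : z0 ≤ t * N) :
    ∑' m, ind (Al 1 t z0) (PhO N z0) m = ∑ d ∈ Dd 1 t z0 (t * N), PhO N (t * d) d := by
  rw [proc ht h (harmO N (t * N))]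
  have : ∀ m, ind (Al 1 t (t * N)) (PhO N (t * N)) m = 0 := by
    intro m
    unfold ind
    split_ifs with hm
    · exact PhO_big (Nat.lt_of_mul_lt_mul_left hm.2.2)
    · rfl
  rw [tsum_congr this, tsum_zero, zero_add]

lemma sm_ident (z N : ℕ) : ∑' m, ind (Sm 1 z) (PhO N z) m = ∑ n ∈ Ioc 0 N, 1 / (n:ℝ) := by
  have h2 := proc (y := 1) (t := z + 1) (by omega) (Nat.zero_le z) (harmO N z)
  rw [tsum_al_zero (by omega), Dd_empty (by omega), ind_congr (fun n => al_of_lt (Nat.lt_succ_self z))] at h2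
  simp only [sum_empty, add_zero] at h2
  rw [← h2]
  unfold PhO Og
  have : rf 0 (N / 1) = Ioc 0 N := by
    ext r; rw [mem_rf, mem_Ioc, Nat.div_one]
    constructor
    · exact fun h => h.1
    · exact fun h => ⟨h, by omega, fun p hp _ => hp.pos⟩
  rw [this]; simp

lemma PhO_Pz {P : ℕ → Prop} {z : ℕ} (hP : ∀ m, P m → Sm 1 z m) (Y : ℝ) :
    ∑' m, ind P (fun m => Ph 1 z m * Pz z (Y - Real.log m)) m = Wf 1 z * ∑' m, ind P (PhO ⌊Real.exp Y⌋₊ z) m := by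
  rw [← tsum_mul_left]
  apply tsum_congr
  intro m
  unfold ind
  split_ifs with h
  · unfold PhO Ph Pz
    rw [floor_exp_div (Nat.pos_of_ne_zero (hP m h).1)]; ring
  · simp

lemma Wf10 (z : ℕ) : Wf 1 z = Wf 0 z := by
  have : pr 1 z = pr 0 z := by
    ext p; rw [mem_pr, mem_pr]
    constructor
    · exact fun h => ⟨h.1, h.1.pos, h.2.2⟩
    · exact fun h => ⟨h.1, h.1.one_lt, h.2.2⟩
  unfold Wf; rw [this]

lemma exists_log_ge (A : ℝ) : ∃ z0 : ℕ, 2 ≤ z0 ∧ ∀ z, z0 ≤ z → A ≤ Real.log z := by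
  obtain ⟨n, hn⟩ := exists_nat_gt (Real.exp A)
  refine ⟨max n 2, le_max_right _ _, fun z hz => ?_⟩
  have h1 : n ≤ z := (le_max_left _ _).trans hz
  have h2 : (n:ℝ) ≤ z := by exact_mod_cast h1
  rw [Real.le_log_iff_exp_le (lt_trans (Real.exp_pos A) (lt_of_lt_of_le hn h2))]
  linarith

lemma Lg_abs {z : ℕ} (hz : 1 ≤ z) : |Real.log z - Lg 1 z| ≤ cL + 1 := by
  have h1 := Lg_upper (le_refl 1) hz
  have h2 := Lg_lower (le_refl 1) hz
  simp only [Nat.cast_one, Real.log_one] at h1 h2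
  rw [abs_le]; constructor <;> linarith

theorem W_lim (ε : ℝ) (hε : 0 < ε) : ∃ z0 : ℕ, 2 ≤ z0 ∧ ∀ z, z0 ≤ z → |Wf 1 z * Real.log z - CC| ≤ ε := by
  have hcV := cV_pos
  have hcL := cL_pos
  obtain ⟨c1, c2⟩ := CC_bd
  obtain ⟨U, hU8, hU⟩ : ∃ U : ℝ, 8 ≤ U ∧ (5000 + 32 * cV) / U ≤ ε / 2 := by
    refine ⟨max 8 ((5000 + 32 * cV) / (ε / 2)), le_max_left _ _, ?_⟩
    rw [div_le_iff₀ (by positivity), ← div_le_iff₀' (by positivity)]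
    exact le_max_right _ _
  obtain ⟨Cu, hCu, H⟩ := abs_main U
  set B : ℝ := 1 + (cL + 1) + Cu with hB
  obtain ⟨z0, hz0, hz⟩ := exists_log_ge (max (cL + 1) (B / (ε / 2)))
  refine ⟨z0, hz0, fun z hzz => ?_⟩
  have hz2 : 2 ≤ z := hz0.trans hzz
  have hs1 := (le_max_left _ _).trans (hz z hzz)
  have hs2 := (le_max_right _ _).trans (hz z hzz)
  set s := Real.log z with hsd
  have hs : 0 < s := by linarith
  have hL := Lg_abs (by omega : 1 ≤ z)
  rw [← hsd] at hL
  set Y := U * s with hY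
  have hY0 : 0 < Y := by positivity
  have h := H z Y (Sm 1 z) hz2 hs1 (by rw [hY]; nlinarith) le_rfl (fun _ h => h)
  rw [PhO_Pz (fun _ h => h), sm_ident, sm_sum, sm_sum1, smQ_sum, ← hsd] at h
  set Hs := ∑ n ∈ Ioc 0 ⌊Real.exp Y⌋₊, 1 / (n:ℝ) with hHs
  have g1 := sum_inv_ge ⌊Real.exp Y⌋₊
  have g2 := sum_inv_le _ (floor_exp_ge hY0.le)
  have g3 := log_floor_le hY0.le
  have g4 := log_floor_ge hY0.le
  rw [← hHs] at g1 g2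
  have hW1 : Wf 1 z * s ≤ 1 := by rw [Wf10]; exact Wf_upper z
  have hW0 : 0 ≤ Wf 1 z * s := mul_nonneg (Wf_pos _ _).le hs.le
  set a := Wf 1 z * s with ha
  have hV := Vr_le z (by omega)
  rw [← hsd] at hV
  have e5 : 5000 * s ^ 4 / Y ^ 3 ≤ 5000 / U * s := by
    rw [hY]
    have : 5000 * s ^ 4 / (U * s) ^ 3 = 5000 / U ^ 3 * s := by field_simp
    rw [this]
    gcongr
    calc U = U ^ 1 := (pow_one U).symm
      _ ≤ U ^ 3 := pow_le_pow_right₀ (by linarith) (by norm_num)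
  have e6 : 32 * Vr 1 z / Y ≤ 32 * cV / U * s := by
    calc 32 * Vr 1 z / Y ≤ 32 * (cV * s ^ 2) / Y := by gcongr
      _ = _ := by rw [hY]; field_simp
  have key : |a * Y - CC * Y| ≤ B + (5000 + 32 * cV) / U * s := by
    have e7 : (5000 + 32 * cV) / U * s = 5000 / U * s + 32 * cV / U * s := by ring
    have e8 : s * (Wf 1 z * Hs) = a * Hs := by rw [ha]; ring
    rw [e8] at h
    have k1 : |a * (Hs - Y)| ≤ 1 := by
      rw [abs_mul, abs_of_nonneg hW0]
      have : |Hs - Y| ≤ 1 := by rw [abs_le]; constructor <;> linarith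
      nlinarith [abs_nonneg (Hs - Y)]
    have k2 : |CC * (s - Lg 1 z)| ≤ cL + 1 := by
      rw [abs_mul, abs_of_nonneg (by linarith)]
      nlinarith [abs_nonneg (s - Lg 1 z)]
    have e9 : a * Y - CC * Y = (a * Hs - CC * ((Y + s - Lg 1 z) * 1 - 0)) - a * (Hs - Y) + CC * (s - Lg 1 z) := by ring
    rw [e7, hB, e9]
    have t1 := abs_add_le ((a * Hs - CC * ((Y + s - Lg 1 z) * 1 - 0)) - a * (Hs - Y)) (CC * (s - Lg 1 z))
    have t2 := abs_sub (a * Hs - CC * ((Y + s - Lg 1 z) * 1 - 0)) (a * (Hs - Y))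
    linarith
  rw [← sub_mul, abs_mul, abs_of_pos hY0] at key
  have h9 : |a - CC| ≤ (B + (5000 + 32 * cV) / U * s) / Y := by rw [le_div_iff₀ hY0]; exact key
  refine h9.trans ?_
  rw [div_le_iff₀ hY0]
  have hB0 : 0 ≤ B := by rw [hB]; positivity
  have j1 : B ≤ ε / 2 * s := by rw [div_le_iff₀ (by positivity)] at hs2; linarith
  have j2 : (5000 + 32 * cV) / U * s ≤ ε / 2 * s := by gcongr
  have j3 : ε * s ≤ ε * Y := by rw [hY]; nlinarith [mul_pos hε hs]
  linarith

end

section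
open MeasureTheory

noncomputable def FF (t : ℕ) (X : ℝ) : ℝ := X * Tf 1 t ⌊Real.exp X⌋₊

lemma FF_nonneg (t : ℕ) {X : ℝ} (h : 0 ≤ X) : 0 ≤ FF t X := mul_nonneg h (T_nonneg _ _ _)

lemma FF_le {t : ℕ} (ht : 1 ≤ t) {X : ℝ} (h : 0 ≤ X) : FF t X ≤ cT t + 1 := by
  have h1 := log_floor_ge h
  have h2 := T_log ht ⌊Real.exp X⌋₊
  have h3 := T_le_one (y := 1) (z := ⌊Real.exp X⌋₊) ht
  have h4 := T_nonneg 1 t ⌊Real.exp X⌋₊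
  unfold FF
  nlinarith

lemma FF_meas (t : ℕ) : Measurable (FF t) := by
  unfold FF
  apply measurable_id.mul
  exact (measurable_from_nat (f := fun n => Tf 1 t n)).comp (Nat.measurable_floor.comp Real.measurable_exp)

lemma kkF_ii {t : ℕ} (ht : 1 ≤ t) {X U : ℝ} (hX : 0 ≤ X) (hU : 1 ≤ U) :
    IntervalIntegrable (fun u => kk u * FF t (X / u)) volume 1 U := by
  have h := kk_ii1 (le_refl (1:ℝ)) hU
  rw [intervalIntegrable_iff_integrableOn_Ioc_of_le hU] at *
  apply Integrable.mul_bdd (c := cT t + 1) h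
  · exact ((FF_meas t).comp (measurable_const.div measurable_id)).aestronglyMeasurable
  · filter_upwards [ae_restrict_mem measurableSet_Ioc] with u hu
    have : 0 ≤ X / u := div_nonneg hX (by linarith [hu.1])
    rw [Real.norm_eq_abs, abs_of_nonneg (FF_nonneg t this)]
    exact FF_le ht this

lemma int_ioi {f : ℝ → ℝ} {a U : ℝ} (h1 : 1 ≤ a) (hU : a ≤ U) :
    ∫ u in a..U, f u = ∫ u in (1:ℝ)..U, (Set.Ioi a).indicator f u := by
  rw [intervalIntegral.integral_of_le hU, intervalIntegral.integral_of_le (h1.trans hU),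
    MeasureTheory.integral_indicator measurableSet_Ioi, MeasureTheory.Measure.restrict_restrict measurableSet_Ioi]
  congr 2
  ext x
  simp only [Set.mem_inter_iff, Set.mem_Ioi, Set.mem_Ioc]
  constructor
  · exact fun h => ⟨h.1, by linarith [h.1], h.2⟩
  · exact fun h => ⟨h.1, h.2.2⟩

lemma Dd_filter {t : ℕ} (ht : 1 ≤ t) {z0 z E : ℕ} (h : z0 ≤ z) (g : ℕ → ℝ) :
    ∑ d ∈ Dd 1 t z E, g d = ∑ d ∈ Dd 1 t z0 E, if z < t * d then g d else 0 := by
  classical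
  rw [← Finset.sum_filter]
  apply Finset.sum_congr _ (fun _ _ => rfl)
  ext d
  rw [Finset.mem_filter, mem_Dd ht, mem_Dd ht]
  constructor
  · rintro ⟨a, b, c⟩; exact ⟨⟨a, by omega, c⟩, b⟩
  · rintro ⟨⟨a, b, c⟩, d⟩; exact ⟨a, d, c⟩

lemma floor_lt_iff {n : ℕ} (hn : 0 < n) (w : ℝ) : ⌊Real.exp w⌋₊ < n ↔ w < Real.log n := by
  rw [Nat.floor_lt (Real.exp_pos _).le, Real.lt_log_iff_exp_lt (by exact_mod_cast hn)]

lemma le_floor_iff' {n : ℕ} (hn : 0 < n) (w : ℝ) : n ≤ ⌊Real.exp w⌋₊ ↔ Real.log n ≤ w := by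
  rw [← not_lt, floor_lt_iff hn, not_lt]

/-- Abel summation step -/
lemma abel {t : ℕ} (ht : 1 ≤ t) {z0 : ℕ} (hz : 2 ≤ z0) {X : ℝ} (hX : Real.log z0 ≤ X) :
    X * ∑ d ∈ Dd 1 t z0 ⌊Real.exp X⌋₊, Wf 1 (t * d) / d * om (X / Real.log ((t * d : ℕ):ℝ)) =
    om (X / Real.log z0) * (X * Tf 1 t z0) - FF t X + ∫ u in (1:ℝ)..(X / Real.log z0), kk u * FF t (X / u) := by
  have hs : 0 < Real.log z0 := Real.log_pos (by exact_mod_cast hz)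
  have hX0 : 0 < X := by linarith
  set U := X / Real.log z0 with hU
  have hU1 : 1 ≤ U := by rw [hU, le_div_iff₀ hs]; linarith
  set E := ⌊Real.exp X⌋₊ with hE
  have hzE : z0 ≤ E := by rw [hE, le_floor_iff' (by omega)]; exact hX
  have hTs := T_step (y := 1) ht hzE
  have hd : ∀ d ∈ Dd 1 t z0 E, 1 ≤ X / Real.log ((t * d : ℕ):ℝ) ∧ X / Real.log ((t * d : ℕ):ℝ) ≤ U ∧
      0 < Real.log ((t * d : ℕ):ℝ) := by
    intro d hd
    rw [mem_Dd ht] at hd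
    have h1 : Real.log z0 ≤ Real.log ((t * d : ℕ):ℝ) :=
      Real.log_le_log (by exact_mod_cast (by omega : 0 < z0)) (by exact_mod_cast hd.2.1.le)
    have h2 : Real.log ((t * d : ℕ):ℝ) ≤ X := (le_floor_iff' (by omega) X).1 hd.2.2
    have h3 : 0 < Real.log ((t * d : ℕ):ℝ) := by linarith
    refine ⟨by rw [le_div_iff₀ h3]; linarith, ?_, h3⟩
    rw [hU]; gcongr
  have e1 : ∀ d ∈ Dd 1 t z0 E, Wf 1 (t * d) / d * om (X / Real.log ((t * d : ℕ):ℝ)) =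
      om U * (Wf 1 (t * d) / d) + ∫ u in (1:ℝ)..U, Wf 1 (t * d) / d *
        (Set.Ioi (X / Real.log ((t * d : ℕ):ℝ))).indicator (fun u => kk u / u) u := by
    intro d h
    obtain ⟨h1, h2, h3⟩ := hd d h
    rw [intervalIntegral.integral_const_mul, ← int_ioi h1 h2, ← om_int h1 h2]
    ring
  rw [Finset.sum_congr rfl e1, Finset.sum_add_distrib, ← Finset.mul_sum, ← intervalIntegral.integral_finsetSum]
  swap
  · intro d h
    apply IntervalIntegrable.const_mul
    have := kkd_ii (le_refl (1:ℝ)) hU1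
    rw [intervalIntegrable_iff_integrableOn_Ioc_of_le hU1] at *
    exact Integrable.indicator this measurableSet_Ioi
  have e2 : ∫ u in (1:ℝ)..U, ∑ d ∈ Dd 1 t z0 E, Wf 1 (t * d) / d *
        (Set.Ioi (X / Real.log ((t * d : ℕ):ℝ))).indicator (fun u => kk u / u) u =
      ∫ u in (1:ℝ)..U, (X⁻¹ * (kk u * FF t (X / u)) - Tf 1 t E * (kk u / u)) := by
    apply intervalIntegral.integral_congr
    intro u hu
    rw [Set.uIcc_of_le hU1] at hu
    have hu0 : 0 < u := by linarith [hu.1]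
    show ∑ d ∈ Dd 1 t z0 E, Wf 1 (t * d) / d *
        (Set.Ioi (X / Real.log ((t * d : ℕ):ℝ))).indicator (fun u => kk u / u) u = X⁻¹ * (kk u * FF t (X / u)) - Tf 1 t E * (kk u / u)
    have h1 : z0 ≤ ⌊Real.exp (X / u)⌋₊ := by
      rw [le_floor_iff' (by omega), le_div_iff₀ hu0, mul_comm, ← le_div_iff₀ hs]; exact hu.2
    have h2 : ⌊Real.exp (X / u)⌋₊ ≤ E := by
      apply Nat.floor_le_floor
      apply Real.exp_le_exp.2
      exact div_le_self hX0.le hu.1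
    have h3 := T_step (y := 1) ht h2
    rw [Dd_filter ht h1] at h3
    have h4 : X⁻¹ * (kk u * FF t (X / u)) = kk u / u * Tf 1 t ⌊Real.exp (X / u)⌋₊ := by
      unfold FF; field_simp
    rw [h4, h3, mul_add, Finset.mul_sum, mul_comm (Tf 1 t E), add_sub_cancel_left]
    apply Finset.sum_congr rfl
    intro d hdd
    obtain ⟨g1, g2, g3⟩ := hd d hdd
    have hpos : 0 < t * d := by
      have := (mem_Dd ht).1 hdd
      omega
    have h5 : u ∈ Set.Ioi (X / Real.log ((t * d : ℕ):ℝ)) ↔ ⌊Real.exp (X / u)⌋₊ < t * d := by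
      rw [floor_lt_iff hpos, Set.mem_Ioi, div_lt_iff₀ g3, div_lt_iff₀ hu0, mul_comm]
    by_cases hc : ⌊Real.exp (X / u)⌋₊ < t * d
    · rw [if_pos hc, Set.indicator_of_mem (h5.2 hc)]; ring
    · rw [if_neg hc, Set.indicator_of_notMem (fun h => hc (h5.1 h))]; ring
  rw [e2, intervalIntegral.integral_sub ((kkF_ii ht hX0.le hU1).const_mul _) ((kkd_ii le_rfl hU1).const_mul _),
    intervalIntegral.integral_const_mul, intervalIntegral.integral_const_mul, ← om_int le_rfl hU1,
    om_lt2 1 (by norm_num), hTs]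
  have : FF t X = X * Tf 1 t E := rfl
  rw [this]
  field_simp
  ring

end

section
open MeasureTheory

/-- right side termwise -/
lemma right_term {t : ℕ} (ht : 1 ≤ t) {Cu δ X U1 : ℝ} (hCu : 0 ≤ Cu)
    (H : ∀ z : ℕ, 2 ≤ z → ∀ w, 0 ≤ w → w ≤ U1 * Real.log z → |Pz z w - gg (w / Real.log z)| ≤ Cu / Real.log z)
    (hδ : δ ≤ 0.04) {z0 : ℕ} (hz0 : 2 ≤ z0)
    (HW : ∀ z, z0 ≤ z → |Wf 1 z * Real.log z - CC| ≤ δ) (hX : X ≤ U1 * Real.log z0)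
    (hU1 : 0 ≤ U1) {d : ℕ} (hd : d ∈ Dd 1 t z0 ⌊Real.exp X⌋₊) :
    |PhO ⌊Real.exp (X - Real.log t)⌋₊ (t * d) d - X / CC * (Wf 1 (t * d) / d * om (X / Real.log ((t * d : ℕ):ℝ)))|
      ≤ (2 * Cu + 4 * δ * X) * (Wf 1 (t * d) / d) := by
  obtain ⟨c1, c2⟩ := CC_bd
  rw [mem_Dd ht] at hd
  obtain ⟨hd1, hd2, hd3⟩ := hd
  have hd0 : 0 < d := Nat.pos_of_ne_zero hd1.1
  have htd : 0 < t * d := by positivity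
  have hW := HW (t * d) hd2.le
  have hWp := Wf_pos 1 (t * d)
  have hv3 : Real.log ((t * d : ℕ):ℝ) ≤ X := (le_floor_iff' htd X).1 hd3
  have hsv : Real.log z0 ≤ Real.log ((t * d : ℕ):ℝ) :=
    Real.log_le_log (by exact_mod_cast (by omega : 0 < z0)) (by exact_mod_cast hd2.le)
  have hs : 0 < Real.log z0 := Real.log_pos (by exact_mod_cast hz0)
  have hlog : Real.log ((t * d : ℕ):ℝ) = Real.log t + Real.log d := by
    push_cast
    rw [Real.log_mul (by positivity) (by positivity)]
  have hN : PhO ⌊Real.exp (X - Real.log t)⌋₊ (t * d) d = Pz (t * d) (X - Real.log ((t * d : ℕ):ℝ)) / d := by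
    unfold PhO Pz
    rw [floor_exp_div hd0, hlog]
    ring_nf
  set v := Real.log ((t * d : ℕ):ℝ) with hv
  set W := Wf 1 (t * d) with hWd
  have hv0 : 0 < v := by linarith
  have hX0 : 0 < X := by linarith
  have hP := H (t * d) (by omega) (X - v) (by linarith) (by
    rw [← hv]; have := mul_le_mul_of_nonneg_left hsv hU1; linarith)
  rw [← hv] at hP
  have hu1 : 1 ≤ X / v := by rw [le_div_iff₀ hv0]; linarith
  have hg : gg ((X - v) / v) = X / v * om (X / v) := by
    unfold om
    have : (X - v) / v = X / v - 1 := by field_simp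
    rw [this]
    field_simp
  rw [hg] at hP
  have ho0 := om_nonneg _ hu1
  have ho1 := om_le _ hu1
  set P := Pz (t * d) (X - v)
  set o := om (X / v)
  have hδ0 : 0 ≤ δ := (abs_nonneg _).trans hW
  have hiv : 1 / v ≤ 2 * W := by
    rw [div_le_iff₀ hv0]
    have := (abs_le.1 hW).1
    nlinarith
  have hdr : (0:ℝ) < d := by exact_mod_cast hd0
  have key : |P - X / CC * (W * o)| ≤ (2 * Cu + 4 * δ * X) * W := by
    have e : P - X / CC * (W * o) = (P - X / v * o) + o * X * (1 / CC) * (1 / v) * (-(W * v - CC)) := by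
      have : CC ≠ 0 := by linarith
      field_simp
      ring
    rw [e]
    refine (abs_add_le _ _).trans ?_
    have h1 : Cu / v ≤ 2 * Cu * W := by
      have := mul_le_mul_of_nonneg_left hiv hCu
      calc Cu / v = Cu * (1 / v) := by ring
        _ ≤ _ := by linarith
    have hC1 : 1 / CC ≤ 2 := by rw [div_le_iff₀ (by linarith)]; linarith
    have h2 : |o * X * (1 / CC) * (1 / v) * (-(W * v - CC))| ≤ 1 * X * 2 * (2 * W) * δ := by
      rw [abs_mul, abs_neg]
      have hC0 : 0 ≤ 1 / CC := by positivity
      have hv1 : 0 ≤ 1 / v := by positivity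
      rw [abs_of_nonneg (by positivity : 0 ≤ o * X * (1 / CC) * (1 / v))]
      gcongr
    linarith
  rw [hN]
  have e : P / d - X / CC * (W / d * o) = (P - X / CC * (W * o)) / d := by ring
  rw [e, abs_div, abs_of_pos hdr]
  calc _ ≤ (2 * Cu + 4 * δ * X) * W / d := by gcongr
    _ = _ := by ring

lemma right_sum {t : ℕ} (ht : 1 ≤ t) {Cu δ X U1 : ℝ} (hCu : 0 ≤ Cu)
    (H : ∀ z : ℕ, 2 ≤ z → ∀ w, 0 ≤ w → w ≤ U1 * Real.log z → |Pz z w - gg (w / Real.log z)| ≤ Cu / Real.log z)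
    (hδ : δ ≤ 0.04) {z0 : ℕ} (hz0 : 2 ≤ z0)
    (HW : ∀ z, z0 ≤ z → |Wf 1 z * Real.log z - CC| ≤ δ) (hX : X ≤ U1 * Real.log z0)
    (hU1 : 0 ≤ U1) (hX1 : Real.log z0 ≤ X) :
    |∑ d ∈ Dd 1 t z0 ⌊Real.exp X⌋₊, PhO ⌊Real.exp (X - Real.log t)⌋₊ (t * d) d -
      (X * ∑ d ∈ Dd 1 t z0 ⌊Real.exp X⌋₊, Wf 1 (t * d) / d * om (X / Real.log ((t * d : ℕ):ℝ))) / CC|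
      ≤ (2 * Cu + 4 * δ * X) * Tf 1 t z0 := by
  have hs : 0 < Real.log z0 := Real.log_pos (by exact_mod_cast hz0)
  have hδ0 : 0 ≤ δ := (abs_nonneg _).trans (HW z0 le_rfl)
  have hX0 : 0 < X := by linarith
  have e : (X * ∑ d ∈ Dd 1 t z0 ⌊Real.exp X⌋₊, Wf 1 (t * d) / d * om (X / Real.log ((t * d : ℕ):ℝ))) / CC
    = ∑ d ∈ Dd 1 t z0 ⌊Real.exp X⌋₊, X / CC * (Wf 1 (t * d) / d * om (X / Real.log ((t * d : ℕ):ℝ))) := by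
    rw [← Finset.mul_sum]; ring
  rw [e, ← Finset.sum_sub_distrib]
  refine (Finset.abs_sum_le_sum_abs _ _).trans ?_
  refine (Finset.sum_le_sum (fun d hd => right_term ht hCu H hδ hz0 HW hX hU1 hd)).trans ?_
  rw [← Finset.mul_sum]
  have hzE : z0 ≤ ⌊Real.exp X⌋₊ := by rw [le_floor_iff' (by omega)]; exact hX1
  have h1 := T_step (y := 1) ht hzE
  have h2 := T_nonneg 1 t ⌊Real.exp X⌋₊
  apply mul_le_mul_of_nonneg_left
  · linarith
  · positivity

lemma Dd_floor {t : ℕ} (ht : 1 ≤ t) (z0 : ℕ) (X : ℝ) :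
    Dd 1 t z0 (t * ⌊Real.exp (X - Real.log t)⌋₊) = Dd 1 t z0 ⌊Real.exp X⌋₊ := by
  rw [← floor_exp_div (by omega : 0 < t)]
  ext d
  rw [mem_Dd ht, mem_Dd ht]
  have : t * d ≤ t * (⌊Real.exp X⌋₊ / t) ↔ t * d ≤ ⌊Real.exp X⌋₊ := by
    rw [Nat.mul_le_mul_left_iff (by omega), Nat.le_div_iff_mul_le (by omega), mul_comm]
  rw [this]

lemma om_M {t : ℕ} (ht : 1 ≤ t) {z0 : ℕ} (hz0 : 2 ≤ z0) {X : ℝ} (hX1 : Real.log z0 ≤ X) :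
    ∑ d ∈ Dd 1 t z0 ⌊Real.exp X⌋₊, Wf 1 (t * d) / d * om (X / Real.log ((t * d : ℕ):ℝ)) ≤ Tf 1 t z0 := by
  have hs : 0 < Real.log z0 := Real.log_pos (by exact_mod_cast hz0)
  have hzE : z0 ≤ ⌊Real.exp X⌋₊ := by rw [le_floor_iff' (by omega)]; exact hX1
  have h1 := T_step (y := 1) ht hzE
  have h2 := T_nonneg 1 t ⌊Real.exp X⌋₊
  have : ∑ d ∈ Dd 1 t z0 ⌊Real.exp X⌋₊, Wf 1 (t * d) / d * om (X / Real.log ((t * d : ℕ):ℝ)) ≤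
      ∑ d ∈ Dd 1 t z0 ⌊Real.exp X⌋₊, Wf 1 (t * d) / d := by
    apply Finset.sum_le_sum
    intro d hd
    rw [mem_Dd ht] at hd
    obtain ⟨hd1, hd2, hd3⟩ := hd
    have hd0 : 0 < d := Nat.pos_of_ne_zero hd1.1
    have htd : 0 < t * d := by positivity
    have hv3 : Real.log ((t * d : ℕ):ℝ) ≤ X := (le_floor_iff' htd X).1 hd3
    have hsv : Real.log z0 ≤ Real.log ((t * d : ℕ):ℝ) :=
      Real.log_le_log (by exact_mod_cast (by omega : 0 < z0)) (by exact_mod_cast hd2.le)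
    have := om_le (X / Real.log ((t * d : ℕ):ℝ)) (by rw [le_div_iff₀ (by linarith)]; linarith)
    have hW : 0 ≤ Wf 1 (t * d) / d := div_nonneg (Wf_pos 1 _).le (Nat.cast_nonneg _)
    nlinarith
  linarith

noncomputable def cA (t : ℕ) : ℝ := (40625 + 192 * cV) * cT t

set_option maxHeartbeats 2000000 in
theorem F_eq {t : ℕ} (ht : 1 ≤ t) (U1 : ℝ) (hU1 : 16 ≤ U1) (ε : ℝ) (hε : 0 < ε) :
    ∃ z1 : ℕ, 2 ≤ z1 ∧ ∀ z0, z1 ≤ z0 → ∀ X : ℝ, 16 * Real.log z0 ≤ X → X ≤ U1 * Real.log z0 →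
    |FF t X - CC * Kf 1 t z0 - ∫ u in (1:ℝ)..(X / Real.log z0), kk u * FF t (X / u)| ≤
      cA t / (X / Real.log z0) + ε := by
  obtain ⟨c1, c2⟩ := CC_bd
  have hcT := cT_pos ht
  have hcV := cV_pos
  have hcL := cL_pos
  obtain ⟨Cu, hCu, HL⟩ := abs_main U1
  obtain ⟨Cv, hCv, HR⟩ := Pz_gg U1
  have hlt : 0 ≤ Real.log t := Real.log_nonneg (by exact_mod_cast ht)
  set B := (Cu + 6 * Cv + Real.log t + cL + 1) * cT t + 64 * cV * |Ed t 2| with hB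
  obtain ⟨δ, hδ0, hδ1, hδ2⟩ : ∃ δ : ℝ, 0 < δ ∧ δ ≤ 0.04 ∧ 7 * δ * (U1 * cT t) ≤ ε / 2 := by
    refine ⟨min 0.04 (ε / (14 * (U1 * cT t))), lt_min (by norm_num) (by positivity), min_le_left _ _, ?_⟩
    have := min_le_right (0.04:ℝ) (ε / (14 * (U1 * cT t)))
    rw [le_div_iff₀ (by positivity)] at this
    linarith
  obtain ⟨za, hza, HW⟩ := W_lim δ hδ0
  obtain ⟨zb, hzb, Hb⟩ := exists_log_ge (max (max (cL + 1) (Real.log t)) (2 * B / ε))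
  refine ⟨max za zb, hza.trans (le_max_left _ _), fun z0 hz0 X hX1 hX2 => ?_⟩
  have hz2 : 2 ≤ z0 := hza.trans ((le_max_left _ _).trans hz0)
  have hs1 := Hb z0 ((le_max_right _ _).trans hz0)
  have hsc : cL + 1 ≤ Real.log z0 := (le_max_left _ _).trans ((le_max_left _ _).trans hs1)
  have hst : Real.log t ≤ Real.log z0 := (le_max_right _ _).trans ((le_max_left _ _).trans hs1)
  have hsB : 2 * B / ε ≤ Real.log z0 := (le_max_right _ _).trans hs1
  have hL := Lg_abs (by omega : 1 ≤ z0)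
  have hT1 := T_log ht z0
  have hQ1 := Q_le ht z0 (by omega)
  have hQ2 := Ed_le ht z0 hz2
  have hHW : ∀ z, z0 ≤ z → |Wf 1 z * Real.log z - CC| ≤ δ := fun z hz => HW z ((le_max_left _ _).trans (hz0.trans hz))
  have ha := hHW z0 le_rfl
  have hs : 0 < Real.log z0 := by linarith
  have hRs := right_sum ht hCv HR hδ1 hz2 hHW hX2 (by linarith) (by linarith)
  have hab := abel ht hz2 (X := X) (by linarith)
  have hM := om_M ht hz2 (X := X) (by linarith)
  have hAl : ∀ m, Al 1 t z0 m → Sm 1 z0 m := fun m h => h.1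
  have hYle : X - Real.log t ≤ U1 * Real.log z0 := by linarith
  have hHL := HL z0 (X - Real.log t) (Al 1 t z0) hz2 hsc (by linarith) hYle hAl
  rw [PhO_Pz hAl] at hHL
  have hfe := fe_ident (N := ⌊Real.exp (X - Real.log t)⌋₊) (z0 := z0) ht (by
    have : z0 ≤ ⌊Real.exp (X - Real.log t)⌋₊ := by rw [le_floor_iff' (by omega)]; linarith
    nlinarith)
  rw [Dd_floor ht] at hfe
  rw [← hfe] at hRs
  rw [hab] at hRs
  rw [show (∑' m, ind (Al 1 t z0) (Ph 1 z0) m) = Tf 1 t z0 from rfl,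
    show (∑' m, ind (Al 1 t z0) (Ph1 1 z0) m) = Kf 1 t z0 from rfl] at hHL
  have hS2 := congrArg id hab
  simp only [id] at hS2
  have hTn := T_nonneg 1 t z0
  have hU16 : 16 ≤ X / Real.log z0 := by rw [le_div_iff₀ hs]; exact hX1
  have hom := CC_spec (X / Real.log z0) (by linarith)
  set S := ∑' m, ind (Al 1 t z0) (PhO ⌊Real.exp (X - Real.log t)⌋₊ z0) m with hSd
  set M := ∑ d ∈ Dd 1 t z0 ⌊Real.exp X⌋₊, Wf 1 (t * d) / d * om (X / Real.log ((t * d : ℕ):ℝ)) with hMd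
  set I := ∫ u in (1:ℝ)..(X / Real.log z0), kk u * FF t (X / u) with hI
  set Q := ∑' m, ind (Al 1 t z0) (PhQ z0) m with hQd
  set K := Kf 1 t z0
  set T := Tf 1 t z0
  set s := Real.log z0
  set W := Wf 1 z0
  set L := Lg 1 z0
  set F := FF t X
  set o := om (X / s)
  set lt := Real.log t
  have hX0 : 0 < X := by linarith
  have hXT : X * T ≤ U1 * cT t := by
    calc X * T ≤ U1 * s * T := by gcongr
      _ = U1 * (T * s) := by ring
      _ ≤ _ := by gcongr
  have hTs : T ≤ cT t / s := by rw [le_div_iff₀ hs]; exact hT1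
  have hQ : Q ≤ cV * (|Ed t 2| + 3 * cT t * s) := hQ1.trans (mul_le_mul_of_nonneg_left hQ2 hcV.le)
  -- bound S
  have hRs' : |CC * S - X * M| ≤ (2 * Cv + 4 * δ * X) * T := by
    have e : CC * S - X * M = CC * (S - (o * (X * T) - F + I) / CC) := by
      rw [hS2]
      have : CC ≠ 0 := by linarith
      field_simp
    rw [e, abs_mul, abs_of_pos (by linarith : 0 < CC)]
    have h0 : 0 ≤ (2 * Cv + 4 * δ * X) * T := by positivity
    nlinarith
  have hSb : δ * S ≤ (3 * δ * X + 4 * Cv) * T := by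
    have h1 := (abs_le.1 hRs').2
    have h2 : X * M ≤ X * T := by gcongr
    have h3 : CC * S ≤ (X + 2 * Cv + 4 * δ * X) * T := by linarith
    have h4 : 4 * δ * X * T ≤ 0.16 * (X * T) := by
      have : 0 ≤ X * T := by positivity
      nlinarith
    have h6 : S ≤ (3 * X + 4 * Cv) * T := by
      by_contra hcon
      push Not at hcon
      have hp : 0 ≤ (3 * X + 4 * Cv) * T := by positivity
      have : 0 ≤ X * T := by positivity
      have : 0 ≤ Cv * T := by positivity
      nlinarith
    have h7 := mul_le_mul_of_nonneg_left h6 hδ0.le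
    have : 0 ≤ Cv * T := by positivity
    nlinarith
  have hSn : 0 ≤ S := by
    rw [hSd]; apply tsum_nonneg; apply ind_nonneg
    intro n _
    unfold PhO
    exact div_nonneg (Og_nonneg _ _) (Nat.cast_nonneg _)
  have key : F - CC * K - I = (o - CC) * (X * T) - (s * (W * S) - CC * ((X - lt + s - L) * T - K))
      + (W * s - CC) * S - CC * ((s - L - lt) * T) + (CC * S - X * M) := by
    rw [hS2]; ring
  have b1 : |(o - CC) * (X * T)| ≤ 625 * cT t / (X / s) := by
    rw [abs_mul, abs_of_nonneg (by positivity : 0 ≤ X * T)]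
    have h1 : X * T ≤ cT t * (X / s) := by
      calc X * T ≤ X * (cT t / s) := by gcongr
        _ = _ := by ring
    set U := X / s
    calc |o - CC| * (X * T) ≤ 625 / U ^ 4 * (cT t * U) := by gcongr
      _ = 625 * cT t / U * (1 / U ^ 2) := by field_simp
      _ ≤ 625 * cT t / U * 1 := by
        gcongr
        rw [div_le_one (by positivity)]
        nlinarith
      _ = _ := by ring
  have b2 : (Cu + 5000 * s ^ 4 / (X - lt) ^ 3) * T + 32 * Q / (X - lt) ≤
      (Cu * cT t + 64 * cV * |Ed t 2|) / s + (40000 + 192 * cV) * cT t / (X / s) := by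
    have hY : X / 2 ≤ X - lt := by linarith
    have h1 : 5000 * s ^ 4 / (X - lt) ^ 3 ≤ 40000 * s * (1 / (X / s)) := by
      calc 5000 * s ^ 4 / (X - lt) ^ 3 ≤ 5000 * s ^ 4 / (X / 2) ^ 3 := by gcongr
        _ = 40000 * s * (1 / (X / s)) * (1 / (X / s)) ^ 2 := by field_simp; norm_num
        _ ≤ 40000 * s * (1 / (X / s)) * 1 := by
          gcongr
          apply pow_le_one₀ (by positivity)
          rw [div_le_one (by positivity)]; linarith
        _ = _ := by ring
    have h2 : 32 * Q / (X - lt) ≤ 64 * cV * |Ed t 2| / s + 192 * cV * cT t / (X / s) := by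
      have hq0 : 0 ≤ |Ed t 2| := abs_nonneg _
      calc 32 * Q / (X - lt) ≤ 32 * (cV * (|Ed t 2| + 3 * cT t * s)) / (X - lt) := by
            apply div_le_div_of_nonneg_right _ (by linarith); linarith
        _ ≤ 32 * (cV * (|Ed t 2| + 3 * cT t * s)) / (X / 2) := by gcongr
        _ = 64 * cV * |Ed t 2| / X + 192 * cV * cT t / (X / s) := by field_simp; ring
        _ ≤ _ := by gcongr; linarith
    have h3 : (Cu + 5000 * s ^ 4 / (X - lt) ^ 3) * T ≤ (Cu + 40000 * s * (1 / (X / s))) * (cT t / s) := by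
      gcongr
    have e : (Cu + 40000 * s * (1 / (X / s))) * (cT t / s) = Cu * cT t / s + 40000 * cT t / (X / s) := by
      field_simp
    rw [e] at h3
    calc _ ≤ (Cu * cT t / s + 40000 * cT t / (X / s)) + (64 * cV * |Ed t 2| / s + 192 * cV * cT t / (X / s)) := by
          linarith
      _ = _ := by ring
  have b3 : |(W * s - CC) * S| ≤ (3 * δ * X + 4 * Cv) * T := by
    rw [abs_mul, abs_of_nonneg hSn]
    exact (mul_le_mul_of_nonneg_right ha hSn).trans hSb
  have b4 : |CC * ((s - L - lt) * T)| ≤ (lt + cL + 1) * T := by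
    rw [abs_mul, abs_mul, abs_of_nonneg hTn, abs_of_pos (by linarith : 0 < CC)]
    have h1 : |s - L - lt| ≤ cL + 1 + lt := by
      have := abs_sub (s - L) lt
      rw [abs_of_nonneg hlt] at this
      linarith
    have h2 : |s - L - lt| * T ≤ (cL + 1 + lt) * T := by gcongr
    have h3 : 0 ≤ |s - L - lt| * T := by positivity
    nlinarith
  have hBs : B / s ≤ ε / 2 := by
    rw [div_le_iff₀ hε] at hsB
    rw [div_le_iff₀ hs]
    linarith
  have hTc : (lt + cL + 1 + 6 * Cv) * T ≤ (lt + cL + 1 + 6 * Cv) * cT t / s := by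
    calc _ ≤ (lt + cL + 1 + 6 * Cv) * (cT t / s) := by gcongr
      _ = _ := by ring
  have hBe : B / s = (Cu * cT t + 64 * cV * |Ed t 2|) / s + (lt + cL + 1 + 6 * Cv) * cT t / s := by
    rw [hB]; ring
  have hcAe : cA t / (X / s) = 625 * cT t / (X / s) + (40000 + 192 * cV) * cT t / (X / s) := by
    unfold cA; ring
  have hδX : 7 * δ * (X * T) ≤ ε / 2 := by
    have : 7 * δ * (X * T) ≤ 7 * δ * (U1 * cT t) := by gcongr
    linarith
  have hHL' : |s * (W * S) - CC * ((X - lt + s - L) * T - K)| ≤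
    (Cu * cT t + 64 * cV * |Ed t 2|) / s + (40000 + 192 * cV) * cT t / (X / s) := hHL.trans b2
  rw [key, hcAe]
  have t1 := abs_add_le ((o - CC) * (X * T) - (s * (W * S) - CC * ((X - lt + s - L) * T - K))
      + (W * s - CC) * S - CC * ((s - L - lt) * T)) (CC * S - X * M)
  have t2 := abs_sub ((o - CC) * (X * T) - (s * (W * S) - CC * ((X - lt + s - L) * T - K))
      + (W * s - CC) * S) (CC * ((s - L - lt) * T))
  have t3 := abs_add_le ((o - CC) * (X * T) - (s * (W * S) - CC * ((X - lt + s - L) * T - K)))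
      ((W * s - CC) * S)
  have t4 := abs_sub ((o - CC) * (X * T)) (s * (W * S) - CC * ((X - lt + s - L) * T - K))
  linarith

end

section
open MeasureTheory Filter Topology

lemma T_lim {t : ℕ} (ht : 1 ≤ t) (ε : ℝ) (hε : 0 < ε) : ∃ z0 : ℕ, 2 ≤ z0 ∧ ∀ z, z0 ≤ z → Tf 1 t z ≤ ε := by
  obtain ⟨z0, h2, h⟩ := exists_log_ge (cT t / ε)
  refine ⟨z0, h2, fun z hz => ?_⟩
  have h1 := h z hz
  have h3 := T_log ht z
  have hc := cT_pos ht
  have hl : 0 < Real.log z := lt_of_lt_of_le (by positivity) h1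
  rw [div_le_iff₀ hε] at h1
  have h4 : Tf 1 t z * Real.log z ≤ ε * Real.log z := by linarith
  exact le_of_mul_le_mul_right h4 hl

noncomputable def kq (t : ℕ) : ℝ := Real.log t + cL + 1

lemma kq_pos {t : ℕ} (ht : 1 ≤ t) : 0 < kq t := by
  have := cL_pos
  have := Real.log_nonneg (by exact_mod_cast ht : (1:ℝ) ≤ t)
  unfold kq; linarith

lemma K_diff {t : ℕ} (ht : 1 ≤ t) {z0 z1 : ℕ} (h : z0 ≤ z1) :
    |Kf 1 t z0 - Kf 1 t z1| ≤ kq t * Tf 1 t z0 := by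
  have h1 := K_step (y := 1) ht h
  have h2 := T_step (y := 1) ht h
  have h3 := T_nonneg 1 t z1
  have e : Kf 1 t z0 - Kf 1 t z1 = ∑ d ∈ Dd 1 t z0 z1, Wf 1 (t * d) * (Real.log d - Lg 1 (t * d)) / d := by linarith
  rw [e]
  refine (Finset.abs_sum_le_sum_abs _ _).trans ?_
  have : ∀ d ∈ Dd 1 t z0 z1, |Wf 1 (t * d) * (Real.log d - Lg 1 (t * d)) / d| ≤ kq t * (Wf 1 (t * d) / d) := by
    intro d hd
    rw [mem_Dd ht] at hd
    have hd0 : 0 < d := Nat.pos_of_ne_zero hd.1.1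
    have htd : 1 ≤ t * d := Nat.mul_pos (by omega) hd0
    have hL := Lg_abs htd
    have hlog : Real.log ((t * d : ℕ):ℝ) = Real.log t + Real.log d := by
      push_cast
      rw [Real.log_mul (by positivity) (by positivity)]
    have hlt : 0 ≤ Real.log t := Real.log_nonneg (by exact_mod_cast ht)
    rw [hlog] at hL
    have hb : |Real.log d - Lg 1 (t * d)| ≤ kq t := by
      have e : Real.log d - Lg 1 (t * d) = (Real.log t + Real.log d - Lg 1 (t * d)) - Real.log t := by ring
      rw [e]
      refine (abs_sub _ _).trans ?_
      rw [abs_of_nonneg hlt]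
      unfold kq; linarith
    have hW := Wf_pos 1 (t * d)
    rw [abs_div, abs_mul, abs_of_pos hW, abs_of_nonneg (Nat.cast_nonneg d : (0:ℝ) ≤ (d:ℝ))]
    calc _ ≤ Wf 1 (t * d) * kq t / d := by gcongr
      _ = _ := by ring
  refine (Finset.sum_le_sum this).trans ?_
  rw [← Finset.mul_sum]
  have := kq_pos ht
  apply mul_le_mul_of_nonneg_left _ this.le
  linarith

lemma K_lim_ex {t : ℕ} (ht : 1 ≤ t) : ∃ K, Tendsto (fun z => Kf 1 t z) atTop (𝓝 K) := by
  apply cauchySeq_tendsto_of_complete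
  rw [Metric.cauchySeq_iff']
  intro ε hε
  have hk := kq_pos ht
  obtain ⟨z0, h2, h⟩ := T_lim ht (ε / (2 * kq t)) (by positivity)
  refine ⟨z0, fun n hn => ?_⟩
  rw [dist_comm, Real.dist_eq]
  have h1 := K_diff ht hn
  have h3 := h z0 le_rfl
  rw [le_div_iff₀ (by positivity)] at h3
  linarith

open Classical in
noncomputable def KK (t : ℕ) : ℝ := if h : 1 ≤ t then (K_lim_ex h).choose else 0

lemma KK_lim {t : ℕ} (ht : 1 ≤ t) : Tendsto (fun z => Kf 1 t z) atTop (𝓝 (KK t)) := by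
  unfold KK
  rw [dif_pos ht]
  exact (K_lim_ex ht).choose_spec

lemma om_ii {a b : ℝ} (ha : 1 ≤ a) (hb : 1 ≤ b) : IntervalIntegrable om volume a b := by
  apply ContinuousOn.intervalIntegrable
  apply om_contOn.mono
  intro x hx
  have h1 : min a b ≤ x := hx.1
  have h2 : 1 ≤ min a b := le_min ha hb
  rw [Set.mem_Ioi]
  linarith

lemma kk_int {U : ℝ} (hU : 2 ≤ U) : ∫ u in (1:ℝ)..U, kk u = ∫ u in (U-1)..U, om u := by
  rw [← intervalIntegral.integral_add_adjacent_intervals (kk_ii1 (a := 1) (b := 2) (by norm_num) (by norm_num))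
    (kk_ii1 (a := 2) (b := U) (by norm_num) (by linarith))]
  have e1 : ∫ u in (1:ℝ)..2, kk u = ∫ u in (1:ℝ)..2, om u := by
    rw [intervalIntegral.integral_of_le (by norm_num), intervalIntegral.integral_of_le (by norm_num),
      integral_Ioc_eq_integral_Ioo, integral_Ioc_eq_integral_Ioo]
    apply setIntegral_congr_fun measurableSet_Ioo
    intro u hu
    rw [om_lt2 u hu.2.le]
    unfold kk
    rw [if_pos hu.2]
  have e2 : ∫ u in (2:ℝ)..U, kk u = ∫ u in (2:ℝ)..U, (om u - om (u - 1)) := by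
    apply intervalIntegral.integral_congr
    intro u hu
    rw [Set.uIcc_of_le hU] at hu
    simp only
    unfold kk
    rw [if_neg (by linarith [hu.1])]
  have hc : IntervalIntegrable (fun u => om (u - 1)) volume 2 U := by
    apply ContinuousOn.intervalIntegrable
    apply om_contOn.comp (by fun_prop)
    intro x hx
    rw [Set.uIcc_of_le hU] at hx
    simp only [Set.mem_Ioi]
    linarith [hx.1]
  rw [e1, e2, intervalIntegral.integral_sub (om_ii (by norm_num) (by linarith)) hc,
    intervalIntegral.integral_comp_sub_right (fun u => om u)]
  have a1 := intervalIntegral.integral_add_adjacent_intervals (om_ii (a := 1) (b := 2) (by norm_num) (by norm_num))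
    (om_ii (a := 2) (b := U) (by norm_num) (by linarith))
  have a2 := intervalIntegral.integral_add_adjacent_intervals (om_ii (a := 1) (b := U-1) (by norm_num) (by linarith))
    (om_ii (a := U-1) (b := U) (by linarith) (by linarith))
  have e3 : (2:ℝ) - 1 = 1 := by norm_num
  rw [e3]
  linarith

lemma kk_int_abs {U : ℝ} (hU : 2 ≤ U) : |(∫ u in (1:ℝ)..U, kk u) - CC| ≤ 625 / (U - 1) ^ 4 := by
  rw [kk_int hU]
  have e : (∫ u in (U-1)..U, om u) - CC = ∫ u in (U-1)..U, (om u - CC) := by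
    rw [intervalIntegral.integral_sub (om_ii (by linarith) (by linarith)) (by simp)]
    simp
  rw [e]
  have := int_abs_le (f := fun u => om u - CC) (a := U - 1) (b := U) (M := 625 / (U - 1) ^ 4) (by linarith) (by
    intro x h1 h2
    refine (CC_spec x (by linarith)).trans ?_
    have : 0 < U - 1 := by linarith
    gcongr)
  simpa using this

/-- contraction principle -/
lemma contr {G : ℝ → ℝ} {B0 : ℝ} (hB : ∀ X, 0 ≤ X → |G X| ≤ B0)
    (H : ∀ η, 0 < η → ∃ U X0 : ℝ, 1 ≤ U ∧ 0 ≤ X0 ∧ ∀ X, X0 ≤ X → ∀ B, 0 ≤ B →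
      (∀ X', X / U ≤ X' → |G X'| ≤ B) → |G X| ≤ 0.992 * B + η) :
    ∀ ε, 0 < ε → ∃ X0 : ℝ, 0 ≤ X0 ∧ ∀ X, X0 ≤ X → |G X| ≤ ε := by
  intro ε hε
  have hB0 : 0 ≤ B0 := (abs_nonneg _).trans (hB 0 le_rfl)
  obtain ⟨U, X0, hU, hX0, h⟩ := H (ε / 250) (by positivity)
  have key : ∀ n : ℕ, ∃ Xn : ℝ, 0 ≤ Xn ∧ ∀ X, Xn ≤ X → |G X| ≤ 0.992 ^ n * B0 + ε / 2 := by
    intro n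
    induction n with
    | zero => exact ⟨0, le_rfl, fun X hX => by have := hB X hX; simp; linarith⟩
    | succ n ih =>
      obtain ⟨Xn, hXn, hn⟩ := ih
      refine ⟨max X0 (U * Xn), hX0.trans (le_max_left _ _), fun X hX => ?_⟩
      have := h X ((le_max_left _ _).trans hX) (0.992 ^ n * B0 + ε / 2) (by positivity) (by
        intro X' hX'
        apply hn
        refine le_trans ?_ hX'
        rw [le_div_iff₀ (by linarith), mul_comm]
        exact (le_max_right _ _).trans hX)
      rw [pow_succ]
      linarith
  have hl : Tendsto (fun n : ℕ => (0.992:ℝ) ^ n * B0) atTop (𝓝 (0 * B0)) :=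
    (tendsto_pow_atTop_nhds_zero_of_lt_one (by norm_num) (by norm_num)).mul_const _
  rw [zero_mul] at hl
  obtain ⟨n, hn⟩ := ((tendsto_order.1 hl).2 (ε / 2) (by linarith)).exists
  obtain ⟨Xn, h0, hh⟩ := key n
  exact ⟨Xn, h0, fun X hX => (hh X hX).trans (by linarith)⟩

noncomputable def Fs (t : ℕ) : ℝ := CC * KK t / (1 - CC)

lemma kkG_abs {t : ℕ} (ht : 1 ≤ t) {X U B f : ℝ} (hX : 0 ≤ X) (hU : 3 ≤ U) (hB0 : 0 ≤ B)
    (hB : ∀ X', X / U ≤ X' → |FF t X' - f| ≤ B) :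
    |(∫ u in (1:ℝ)..U, kk u * FF t (X / u)) - f * ∫ u in (1:ℝ)..U, kk u| ≤ 0.992 * B := by
  have hk := kk_ii1 (le_refl (1:ℝ)) (by linarith : 1 ≤ U)
  rw [← intervalIntegral.integral_const_mul, ← intervalIntegral.integral_sub (kkF_ii ht hX (by linarith)) (hk.const_mul f)]
  have h1 : ‖∫ u in (1:ℝ)..U, (kk u * FF t (X / u) - f * kk u)‖ ≤ ∫ u in (1:ℝ)..U, |kk u| * B := by
    apply intervalIntegral.norm_integral_le_of_norm_le (by linarith)
    · apply ae_of_all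
      intro u hu
      have e : kk u * FF t (X / u) - f * kk u = kk u * (FF t (X / u) - f) := by ring
      rw [e, norm_mul, Real.norm_eq_abs, Real.norm_eq_abs]
      apply mul_le_mul_of_nonneg_left _ (abs_nonneg _)
      apply hB
      apply div_le_div_of_nonneg_left hX (by linarith [hu.1]) hu.2
    · exact (ak_ii (le_refl (1:ℝ)) (by linarith)).mul_const B
  rw [intervalIntegral.integral_mul_const, Real.norm_eq_abs] at h1
  have h2 := ak_total U hU
  have := mul_le_mul_of_nonneg_right h2 hB0
  linarith

theorem FF_lim {t : ℕ} (ht : 1 ≤ t) : ∀ ε, 0 < ε → ∃ X0 : ℝ, 0 ≤ X0 ∧ ∀ X, X0 ≤ X → |FF t X - Fs t| ≤ ε := by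
  obtain ⟨c1, c2⟩ := CC_bd
  apply contr (G := fun X => FF t X - Fs t) (B0 := cT t + 1 + |Fs t|)
  · intro X hX
    have h1 := FF_le ht hX
    have h2 := FF_nonneg t hX
    refine (abs_sub _ _).trans ?_
    rw [abs_of_nonneg h2]; linarith
  intro η hη
  have hcA : 0 < cA t := by
    have := cT_pos ht; have := cV_pos
    unfold cA; positivity
  -- choose U0
  obtain ⟨U0, hU0, hU0a⟩ : ∃ U0 : ℝ, 16 ≤ U0 ∧ (cA t + 625 * 2 * |Fs t|) / U0 ≤ η / 3 := by
    have hp : 0 ≤ (cA t + 625 * 2 * |Fs t|) := by positivity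
    refine ⟨max 16 ((cA t + 625 * 2 * |Fs t|) / (η / 3)), le_max_left _ _, ?_⟩
    have h16 : (16:ℝ) ≤ max 16 ((cA t + 625 * 2 * |Fs t|) / (η / 3)) := le_max_left _ _
    have h := le_max_right (16:ℝ) ((cA t + 625 * 2 * |Fs t|) / (η / 3))
    rw [div_le_iff₀ (by positivity)] at h
    rw [div_le_iff₀ (by linarith)]
    linarith
  obtain ⟨z1, hz1, HF⟩ := F_eq ht (2 * U0) (by linarith) (η / 3) (by positivity)
  have hK := KK_lim ht
  rw [Metric.tendsto_atTop] at hK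
  obtain ⟨z2, hz2⟩ := hK (η / 3) (by positivity)
  refine ⟨2 * U0, U0 * (max 2 (Real.log (max z1 z2 : ℕ)) ), by linarith, by positivity, fun X hX B hB0 hB => ?_⟩
  have hU0p : 0 < U0 := by linarith
  have hXU : max 2 (Real.log (max z1 z2 : ℕ)) ≤ X / U0 := by rw [le_div_iff₀ hU0p]; linarith
  have hX2 : 2 ≤ X / U0 := (le_max_left _ _).trans hXU
  have hXz : Real.log (max z1 z2 : ℕ) ≤ X / U0 := (le_max_right _ _).trans hXU
  set z0 := ⌊Real.exp (X / U0)⌋₊ with hz0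
  have hzz : max z1 z2 ≤ z0 := by
    rw [hz0, le_floor_iff' (lt_of_lt_of_le (by omega) (le_max_left z1 z2))]
    exact hXz
  have hs1 := log_floor_le (by linarith : 0 ≤ X / U0)
  have hs2 := log_floor_ge (by linarith : 0 ≤ X / U0)
  rw [← hz0] at hs1 hs2
  have hX0 : 0 < X := by
    rw [le_div_iff₀ hU0p] at hX2; linarith
  have hsp : 0 < Real.log z0 := by linarith
  have hXs : X / U0 * U0 = X := by field_simp
  have hUa : U0 * Real.log z0 ≤ X := by
    calc U0 * Real.log z0 ≤ U0 * (X / U0) := by gcongr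
      _ = X := by rw [mul_comm]; exact hXs
  have hUb : X ≤ 2 * U0 * Real.log z0 := by
    have h : X / U0 ≤ 2 * Real.log z0 := by linarith
    rw [div_le_iff₀ hU0p] at h
    linarith
  have hF := HF z0 ((le_max_left _ _).trans hzz) X (by nlinarith) hUb
  have hKz := hz2 z0 ((le_max_right _ _).trans hzz)
  rw [Real.dist_eq] at hKz
  have hU1 : U0 ≤ X / Real.log z0 := by rw [le_div_iff₀ hsp]; exact hUa
  have hU2 : X / Real.log z0 ≤ 2 * U0 := by rw [div_le_iff₀ hsp]; exact hUb
  set U := X / Real.log z0 with hU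
  have hG := kkG_abs ht (X := X) (U := U) (B := B) (f := Fs t) hX0.le (by linarith) hB0 (by
    intro X' hX'
    apply hB X'
    refine le_trans ?_ hX'
    apply div_le_div_of_nonneg_left hX0.le (by linarith) hU2)
  have hk := kk_int_abs (U := U) (by linarith)
  set I := ∫ u in (1:ℝ)..U, kk u * FF t (X / u)
  set k := ∫ u in (1:ℝ)..U, kk u
  have hFs : Fs t = CC * KK t + Fs t * CC := by
    unfold Fs
    have : 1 - CC ≠ 0 := by linarith
    field_simp
    ring
  have key : FF t X - Fs t = (FF t X - CC * Kf 1 t z0 - I) + (I - Fs t * k) + CC * (Kf 1 t z0 - KK t)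
      + Fs t * (k - CC) := by
    linarith
  have b1 : cA t / U ≤ cA t / U0 := by gcongr
  have b2 : |Fs t * (k - CC)| ≤ |Fs t| * (625 * 2 / U0) := by
    rw [abs_mul]
    apply mul_le_mul_of_nonneg_left _ (abs_nonneg _)
    refine hk.trans ?_
    have : U0 / 2 ≤ U - 1 := by linarith
    calc 625 / (U - 1) ^ 4 ≤ 625 / (U0 / 2) ^ 4 := by gcongr
      _ ≤ 625 / (U0 / 2) ^ 1 := by
        gcongr
        · linarith
        · norm_num
      _ = _ := by field_simp
  have b3 : |CC * (Kf 1 t z0 - KK t)| ≤ η / 3 := by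
    rw [abs_mul, abs_of_pos (by linarith : 0 < CC)]
    have := abs_nonneg (Kf 1 t z0 - KK t)
    nlinarith
  have e : (cA t + 625 * 2 * |Fs t|) / U0 = cA t / U0 + |Fs t| * (625 * 2 / U0) := by ring
  rw [e] at hU0a
  rw [key]
  have t1 := abs_add_le ((FF t X - CC * Kf 1 t z0 - I) + (I - Fs t * k) + CC * (Kf 1 t z0 - KK t)) (Fs t * (k - CC))
  have t2 := abs_add_le ((FF t X - CC * Kf 1 t z0 - I) + (I - Fs t * k)) (CC * (Kf 1 t z0 - KK t))
  have t3 := abs_add_le (FF t X - CC * Kf 1 t z0 - I) (I - Fs t * k)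
  linarith

end

section
open Filter Topology

lemma Dd_split {t : ℕ} (ht : 1 ≤ t) {z0 z1 z2 : ℕ} (h1 : z0 ≤ z1) (h2 : z1 ≤ z2) (g : ℕ → ℝ) :
    ∑ d ∈ Dd 1 t z0 z2, g d = ∑ d ∈ Dd 1 t z0 z1, g d + ∑ d ∈ Dd 1 t z1 z2, g d := by
  classical
  rw [← Finset.sum_union]
  · congr 1
    ext d
    rw [Finset.mem_union, mem_Dd ht, mem_Dd ht, mem_Dd ht]
    constructor
    · rintro ⟨a, b, c⟩
      rcases le_or_gt (t * d) z1 with h | h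
      · exact Or.inl ⟨a, b, h⟩
      · exact Or.inr ⟨a, h, c⟩
    · rintro (⟨a, b, c⟩ | ⟨a, b, c⟩)
      · exact ⟨a, b, by omega⟩
      · exact ⟨a, by omega, c⟩
  · rw [Finset.disjoint_left]
    intro d hd hd'
    rw [mem_Dd ht] at hd hd'
    omega

lemma floor_mono {a b : ℝ} (h : a ≤ b) : ⌊Real.exp a⌋₊ ≤ ⌊Real.exp b⌋₊ :=
  Nat.floor_mono (Real.exp_le_exp.2 h)

/-- one piece of the window -/
lemma piece {t : ℕ} (ht : 1 ≤ t) {δ a b : ℝ} (ha : 0 < a) (hab : a ≤ b) (hδ : 0 < δ)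
    (HW : ∀ z : ℕ, ⌊Real.exp a⌋₊ ≤ z → |Wf 1 z * Real.log z - CC| ≤ δ) :
    (FF t a - a / b * FF t b) / (CC + δ) ≤ ∑ d ∈ Dd 1 t ⌊Real.exp a⌋₊ ⌊Real.exp b⌋₊, 1 / (d:ℝ) := by
  obtain ⟨c1, c2⟩ := CC_bd
  have hT := T_step (y := 1) ht (floor_mono hab)
  have e : FF t a - a / b * FF t b = a * (Tf 1 t ⌊Real.exp a⌋₊ - Tf 1 t ⌊Real.exp b⌋₊) := by
    unfold FF
    have : b ≠ 0 := by linarith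
    field_simp
  have e2 : Tf 1 t ⌊Real.exp a⌋₊ - Tf 1 t ⌊Real.exp b⌋₊ =
    ∑ d ∈ Dd 1 t ⌊Real.exp a⌋₊ ⌊Real.exp b⌋₊, Wf 1 (t * d) / d := by linarith
  rw [e, e2, div_le_iff₀ (by linarith), Finset.mul_sum, Finset.sum_mul]
  apply Finset.sum_le_sum
  intro d hd
  rw [mem_Dd ht] at hd
  have hd0 : 0 < d := Nat.pos_of_ne_zero hd.1.1
  have htd : 0 < t * d := Nat.mul_pos (by omega) hd0
  have h1 := (floor_lt_iff htd a).1 hd.2.1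
  have h2 := (abs_le.1 (HW _ hd.2.1.le)).2
  have hW := Wf_pos 1 (t * d)
  have h3 : a * Wf 1 (t * d) ≤ CC + δ := by nlinarith
  calc a * (Wf 1 (t * d) / d) = (a * Wf 1 (t * d)) / d := by ring
    _ ≤ (CC + δ) / d := by gcongr
    _ = _ := by ring

lemma pieces {t : ℕ} (ht : 1 ≤ t) {δ a ρ ε : ℝ} (ha : 0 < a) (hρ : 1 ≤ ρ) (hδ : 0 < δ) (hε : 0 < ε)
    (HW : ∀ z : ℕ, ⌊Real.exp a⌋₊ ≤ z → |Wf 1 z * Real.log z - CC| ≤ δ)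
    (HF : ∀ X, a ≤ X → |FF t X - Fs t| ≤ ε) (J : ℕ) :
    J * ((Fs t * (1 - 1 / ρ) - 2 * ε) / (CC + δ)) ≤
      ∑ d ∈ Dd 1 t ⌊Real.exp a⌋₊ ⌊Real.exp (a * ρ ^ J)⌋₊, 1 / (d:ℝ) := by
  obtain ⟨c1, c2⟩ := CC_bd
  induction J with
  | zero =>
    simp only [Nat.cast_zero, zero_mul]
    apply Finset.sum_nonneg
    intro d _
    positivity
  | succ J ih =>
    have hp1 : 1 ≤ ρ ^ J := one_le_pow₀ hρ
    have hb : a ≤ a * ρ ^ J := by nlinarith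
    have hc : a * ρ ^ J ≤ a * ρ ^ (J+1) := by rw [pow_succ]; nlinarith
    rw [Dd_split ht (floor_mono hb) (floor_mono hc)]
    have hp := piece ht (by linarith : 0 < a * ρ ^ J) hc hδ (fun z hz => HW z ((floor_mono hb).trans hz))
    have e : a * ρ ^ J / (a * ρ ^ (J+1)) = 1 / ρ := by
      have : ρ ≠ 0 := by linarith
      have : ρ ^ J ≠ 0 := by positivity
      rw [pow_succ]; field_simp
    rw [e] at hp
    have h1 := (abs_le.1 (HF _ hb)).1
    have h2 := (abs_le.1 (HF _ (hb.trans hc))).2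
    have h3 : 1 / ρ ≤ 1 := by rw [div_le_one (by linarith)]; exact hρ
    have h4 : 0 ≤ 1 / ρ := by positivity
    have h5 : Fs t * (1 - 1 / ρ) - 2 * ε ≤ FF t (a * ρ ^ J) - 1 / ρ * FF t (a * ρ ^ (J+1)) := by
      nlinarith
    have h6 : (Fs t * (1 - 1 / ρ) - 2 * ε) / (CC + δ) ≤
      (FF t (a * ρ ^ J) - 1 / ρ * FF t (a * ρ ^ (J+1))) / (CC + δ) :=
      div_le_div_of_nonneg_right h5 (by linarith)
    push_cast
    linarith

lemma Fs_nonneg {t : ℕ} (ht : 1 ≤ t) : 0 ≤ Fs t := by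
  by_contra h
  push Not at h
  obtain ⟨X0, h0, hX⟩ := FF_lim ht (-Fs t / 2) (by linarith)
  have h1 := (abs_le.1 (hX X0 le_rfl)).2
  have h2 := FF_nonneg t h0
  linarith

lemma KK_nonneg {t : ℕ} (ht : 1 ≤ t) : 0 ≤ KK t := by
  obtain ⟨c1, c2⟩ := CC_bd
  have h := Fs_nonneg ht
  unfold Fs at h
  by_contra hc
  push Not at hc
  have : CC * KK t / (1 - CC) < 0 := div_neg_of_neg_of_pos (by nlinarith) (by linarith)
  linarith

theorem window {t : ℕ} (ht : 1 ≤ t) (ε : ℝ) (hε : 0 < ε) : ∃ V0 : ℝ, 0 < V0 ∧ ∀ V, V0 ≤ V →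
    1.4756 * KK t - ε ≤ ∑ d ∈ Dd 1 t ⌊Real.exp (V / 2)⌋₊ ⌊Real.exp (0.985 * V)⌋₊, 1 / (d:ℝ) := by
  obtain ⟨c1, c2⟩ := CC_bd
  have hK := KK_nonneg ht
  set ρ : ℝ := 1.0068 with hρ
  have hF : 2.1848 * (CC * KK t) ≤ Fs t := by
    unfold Fs
    rw [le_div_iff₀ (by linarith)]
    have : 0 ≤ CC * KK t := by positivity
    nlinarith
  -- error parameter
  obtain ⟨e, he0, he1⟩ : ∃ e : ℝ, 0 < e ∧ e * (400 + 2 * (1.4757 * KK t)) ≤ ε := by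
    refine ⟨ε / (400 + 2 * (1.4757 * KK t)), by positivity, ?_⟩
    rw [div_mul_cancel₀ _ (by positivity)]
  obtain ⟨X0, hX0, HF⟩ := FF_lim ht e he0
  obtain ⟨z0, hz0, HW⟩ := W_lim e he0
  have hz0p : 0 < Real.log z0 := Real.log_pos (by exact_mod_cast hz0)
  refine ⟨2 * (X0 + Real.log z0), by linarith, fun V hV => ?_⟩
  have h1 := pieces ht (a := V / 2) (ρ := ρ) (δ := e) (ε := e) (by linarith) (by norm_num [hρ]) he0 he0
    (fun z hz => HW z (le_trans (by rw [le_floor_iff' (by omega)]; linarith) hz))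
    (fun X hX => HF X (by linarith)) 100
  have hpow : ρ ^ 100 ≤ 1.97 := by rw [hρ]; norm_num
  have hle : V / 2 * ρ ^ 100 ≤ 0.985 * V := by
    have : 0 < V := by linarith
    nlinarith
  have hone : 1 ≤ ρ ^ 100 := one_le_pow₀ (by norm_num [hρ])
  have h2 := Dd_split ht (floor_mono (show V / 2 ≤ V / 2 * ρ ^ 100 by
    have : 0 < V := by linarith
    nlinarith)) (floor_mono hle) (fun d => 1 / (d:ℝ))
  have h3 : 0 ≤ ∑ d ∈ Dd 1 t ⌊Real.exp (V / 2 * ρ ^ 100)⌋₊ ⌊Real.exp (0.985 * V)⌋₊, 1 / (d:ℝ) :=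
    Finset.sum_nonneg (fun d _ => by positivity)
  rw [h2]
  have hσ : (0.6754:ℝ) ≤ ((100:ℕ):ℝ) * (1 - 1 / ρ) := by rw [hρ]; norm_num
  have hmain : 1.4756 * KK t - ε ≤ ((100:ℕ):ℝ) * ((Fs t * (1 - 1 / ρ) - 2 * e) / (CC + e)) := by
    have hx : ((100:ℕ):ℝ) * ((Fs t * (1 - 1 / ρ) - 2 * e) / (CC + e)) =
      (Fs t * (((100:ℕ):ℝ) * (1 - 1 / ρ)) - 200 * e) / (CC + e) := by push_cast; ring
    rw [hx, le_div_iff₀ (by linarith)]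
    have hy : 2.1848 * (CC * KK t) * 0.6754 ≤ Fs t * (((100:ℕ):ℝ) * (1 - 1 / ρ)) := by
      apply mul_le_mul hF hσ (by norm_num) (Fs_nonneg ht)
    have : 0 ≤ CC * KK t := by positivity
    have h5 : 0 ≤ e * KK t := by positivity
    have h6 : ε * 0.5 ≤ ε * (CC + e) := by
      apply mul_le_mul_of_nonneg_left _ hε.le; linarith
    nlinarith
  linarith

end

section
open Finset

lemma log_ratio_le {a b : ℝ} (ha : 0 < a) (hb : 0 < b) : Real.log a - Real.log b ≤ a / b - 1 := by
  rw [← Real.log_div ha.ne' hb.ne']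
  exact Real.log_le_sub_one_of_pos (by positivity)

lemma log_ratio_ge {a b : ℝ} (ha : 0 < a) (hb : 0 < b) : 1 - b / a ≤ Real.log a - Real.log b := by
  have := log_ratio_le hb ha
  linarith

lemma log3_bd : (1.098604:ℝ) ≤ Real.log 3 ∧ Real.log 3 ≤ 1.098621 := by
  have h1 := log_ratio_le (a := 3 ^ 12) (b := 2 ^ 19) (by norm_num) (by norm_num)
  have h2 := log_ratio_ge (a := 3 ^ 12) (b := 2 ^ 19) (by norm_num) (by norm_num)
  rw [Real.log_pow, Real.log_pow] at h1 h2
  norm_num at h1 h2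
  have := Real.log_two_gt_d9
  have := Real.log_two_lt_d9
  constructor <;> linarith

lemma log5_bd : (1.6093:ℝ) ≤ Real.log 5 ∧ Real.log 5 ≤ 1.60956 := by
  have h1 := log_ratio_le (a := 3 ^ 4) (b := 2 ^ 4 * 5) (by norm_num) (by norm_num)
  have h2 := log_ratio_ge (a := 3 ^ 4) (b := 2 ^ 4 * 5) (by norm_num) (by norm_num)
  rw [Real.log_mul (by norm_num) (by norm_num), Real.log_pow, Real.log_pow] at h1 h2
  norm_num at h1 h2
  have := Real.log_two_gt_d9
  have := Real.log_two_lt_d9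
  have := log3_bd
  constructor <;> linarith

lemma pat30 (n M : ℕ) (hn : 0 < n) :
    30 * M / n + M / n ≤ 15 * M / n + 10 * M / n + 6 * M / n + 1 := by
  have h0 := Nat.div_add_mod M n
  have hlt := Nat.mod_lt M hn
  set q := M / n
  set r := M % n
  have e : ∀ k : ℕ, k * M / n = k * q + k * r / n := by
    intro k
    rw [← h0, show k * (n * q + r) = k * r + n * (k * q) by ring, Nat.add_mul_div_left _ _ hn, add_comm]
  rw [e, e, e, e]
  have e30 := Nat.div_add_mod (30 * r) n
  have hl := Nat.mod_lt (30 * r) hn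
  set a := 30 * r / n with ha
  have ha30 : a < 30 := by rw [ha, Nat.div_lt_iff_lt_mul hn]; nlinarith
  have h15 : a / 2 = 15 * r / n := by
    rw [ha, Nat.div_div_eq_div_mul, mul_comm n 2, show 30 * r = 2 * (15 * r) by ring, Nat.mul_div_mul_left _ _ (by norm_num)]
  have h10 : a / 3 = 10 * r / n := by
    rw [ha, Nat.div_div_eq_div_mul, mul_comm n 3, show 30 * r = 3 * (10 * r) by ring, Nat.mul_div_mul_left _ _ (by norm_num)]
  have h6 : a / 5 = 6 * r / n := by
    rw [ha, Nat.div_div_eq_div_mul, mul_comm n 5, show 30 * r = 5 * (6 * r) by ring, Nat.mul_div_mul_left _ _ (by norm_num)]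
  have hd : ∀ b < 30, b ≤ b / 2 + b / 3 + b / 5 + 1 := by decide
  have := hd a ha30
  rw [h15, h10, h6] at this
  omega

lemma slog_eq' {N B : ℕ} (h : N ≤ B) :
    slog N = ∑ n ∈ Ioc 0 B, ArithmeticFunction.vonMangoldt n * ((N / n : ℕ) : ℝ) := by
  rw [slog_eq]
  apply Finset.sum_subset (Finset.Ioc_subset_Ioc_right h)
  intro n hn hn'
  simp only [mem_Ioc] at hn hn'
  rw [Nat.div_eq_of_lt (by omega)]
  simp

lemma psi30 (M : ℕ) : slog (30 * M) - slog (15 * M) - slog (10 * M) - slog (6 * M) + slog M ≤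
    Chebyshev.psi ((30 * M : ℕ):ℝ) := by
  have hp : Chebyshev.psi ((30 * M : ℕ):ℝ) = ∑ n ∈ Ioc 0 (30 * M), ArithmeticFunction.vonMangoldt n := by
    unfold Chebyshev.psi
    rw [Nat.floor_natCast]
  rw [hp, slog_eq' (le_refl (30 * M)), slog_eq' (by omega : 15 * M ≤ 30 * M), slog_eq' (by omega : 10 * M ≤ 30 * M),
    slog_eq' (by omega : 6 * M ≤ 30 * M), slog_eq' (by omega : M ≤ 30 * M), ← sum_sub_distrib, ← sum_sub_distrib,
    ← sum_sub_distrib, ← sum_add_distrib]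
  apply sum_le_sum
  intro n hn
  have hn0 : 0 < n := (mem_Ioc.1 hn).1
  have h := pat30 n M hn0
  have h' : ((30 * M / n : ℕ):ℝ) + ((M / n : ℕ):ℝ) ≤ ((15 * M / n : ℕ):ℝ) + ((10 * M / n : ℕ):ℝ) + ((6 * M / n : ℕ):ℝ) + 1 := by
    exact_mod_cast h
  have hv := ArithmeticFunction.vonMangoldt_nonneg (n := n)
  nlinarith

lemma psi30_lower (M : ℕ) (hM : 0 < M) :
    27.637 * (M:ℝ) - 3 - 3 * Real.log (15 * M) ≤ Chebyshev.psi ((30 * M : ℕ):ℝ) := by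
  have h := psi30 M
  have hMr : (0:ℝ) < M := by exact_mod_cast hM
  have a1 := slog_lower (30 * M)
  have a2 := slog_upper (15 * M) (by omega)
  have a3 := slog_upper (10 * M) (by omega)
  have a4 := slog_upper (6 * M) (by omega)
  have a5 := slog_lower M
  have e : ∀ k : ℕ, 0 < k → Real.log ((k * M : ℕ):ℝ) = Real.log k + Real.log M := by
    intro k hk
    have : (0:ℝ) < k := by exact_mod_cast hk
    push_cast; rw [Real.log_mul (by positivity) (by positivity)]
  rw [e _ (by norm_num)] at a1 a2 a3 a4
  push_cast at a1 a2 a3 a4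
  have f30 : Real.log 30 = Real.log 2 + Real.log 3 + Real.log 5 := by
    rw [← Real.log_mul (by norm_num) (by norm_num), ← Real.log_mul (by norm_num) (by norm_num)]; norm_num
  have f15 : Real.log 15 = Real.log 3 + Real.log 5 := by
    rw [← Real.log_mul (by norm_num) (by norm_num)]; norm_num
  have f10 : Real.log 10 = Real.log 2 + Real.log 5 := by
    rw [← Real.log_mul (by norm_num) (by norm_num)]; norm_num
  have f6 : Real.log 6 = Real.log 2 + Real.log 3 := by
    rw [← Real.log_mul (by norm_num) (by norm_num)]; norm_num
  have f : Real.log (15 * M) = Real.log 15 + Real.log M := by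
    rw [Real.log_mul (by norm_num) (by positivity)]
  rw [f, f15]
  rw [f30] at a1
  rw [f15] at a2
  rw [f10] at a3
  rw [f6] at a4
  have g2 := Real.log_two_gt_d9
  have g2' := Real.log_two_lt_d9
  have g3 := log3_bd
  have g5 := log5_bd
  have key : 27.637 * (M:ℝ) ≤ (14 * Real.log 2 + 9 * Real.log 3 + 5 * Real.log 5) * M := by
    apply mul_le_mul_of_nonneg_right _ hMr.le
    linarith
  linarith

theorem theta_low : ∃ y0 : ℝ, 1 ≤ y0 ∧ ∀ y, y0 ≤ y → 0.921 * y ≤ Chebyshev.theta y := by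
  have h1 : (fun x : ℝ => Real.sqrt x * Real.log x) =o[Filter.atTop] (fun x : ℝ => x) := by
    have h : (Real.log) =o[Filter.atTop] (fun x : ℝ => x ^ (1/2:ℝ)) := isLittleO_log_rpow_atTop (by norm_num)
    have h2 := (Asymptotics.isBigO_refl (fun x : ℝ => Real.sqrt x) Filter.atTop).mul_isLittleO h
    refine h2.congr' (Filter.EventuallyEq.refl _ _) ?_
    filter_upwards [Filter.eventually_ge_atTop (0:ℝ)] with x hx
    rw [← Real.sqrt_eq_rpow, Real.mul_self_sqrt hx]
  have h2 : Real.log =o[Filter.atTop] (fun x : ℝ => x) := Real.isLittleO_log_id_atTop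
  have b1 := h1.bound (show (0:ℝ) < 0.00001 / 4 by norm_num)
  have b2 := h2.bound (show (0:ℝ) < 0.00001 / 4 by norm_num)
  rw [Filter.eventually_atTop] at b1 b2
  obtain ⟨x1, b1⟩ := b1
  obtain ⟨x2, b2⟩ := b2
  refine ⟨max 10000000 (max x1 x2 + 30), by apply le_max_of_le_left; norm_num, fun y hy => ?_⟩
  have hy1 : (10000000:ℝ) ≤ y := (le_max_left _ _).trans hy
  have hy2 := (le_max_right _ _).trans hy
  have hx1 : x1 + 30 ≤ y := by linarith [le_max_left x1 x2]
  have hx2 : x2 + 30 ≤ y := by linarith [le_max_right x1 x2]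
  set M := ⌊y / 30⌋₊ with hM
  have hM1 : (M:ℝ) ≤ y / 30 := Nat.floor_le (by positivity)
  have hM2 : y / 30 < M + 1 := Nat.lt_floor_add_one _
  have hMp : (0:ℝ) < M := by linarith
  have hMn : 0 < M := by exact_mod_cast hMp
  have hl := psi30_lower M hMn
  have c1 := b1 ((30 * M : ℕ):ℝ) (by push_cast; linarith)
  have c2 := b2 ((30 * M : ℕ):ℝ) (by push_cast; linarith)
  have hd := Chebyshev.psi_sub_theta_le (x := ((30 * M : ℕ):ℝ)) (by push_cast; linarith)
  have hmono := Chebyshev.theta_mono (show ((30 * M : ℕ):ℝ) ≤ y by push_cast; linarith)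
  rw [Real.norm_eq_abs, Real.norm_eq_abs, abs_of_pos (by positivity : 0 < ((30 * M : ℕ):ℝ))] at c1 c2
  have c1' := (le_abs_self _).trans c1
  have c2' := (le_abs_self _).trans c2
  have hlog : Real.log (15 * M) ≤ Real.log ((30 * M : ℕ):ℝ) := by
    apply Real.log_le_log (by positivity)
    push_cast; linarith
  push_cast at *
  linarith

end

section
open Filter Topology

lemma pr10 (z : ℕ) : pr 1 z = pr 0 z := by
  ext p; rw [mem_pr, mem_pr]
  constructor
  · exact fun h => ⟨h.1, h.1.pos, h.2.2⟩
  · exact fun h => ⟨h.1, h.1.one_lt, h.2.2⟩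

lemma Lg_low {z : ℕ} (hz : 0 < z) : Real.log z - 1 ≤ Lg 1 z := by
  have : Lg 1 z = Lg 0 z := by unfold Lg; rw [pr10]
  rw [this, Lg_zero_eq]
  exact Lf_lower z hz

lemma pr_np {z : ℕ} (h : ¬ (z+1).Prime) : pr 1 (z+1) = pr 1 z := by
  ext p; rw [mem_pr, mem_pr]
  constructor
  · rintro ⟨a, b, c⟩
    refine ⟨a, b, ?_⟩
    rcases Nat.lt_or_eq_of_le c with h1 | h1
    · omega
    · rw [h1] at a; exact absurd a h
  · rintro ⟨a, b, c⟩
    exact ⟨a, b, by omega⟩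

lemma pr_p {z : ℕ} (h : (z+1).Prime) : pr 1 (z+1) = insert (z+1) (pr 1 z) ∧ z + 1 ∉ pr 1 z := by
  constructor
  · ext p; rw [Finset.mem_insert, mem_pr, mem_pr]
    constructor
    · rintro ⟨a, b, c⟩
      rcases Nat.lt_or_eq_of_le c with h1 | h1
      · exact Or.inr ⟨a, b, by omega⟩
      · exact Or.inl h1
    · rintro (rfl | ⟨a, b, c⟩)
      · exact ⟨h, h.one_lt, le_rfl⟩
      · exact ⟨a, b, by omega⟩
  · rw [mem_pr]; omega

def WL (z : ℕ) (w l : ℝ) : Prop := 0 ≤ w ∧ w ≤ Wf 1 z ∧ l ≤ Lg 1 z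

lemma WL_np {z : ℕ} {w l : ℝ} (h : ¬ (z+1).Prime) (H : WL z w l) : WL (z+1) w l := by
  unfold WL Wf Lg at *
  rw [pr_np h]; exact H

lemma WL_p {z : ℕ} {w l w' l' lo : ℝ} (h : (z+1).Prime) (H : WL z w l) (hlo : lo ≤ Real.log ((z+1:ℕ):ℝ))
    (h0 : 0 ≤ w') (hw : w' ≤ w * (1 - 1 / ((z+1:ℕ):ℝ))) (hl : l' ≤ l + lo / z) : WL (z+1) w' l' := by
  obtain ⟨a, b, c⟩ := H
  obtain ⟨e1, e2⟩ := pr_p h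
  refine ⟨h0, ?_, ?_⟩
  · unfold Wf at *
    rw [e1, Finset.prod_insert e2]
    refine hw.trans ?_
    rw [mul_comm]
    apply mul_le_mul_of_nonneg_left b
    rw [sub_nonneg, div_le_one (by positivity)]
    push_cast
    have : (0:ℝ) ≤ z := Nat.cast_nonneg z
    linarith
  · unfold Lg at *
    rw [e1, Finset.sum_insert e2]
    have : (((z+1:ℕ):ℝ) - 1) = z := by push_cast; ring
    rw [this]
    have : lo / z ≤ Real.log ((z+1:ℕ):ℝ) / z := div_le_div_of_nonneg_right hlo (Nat.cast_nonneg z)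
    linarith

lemma rd_one {t : ℕ} : Rd 1 t 1 := by
  refine ⟨one_ne_zero, fun p hp h => ?_, ?_⟩
  · have := Nat.dvd_one.1 h; rw [this] at hp; exact absurd hp Nat.not_prime_one
  · intro d hd h1
    have := Nat.dvd_one.1 hd; omega

lemma rd_two {t : ℕ} (ht : 2 ≤ t) : Rd 1 t 2 := by
  refine ⟨two_ne_zero, fun p hp _ => hp.one_lt, ?_⟩
  intro d hd h1
  have h2 : d = 2 := by have := Nat.le_of_dvd (by norm_num) hd; omega
  subst h2
  norm_num
  omega

/-- lower bound for the limit constant -/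
lemma KK_low {t : ℕ} (ht : 2 ≤ t) {w1 l1 w2 l2 : ℝ} (H1 : WL t w1 l1) (H2 : WL (2 * t) w2 l2) :
    Real.log t - 1 + w1 * (l1 - Real.log t + 1) + w2 / 2 * (l2 - Real.log 2 - Real.log t + 1) ≤ KK t := by
  have ht1 : 1 ≤ t := by omega
  set A := w1 * (l1 - Real.log t + 1) + w2 / 2 * (l2 - Real.log 2 - Real.log t + 1) with hA
  have hT : Tendsto (fun z => Tf 1 t z) atTop (𝓝 0) := by
    rw [Metric.tendsto_atTop]
    intro ε hε
    obtain ⟨z0, _, h⟩ := T_lim ht1 (ε / 2) (by positivity)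
    refine ⟨z0, fun n hn => ?_⟩
    rw [Real.dist_eq, sub_zero, abs_of_nonneg (T_nonneg _ _ _)]
    linarith [h n hn]
  have hlim : Tendsto (fun z => (Real.log t - 1) * (1 - Tf 1 t z) + A) atTop (𝓝 ((Real.log t - 1) * (1 - 0) + A)) :=
    ((hT.const_sub 1).const_mul _).add_const _
  have hle : ∀ᶠ z in atTop, (Real.log t - 1) * (1 - Tf 1 t z) + A ≤ Kf 1 t z := by
    filter_upwards [eventually_ge_atTop (2 * t)] with z hz
    rw [K_id ht1]
    have hs := T_step (y := 1) ht1 (Nat.zero_le z)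
    rw [T_zero ht1] at hs
    have e1 : 1 - Tf 1 t z = ∑ d ∈ Dd 1 t 0 z, Wf 1 (t * d) / d := by linarith
    rw [e1]
    have e2 : ∑ d ∈ Dd 1 t 0 z, Wf 1 (t * d) / d * (Lg 1 (t * d) - Real.log d) =
        (Real.log t - 1) * ∑ d ∈ Dd 1 t 0 z, Wf 1 (t * d) / d +
        ∑ d ∈ Dd 1 t 0 z, Wf 1 (t * d) / d * (Lg 1 (t * d) - Real.log t - Real.log d + 1) := by
      rw [Finset.mul_sum, ← Finset.sum_add_distrib]
      apply Finset.sum_congr rfl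
      intro d _; ring
    rw [e2]
    have hsub : ({1, 2} : Finset ℕ) ⊆ Dd 1 t 0 z := by
      intro d hd
      rw [mem_Dd ht1]
      simp only [Finset.mem_insert, Finset.mem_singleton] at hd
      rcases hd with rfl | rfl
      · exact ⟨rd_one, by omega, by omega⟩
      · exact ⟨rd_two ht, by omega, by omega⟩
    have hE : ∀ d, 0 < d → 0 ≤ Lg 1 (t * d) - Real.log t - Real.log d + 1 := by
      intro d hd
      have htd : 0 < t * d := Nat.mul_pos (by omega) hd
      have h := Lg_low htd
      have hlog : Real.log ((t * d : ℕ):ℝ) = Real.log t + Real.log d := by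
        push_cast
        rw [Real.log_mul (by positivity) (by positivity)]
      rw [hlog] at h
      linarith
    have h3 : ∑ d ∈ ({1, 2} : Finset ℕ), Wf 1 (t * d) / d * (Lg 1 (t * d) - Real.log t - Real.log d + 1) ≤
        ∑ d ∈ Dd 1 t 0 z, Wf 1 (t * d) / d * (Lg 1 (t * d) - Real.log t - Real.log d + 1) := by
      apply Finset.sum_le_sum_of_subset_of_nonneg hsub
      intro d hd _
      rw [mem_Dd ht1] at hd
      exact mul_nonneg (div_nonneg (Wf_pos 1 _).le (Nat.cast_nonneg _)) (hE d (Nat.pos_of_ne_zero hd.1.1))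
    rw [Finset.sum_pair (by norm_num)] at h3
    have q1 := hE 1 one_pos
    have q2 := hE 2 two_pos
    rw [mul_comm t 2] at h3 q2
    simp only [mul_one, Nat.cast_one, Real.log_one, div_one, sub_zero, Nat.cast_ofNat] at h3 q1 q2
    obtain ⟨a1, b1, c1⟩ := H1
    obtain ⟨a2, b2, c2⟩ := H2
    have r1 : w1 * (l1 - Real.log t + 1) ≤ Wf 1 t * (Lg 1 t - Real.log t + 1) := by
      calc _ ≤ w1 * (Lg 1 t - Real.log t + 1) := mul_le_mul_of_nonneg_left (by linarith) a1
        _ ≤ _ := mul_le_mul_of_nonneg_right b1 q1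
    have r2 : w2 / 2 * (l2 - Real.log 2 - Real.log t + 1) ≤ Wf 1 (2 * t) / 2 * (Lg 1 (2 * t) - Real.log t - Real.log 2 + 1) := by
      calc _ ≤ w2 / 2 * (Lg 1 (2 * t) - Real.log t - Real.log 2 + 1) := mul_le_mul_of_nonneg_left (by linarith) (by linarith)
        _ ≤ _ := mul_le_mul_of_nonneg_right (by linarith) q2
    linarith
  have := le_of_tendsto_of_tendsto hlim (KK_lim ht1) hle
  linarith

lemma log7_bd : (1.9458:ℝ) ≤ Real.log 7 := by
  have h2 := log_ratio_ge (a := 7 ^ 4) (b := 2 ^ 5 * 3 * 5 ^ 2) (by norm_num) (by norm_num)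
  rw [Real.log_mul (by norm_num) (by norm_num), Real.log_mul (by norm_num) (by norm_num), Real.log_pow, Real.log_pow,
    Real.log_pow] at h2
  norm_num at h2
  linarith [Real.log_two_gt_d9, log3_bd.1, log5_bd.1]

/-- logs of larger primes from the square minus one -/
lemma log_sq {p m : ℕ} {c : ℝ} (hp : 0 < p) (hm : 0 < m) (h : m ≤ p ^ 2) (hc : 2 * c ≤ Real.log m) : c ≤ Real.log p := by
  have h1 : Real.log m ≤ Real.log ((p ^ 2 : ℕ) : ℝ) := Real.log_le_log (by exact_mod_cast hm) (by exact_mod_cast h)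
  rw [Nat.cast_pow, Real.log_pow] at h1
  push_cast at h1
  linarith

lemma log_mulN (a b : ℕ) (ha : 0 < a) (hb : 0 < b) : Real.log ((a * b : ℕ):ℝ) = Real.log a + Real.log b := by
  push_cast
  rw [Real.log_mul (by positivity) (by positivity)]

set_option maxHeartbeats 1000000 in
theorem K_num : (0.455:ℝ) ≤ ∑ t ∈ Finset.Ico 2 20, KK t / (t * (t + 1)) + KK 20 / 20 := by
  have g2 : (0.693147:ℝ) ≤ Real.log 2 := by linarith [Real.log_two_gt_d9]
  have u2 : Real.log 2 ≤ 0.693148 := by linarith [Real.log_two_lt_d9]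
  have g3 := log3_bd.1
  have g5 := log5_bd.1
  have g7 := log7_bd
  have f4 := log_mulN 2 2 (by norm_num) (by norm_num)
  have f6 := log_mulN 2 3 (by norm_num) (by norm_num)
  have f8 := log_mulN 2 4 (by norm_num) (by norm_num)
  have f9 := log_mulN 3 3 (by norm_num) (by norm_num)
  have f10 := log_mulN 2 5 (by norm_num) (by norm_num)
  have f12 := log_mulN 3 4 (by norm_num) (by norm_num)
  have f14 := log_mulN 2 7 (by norm_num) (by norm_num)
  have f15 := log_mulN 3 5 (by norm_num) (by norm_num)
  have f16 := log_mulN 4 4 (by norm_num) (by norm_num)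
  have f18 := log_mulN 3 6 (by norm_num) (by norm_num)
  have f20 := log_mulN 4 5 (by norm_num) (by norm_num)
  have f120 := log_mulN 6 20 (by norm_num) (by norm_num)
  have f168 := log_mulN 12 14 (by norm_num) (by norm_num)
  have f288 := log_mulN 16 18 (by norm_num) (by norm_num)
  have f360 := log_mulN 18 20 (by norm_num) (by norm_num)
  have f840 := log_mulN 7 120 (by norm_num) (by norm_num)
  have f960 := log_mulN 8 120 (by norm_num) (by norm_num)
  norm_num at f4 f6 f8 f9 f10 f12 f14 f15 f16 f18 f20 f120 f168 f288 f360 f840 f960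
  have g11 : (2.3936:ℝ) ≤ Real.log 11 := by
    exact_mod_cast log_sq (p := 11) (m := 120) (c := 2.3936) (by norm_num) (by norm_num) (by norm_num) (by norm_num; linarith)
  have g13 : (2.5618:ℝ) ≤ Real.log 13 := by
    exact_mod_cast log_sq (p := 13) (m := 168) (c := 2.5618) (by norm_num) (by norm_num) (by norm_num) (by norm_num; linarith)
  have g17 : (2.8314:ℝ) ≤ Real.log 17 := by
    exact_mod_cast log_sq (p := 17) (m := 288) (c := 2.8314) (by norm_num) (by norm_num) (by norm_num) (by norm_num; linarith)
  have g19 : (2.9429:ℝ) ≤ Real.log 19 := by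
    exact_mod_cast log_sq (p := 19) (m := 360) (c := 2.9429) (by norm_num) (by norm_num) (by norm_num) (by norm_num; linarith)
  have f528 := log_mulN 16 33 (by norm_num) (by norm_num)
  have f33 := log_mulN 3 11 (by norm_num) (by norm_num)
  have f1368 := log_mulN 72 19 (by norm_num) (by norm_num)
  have f72 := log_mulN 8 9 (by norm_num) (by norm_num)
  norm_num at f528 f33 f1368 f72
  have g23 : (3.132:ℝ) ≤ Real.log 23 := by
    exact_mod_cast log_sq (p := 23) (m := 528) (c := 3.132) (by norm_num) (by norm_num) (by norm_num) (by norm_num; linarith)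
  have g29 : (3.366:ℝ) ≤ Real.log 29 := by
    exact_mod_cast log_sq (p := 29) (m := 840) (c := 3.366) (by norm_num) (by norm_num) (by norm_num) (by norm_num; linarith)
  have g31 : (3.433:ℝ) ≤ Real.log 31 := by
    exact_mod_cast log_sq (p := 31) (m := 960) (c := 3.433) (by norm_num) (by norm_num) (by norm_num) (by norm_num; linarith)
  have g37 : (3.609:ℝ) ≤ Real.log 37 := by
    exact_mod_cast log_sq (p := 37) (m := 1368) (c := 3.609) (by norm_num) (by norm_num) (by norm_num) (by norm_num; linarith)
  have h1 : WL 1 1 0 := by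
    have e : pr 1 1 = ∅ := by
      ext p; rw [mem_pr]; simp
    unfold WL Wf Lg
    rw [e]; simp
  have h2 := WL_p (z := 1) (by norm_num) (l' := 0.6931) (w' := 0.50000) h1 g2 (by norm_num) (by norm_num) (by norm_num)
  have h3 := WL_p (z := 2) (by norm_num) (l' := 1.2424) (w' := 0.33333) h2 g3 (by norm_num) (by norm_num) (by norm_num)
  have h4 := WL_np (z := 3) (by norm_num) h3
  have h5 := WL_p (z := 4) (by norm_num) (l' := 1.6447) (w' := 0.26666) h4 g5 (by norm_num) (by norm_num) (by norm_num)
  have h6 := WL_np (z := 5) (by norm_num) h5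
  have h7 := WL_p (z := 6) (by norm_num) (l' := 1.9690) (w' := 0.22856) h6 g7 (by norm_num) (by norm_num) (by norm_num)
  have h8 := WL_np (z := 7) (by norm_num) h7
  have h9 := WL_np (z := 8) (by norm_num) h8
  have h10 := WL_np (z := 9) (by norm_num) h9
  have h11 := WL_p (z := 10) (by norm_num) (l' := 2.2083) (w' := 0.20778) h10 g11 (by norm_num) (by norm_num) (by norm_num)
  have h12 := WL_np (z := 11) (by norm_num) h11
  have h13 := WL_p (z := 12) (by norm_num) (l' := 2.4217) (w' := 0.19179) h12 g13 (by norm_num) (by norm_num) (by norm_num)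
  have h14 := WL_np (z := 13) (by norm_num) h13
  have h15 := WL_np (z := 14) (by norm_num) h14
  have h16 := WL_np (z := 15) (by norm_num) h15
  have h17 := WL_p (z := 16) (by norm_num) (l' := 2.5986) (w' := 0.18050) h16 g17 (by norm_num) (by norm_num) (by norm_num)
  have h18 := WL_np (z := 17) (by norm_num) h17
  have h19 := WL_p (z := 18) (by norm_num) (l' := 2.7620) (w' := 0.17100) h18 g19 (by norm_num) (by norm_num) (by norm_num)
  have h20 := WL_np (z := 19) (by norm_num) h19
  have h21 := WL_np (z := 20) (by norm_num) h20
  have h22 := WL_np (z := 21) (by norm_num) h21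
  have h23 := WL_p (z := 22) (by norm_num) (l' := 2.9043) (w' := 0.16356) h22 g23 (by norm_num) (by norm_num) (by norm_num)
  have h24 := WL_np (z := 23) (by norm_num) h23
  have h25 := WL_np (z := 24) (by norm_num) h24
  have h26 := WL_np (z := 25) (by norm_num) h25
  have h27 := WL_np (z := 26) (by norm_num) h26
  have h28 := WL_np (z := 27) (by norm_num) h27
  have h29 := WL_p (z := 28) (by norm_num) (l' := 3.0245) (w' := 0.15792) h28 g29 (by norm_num) (by norm_num) (by norm_num)
  have h30 := WL_np (z := 29) (by norm_num) h29
  have h31 := WL_p (z := 30) (by norm_num) (l' := 3.1389) (w' := 0.15282) h30 g31 (by norm_num) (by norm_num) (by norm_num)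
  have h32 := WL_np (z := 31) (by norm_num) h31
  have h33 := WL_np (z := 32) (by norm_num) h32
  have h34 := WL_np (z := 33) (by norm_num) h33
  have h35 := WL_np (z := 34) (by norm_num) h34
  have h36 := WL_np (z := 35) (by norm_num) h35
  have h37 := WL_p (z := 36) (by norm_num) (l' := 3.2391) (w' := 0.14868) h36 g37 (by norm_num) (by norm_num) (by norm_num)
  have h38 := WL_np (z := 37) (by norm_num) h37
  have h39 := WL_np (z := 38) (by norm_num) h38
  have h40 := WL_np (z := 39) (by norm_num) h39
  have k2 : (0.3357:ℝ) ≤ KK 2 := by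
    refine le_trans ?_ (KK_low (by norm_num) h2 h4)
    have e := g2
    norm_num; linarith
  have k3 : (0.5934:ℝ) ≤ KK 3 := by
    refine le_trans ?_ (KK_low (by norm_num) h3 h6)
    have e := g3
    norm_num; linarith
  have k4 : (0.7732:ℝ) ≤ KK 4 := by
    refine le_trans ?_ (KK_low (by norm_num) h4 h8)
    have e := f4
    norm_num; linarith
  have k5 : (0.9614:ℝ) ≤ KK 5 := by
    refine le_trans ?_ (KK_low (by norm_num) h5 h10)
    have e := g5
    norm_num; linarith
  have k6 : (1.0942:ℝ) ≤ KK 6 := by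
    refine le_trans ?_ (KK_low (by norm_num) h6 h12)
    have e := f6
    norm_num; linarith
  have k7 : (1.2546:ℝ) ≤ KK 7 := by
    refine le_trans ?_ (KK_low (by norm_num) h7 h14)
    have e := g7
    norm_num; linarith
  have k8 : (1.3449:ℝ) ≤ KK 8 := by
    refine le_trans ?_ (KK_low (by norm_num) h8 h16)
    have e := f8
    norm_num; linarith
  have k9 : (1.4374:ℝ) ≤ KK 9 := by
    refine le_trans ?_ (KK_low (by norm_num) h9 h18)
    have e := f9
    norm_num; linarith
  have k10 : (1.5202:ℝ) ≤ KK 10 := by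
    refine le_trans ?_ (KK_low (by norm_num) h10 h20)
    have e := f10
    norm_num; linarith
  have k11 : (1.6205:ℝ) ≤ KK 11 := by
    refine le_trans ?_ (KK_low (by norm_num) h11 h22)
    have e := g11
    norm_num; linarith
  have k12 : (1.6944:ℝ) ≤ KK 12 := by
    refine le_trans ?_ (KK_low (by norm_num) h12 h24)
    have e := f12
    norm_num; linarith
  have k13 : (1.7797:ℝ) ≤ KK 13 := by
    refine le_trans ?_ (KK_low (by norm_num) h13 h26)
    have e := g13
    norm_num; linarith
  have k14 : (1.8357:ℝ) ≤ KK 14 := by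
    refine le_trans ?_ (KK_low (by norm_num) h14 h28)
    have e := f14
    norm_num; linarith
  have k15 : (1.8939:ℝ) ≤ KK 15 := by
    refine le_trans ?_ (KK_low (by norm_num) h15 h30)
    have e := f15
    norm_num; linarith
  have k16 : (1.9484:ℝ) ≤ KK 16 := by
    refine le_trans ?_ (KK_low (by norm_num) h16 h32)
    have e := f16
    norm_num; linarith
  have k17 : (2.0167:ℝ) ≤ KK 17 := by
    refine le_trans ?_ (KK_low (by norm_num) h17 h34)
    have e := g17
    norm_num; linarith
  have k18 : (2.0605:ℝ) ≤ KK 18 := by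
    refine le_trans ?_ (KK_low (by norm_num) h18 h36)
    have e := f18
    norm_num; linarith
  have k19 : (2.1276:ℝ) ≤ KK 19 := by
    refine le_trans ?_ (KK_low (by norm_num) h19 h38)
    have e := g19
    norm_num; linarith
  have k20 : (2.1674:ℝ) ≤ KK 20 := by
    refine le_trans ?_ (KK_low (by norm_num) h20 h40)
    have e := f20
    norm_num; linarith
  have hsum : ∑ t ∈ Finset.Ico 2 20, KK t / (t * (t + 1)) = KK 2 / 6 + KK 3 / 12 + KK 4 / 20 + KK 5 / 30 + KK 6 / 42 +
      KK 7 / 56 + KK 8 / 72 + KK 9 / 90 + KK 10 / 110 + KK 11 / 132 + KK 12 / 156 + KK 13 / 182 + KK 14 / 210 +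
      KK 15 / 240 + KK 16 / 272 + KK 17 / 306 + KK 18 / 342 + KK 19 / 380 := by
    rw [Finset.sum_Ico_eq_sum_range]
    simp only [Nat.reduceSub, Finset.sum_range_succ, Finset.sum_range_zero]
    norm_num
  rw [hsum]
  linarith

end

section
open Filter Topology

lemma inA_mul {X m q t : ℕ} (hm : Rd 1 t m) (hq : q.Prime) (hle : q * (t * m) ≤ X)
    (hX : X < (t * m) ^ 2) : InA X (m * q) := by
  have hm0 : 0 < m := Nat.pos_of_ne_zero hm.1
  refine ⟨Nat.mul_pos hm0 hq.pos, fun d hd hd1 => ?_⟩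
  have htm : t * m ≤ X := (Nat.le_mul_of_pos_left _ hq.pos).trans hle
  by_cases hqd : q ∣ d
  · obtain ⟨e, rfl⟩ := hqd
    have he : e ∣ m := by
      rw [mul_comm m q] at hd
      exact Nat.dvd_of_mul_dvd_mul_left hq.pos hd
    have he0 : 0 < e := Nat.pos_of_dvd_of_pos he hm0
    rcases Nat.lt_or_ge 1 e with h1 | h1
    · have h2 := hm.2.2 e he h1
      have h3 : (q * e).minFac ≤ e.minFac :=
        Nat.minFac_le_of_dvd (Nat.minFac_prime (by omega)).two_le
          ((Nat.minFac_dvd e).trans (Dvd.intro_left q rfl))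
      calc q * e * (q * e).minFac ≤ q * e * e.minFac := Nat.mul_le_mul_left _ h3
        _ = q * (e * e.minFac) := by ring
        _ ≤ q * (t * m) := Nat.mul_le_mul_left _ h2
        _ ≤ X := hle
    · have h2 : e = 1 := by omega
      subst h2
      rw [mul_one, hq.minFac_eq]
      have h3 : q < t * m := by
        by_contra h
        push Not at h
        have := Nat.mul_le_mul_right (t * m) h
        rw [pow_two] at hX
        omega
      exact (Nat.mul_le_mul_left q h3.le).trans hle
  · have h1 : Nat.Coprime d q := ((Nat.Prime.coprime_iff_not_dvd hq).2 hqd).symm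
    have h2 : d ∣ m := h1.dvd_of_dvd_mul_right hd
    exact (hm.2.2 d h2 hd1).trans htm

lemma sum_log_primeFactors_le {n X : ℕ} (hn : 0 < n) (hnX : n ≤ X) :
    ∑ q ∈ n.primeFactors, Real.log (q:ℝ) ≤ Real.log X := by
  have h0 : ∀ q ∈ n.primeFactors, (q:ℝ) ≠ 0 := fun q hq => by
    exact_mod_cast (Nat.prime_of_mem_primeFactors hq).ne_zero
  rw [← Real.log_prod h0]
  have h1 : ∏ q ∈ n.primeFactors, q ≤ X :=
    (Nat.le_of_dvd hn (Nat.prod_primeFactors_dvd n)).trans hnX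
  have h2 : 0 < ∏ q ∈ n.primeFactors, q :=
    Finset.prod_pos fun q hq => (Nat.prime_of_mem_primeFactors hq).pos
  rw [← Nat.cast_prod]
  exact Real.log_le_log (by exact_mod_cast h2) (by exact_mod_cast h1)

open Classical in
lemma count1 {X : ℕ} (M : Finset ℕ) (τ : ℕ → ℕ)
    (hM : ∀ m ∈ M, 1 ≤ τ m ∧ Rd 1 (τ m) m ∧ X < (τ m * m) ^ 2) :
    ∑ m ∈ M, Chebyshev.theta ((X:ℝ) / (τ m * m : ℕ)) ≤
      (((Finset.range (X+1)).filter (InA X)).card : ℝ) * Real.log X := by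
  have hfin : ∀ m ∈ M, Chebyshev.theta ((X:ℝ) / (τ m * m : ℕ)) =
      ∑ q ∈ (Finset.Ioc 0 (X / (τ m * m))).filter Nat.Prime, Real.log (q:ℝ) := by
    intro m hm
    rw [Chebyshev.theta, Nat.floor_div_eq_div]
  rw [Finset.sum_congr rfl hfin, Finset.sum_sigma']
  have hA : ∀ n ∈ (Finset.range (X+1)).filter (InA X),
      ∑ q ∈ n.primeFactors, Real.log (q:ℝ) ≤ Real.log X := by
    intro n hn
    rw [Finset.mem_filter, Finset.mem_range] at hn
    exact sum_log_primeFactors_le hn.2.1 (by omega)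
  have h2 := Finset.sum_le_card_nsmul _ _ _ hA
  rw [nsmul_eq_mul] at h2
  refine le_trans ?_ h2
  rw [Finset.sum_sigma']
  apply sum_inj_le (fun x : (_ : ℕ) × ℕ => (⟨x.1 * x.2, x.2⟩ : (_ : ℕ) × ℕ))
  · rintro ⟨n, q⟩ _ _
    exact Real.log_natCast_nonneg q
  · rintro ⟨m, q⟩ h
    simp only [Finset.mem_sigma, Finset.mem_filter, Finset.mem_Ioc, Finset.mem_range] at h ⊢
    obtain ⟨hm, ⟨h0, h1⟩, hq⟩ := h
    obtain ⟨ht, hr, hx⟩ := hM m hm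
    have hm0 : 0 < m := Nat.pos_of_ne_zero hr.1
    have h3 : q * (τ m * m) ≤ X := (Nat.le_div_iff_mul_le (Nat.mul_pos ht hm0)).1 h1
    have h4 := inA_mul hr hq h3 hx
    refine ⟨⟨?_, h4⟩, ?_⟩
    · have : m * q ≤ q * (τ m * m) := by
        rw [mul_comm m q]
        exact Nat.mul_le_mul_left _ (Nat.le_mul_of_pos_left _ ht)
      omega
    · rw [Nat.mem_primeFactors]
      exact ⟨hq, Dvd.intro_left m rfl, h4.1.ne'⟩
  · rintro ⟨m, q⟩ h ⟨m', q'⟩ h' he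
    simp only [Finset.coe_sigma, Set.mem_sigma_iff, Finset.mem_coe, Finset.mem_filter, Finset.mem_Ioc] at h h'
    simp only [Sigma.mk.injEq, heq_eq_eq] at he ⊢
    obtain ⟨he1, rfl⟩ := he
    exact ⟨Nat.eq_of_mul_eq_mul_right h.2.1.1 he1, rfl⟩
  · rintro ⟨m, q⟩ h
    exact le_rfl

noncomputable def wgt (t : ℕ) : ℝ := if t = 20 then 1/20 else 1/((t:ℝ)*(t+1))

lemma wgt_nonneg (t : ℕ) : 0 ≤ wgt t := by
  unfold wgt; split_ifs <;> positivity

lemma wgt_sum {s : ℕ} (h2 : 2 ≤ s) (h20 : s ≤ 20) :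
    ∑ t ∈ Finset.Icc s 20, wgt t = 1 / (s:ℝ) := by
  induction h20 using Nat.decreasingInduction with
  | self => simp [wgt]
  | of_succ k hk ih =>
    rw [← Finset.add_sum_Ioc_eq_sum_Icc hk.le, ← Finset.Icc_succ_left_eq_Ioc]
    have := ih (by omega)
    simp only [Nat.succ_eq_succ, Nat.succ_eq_add_one] at this ⊢
    rw [this, wgt, if_neg (by omega)]
    have : (0:ℝ) < k := by exact_mod_cast (by omega : 0 < k)
    push_cast
    field_simp
    ring

open Classical in
/-- combine the windows for t = 2..20 -/
lemma weighted (D : ℕ → Finset ℕ) : ∃ (M : Finset ℕ) (τ : ℕ → ℕ),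
    (∀ m ∈ M, 2 ≤ τ m ∧ τ m ≤ 20 ∧ m ∈ D (τ m)) ∧
    ∑ t ∈ Finset.Icc 2 20, wgt t * ∑ m ∈ D t, 1 / (m:ℝ) ≤ ∑ m ∈ M, 1 / ((τ m * m : ℕ) : ℝ) := by
  let M := (Finset.Icc 2 20).biUnion D
  have hM : ∀ m ∈ M, ∃ t, 2 ≤ t ∧ t ≤ 20 ∧ m ∈ D t := by
    intro m hm
    obtain ⟨t, ht, h⟩ := Finset.mem_biUnion.1 hm
    rw [Finset.mem_Icc] at ht
    exact ⟨t, ht.1, ht.2, h⟩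
  let τ : ℕ → ℕ := fun m => if h : ∃ t, 2 ≤ t ∧ t ≤ 20 ∧ m ∈ D t then Nat.find h else 0
  have hτ : ∀ m (h : ∃ t, 2 ≤ t ∧ t ≤ 20 ∧ m ∈ D t), τ m = Nat.find h := fun m h => dif_pos h
  have hsp : ∀ m ∈ M, 2 ≤ τ m ∧ τ m ≤ 20 ∧ m ∈ D (τ m) := by
    intro m hm
    rw [hτ m (hM m hm)]
    exact Nat.find_spec (hM m hm)
  refine ⟨M, τ, hsp, ?_⟩
  have h1 : ∀ t ∈ Finset.Icc 2 20, wgt t * ∑ m ∈ D t, 1 / (m:ℝ) ≤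
      ∑ m ∈ M, if τ m ≤ t then wgt t * (1 / (m:ℝ)) else 0 := by
    intro t ht
    rw [Finset.mul_sum, ← Finset.sum_filter]
    apply Finset.sum_le_sum_of_subset_of_nonneg
    · intro m hm
      have hmM : m ∈ M := Finset.mem_biUnion.2 ⟨t, ht, hm⟩
      rw [Finset.mem_filter, hτ m (hM m hmM)]
      rw [Finset.mem_Icc] at ht
      exact ⟨hmM, Nat.find_min' _ ⟨ht.1, ht.2, hm⟩⟩
    · intro m _ _
      have := wgt_nonneg t
      positivity
  refine (Finset.sum_le_sum h1).trans ?_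
  rw [Finset.sum_comm]
  apply Finset.sum_le_sum
  intro m hm
  obtain ⟨a, b, c⟩ := hsp m hm
  rw [← Finset.sum_filter, ← Finset.sum_mul]
  have : (Finset.Icc 2 20).filter (fun t => τ m ≤ t) = Finset.Icc (τ m) 20 := by
    ext t; simp only [Finset.mem_filter, Finset.mem_Icc]; omega
  rw [this, wgt_sum a b, Nat.cast_mul, one_div_mul_one_div]

lemma K_wgt : (0.455:ℝ) ≤ ∑ t ∈ Finset.Icc 2 20, wgt t * KK t := by
  refine K_num.trans (le_of_eq ?_)
  rw [show Finset.Icc 2 20 = insert 20 (Finset.Ico 2 20) by decide, Finset.sum_insert (by simp), add_comm]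
  congr 1
  · simp [wgt]; ring
  · apply Finset.sum_congr rfl
    intro t ht
    rw [Finset.mem_Ico] at ht
    rw [wgt, if_neg (by omega)]; ring

open Classical in
lemma count2 : ∃ X0 : ℕ, ∀ X : ℕ, X0 ≤ X → (0.618:ℝ) * X ≤
    (((Finset.range (X+1)).filter (InA X)).card : ℝ) * Real.log X := by
  obtain ⟨y0, hy0, hth⟩ := theta_low
  have hw : ∀ t : ℕ, ∃ V0 : ℝ, ∀ V, V0 ≤ V → 1 ≤ t → 1.4756 * KK t - 0.0001 ≤
      ∑ d ∈ Dd 1 t ⌊Real.exp (V / 2)⌋₊ ⌊Real.exp (0.985 * V)⌋₊, 1 / (d:ℝ) := by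
    intro t
    by_cases ht : 1 ≤ t
    · obtain ⟨V0, _, h⟩ := window ht 0.0001 (by norm_num)
      exact ⟨V0, fun V hV _ => h V hV⟩
    · exact ⟨0, fun _ _ h => absurd h ht⟩
  choose W hW using hw
  have hlog : Tendsto (fun X : ℕ => Real.log (X:ℝ)) atTop atTop :=
    Real.tendsto_log_atTop.comp tendsto_natCast_atTop_atTop
  have hev : ∀ᶠ X : ℕ in atTop, 1 ≤ X ∧ Real.log y0 / 0.015 ≤ Real.log (X:ℝ) ∧
      ∀ t ∈ Finset.Icc 2 20, W t ≤ Real.log (X:ℝ) := by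
    refine (eventually_ge_atTop 1).and ((hlog.eventually_ge_atTop _).and ?_)
    rw [Filter.eventually_all_finset]
    exact fun t _ => hlog.eventually_ge_atTop _
  obtain ⟨X0, hX0⟩ := eventually_atTop.1 hev
  refine ⟨X0, fun X hX => ?_⟩
  obtain ⟨hX1, hVy, hVW⟩ := hX0 X hX
  set V := Real.log (X:ℝ) with hV
  have hXpos : (0:ℝ) < X := by exact_mod_cast hX1
  obtain ⟨M, τ, hM, hS⟩ := weighted (fun t => Dd 1 t ⌊Real.exp (V / 2)⌋₊ ⌊Real.exp (0.985 * V)⌋₊)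
  have hM' : ∀ m ∈ M, 1 ≤ τ m ∧ Rd 1 (τ m) m ∧ 0 < τ m * m ∧
      V / 2 < Real.log ((τ m * m : ℕ):ℝ) ∧ Real.log ((τ m * m : ℕ):ℝ) ≤ 0.985 * V := by
    intro m hm
    obtain ⟨a, b, c⟩ := hM m hm
    rw [mem_Dd (by omega)] at c
    have h0 : 0 < τ m * m := by omega
    exact ⟨by omega, c.1, h0, (floor_lt_iff h0 _).1 c.2.1, (le_floor_iff' h0 _).1 c.2.2⟩
  have hc := count1 (X := X) M τ (by
    intro m hm
    obtain ⟨a, b, c, d, e⟩ := hM' m hm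
    refine ⟨a, b, ?_⟩
    have h0 : (0:ℝ) < ((τ m * m : ℕ):ℝ) := by exact_mod_cast c
    have : Real.log (X:ℝ) < Real.log (((τ m * m : ℕ):ℝ)^2) := by
      rw [Real.log_pow]; push_cast at d ⊢; linarith
    have := (Real.log_lt_log_iff hXpos (by positivity)).1 this
    exact_mod_cast this)
  refine le_trans ?_ hc
  have h3 : ∀ m ∈ M, 0.921 * (X:ℝ) * (1 / ((τ m * m : ℕ):ℝ)) ≤
      Chebyshev.theta ((X:ℝ) / (τ m * m : ℕ)) := by
    intro m hm
    obtain ⟨a, b, c, d, e⟩ := hM' m hm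
    have h0 : (0:ℝ) < ((τ m * m : ℕ):ℝ) := by exact_mod_cast c
    have := hth ((X:ℝ) / (τ m * m : ℕ)) (by
      rw [← Real.log_le_log_iff (by linarith) (by positivity), Real.log_div hXpos.ne' h0.ne']
      rw [div_le_iff₀ (by norm_num)] at hVy
      linarith)
    refine le_trans (le_of_eq ?_) this
    ring
  refine le_trans ?_ (Finset.sum_le_sum h3)
  rw [← Finset.mul_sum]
  have h4 : ∑ t ∈ Finset.Icc 2 20, wgt t * (1.4756 * KK t - 0.0001) ≤
      ∑ m ∈ M, 1 / ((τ m * m : ℕ) : ℝ) := by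
    refine le_trans (Finset.sum_le_sum fun t ht => ?_) hS
    exact mul_le_mul_of_nonneg_left (hW t V (hVW t ht) (by rw [Finset.mem_Icc] at ht; omega)) (wgt_nonneg t)
  have h5 : ∑ t ∈ Finset.Icc 2 20, wgt t * (1.4756 * KK t - 0.0001) =
      1.4756 * ∑ t ∈ Finset.Icc 2 20, wgt t * KK t - 0.0001 * ∑ t ∈ Finset.Icc 2 20, wgt t := by
    rw [Finset.mul_sum, Finset.mul_sum, ← Finset.sum_sub_distrib]
    exact Finset.sum_congr rfl fun t _ => by ring
  have h6 := wgt_sum (le_refl 2) (by norm_num)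
  have h7 := K_wgt
  rw [h5, h6] at h4
  have h8 : (0.6712:ℝ) ≤ ∑ m ∈ M, 1 / ((τ m * m : ℕ) : ℝ) := by
    push_cast at h4 ⊢
    linarith
  calc (0.618:ℝ) * X ≤ 0.921 * X * 0.6712 := by nlinarith
    _ ≤ _ := mul_le_mul_of_nonneg_left h8 (by positivity)

end

section
open Filter Topology

lemma fchain_bdd (x : ℝ) :
    BddAbove {L : ℕ | ∃ l : List ℕ, IsDivChain l ∧ (∀ n ∈ l, (n : ℝ) ≤ x) ∧ l.length = L} := by
  refine ⟨⌊x⌋₊, ?_⟩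
  rintro L ⟨l, hl, hx, rfl⟩
  exact len_le hl.1 fun n hn => ⟨hl.2.1 n hn, Nat.le_floor (hx n hn)⟩

lemma fchain_mem (x : ℝ) : ∃ l : List ℕ, IsDivChain l ∧ (∀ n ∈ l, (n : ℝ) ≤ x) ∧ l.length = fchain x :=
  Nat.sSup_mem (s := {L : ℕ | ∃ l : List ℕ, IsDivChain l ∧ (∀ n ∈ l, (n : ℝ) ≤ x) ∧ l.length = L})
    ⟨0, [], ⟨List.nodup_nil, by simp, List.IsChain.nil⟩, by simp, rfl⟩ (fchain_bdd x)

lemma fchain_lower : ∀ᶠ x : ℝ in atTop, (0.3061:ℝ) ≤ (fchain x : ℝ) * Real.log x / x := by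
  classical
  obtain ⟨X0, hX0⟩ := count2
  filter_upwards [eventually_ge_atTop (2 * (X0:ℝ) + 1000)] with x hx
  have hx0 : (0:ℝ) ≤ (X0:ℝ) := Nat.cast_nonneg X0
  have hxp : 0 < x := by linarith
  set X := ⌊x / 2⌋₊ with hXd
  have h1 : X0 ≤ X := Nat.le_floor (by linarith)
  have h2 : (X:ℝ) ≤ x / 2 := Nat.floor_le (by linarith)
  have h3 : x / 2 < X + 1 := Nat.lt_floor_add_one _
  have hXpos : (0:ℝ) < X := by linarith
  have hc := hX0 X h1
  obtain ⟨l, a, b, c, d, e⟩ := chain_lemma X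
  have hlen : ((Finset.range (X+1)).filter (InA X)).card ≤ l.length := by
    rw [← List.toFinset_card_of_nodup a]
    apply Finset.card_le_card
    intro n hn
    rw [List.mem_toFinset]
    exact e n (Finset.mem_filter.1 hn).2
  have hf : l.length ≤ fchain x := by
    apply le_csSup (fchain_bdd x)
    refine ⟨l, ⟨a, b, c⟩, fun n hn => ?_, rfl⟩
    rcases d n hn with h | h
    · rw [h]; push_cast; linarith
    · have : (n:ℝ) ≤ 2 * X := by exact_mod_cast h
      linarith
  have h4 : (((Finset.range (X+1)).filter (InA X)).card : ℝ) ≤ fchain x := by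
    exact_mod_cast hlen.trans hf
  have h5 : Real.log X ≤ Real.log x := Real.log_le_log hXpos (by linarith)
  have h6 : 0 ≤ Real.log X := Real.log_natCast_nonneg X
  have h7 := mul_le_mul h4 h5 h6 (Nat.cast_nonneg _)
  rw [le_div_iff₀ hxp]
  linarith

lemma fchain_cobdd :
    IsCoboundedUnder (· ≥ ·) atTop (fun x : ℝ => (fchain x : ℝ) * Real.log x / x) := by
  obtain ⟨C, hC⟩ := upper_U
  apply IsCoboundedUnder.of_frequently_le (a := C * Real.log 2)
  rw [Filter.frequently_atTop]
  intro a
  obtain ⟨s, hs⟩ := exists_nat_gt a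
  obtain ⟨j, hj, h⟩ := hC s
  refine ⟨(2:ℝ)^j, ?_, ?_⟩
  · have h1 : s < 2 ^ s := Nat.lt_two_pow_self
    have h2 : j < 2 ^ j := Nat.lt_two_pow_self
    have h3 := (Finset.mem_Ico.1 hj).1
    have h4 : s ≤ 2 ^ j := by omega
    have h5 : (s:ℝ) ≤ 2 ^ j := by exact_mod_cast h4
    linarith
  · obtain ⟨l, hl, hx, hlen⟩ := fchain_mem ((2:ℝ)^j)
    have h1 := h l hl.1 (fun n hn => ⟨hl.2.1 n hn, by exact_mod_cast hx n hn⟩) hl.2.2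
    rw [hlen] at h1
    have hp : (0:ℝ) < 2 ^ j := by positivity
    show (fchain ((2:ℝ)^j) : ℝ) * Real.log ((2:ℝ)^j) / (2:ℝ)^j ≤ _
    rw [div_le_iff₀ hp, Real.log_pow]
    have h2 := mul_le_mul_of_nonneg_right h1 (Real.log_nonneg (by norm_num : (1:ℝ) ≤ 2))
    linarith

end

/-- `liminf_{x→∞} f(x)·(log x)/x > 0.306`. -/
theorem stmt_4 :
    (0.306 : ℝ) < Filter.liminf (fun x : ℝ => (fchain x : ℝ) * Real.log x / x) Filter.atTop := by
  exact lt_of_lt_of_le (by norm_num) (Filter.le_liminf_of_le fchain_cobdd fchain_lower)
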